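/- There exists an absolute constant C > 0 such that for every fixed ε ∈ (0,1) there exist arbitrarily large finite sets A ⊆ ℝ such that max(|kA|, |A^{(k)}|) ≤ |A|^{C^{1/ε} + ε·log k} holds simultaneously for every integer k ≥ 3; that is, for every N there is a finite A ⊆ ℝ with |A| ≥ N satisfying this bound for all k ≥ 3. -/

import Mathlib

open Pointwise

/-- The `k`-fold sum set `kA = {a₁ + ⋯ + a_k : aᵢ ∈ A}`. -/
def kfoldSumSet {R : Type*} [AddCommMonoid R] (k : ℕ) (A : Set R) : Set R :=
  {x | ∃ f : Fin k → R, (∀ i, f i ∈ A) ∧ ∑ i, f i = x}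

/-- The `k`-fold product set `A^{(k)} = {a₁ ⋯ a_k : aᵢ ∈ A}`. -/
def kfoldProdSet {R : Type*} [CommMonoid R] (k : ℕ) (A : Set R) : Set R :=
  {x | ∃ f : Fin k → R, (∀ i, f i ∈ A) ∧ ∏ i, f i = x}

/-! ### Filtrations by the augmentation ideal of a group algebra -/

namespace GroupAlgebra

local notation "𝔽₂" => ZMod 2

section

variable {G : Type*} [Group G] {A : Type*} [Ring A] (u : G →* A)

/-- The submodule generated by all `(g - 1) • w` with `w ∈ W`. -/
noncomputable def augMul {V : Type*} [AddCommGroup V] [Module A V]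
    (W : Submodule A V) : Submodule A V :=
  Submodule.span _ {x | ∃ g : G, ∃ w ∈ W, x = (u g - 1) • w}

section
variable {V : Type*} [AddCommGroup V] [Module A V]
variable {V' : Type*} [AddCommGroup V'] [Module A V']

theorem sub_one_smul_mem_augMul {W : Submodule A V} (g : G) {w : V}
    (hw : w ∈ W) : (u g - 1) • w ∈ augMul u W :=
  Submodule.subset_span ⟨g, w, hw, rfl⟩

theorem augMul_le (W : Submodule A V) : augMul u W ≤ W := by
  refine Submodule.span_le.2 ?_
  rintro _ ⟨g, w, hw, rfl⟩
  exact W.smul_mem _ hw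

theorem augMul_mono {W W' : Submodule A V} (h : W ≤ W') :
    augMul u W ≤ augMul u W' := by
  refine Submodule.span_mono ?_
  rintro _ ⟨g, w, hw, rfl⟩
  exact ⟨g, w, h hw, rfl⟩

theorem map_augMul (f : V →ₗ[A] V') (W : Submodule A V) :
    (augMul u W).map f = augMul u (W.map f) := by
  rw [augMul, augMul, Submodule.map_span]
  congr 1
  ext x
  constructor
  · rintro ⟨_, ⟨g, w, hw, rfl⟩, rfl⟩
    exact ⟨g, f w, ⟨w, hw, rfl⟩, by rw [map_smul]⟩
  · rintro ⟨g, _, ⟨w, hw, rfl⟩, rfl⟩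
    exact ⟨_, ⟨g, w, hw, rfl⟩, by rw [map_smul]⟩

theorem map_iterate_augMul (f : V →ₗ[A] V')
    (W : Submodule A V) (n : ℕ) :
    ((augMul u)^[n] W).map f = (augMul u)^[n] (W.map f) := by
  induction n with
  | zero => rfl
  | succ n ih => rw [Function.iterate_succ_apply', Function.iterate_succ_apply', map_augMul u, ih]

theorem iterate_augMul_mono {W W' : Submodule A V} (h : W ≤ W') (n : ℕ) :
    (augMul u)^[n] W ≤ (augMul u)^[n] W' := by
  induction n with
  | zero => exact h
  | succ n ih =>
    rw [Function.iterate_succ_apply', Function.iterate_succ_apply']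
    exact augMul_mono u ih

theorem iterate_augMul_pi (d : ℕ) (W : Submodule A V) (n : ℕ) :
    (augMul u)^[n] (Submodule.pi Set.univ fun _ : Fin d => W) =
      Submodule.pi Set.univ fun _ : Fin d => (augMul u)^[n] W := by
  have key : ∀ W : Submodule A V,
      augMul u (Submodule.pi Set.univ fun _ : Fin d => W) =
      Submodule.pi Set.univ fun _ : Fin d => augMul u W := by
    intro W
    apply le_antisymm
    · refine Submodule.span_le.2 ?_
      rintro _ ⟨g, w, hw, rfl⟩ i -
      exact sub_one_smul_mem_augMul u g (hw i trivial)
    · intro v hv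
      have : v = ∑ i, LinearMap.single A (fun _ : Fin d => V) i (v i) := by
        simp [LinearMap.single_apply, Finset.univ_sum_single]
      rw [this]
      refine Submodule.sum_mem _ fun i _ => ?_
      have h1 : LinearMap.single A (fun _ : Fin d => V) i (v i) ∈
          (augMul u W).map (LinearMap.single A (fun _ : Fin d => V) i) :=
        ⟨_, hv i trivial, rfl⟩
      rw [map_augMul u] at h1
      refine augMul_mono u ?_ h1
      rintro _ ⟨w, hw, rfl⟩ j -
      by_cases h : i = j
      · subst h; simpa using hw
      · simp [LinearMap.single_apply, Pi.single_eq_of_ne (Ne.symm h)]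
  induction n with
  | zero => rfl
  | succ n ih => rw [Function.iterate_succ_apply', ih, key, Function.iterate_succ_apply']

variable [Algebra 𝔽₂ A] [Module 𝔽₂ V] [IsScalarTower 𝔽₂ A V]

/-- For a finite `2`-group, a nonzero finite submodule is not equal to its augmentation part. -/
theorem augMul_ne_self (hG : IsPGroup 2 G) (hu : Submodule.span 𝔽₂ (Set.range u) = ⊤) [Finite V]
    {W : Submodule A V} (hW : W ≠ ⊥) : augMul u W ≠ W := by
  classical
  let act : MulAction G (W →ₗ[𝔽₂] 𝔽₂) :=
    { smul := fun g l => l ∘ₗ Algebra.lsmul 𝔽₂ 𝔽₂ W (u g⁻¹)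
      one_smul := fun l => by
        ext w
        change l (u 1⁻¹ • w) = l w
        rw [inv_one, map_one, one_smul]
      mul_smul := fun g h l => by
        ext w
        change l (u (g * h)⁻¹ • w) =
          l (u h⁻¹ • u g⁻¹ • w)
        rw [mul_inv_rev, map_mul, mul_smul] }
  have hnt : Nontrivial W := (Submodule.nontrivial_iff_ne_bot).2 hW
  have hcard : 2 ∣ Nat.card (W →ₗ[𝔽₂] 𝔽₂) := by
    have : Nontrivial (Module.Dual 𝔽₂ W) := inferInstance
    have h := Module.natCard_eq_pow_finrank (K := 𝔽₂) (V := Module.Dual 𝔽₂ W)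
    rw [Nat.card_zmod] at h
    change 2 ∣ Nat.card (Module.Dual 𝔽₂ W)
    rw [h]
    exact dvd_pow_self 2 (Module.finrank_pos.ne')
  have : Finite (W →ₗ[𝔽₂] 𝔽₂) := DFunLike.finite _
  obtain ⟨l, hl, h0⟩ := hG.exists_fixed_point_of_prime_dvd_card_of_fixed_point
    (W →ₗ[𝔽₂] 𝔽₂) hcard (a := 0) (fun g => by ext w; rfl)
  intro heq
  apply h0
  have hker : ∀ v (hv : v ∈ augMul u W), l ⟨v, augMul_le u W hv⟩ = 0 := by
    have hinv : ∀ (g : G) (w : W), l (u g • w) = l w := by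
      intro g w
      have := DFunLike.congr_fun (hl g⁻¹) w
      change l (u g⁻¹⁻¹ • w) = l w at this
      rwa [inv_inv] at this
    have hspan : augMul u W ≤ (Submodule.span A
        {x : W | ∃ g : G, ∃ w : W, x = (u g - 1) • w}).map W.subtype := by
      refine Submodule.span_le.2 ?_
      rintro _ ⟨g, w, hw, rfl⟩
      exact ⟨_, Submodule.subset_span ⟨g, ⟨w, hw⟩, rfl⟩, rfl⟩
    have hz : ∀ x ∈ (Submodule.span A
        {x : W | ∃ g : G, ∃ w : W, x = (u g - 1) • w}), l x = 0 := by
      intro x hx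
      induction hx using Submodule.span_induction with
      | mem x hx =>
        obtain ⟨g, w, rfl⟩ := hx
        rw [sub_smul, one_smul, map_sub, hinv, sub_self]
      | zero => exact map_zero l
      | add a b _ _ ha hb => rw [map_add, ha, hb, add_zero]
      | smul a x _ hx =>
        have ha : a ∈ Submodule.span 𝔽₂ (Set.range u) := hu ▸ Submodule.mem_top
        induction ha using Submodule.span_induction with
        | mem a ha =>
          obtain ⟨g, rfl⟩ := ha
          rw [hinv, hx]
        | zero => rw [zero_smul, map_zero]
        | add a b _ _ ha hb => rw [add_smul, map_add, ha, hb, add_zero]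
        | smul r a _ ha => rw [smul_assoc, map_smul, ha, smul_zero]
    intro v hv
    obtain ⟨x, hx, rfl⟩ := hspan hv
    exact hz x hx
  ext w
  exact (hker w (heq.symm ▸ w.2 : (w : V) ∈ augMul u W)).symm

/-- Nakayama's lemma for finite modules over a finite `2`-group. -/
theorem le_of_le_sup_augMul (hG : IsPGroup 2 G) (hu : Submodule.span 𝔽₂ (Set.range u) = ⊤) [Finite V]
    {W N : Submodule A V} (h : N ≤ W ⊔ augMul u N) : N ≤ W := by
  have h1 : N.map W.mkQ ≤ augMul u (N.map W.mkQ) := by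
    rw [← map_augMul u]
    refine (Submodule.map_mono h).trans ?_
    rw [Submodule.map_sup, Submodule.mkQ_map_self, bot_sup_eq]
  have h2 : N.map W.mkQ = ⊥ := by
    by_contra hne
    have : Finite (V ⧸ W) := Finite.of_surjective _ W.mkQ_surjective
    exact augMul_ne_self u hG hu hne (le_antisymm (augMul_le u _) h1)
  rw [← W.ker_mkQ]
  exact LinearMap.le_ker_iff_map.2 h2

theorem finrank_quotient_add (W : Submodule A V) [Finite V] :
    Module.finrank 𝔽₂ (V ⧸ W) + Module.finrank 𝔽₂ W = Module.finrank 𝔽₂ V := by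
  have h := Submodule.finrank_quotient_add_finrank (W.restrictScalars 𝔽₂)
  rw [← h]
  congr 1

theorem finrank_quotient_le_of_surjective [Module 𝔽₂ V'] [IsScalarTower 𝔽₂ A V']
    [Finite V] [Finite V'] (f : V →ₗ[A] V') (hf : Function.Surjective f) (n : ℕ) :
    Module.finrank 𝔽₂ (V' ⧸ ((augMul u)^[n] ⊤ : Submodule A V')) ≤
      Module.finrank 𝔽₂ (V ⧸ ((augMul u)^[n] ⊤ : Submodule A V)) := by
  have hle : ((augMul u)^[n] ⊤ : Submodule A V) ≤
      ((augMul u)^[n] ⊤ : Submodule A V').comap f := by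
    rw [← Submodule.map_le_iff_le_comap, map_iterate_augMul u]
    exact iterate_augMul_mono u le_top n
  have hs : Function.Surjective ((Submodule.mapQ _ _ f hle).restrictScalars 𝔽₂) := by
    intro y
    obtain ⟨y, rfl⟩ := Submodule.Quotient.mk_surjective _ y
    obtain ⟨x, rfl⟩ := hf y
    exact ⟨Submodule.Quotient.mk x, rfl⟩
  exact LinearMap.finrank_le_finrank_of_surjective hs

theorem finrank_pi_quotient (d n : ℕ) [Finite V] :
    Module.finrank 𝔽₂ ((Fin d → V) ⧸
      ((augMul u)^[n] ⊤ : Submodule A (Fin d → V))) =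
      d * Module.finrank 𝔽₂ (V ⧸ ((augMul u)^[n] ⊤ : Submodule A V)) := by
  have h : ((augMul u)^[n] ⊤ : Submodule A (Fin d → V)) =
      Submodule.pi Set.univ fun _ : Fin d => (augMul u)^[n] ⊤ := by
    rw [← iterate_augMul_pi u, Submodule.pi_top]
  let W : Submodule A V := (augMul u)^[n] ⊤
  let q : (Fin d → V) →ₗ[A] (Fin d → V ⧸ W) := LinearMap.pi fun i => W.mkQ ∘ₗ LinearMap.proj i
  have hq : Function.Surjective q := fun y => by
    choose x hx using fun i => W.mkQ_surjective (y i)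
    exact ⟨x, funext hx⟩
  have hk : Submodule.pi Set.univ (fun _ : Fin d => W) = LinearMap.ker q := by
    ext v
    simp [q, Submodule.mem_pi, funext_iff]
  rw [h]
  change Module.finrank 𝔽₂ ((Fin d → V) ⧸ Submodule.pi Set.univ (fun _ : Fin d => W)) = _
  rw [hk, ((LinearMap.quotKerEquivOfSurjective q hq).restrictScalars 𝔽₂).finrank_eq]
  simp [Module.finrank_pi_fintype, W]

/-- A minimal system of generators of a finite module. -/
theorem exists_minimal_cover (hG : IsPGroup 2 G) (hu : Submodule.span 𝔽₂ (Set.range u) = ⊤)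
    [Finite A] [Finite V] (hA : Module.finrank 𝔽₂ (A ⧸ augMul u (⊤ : Submodule A A)) = 1) :
    ∃ f : (Fin (Module.finrank 𝔽₂ (V ⧸ augMul u (⊤ : Submodule A V))) → A) →ₗ[A] V,
      Function.Surjective f ∧ LinearMap.ker f ≤ augMul u ⊤ := by
  set W : Submodule A V := augMul u ⊤ with hW
  set d := Module.finrank 𝔽₂ (V ⧸ W) with hd
  have : Finite (V ⧸ W) := Finite.of_surjective _ W.mkQ_surjective
  let b : Module.Basis (Fin d) 𝔽₂ (V ⧸ W) := Module.finBasis 𝔽₂ (V ⧸ W)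
  choose x hx using fun i => W.mkQ_surjective (b i)
  let f : (Fin d → A) →ₗ[A] V := Fintype.linearCombination A x
  have hf : Function.Surjective f := by
    rw [← LinearMap.range_eq_top, eq_top_iff]
    apply le_of_le_sup_augMul u hG hu
    intro v _
    have h1 : v - f (fun i => algebraMap 𝔽₂ A (b.repr (W.mkQ v) i)) ∈ W := by
      refine (Submodule.Quotient.mk_eq_zero W).1 ?_
      change W.mkQ (v - f _) = 0
      rw [map_sub, sub_eq_zero]
      have hs : ∀ (c : 𝔽₂) (v : V), W.mkQ (c • v) = c • W.mkQ v := fun _ _ => rfl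
      simp only [f, Fintype.linearCombination_apply, map_sum, algebraMap_smul, hs, hx]
      exact (b.sum_repr _).symm
    rw [← sub_add_cancel v (f _), add_comm]
    exact Submodule.add_mem_sup (LinearMap.mem_range_self _ _) h1
  refine ⟨f, hf, ?_⟩
  have hle : (augMul u ⊤ : Submodule A (Fin d → A)) ≤ W.comap f := by
    rw [← Submodule.map_le_iff_le_comap, map_augMul]
    exact augMul_mono u le_top
  have hs : Function.Surjective ((Submodule.mapQ _ _ f hle).restrictScalars 𝔽₂) := by
    intro y
    obtain ⟨y, rfl⟩ := Submodule.Quotient.mk_surjective _ y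
    obtain ⟨x, rfl⟩ := hf y
    exact ⟨Submodule.Quotient.mk x, rfl⟩
  have hfin : Finite ((Fin d → A) ⧸ (augMul u ⊤ : Submodule A (Fin d → A))) :=
    Finite.of_surjective _ (Submodule.mkQ_surjective _)
  have hr : Module.finrank 𝔽₂ ((Fin d → A) ⧸ (augMul u ⊤ : Submodule A (Fin d → A))) =
      Module.finrank 𝔽₂ (V ⧸ W) := by
    exact (finrank_pi_quotient (V := A) u d 1).trans ((congrArg (d * ·) hA).trans (mul_one d))
  have hi := (LinearMap.injective_iff_surjective_of_finrank_eq_finrank hr).2 hs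
  intro v hv
  rw [← Submodule.ker_mkQ (augMul u ⊤ : Submodule A (Fin d → A)), LinearMap.mem_ker]
  apply hi
  rw [map_zero]
  change Submodule.Quotient.mk (f v) = 0
  rw [LinearMap.mem_ker.1 hv]
  rfl

theorem restrictScalars_augMul_top_le_ker (hu : Submodule.span 𝔽₂ (Set.range u) = ⊤)
    (φ : V →ₗ[𝔽₂] 𝔽₂) (hφ : ∀ g v, φ (u g • v) = φ v) :
    (augMul u (⊤ : Submodule A V)).restrictScalars 𝔽₂ ≤ LinearMap.ker φ := by
  intro x hx
  replace hx : x ∈ Submodule.span A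
    {x : V | ∃ g : G, ∃ w ∈ (⊤ : Submodule A V), x = (u g - 1) • w} := hx
  rw [LinearMap.mem_ker]
  induction hx using Submodule.span_induction with
  | mem x hx =>
    obtain ⟨g, w, -, rfl⟩ := hx
    rw [sub_smul, one_smul, map_sub, hφ, sub_self]
  | zero => exact map_zero _
  | add a b _ _ ha hb => rw [map_add, ha, hb, add_zero]
  | smul a x _ hx0 =>
    have ha : a ∈ Submodule.span 𝔽₂ (Set.range u) := hu ▸ Submodule.mem_top
    induction ha using Submodule.span_induction with
    | mem a ha =>
      obtain ⟨g, rfl⟩ := ha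
      rw [hφ, hx0]
    | zero => rw [zero_smul, map_zero]
    | add a b _ _ ha hb => rw [add_smul, map_add, ha, hb, add_zero]
    | smul r a _ ha => rw [smul_assoc, map_smul, ha, smul_zero]

/-- Invariant functionals on a module form a space of dimension `dim V / I V`. -/
theorem card_invariant_functionals (hu : Submodule.span 𝔽₂ (Set.range u) = ⊤) [Finite V] :
    Nat.card {φ : V →ₗ[𝔽₂] 𝔽₂ // ∀ g v, φ (u g • v) = φ v} =
      2 ^ Module.finrank 𝔽₂ (V ⧸ augMul u (⊤ : Submodule A V)) := by
  set W : Submodule A V := augMul u ⊤ with hW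
  have : Finite (V ⧸ W) := Finite.of_surjective _ W.mkQ_surjective
  rw [← Subspace.dual_finrank_eq]
  have h := Module.natCard_eq_pow_finrank (K := 𝔽₂) (V := Module.Dual 𝔽₂ (V ⧸ W))
  rw [Nat.card_zmod] at h
  rw [← h]
  have key : ∀ φ : V →ₗ[𝔽₂] 𝔽₂, (∀ g v, φ (u g • v) = φ v) →
      W.restrictScalars 𝔽₂ ≤ LinearMap.ker φ := restrictScalars_augMul_top_le_ker u hu
  refine Nat.card_congr
    { toFun := fun φ => ((W.restrictScalars 𝔽₂).liftQ φ.1 (key φ.1 φ.2) :)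
      invFun := fun l => ⟨l ∘ₗ (W.mkQ.restrictScalars 𝔽₂), fun g v => ?_⟩
      left_inv := fun φ => ?_
      right_inv := fun l => ?_ }
  · simp only [LinearMap.comp_apply, LinearMap.restrictScalars_apply]
    rw [← sub_eq_zero, ← map_sub, ← map_sub]
    have : u g • v - v ∈ W := by
      have := sub_one_smul_mem_augMul u g (Submodule.mem_top (x := v) (R := A))
      rwa [sub_smul, one_smul] at this
    have h0 : W.mkQ (u g • v - v) = 0 := (Submodule.Quotient.mk_eq_zero W).2 this
    rw [h0, map_zero]
  · ext v; rfl
  · refine LinearMap.ext fun q => ?_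
    obtain ⟨v, rfl⟩ := W.mkQ_surjective q
    rfl

end

end

section

variable {G : Type*} [Group G] {A : Type*} [Ring A] (u : G →* A)

variable [Algebra 𝔽₂ A] [Finite A]

theorem golodShafarevich_step (hG : IsPGroup 2 G) (hu : Submodule.span 𝔽₂ (Set.range u) = ⊤)
    (hA : Module.finrank 𝔽₂ (A ⧸ augMul u (⊤ : Submodule A A)) = 1) {d : ℕ}
    (f : (Fin d → A) →ₗ[A] (augMul u (⊤ : Submodule A A)))
    (hf : Function.Surjective f) (hker : LinearMap.ker f ≤ augMul u ⊤) (n : ℕ) :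
    d * Module.finrank 𝔽₂ (A ⧸ ((augMul u)^[n + 1] ⊤ : Submodule A A)) + 1 ≤
      Module.finrank 𝔽₂ (A ⧸ ((augMul u)^[n + 2] ⊤ : Submodule A A)) +
      Module.finrank 𝔽₂
        (LinearMap.ker f ⧸ augMul u (⊤ : Submodule A (LinearMap.ker f))) *
        Module.finrank 𝔽₂ (A ⧸ ((augMul u)^[n] ⊤ : Submodule A A)) := by
  set N := LinearMap.ker f with hN
  have hfinq : ∀ (V : Type _) [AddCommGroup V] [Module A V] [Finite V] (W : Submodule A V),
      Finite (V ⧸ W) := fun V _ _ _ W => Finite.of_surjective _ W.mkQ_surjective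
  set r := Module.finrank 𝔽₂ (N ⧸ augMul u (⊤ : Submodule A N)) with hr
  set J2 : Submodule A A := (augMul u)^[n + 2] ⊤ with hJ2
  set P : Submodule A (Fin d → A) := (augMul u)^[n + 1] ⊤ with hP
  let I : Submodule A A := augMul u ⊤
  have hJ2I : J2 = ((augMul u)^[n + 1] (⊤ : Submodule A I)).map I.subtype := by
    rw [map_iterate_augMul, Submodule.map_top, Submodule.range_subtype, hJ2,
      Function.iterate_succ_apply]
  have hfP : (P.map f) = (augMul u)^[n + 1] (⊤ : Submodule A I) := by
    rw [hP, map_iterate_augMul, Submodule.map_top, LinearMap.range_eq_top.2 hf]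
  -- the composite map to the quotient of the ring
  let φ : (Fin d → A) →ₗ[A] A ⧸ J2 := J2.mkQ ∘ₗ I.subtype ∘ₗ f
  have hkφ : LinearMap.ker φ = N ⊔ P := by
    ext v
    have : v ∈ LinearMap.ker φ ↔ ((f v : I) : A) ∈ J2 := Submodule.Quotient.mk_eq_zero J2
    rw [this, hJ2I, ← hfP]
    constructor
    · rintro ⟨_, ⟨w, hw, rfl⟩, hwv⟩
      have h0 : f w = f v := Subtype.ext hwv
      rw [← sub_add_cancel v w]
      exact Submodule.add_mem_sup (by rw [hN, LinearMap.mem_ker, map_sub, h0, sub_self]) hw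
    · intro hv
      obtain ⟨a, ha, w, hw, rfl⟩ := Submodule.mem_sup.1 hv
      refine ⟨f w, ⟨w, hw, rfl⟩, ?_⟩
      rw [map_add, LinearMap.mem_ker.1 ha, zero_add]
      rfl
  have hrφ : LinearMap.range φ = I.map J2.mkQ := by
    rw [LinearMap.range_comp, LinearMap.range_comp, LinearMap.range_eq_top.2 hf, Submodule.map_top,
      Submodule.range_subtype]
  have hJI : J2 ≤ I := by
    rw [hJ2, Function.iterate_succ_apply']
    exact augMul_mono u le_top
  have e1 : Module.finrank 𝔽₂ (A ⧸ J2) = 1 + Module.finrank 𝔽₂ (LinearMap.range φ) := by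
    have := hfinq _ J2
    have h1 := finrank_quotient_add (A := A) (LinearMap.range φ)
    rw [← h1, ← hA]
    congr 1
    rw [hrφ]
    exact ((Submodule.quotientQuotientEquivQuotient J2 I hJI).restrictScalars 𝔽₂).finrank_eq
  have e2 : Module.finrank 𝔽₂ (LinearMap.range φ) =
      Module.finrank 𝔽₂ ((Fin d → A) ⧸ (N ⊔ P)) := by
    rw [← hkφ]
    exact ((φ.quotKerEquivRange).restrictScalars 𝔽₂).finrank_eq.symm
  have e3 : Module.finrank 𝔽₂ ((Fin d → A) ⧸ (N ⊔ P)) +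
      Module.finrank 𝔽₂ (N.map P.mkQ) = Module.finrank 𝔽₂ ((Fin d → A) ⧸ P) := by
    have := hfinq _ P
    have h1 := finrank_quotient_add (A := A) (N.map P.mkQ)
    rw [← h1]
    congr 1
    have h2 : (N ⊔ P).map P.mkQ = N.map P.mkQ := by
      rw [Submodule.map_sup, Submodule.mkQ_map_self, sup_bot_eq]
    rw [← h2]
    exact ((Submodule.quotientQuotientEquivQuotient P (N ⊔ P) le_sup_right).restrictScalars
      𝔽₂).finrank_eq.symm
  have e4 : Module.finrank 𝔽₂ ((Fin d → A) ⧸ P) =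
      d * Module.finrank 𝔽₂ (A ⧸ ((augMul u)^[n + 1] ⊤ : Submodule A A)) :=
    finrank_pi_quotient u d (n + 1)
  obtain ⟨g, hg, -⟩ := exists_minimal_cover (V := N) u hG hu hA
  have e5 : Module.finrank 𝔽₂ (N ⧸ ((augMul u)^[n] ⊤ : Submodule A N)) ≤
      r * Module.finrank 𝔽₂ (A ⧸ ((augMul u)^[n] ⊤ : Submodule A A)) :=
    (finrank_quotient_le_of_surjective u g hg n).trans (finrank_pi_quotient u r n).le
  have e6 : Module.finrank 𝔽₂ (N.map P.mkQ) ≤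
      Module.finrank 𝔽₂ (N ⧸ ((augMul u)^[n] ⊤ : Submodule A N)) := by
    let ψ : N →ₗ[A] (N.map P.mkQ) := P.mkQ.submoduleMap N
    have hψ : Function.Surjective ψ := P.mkQ.submoduleMap_surjective N
    have hle : ((augMul u)^[n] ⊤ : Submodule A N) ≤ LinearMap.ker ψ := by
      intro x hx
      rw [LinearMap.mem_ker]
      apply Subtype.ext
      refine (Submodule.Quotient.mk_eq_zero P).2 ?_
      have h1 : ((augMul u)^[n] ⊤ : Submodule A N).map N.subtype ≤ P := by
        rw [map_iterate_augMul, Submodule.map_top, Submodule.range_subtype, hP,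
          Function.iterate_succ_apply]
        exact iterate_augMul_mono u hker n
      exact h1 ⟨x, hx, rfl⟩
    have := hfinq _ ((augMul u)^[n] ⊤ : Submodule A N)
    refine LinearMap.finrank_le_finrank_of_surjective
      (f := ((Submodule.liftQ _ ψ hle).restrictScalars 𝔽₂)) fun y => ?_
    obtain ⟨x, rfl⟩ := hψ y
    exact ⟨Submodule.Quotient.mk x, rfl⟩
  rw [← e4, ← e3, e1, e2]
  omega

/-- The Golod–Shafarevich inequality, in a weak form sufficient for infinite towers. -/
theorem golodShafarevich (hG : IsPGroup 2 G) (hu : Submodule.span 𝔽₂ (Set.range u) = ⊤)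
    (hA : Module.finrank 𝔽₂ (A ⧸ augMul u (⊤ : Submodule A A)) = 1) {d : ℕ}
    (f : (Fin d → A) →ₗ[A] (augMul u (⊤ : Submodule A A)))
    (hf : Function.Surjective f) (hker : LinearMap.ker f ≤ augMul u ⊤) :
    2 * d ≤ Module.finrank 𝔽₂
        (LinearMap.ker f ⧸ augMul u (⊤ : Submodule A (LinearMap.ker f))) + 3 := by
  by_contra! hlt
  have step := golodShafarevich_step u hG hu hA f hf hker
  set r := Module.finrank 𝔽₂ (LinearMap.ker f ⧸ augMul u (⊤ : Submodule A (LinearMap.ker f)))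
  let a : ℕ → ℕ := fun n => Module.finrank 𝔽₂ (A ⧸ ((augMul u)^[n] ⊤ : Submodule A A))
  change ∀ n, d * a (n + 1) + 1 ≤ a (n + 2) + r * a n at step
  have hrec : ∀ n, 2 * a n + 1 ≤ a (n + 1) := by
    intro n
    induction n with
    | zero =>
      have h0 : a 0 = 0 := by
        have := finrank_quotient_add (A := A) (⊤ : Submodule A A)
        have h2 : Module.finrank 𝔽₂ (⊤ : Submodule A A) = Module.finrank 𝔽₂ A :=
          (Submodule.topEquiv.restrictScalars 𝔽₂).finrank_eq
        change Module.finrank 𝔽₂ (A ⧸ (⊤ : Submodule A A)) = 0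
        omega
      rw [h0]
      exact hA.ge
    | succ n ih =>
      have h1 := step n
      obtain ⟨e, rfl⟩ : ∃ e, d = e + 2 := ⟨d - 2, by omega⟩
      have h2 : r * a n ≤ 2 * e * a n := Nat.mul_le_mul_right _ (by omega)
      nlinarith
  have hge : ∀ n, n ≤ a n := by
    intro n
    induction n with
    | zero => exact Nat.zero_le _
    | succ n ih => have := hrec n; omega
  have hle : ∀ n, a n ≤ Module.finrank 𝔽₂ A := fun n => by
    have := finrank_quotient_add (A := A) ((augMul u)^[n] ⊤ : Submodule A A)
    change Module.finrank 𝔽₂ (A ⧸ ((augMul u)^[n] ⊤ : Submodule A A)) ≤ _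
    omega
  have := hge (Module.finrank 𝔽₂ A + 1)
  have := hle (Module.finrank 𝔽₂ A + 1)
  omega

end

section

open MonoidAlgebra

section
variable (G : Type*) [Group G]

/-- The augmentation of the group algebra. -/
noncomputable def aug : MonoidAlgebra 𝔽₂ G →ₐ[𝔽₂] 𝔽₂ := MonoidAlgebra.lift 𝔽₂ 𝔽₂ G 1

@[simp] theorem aug_of (g : G) : aug G (of 𝔽₂ G g) = 1 := by simp [aug]

theorem span_range_of : Submodule.span 𝔽₂ (Set.range (of 𝔽₂ G)) = ⊤ := by
  refine eq_top_iff.2 fun x _ => ?_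
  induction x using MonoidAlgebra.induction_on with
  | of g => exact Submodule.subset_span ⟨g, rfl⟩
  | add x y hx hy => exact add_mem (hx trivial) (hy trivial)
  | smul r x hx => exact Submodule.smul_mem _ _ (hx trivial)

/-- The augmentation ideal, as a left ideal. -/
noncomputable abbrev augIdeal : Submodule (MonoidAlgebra 𝔽₂ G) (MonoidAlgebra 𝔽₂ G) :=
  augMul (of 𝔽₂ G) ⊤

theorem of_sub_one_mem (g : G) : of 𝔽₂ G g - 1 ∈ augIdeal G := by
  have := sub_one_smul_mem_augMul (of 𝔽₂ G) g
    (Submodule.mem_top (R := MonoidAlgebra 𝔽₂ G) (x := (1 : MonoidAlgebra 𝔽₂ G)))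
  rwa [smul_eq_mul, mul_one] at this

theorem mem_augIdeal_iff_span (x : MonoidAlgebra 𝔽₂ G) : x ∈ augIdeal G ↔
    x ∈ Submodule.span 𝔽₂ (Set.range fun g => of 𝔽₂ G g - 1) := by
  constructor
  · intro hx
    induction hx using Submodule.span_induction with
    | mem x hx =>
      obtain ⟨g, w, -, rfl⟩ := hx
      induction w using MonoidAlgebra.induction_on with
      | of h =>
        have : (of 𝔽₂ G g - 1) • of 𝔽₂ G h = (of 𝔽₂ G (g * h) - 1) - (of 𝔽₂ G h - 1) := by
          rw [smul_eq_mul, sub_mul, map_mul, one_mul]; abel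
        rw [this]
        exact sub_mem (Submodule.subset_span ⟨_, rfl⟩) (Submodule.subset_span ⟨_, rfl⟩)
      | add x y hx hy => rw [smul_add]; exact add_mem hx hy
      | smul r x hx => rw [smul_comm]; exact Submodule.smul_mem _ _ hx
    | zero => exact zero_mem _
    | add a b _ _ ha hb => exact add_mem ha hb
    | smul a x _ hx =>
      clear * - hx
      induction a using MonoidAlgebra.induction_on with
      | of g =>
        induction hx using Submodule.span_induction with
        | mem x hx =>
          obtain ⟨h, rfl⟩ := hx
          have : of 𝔽₂ G g • (of 𝔽₂ G h - 1) = (of 𝔽₂ G (g * h) - 1) - (of 𝔽₂ G g - 1) := by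
            rw [smul_eq_mul, mul_sub, map_mul, mul_one]; abel
          dsimp only
          rw [this]
          exact sub_mem (Submodule.subset_span ⟨_, rfl⟩) (Submodule.subset_span ⟨_, rfl⟩)
        | zero => rw [smul_zero]; exact zero_mem _
        | add a b _ _ ha hb => rw [smul_add]; exact add_mem ha hb
        | smul r x _ hx => rw [smul_comm]; exact Submodule.smul_mem _ _ hx
      | add a b ha hb => rw [add_smul]; exact add_mem ha hb
      | smul r a ha => rw [smul_assoc]; exact Submodule.smul_mem _ _ ha
  · intro hx
    induction hx using Submodule.span_induction with
    | mem x hx => obtain ⟨g, rfl⟩ := hx; exact of_sub_one_mem G g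
    | zero => exact zero_mem _
    | add a b _ _ ha hb => exact add_mem ha hb
    | smul r x _ hx =>
      rw [← algebraMap_smul (MonoidAlgebra 𝔽₂ G) r x]
      exact Submodule.smul_mem _ _ hx

theorem aug_eq_zero_of_mem {x : MonoidAlgebra 𝔽₂ G} (hx : x ∈ augIdeal G) : aug G x = 0 := by
  rw [mem_augIdeal_iff_span] at hx
  induction hx using Submodule.span_induction with
  | mem x hx => obtain ⟨g, rfl⟩ := hx; rw [map_sub, aug_of, map_one, sub_self]
  | zero => exact map_zero _
  | add a b _ _ ha hb => rw [map_add, ha, hb, add_zero]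
  | smul r x _ hx => rw [map_smul, hx, smul_zero]

theorem sub_aug_mem (x : MonoidAlgebra 𝔽₂ G) :
    x - algebraMap 𝔽₂ _ (aug G x) ∈ augIdeal G := by
  induction x using MonoidAlgebra.induction_on with
  | of g => rw [aug_of, map_one]; exact of_sub_one_mem G g
  | add x y hx hy =>
    rw [map_add, map_add, add_sub_add_comm]
    exact add_mem hx hy
  | smul r x hx =>
    rw [map_smul, smul_eq_mul, map_mul, ← Algebra.smul_def, ← smul_sub,
      ← algebraMap_smul (MonoidAlgebra 𝔽₂ G) r]
    exact Submodule.smul_mem _ _ hx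

theorem finrank_quotient_augIdeal [Finite G] :
    Module.finrank 𝔽₂ (MonoidAlgebra 𝔽₂ G ⧸ augIdeal G) = 1 := by
  have hs : Function.Surjective (aug G).toLinearMap := fun c =>
    ⟨algebraMap 𝔽₂ _ c, (aug G).commutes c⟩
  have hk : (augIdeal G).restrictScalars 𝔽₂ = LinearMap.ker (aug G).toLinearMap := by
    ext x
    refine ⟨aug_eq_zero_of_mem G, fun hx => ?_⟩
    have := sub_aug_mem G x
    rwa [show aug G x = 0 from hx, map_zero, sub_zero] at this
  have e := ((aug G).toLinearMap.quotKerEquivOfSurjective hs).finrank_eq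
  rw [← hk, Module.finrank_self] at e
  exact e

/-- Homomorphisms to `𝔽₂` correspond to invariant functionals on the augmentation ideal. -/
theorem card_hom_eq : Nat.card (G →* Multiplicative 𝔽₂) =
    Nat.card {φ : augIdeal G →ₗ[𝔽₂] 𝔽₂ // ∀ g v, φ (of 𝔽₂ G g • v) = φ v} := by
  symm
  let e : G → augIdeal G := fun g => ⟨of 𝔽₂ G g - 1, of_sub_one_mem G g⟩
  have hmul : ∀ g h, e (g * h) = of 𝔽₂ G g • e h + e g := fun g h => Subtype.ext <| by
    simp only [e, map_mul, Submodule.coe_add, Submodule.coe_smul, smul_eq_mul]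
    rw [mul_sub, mul_one]; abel
  have hone : e 1 = 0 := Subtype.ext <| by
    change of 𝔽₂ G 1 - 1 = 0
    rw [map_one, sub_self]
  refine Nat.card_congr (Equiv.ofBijective (fun φ =>
    { toFun := fun g => Multiplicative.ofAdd (φ.1 (e g))
      map_one' := by rw [hone, map_zero]; rfl
      map_mul' := fun g h => by rw [hmul, map_add, φ.2, ofAdd_add, mul_comm] }) ⟨?_, ?_⟩)
  · rintro ⟨φ, hφ⟩ ⟨ψ, hψ⟩ h
    have h1 : ∀ g, φ (e g) = ψ (e g) := fun g => by
      have := DFunLike.congr_fun h g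
      exact Multiplicative.ofAdd.injective this
    ext ⟨x, hx⟩
    have hx' := (mem_augIdeal_iff_span G x).1 hx
    have key : ∀ x ∈ Submodule.span 𝔽₂ (Set.range fun g => of 𝔽₂ G g - 1),
        ∀ hx : x ∈ augIdeal G, φ ⟨x, hx⟩ = ψ ⟨x, hx⟩ := by
      intro x hx'
      induction hx' using Submodule.span_induction with
      | mem x hx => obtain ⟨g, rfl⟩ := hx; intro _; exact h1 g
      | zero => intro h; exact (map_zero φ).trans (map_zero ψ).symm
      | add a b ha hb ha' hb' =>
        intro h
        have ha1 := (mem_augIdeal_iff_span G a).2 ha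
        have hb1 := (mem_augIdeal_iff_span G b).2 hb
        have : (⟨a + b, h⟩ : augIdeal G) = ⟨a, ha1⟩ + ⟨b, hb1⟩ := rfl
        rw [this, map_add, map_add, ha' ha1, hb' hb1]
      | smul r a ha ha' =>
        intro h
        have ha1 := (mem_augIdeal_iff_span G a).2 ha
        have : (⟨r • a, h⟩ : augIdeal G) = r • ⟨a, ha1⟩ := rfl
        rw [this, map_smul, map_smul, ha' ha1]
    exact key x hx' hx
  · intro χ
    let D : MonoidAlgebra 𝔽₂ G →ₐ[𝔽₂] DualNumber 𝔽₂ := MonoidAlgebra.lift 𝔽₂ (DualNumber 𝔽₂) G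
      { toFun := fun g => 1 + TrivSqZeroExt.inr (χ g).toAdd
        map_one' := by simp
        map_mul' := fun g h => by
          ext
          · simp
          · simp [add_comm] }
    have hD : ∀ g, D (of 𝔽₂ G g) = 1 + TrivSqZeroExt.inr (χ g).toAdd := fun g => by simp [D]
    let Λ : MonoidAlgebra 𝔽₂ G →ₗ[𝔽₂] 𝔽₂ := TrivSqZeroExt.sndHom 𝔽₂ 𝔽₂ ∘ₗ D.toLinearMap
    have hfst : ∀ x, (D x).fst = aug G x := fun x => by
      induction x using MonoidAlgebra.induction_on with
      | of g => rw [hD, aug_of]; simp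
      | add x y hx hy => rw [map_add, map_add, TrivSqZeroExt.fst_add, hx, hy]
      | smul r x hx => rw [map_smul, map_smul, TrivSqZeroExt.fst_smul, hx]
    refine ⟨⟨Λ ∘ₗ ((augIdeal G).subtype.restrictScalars 𝔽₂), fun g v => ?_⟩, ?_⟩
    · change (D (of 𝔽₂ G g * v)).snd = (D v).snd
      rw [map_mul, TrivSqZeroExt.snd_mul, hfst v, aug_eq_zero_of_mem G v.2, hD]
      simp
    · ext g
      change Multiplicative.ofAdd (D (of 𝔽₂ G g - 1)).snd = χ g
      rw [map_sub, hD]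
      simp

end

end

section

open MonoidAlgebra

section
variable {G : Type*} [Group G] {V : Type*} [AddCommGroup V] [Module (MonoidAlgebra 𝔽₂ G) V]

/-- The extension of `G` by the kernel of a cover `f` of the augmentation ideal. -/
@[ext] structure CoverGroup (f : V →ₗ[MonoidAlgebra 𝔽₂ G] augIdeal G) where
  /-- the image in `G` -/
  g : G
  /-- the crossed part -/
  v : V
  map_eq : (f v : MonoidAlgebra 𝔽₂ G) = of 𝔽₂ G g - 1

namespace CoverGroup
variable (f : V →ₗ[MonoidAlgebra 𝔽₂ G] augIdeal G)

noncomputable instance : Mul (CoverGroup f) :=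
  ⟨fun x y => ⟨x.g * y.g, x.v + of 𝔽₂ G x.g • y.v, by
    rw [map_add, map_smul, Submodule.coe_add, Submodule.coe_smul, x.map_eq, y.map_eq, map_mul,
      smul_eq_mul, mul_sub, mul_one]; abel⟩⟩

noncomputable instance : One (CoverGroup f) := ⟨⟨1, 0, by rw [map_zero, map_one, sub_self]; rfl⟩⟩

noncomputable instance : Inv (CoverGroup f) :=
  ⟨fun x => ⟨x.g⁻¹, -(of 𝔽₂ G x.g⁻¹ • x.v), by
    rw [map_neg, map_smul, Submodule.coe_neg, Submodule.coe_smul, x.map_eq, smul_eq_mul, mul_sub,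
      ← map_mul, inv_mul_cancel, map_one, mul_one, neg_sub]⟩⟩

@[simp] theorem mul_g (x y : CoverGroup f) : (x * y).g = x.g * y.g := rfl
@[simp] theorem mul_v (x y : CoverGroup f) : (x * y).v = x.v + of 𝔽₂ G x.g • y.v := rfl
@[simp] theorem one_g : (1 : CoverGroup f).g = 1 := rfl
@[simp] theorem one_v : (1 : CoverGroup f).v = 0 := rfl
@[simp] theorem inv_g (x : CoverGroup f) : (x⁻¹).g = x.g⁻¹ := rfl
@[simp] theorem inv_v (x : CoverGroup f) : (x⁻¹).v = -(of 𝔽₂ G x.g⁻¹ • x.v) := rfl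

noncomputable instance : Group (CoverGroup f) :=
  Group.ofLeftAxioms
    (fun x y z => by
      refine CoverGroup.ext (mul_assoc _ _ _) ?_
      simp only [mul_v, mul_g, map_mul, smul_add, mul_smul, add_assoc])
    (fun x => by
      refine CoverGroup.ext (one_mul _) ?_
      rw [mul_v, one_v, one_g, map_one, one_smul, zero_add])
    (fun x => by
      refine CoverGroup.ext (inv_mul_cancel _) ?_
      rw [mul_v, inv_v, inv_g, one_v, neg_add_cancel])

/-- The projection to `G`. -/
noncomputable def proj : CoverGroup f →* G where
  toFun := g
  map_one' := rfl
  map_mul' _ _ := rfl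

theorem proj_surjective (hf : Function.Surjective f) : Function.Surjective (proj f) := fun g => by
  obtain ⟨v, hv⟩ := hf ⟨_, of_sub_one_mem G g⟩
  exact ⟨⟨g, v, by rw [hv]⟩, rfl⟩

instance [Finite G] [Finite V] : Finite (CoverGroup f) :=
  Finite.of_injective (fun x => (x.g, x.v)) fun x y h => by
    simp only [Prod.mk.injEq] at h
    exact CoverGroup.ext h.1 h.2

/-- The kernel of the projection. -/
noncomputable def kerEquiv : (proj f).ker ≃* Multiplicative (LinearMap.ker f) where
  toFun x := Multiplicative.ofAdd ⟨x.1.v, by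
    have h1 : x.1.g = 1 := x.2
    have := x.1.map_eq
    rw [h1, map_one, sub_self] at this
    exact Subtype.ext this⟩
  invFun n := ⟨⟨1, n.toAdd.1, by rw [LinearMap.mem_ker.1 n.toAdd.2, map_one, sub_self]; rfl⟩, rfl⟩
  left_inv x := Subtype.ext <| CoverGroup.ext (show 1 = x.1.g from (show x.1.g = 1 from x.2).symm) rfl
  right_inv _ := rfl
  map_mul' x y := by
    have h1 : x.1.g = 1 := x.2
    refine Multiplicative.toAdd.injective (Subtype.ext ?_)
    change x.1.v + of 𝔽₂ G x.1.g • y.1.v = x.1.v + y.1.v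
    rw [h1, map_one, one_smul]

end CoverGroup
end

universe u

set_option maxHeartbeats 1000000 in
open CoverGroup in
/-- A homomorphism to `𝔽₂` on the group of a minimal cover vanishes on the kernel. -/
theorem CoverGroup.hom_ker_eq_one {G : Type*} [Group G] {V : Type*} [AddCommGroup V]
    [Module (MonoidAlgebra 𝔽₂ G) V] [Module 𝔽₂ V] [IsScalarTower 𝔽₂ (MonoidAlgebra 𝔽₂ G) V]
    (f : V →ₗ[MonoidAlgebra 𝔽₂ G] augIdeal G) (hf : Function.Surjective f)
    (hker : LinearMap.ker f ≤ augMul (of 𝔽₂ G) ⊤) (χ : CoverGroup f →* Multiplicative 𝔽₂) :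
    χ.comp (proj f).ker.subtype = 1 := by
  obtain ⟨l, hl⟩ := (f.restrictScalars 𝔽₂).exists_rightInverse_of_surjective
    (LinearMap.range_eq_top.2 hf)
  replace hl : ∀ x, f (l x) = x := fun x => LinearMap.congr_fun hl x
  let e : G → augIdeal G := fun g => ⟨of 𝔽₂ G g - 1, of_sub_one_mem G g⟩
  have he1 : e 1 = 0 := Subtype.ext <| by
    change of 𝔽₂ G 1 - 1 = 0
    rw [map_one, sub_self]
  let κ : G → 𝔽₂ := fun g => (χ ⟨g, l (e g), by rw [hl]⟩).toAdd
  let c : MonoidAlgebra 𝔽₂ G →ₗ[𝔽₂] 𝔽₂ :=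
    (Finsupp.linearCombination 𝔽₂ κ) ∘ₗ (MonoidAlgebra.coeffLinearEquiv 𝔽₂).toLinearMap
  have hc : ∀ g, c (of 𝔽₂ G g) = κ g := fun g => by
    simp [c, MonoidAlgebra.coeffLinearEquiv_apply]
  have hκ1 : κ 1 = 0 := by
    have : (⟨1, l (e 1), by rw [hl]⟩ : CoverGroup f) = 1 := by
      refine CoverGroup.ext rfl ?_
      change l (e 1) = 0
      rw [he1, map_zero]
    change (χ ⟨1, l (e 1), _⟩).toAdd = 0
    rw [this, map_one]; rfl
  let ν : LinearMap.ker f →+ 𝔽₂ := MonoidHom.toAdditiveLeft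
    ((χ.comp (proj f).ker.subtype).comp (kerEquiv f).symm.toMonoidHom)
  let p : V →ₗ[𝔽₂] LinearMap.ker f :=
    LinearMap.codRestrict ((LinearMap.ker f).restrictScalars 𝔽₂)
      (LinearMap.id - l ∘ₗ (f.restrictScalars 𝔽₂)) (fun v => by
        change f (v - l (f v)) = 0
        rw [map_sub, hl, sub_self])
  let Φ : V →ₗ[𝔽₂] 𝔽₂ := ν.toZModLinearMap 2 ∘ₗ p +
    c ∘ₗ ((augIdeal G).subtype.restrictScalars 𝔽₂) ∘ₗ (f.restrictScalars 𝔽₂)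
  have hΦ : ∀ x : CoverGroup f, Φ x.v = (χ x).toAdd := by
    intro x
    have hx : x = ((kerEquiv f).symm (Multiplicative.ofAdd (p x.v))).1 *
        ⟨x.g, l (e x.g), by rw [hl]⟩ := by
      refine CoverGroup.ext (one_mul _).symm ?_
      change x.v = (x.v - l (f x.v)) + of 𝔽₂ G 1 • l (e x.g)
      have : f x.v = e x.g := Subtype.ext x.map_eq
      rw [map_one, one_smul, this, sub_add_cancel]
    conv_rhs => rw [hx, map_mul, toAdd_mul]
    change ν (p x.v) + c (f x.v) = ν (p x.v) + κ x.g
    rw [x.map_eq, map_sub, hc, ← map_one (of 𝔽₂ G), hc, hκ1, sub_zero]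
  have hinv1 : ∀ g w, f w = e g → ∀ h, Φ (of 𝔽₂ G h • w) = Φ w := by
    intro g w hw h
    have h1 := hΦ (⟨h, l (e h), by rw [hl]⟩ * ⟨g, w, by rw [hw]⟩)
    rw [map_mul, toAdd_mul, ← hΦ, ← hΦ, mul_v, map_add] at h1
    exact add_left_cancel h1
  have hinv : ∀ h w, Φ (of 𝔽₂ G h • w) = Φ w := by
    have key : ∀ y ∈ Submodule.span 𝔽₂ (Set.range fun g => of 𝔽₂ G g - 1), ∀ w,
        (f w : MonoidAlgebra 𝔽₂ G) = y → ∀ h, Φ (of 𝔽₂ G h • w) = Φ w := by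
      intro y hy
      induction hy using Submodule.span_induction with
      | mem y hy => obtain ⟨g, rfl⟩ := hy; exact fun w hw => hinv1 g w (Subtype.ext hw)
      | zero => exact fun w hw => hinv1 1 w (by rw [he1]; exact Subtype.ext hw)
      | add a b ha _ ha' hb' =>
        intro w hw h
        have ha1 := (mem_augIdeal_iff_span G a).2 ha
        have e1 := ha' (l ⟨a, ha1⟩) (by rw [hl]) h
        have e2 := hb' (w - l ⟨a, ha1⟩) (by
          rw [map_sub, hl, Submodule.coe_sub, hw, add_sub_cancel_left]) h
        rw [smul_sub, map_sub, map_sub, e1] at e2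
        exact sub_left_inj.1 e2
      | smul r a ha ha' =>
        intro w hw h
        have ha1 := (mem_augIdeal_iff_span G a).2 ha
        have e1 := ha' (l ⟨a, ha1⟩) (by rw [hl]) h
        have e2 := hinv1 1 (w - r • l ⟨a, ha1⟩) (by
          rw [map_sub, he1, ← map_smul l, hl, sub_eq_zero]
          exact Subtype.ext hw) h
        have e3 : of 𝔽₂ G h • r • l ⟨a, ha1⟩ = r • of 𝔽₂ G h • l ⟨a, ha1⟩ := smul_comm _ _ _
        rw [smul_sub, map_sub Φ, map_sub Φ, e3, map_smul Φ r, map_smul Φ r, e1] at e2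
        exact sub_left_inj.1 e2
    exact fun h w => key _ ((mem_augIdeal_iff_span G _).1 (f w).2) w rfl h
  ext n
  have h1 : n.1.v ∈ LinearMap.ker f := ((kerEquiv f) n).toAdd.2
  have h2 := restrictScalars_augMul_top_le_ker (of 𝔽₂ G) (span_range_of G) Φ hinv (hker h1)
  have h3 := hΦ n.1
  rw [LinearMap.mem_ker.1 h2] at h3
  exact Multiplicative.toAdd.injective h3.symm

namespace CoverGroup
section
variable {G : Type*} [Group G] {V : Type*} [AddCommGroup V]
    [Module (MonoidAlgebra 𝔽₂ G) V] [Module 𝔽₂ V] [IsScalarTower 𝔽₂ (MonoidAlgebra 𝔽₂ G) V]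
    (f : V →ₗ[MonoidAlgebra 𝔽₂ G] augIdeal G)

theorem kerEquiv_conj (x : CoverGroup f) (n m : (proj f).ker)
    (h : (m : CoverGroup f) = x * n * x⁻¹) :
    (kerEquiv f m).toAdd = of 𝔽₂ G x.g • (kerEquiv f n).toAdd := by
  refine Subtype.ext ?_
  have h1 : n.1.g = 1 := n.2
  change m.1.v = of 𝔽₂ G x.g • n.1.v
  rw [h]
  simp only [mul_v, mul_g, inv_v, h1, mul_one, smul_neg, ← mul_smul, ← map_mul, mul_inv_cancel,
    map_one, one_smul]
  abel

theorem card_conj_invariant (hf : Function.Surjective f) :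
    Nat.card {φ : (proj f).ker →* Multiplicative 𝔽₂ // ∀ (x : CoverGroup f) (n m : (proj f).ker),
        (m : CoverGroup f) = x * n * x⁻¹ → φ m = φ n} =
    Nat.card {φ : LinearMap.ker f →ₗ[𝔽₂] 𝔽₂ // ∀ g v, φ (of 𝔽₂ G g • v) = φ v} := by
  let E : ((proj f).ker →* Multiplicative 𝔽₂) ≃ (LinearMap.ker f →ₗ[𝔽₂] 𝔽₂) :=
    { toFun := fun φ => AddMonoidHom.toZModLinearMap 2
        (MonoidHom.toAdditiveLeft (φ.comp (kerEquiv f).symm.toMonoidHom))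
      invFun := fun l => (AddMonoidHom.toMultiplicative l.toAddMonoidHom).comp
        (kerEquiv f).toMonoidHom
      left_inv := fun φ => MonoidHom.ext fun n => by
        change φ ((kerEquiv f).symm (kerEquiv f n)) = φ n
        rw [MulEquiv.symm_apply_apply]
      right_inv := fun l => LinearMap.ext fun n => rfl }
  have hE : ∀ φ n, E φ (kerEquiv f n).toAdd = (φ n).toAdd := fun φ n => by
    change (φ ((kerEquiv f).symm (kerEquiv f n))).toAdd = _
    rw [MulEquiv.symm_apply_apply]
  refine Nat.card_congr (E.subtypeEquiv fun φ => ⟨fun h g v => ?_, fun h x n m hm => ?_⟩)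
  · obtain ⟨x, rfl⟩ := proj_surjective f hf g
    obtain ⟨n, rfl⟩ : ∃ n, (kerEquiv f n).toAdd = v :=
      ⟨(kerEquiv f).symm (Multiplicative.ofAdd v), rfl⟩
    have hmem : x * n * x⁻¹ ∈ (proj f).ker := Subgroup.Normal.conj_mem inferInstance _ n.2 _
    have := kerEquiv_conj f x n ⟨_, hmem⟩ rfl
    change E φ (of 𝔽₂ G x.g • _) = _
    rw [← this, hE, hE, h x n ⟨_, hmem⟩ rfl]
  · have := h x.g (kerEquiv f n).toAdd
    rw [← kerEquiv_conj f x n m hm, hE, hE] at this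
    exact Multiplicative.toAdd.injective this

end
end CoverGroup

open CoverGroup in
/-- A finite `2`-group is a quotient of a group with many invariant characters on the kernel
that do not extend. -/
theorem exists_cover (G : Type u) [Group G] [Finite G] (hG : IsPGroup 2 G) :
    ∃ (Γ : Type u) (_ : Group Γ) (_ : Finite Γ) (π : Γ →* G) (d r : ℕ), Function.Surjective π ∧
      Nat.card (G →* Multiplicative 𝔽₂) = 2 ^ d ∧ 2 * d ≤ r + 3 ∧
      Nat.card {φ : π.ker →* Multiplicative 𝔽₂ // ∀ (x : Γ) (n m : π.ker),
        (m : Γ) = x * n * x⁻¹ → φ m = φ n} = 2 ^ r ∧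
      ∀ χ : Γ →* Multiplicative 𝔽₂, χ.comp π.ker.subtype = 1 := by
  have : Finite (MonoidAlgebra 𝔽₂ G) := by
    have : Finite (G →₀ 𝔽₂) := Finite.of_injective _ DFunLike.coe_injective
    exact Finite.of_equiv _ MonoidAlgebra.coeffEquiv.symm
  have hA := finrank_quotient_augIdeal G
  have hu := span_range_of G
  obtain ⟨f, hf, hker⟩ := exists_minimal_cover (V := augIdeal G) (of 𝔽₂ G) hG hu hA
  have hd := (card_hom_eq G).trans (card_invariant_functionals (V := augIdeal G) (of 𝔽₂ G) hu)
  have hr := card_invariant_functionals (V := LinearMap.ker f) (of 𝔽₂ G) hu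
  have hgs := golodShafarevich (of 𝔽₂ G) hG hu hA f hf hker
  refine ⟨CoverGroup f, inferInstance, inferInstance, proj f, _, _,
    proj_surjective f hf, hd, hgs, ?_, hom_ker_eq_one f hf hker⟩
  exact (card_conj_invariant f hf).trans hr

end

end GroupAlgebra

/-! ### Orders of elements at primes of a Dedekind domain -/

namespace IsDedekindDomain.HeightOneSpectrum

open scoped WithZero nonZeroDivisors Pointwise

section Ord

variable {R : Type*} [CommRing R] [IsDedekindDomain R] {K : Type*} [Field K]
  [Algebra R K] [IsFractionRing R K] (v : HeightOneSpectrum R)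

/-- The order of a nonzero element of the fraction field at a prime. -/
noncomputable def ord (x : Kˣ) : ℤ := -(v.valuationOfNeZero x).toAdd

theorem ord_mul (x y : Kˣ) : v.ord (x * y) = v.ord x + v.ord y := by
  simp [ord, add_comm]

@[simp] theorem ord_one : v.ord (1 : Kˣ) = 0 := by simp [ord]

@[simp] theorem ord_inv (x : Kˣ) : v.ord x⁻¹ = -v.ord x := by simp [ord]

theorem ord_pow (x : Kˣ) (n : ℕ) : v.ord (x ^ n) = n * v.ord x := by simp [ord]

theorem ord_div (x y : Kˣ) : v.ord (x / y) = v.ord x - v.ord y := by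
  rw [div_eq_mul_inv, ord_mul, ord_inv, sub_eq_add_neg]

theorem valuation_eq_exp_neg_ord (x : Kˣ) : v.valuation K (x : K) = WithZero.exp (-v.ord x) := by
  rw [← v.valuationOfNeZero_eq, ord, neg_neg]; rfl

theorem ord_eq_iff {x : Kˣ} {n : ℤ} : v.ord x = n ↔ v.valuation K (x : K) = WithZero.exp (-n) := by
  rw [valuation_eq_exp_neg_ord, WithZero.exp_inj, neg_inj]

theorem ord_nonneg_of_mem {x : Kˣ} {a : R} (h : algebraMap R K a = x) : 0 ≤ v.ord x := by
  have : v.valuation K (algebraMap R K a) ≤ 1 := v.valuation_le_one a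
  rw [h, valuation_eq_exp_neg_ord, ← WithZero.exp_zero, WithZero.exp_le_exp] at this
  omega

theorem ord_pos_iff_mem {x : Kˣ} {a : R} (h : algebraMap R K a = x) :
    0 < v.ord x ↔ a ∈ v.asIdeal := by
  have : v.valuation K (algebraMap R K a) < 1 ↔ a ∈ v.asIdeal := v.valuation_lt_one_iff_mem a
  rw [← this, h, valuation_eq_exp_neg_ord, ← WithZero.exp_zero, WithZero.exp_lt_exp]
  omega

theorem exists_algebraMap_eq_of_ord_nonneg {x : Kˣ}
    (h : ∀ v : HeightOneSpectrum R, 0 ≤ v.ord x) : ∃ a, algebraMap R K a = x := by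
  refine mem_integers_of_valuation_le_one K (x : K) fun v ↦ ?_
  rw [valuation_eq_exp_neg_ord, ← WithZero.exp_zero, WithZero.exp_le_exp]
  have := h v
  omega

theorem ord_units_map (x : Rˣ) : v.ord (Units.map (algebraMap R K : R →* K) x) = 0 := by
  rw [ord, v.valuation_of_unit_eq]; rfl

theorem exists_units_map_eq_of_ord_eq_zero {x : Kˣ}
    (h : ∀ v : HeightOneSpectrum R, v.ord x = 0) :
    ∃ u : Rˣ, Units.map (algebraMap R K : R →* K) u = x := by
  obtain ⟨a, ha⟩ := exists_algebraMap_eq_of_ord_nonneg (x := x) fun v ↦ (h v).ge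
  obtain ⟨b, hb⟩ := exists_algebraMap_eq_of_ord_nonneg (R := R) (x := x⁻¹)
    fun v ↦ by rw [ord_inv, h v, neg_zero]
  refine ⟨⟨a, b, ?_, ?_⟩, Units.ext ha⟩ <;> apply IsFractionRing.injective R K <;>
    simp [ha, hb]

theorem count_spanSingleton (x : Kˣ) :
    FractionalIdeal.count K v (FractionalIdeal.spanSingleton R⁰ (x : K)) = v.ord x := by
  classical
  obtain ⟨a, b, hb, hx⟩ := IsFractionRing.div_surjective (A := R) (x : K)
  have hb0 := nonZeroDivisors.ne_zero hb
  have ha0 : a ≠ 0 := by rintro rfl; exact x.ne_zero (by simp [← hx])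
  rw [FractionalIdeal.count_well_defined K v (a := b) (J := Ideal.span {a})
    (FractionalIdeal.spanSingleton_ne_zero_iff.2 x.ne_zero)]
  · symm
    rw [ord_eq_iff, ← hx, map_div₀, valuation_of_algebraMap, valuation_of_algebraMap,
      intValuation_if_neg _ ha0, intValuation_if_neg _ hb0, ← WithZero.exp_sub]
    congr 1; ring
  · rw [FractionalIdeal.coeIdeal_span_singleton, FractionalIdeal.spanSingleton_mul_spanSingleton,
      ← hx, div_eq_inv_mul]

theorem finite_ord_ne_zero (x : Kˣ) : {v : HeightOneSpectrum R | v.ord x ≠ 0}.Finite := by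
  have := FractionalIdeal.finite_factors (FractionalIdeal.spanSingleton R⁰ (x : K))
  simpa [count_spanSingleton] using this

/-- The divisor of an element. -/
noncomputable def divisor (x : Kˣ) : HeightOneSpectrum R →₀ ℤ :=
  Finsupp.ofSupportFinite (fun v ↦ v.ord x) (finite_ord_ne_zero x)

@[simp] theorem divisor_apply (x : Kˣ) : divisor x v = v.ord x := rfl

/-- The ideal class of a prime. -/
noncomputable def idealClass : ClassGroup R :=
  ClassGroup.mk0 ⟨v.asIdeal, mem_nonZeroDivisors_of_ne_zero v.ne_bot⟩

/-- The ideal class of a divisor. -/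
noncomputable def divisorClass : (HeightOneSpectrum R →₀ ℤ) →+ Additive (ClassGroup R) :=
  Finsupp.liftAddHom fun v ↦ zmultiplesHom _ (Additive.ofMul v.idealClass)

@[simp] theorem divisorClass_single (n : ℤ) :
    divisorClass (Finsupp.single v n) = n • Additive.ofMul v.idealClass := by
  simp [divisorClass]

theorem divisorClass_eq_mk (n : HeightOneSpectrum R →₀ ℤ) (I : (FractionalIdeal R⁰ K)ˣ)
    (hI : ∀ v, FractionalIdeal.count K v I = n v) :
    divisorClass n = Additive.ofMul (ClassGroup.mk K I) := by
  have : I = n.prod fun v k ↦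
      (FractionalIdeal.mk0 K ⟨v.asIdeal, mem_nonZeroDivisors_of_ne_zero v.ne_bot⟩) ^ k := by
    apply Units.ext
    rw [← FractionalIdeal.finprod_heightOneSpectrum_factorization' K I.ne_zero,
      finprod_eq_prod_of_mulSupport_subset (s := n.support)]
    · simp [Finsupp.prod, Units.coe_prod, hI]
    · intro v hv
      rw [Function.mem_mulSupport, hI] at hv
      simp only [Finset.mem_coe, Finsupp.mem_support_iff]
      intro h; simp [h] at hv
  rw [this, map_finsuppProd]
  simp [divisorClass, Finsupp.prod, Finsupp.sum, ofMul_prod, idealClass]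

theorem divisorClass_eq_zero_iff (K : Type*) [Field K] [Algebra R K] [IsFractionRing R K]
    {n : HeightOneSpectrum R →₀ ℤ} :
    divisorClass n = 0 ↔ ∃ x : Kˣ, ∀ v : HeightOneSpectrum R, v.ord x = n v := by
  constructor
  · intro h
    let I : (FractionalIdeal R⁰ K)ˣ := Units.mk0
      (n.prod fun v k ↦ ((v.asIdeal : FractionalIdeal R⁰ K)) ^ k) (by
        rw [Finsupp.prod, Finset.prod_ne_zero_iff]
        exact fun v _ ↦ zpow_ne_zero _ (FractionalIdeal.coeIdeal_ne_zero.mpr v.ne_bot))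
    have hI : ∀ v, FractionalIdeal.count K v I = n v := fun v ↦
      FractionalIdeal.count_finsuppProd K v n
    rw [divisorClass_eq_mk n I hI, ofMul_eq_zero, ClassGroup.mk_eq_one_iff] at h
    obtain ⟨x, hx⟩ := h
    have hx' : (I : FractionalIdeal R⁰ K) = FractionalIdeal.spanSingleton R⁰ x := by
      apply FractionalIdeal.coeToSubmodule_injective
      exact hx.trans (FractionalIdeal.coe_spanSingleton _ _).symm
    have h0 : x ≠ 0 := by
      rintro rfl; apply I.ne_zero; simp [hx']
    refine ⟨Units.mk0 x h0, fun v ↦ ?_⟩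
    rw [← count_spanSingleton, Units.val_mk0, ← hx', hI]
  · rintro ⟨x, hx⟩
    rw [divisorClass_eq_mk n (toPrincipalIdeal R K x) (fun v ↦ by
      rw [coe_toPrincipalIdeal, count_spanSingleton, hx])]
    rw [ofMul_eq_zero, ClassGroup.mk_eq_one_iff, coe_toPrincipalIdeal,
      FractionalIdeal.coe_spanSingleton]
    exact ⟨x, rfl⟩

theorem divisorClass_surjective (R : Type*) [CommRing R] [IsDedekindDomain R] :
    Function.Surjective (divisorClass (R := R)) := by
  intro c
  obtain ⟨I, hI⟩ := ClassGroup.mk0_surjective c.toMul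
  let J := FractionalIdeal.mk0 (FractionRing R) I
  let n : HeightOneSpectrum R →₀ ℤ := Finsupp.ofSupportFinite
    (fun v ↦ FractionalIdeal.count (FractionRing R) v (J : FractionalIdeal R⁰ (FractionRing R)))
    (FractionalIdeal.finite_factors _)
  refine ⟨n, ?_⟩
  rw [divisorClass_eq_mk n J (fun v ↦ rfl), ClassGroup.mk_mk0, hI]; rfl

end Ord

section Action

variable {R : Type*} [CommRing R] [IsDedekindDomain R] {G : Type*} [Group G]
  [MulSemiringAction G R]

instance : MulAction G (HeightOneSpectrum R) where
  smul g v := ⟨g • v.asIdeal, inferInstance, by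
    intro h
    apply v.ne_bot
    rw [← inv_smul_smul g v.asIdeal, h, Ideal.pointwise_smul_def, Ideal.map_bot]⟩
  one_smul v := HeightOneSpectrum.ext (one_smul G v.asIdeal)
  mul_smul g h v := HeightOneSpectrum.ext (mul_smul g h v.asIdeal)

omit [IsDedekindDomain R] in
@[simp] theorem smul_asIdeal (g : G) (v : HeightOneSpectrum R) :
    (g • v).asIdeal = g • v.asIdeal := rfl

theorem intValuation_smul (g : G) (v : HeightOneSpectrum R) (x : R) :
    (g • v).intValuation (g • x) = v.intValuation x := by
  rcases eq_or_ne x 0 with rfl | hx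
  · simp
  have key (v : HeightOneSpectrum R) (g : G) (x : R) (n : ℕ) :
      v.intValuation x ≤ WithZero.exp (-(n : ℤ)) →
        (g • v).intValuation (g • x) ≤ WithZero.exp (-(n : ℤ)) := by
    rw [intValuation_le_pow_iff_mem, intValuation_le_pow_iff_mem, smul_asIdeal,
      Ideal.pointwise_smul_def, ← Ideal.map_pow]
    exact fun h ↦ Ideal.mem_map_of_mem _ h
  have le (v : HeightOneSpectrum R) (g : G) (x : R) (hx : x ≠ 0) :
      (g • v).intValuation (g • x) ≤ v.intValuation x := by
    have := key v g x ((Associates.mk v.asIdeal).count (Associates.mk (Ideal.span {x})).factors)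
    rw [← intValuation_if_neg _ hx] at this
    exact this le_rfl
  refine le_antisymm (le v g x hx) ?_
  simpa using le (g • v) g⁻¹ (g • x) (by simpa [smul_eq_zero_iff_eq] using hx)

end Action

section Gal

variable {K L S : Type*} [Field K] [Field L] [Algebra K L] [CommRing S] [IsDedekindDomain S]
  [Algebra S L] [IsFractionRing S L] [MulSemiringAction Gal(L/K) S]
  [SMulDistribClass Gal(L/K) S L]

theorem ord_smul_smul (g : Gal(L/K)) (v : HeightOneSpectrum S) (x : Lˣ) :
    (g • v).ord (g • x) = v.ord x := by
  rw [ord_eq_iff, ← valuation_eq_exp_neg_ord]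
  obtain ⟨a, b, hb, hx⟩ := IsFractionRing.div_surjective (A := S) (x : L)
  have h (a : S) : g (algebraMap S L a) = algebraMap S L (g • a) := by
    rw [← AlgEquiv.smul_def, Algebra.algebraMap_eq_smul_one, smul_distrib_smul, smul_one,
      ← Algebra.algebraMap_eq_smul_one]
  have : ((g • x : Lˣ) : L) = g x := rfl
  rw [this, ← hx, map_div₀, h, h, map_div₀, map_div₀]
  simp only [valuation_of_algebraMap, intValuation_smul]

theorem ord_smul (g : Gal(L/K)) (v : HeightOneSpectrum S) (x : Lˣ) :
    v.ord (g • x) = (g⁻¹ • v).ord x := by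
  conv_lhs => rw [← smul_inv_smul g v]
  exact ord_smul_smul g _ x

end Gal

end IsDedekindDomain.HeightOneSpectrum

/-! ### Primes in extensions of number fields with trivial different -/

namespace NumberField

open IsDedekindDomain HeightOneSpectrum
open scoped Pointwise

section Tower

variable (K M L : Type*) [Field K] [NumberField K] [Field L] [NumberField L]
  [Field M] [NumberField M] [Algebra K M] [Algebra M L] [Algebra K L] [IsScalarTower K M L]

theorem differentIdeal_eq_top_iff :
    differentIdeal (𝓞 K) (𝓞 L) = ⊤ ↔
      differentIdeal (𝓞 K) (𝓞 M) = ⊤ ∧ differentIdeal (𝓞 M) (𝓞 L) = ⊤ := by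
  have := differentIdeal_eq_differentIdeal_mul_differentIdeal (𝓞 K) (𝓞 M) (𝓞 L)
  constructor
  · intro h
    rw [h, eq_comm, ← Ideal.one_eq_top, mul_eq_one] at this
    refine ⟨?_, by simpa using this.1⟩
    rw [← Ideal.map_eq_top_iff (algebraMap (𝓞 M) (𝓞 L))
      (FaithfulSMul.algebraMap_injective (𝓞 M) (𝓞 L)) (Algebra.IsIntegral.isIntegral), this.2,
      Ideal.one_eq_top]
  · rintro ⟨h1, h2⟩
    rw [this, h1, h2, Ideal.map_top, Ideal.top_mul]

end Tower

section

variable (K : Type*) {L : Type*} [Field K] [NumberField K] [Field L] [NumberField L]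
  [Algebra K L]

instance (w : HeightOneSpectrum (𝓞 L)) : w.asIdeal.LiesOver (w.under (𝓞 K)).asIdeal := ⟨rfl⟩

omit [NumberField K] [NumberField L] in
theorem exists_under_eq (v : HeightOneSpectrum (𝓞 K)) :
    ∃ w : HeightOneSpectrum (𝓞 L), w.under (𝓞 K) = v := by
  obtain ⟨P, hP, h⟩ := v.asIdeal.exists_ideal_over_prime_of_isIntegral_of_isDomain (S := 𝓞 L)
    (by simp [(RingHom.injective_iff_ker_eq_bot _).1
      (FaithfulSMul.algebraMap_injective (𝓞 K) (𝓞 L))])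
  refine ⟨⟨P, hP, ?_⟩, HeightOneSpectrum.ext h⟩
  rintro rfl
  exact v.ne_bot (by rw [← h, Ideal.comap_bot_of_injective _
    (FaithfulSMul.algebraMap_injective (𝓞 K) (𝓞 L))])

variable {K}

theorem ord_algebraMap_of_not_dvd {w : HeightOneSpectrum (𝓞 L)}
    (h : ¬ w.asIdeal ∣ differentIdeal (𝓞 K) (𝓞 L)) (x : Kˣ) :
    w.ord (Units.map (algebraMap K L : K →* L) x) = (w.under (𝓞 K)).ord x := by
  have : Algebra.IsUnramifiedAt (𝓞 K) w.asIdeal := by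
    rwa [← not_dvd_differentIdeal_iff]
  rw [ord_eq_iff, ← valuation_eq_exp_neg_ord, Units.coe_map, MonoidHom.coe_coe,
    ← valuation_liesOver L (w.under (𝓞 K)) w,
    Ideal.ramificationIdx'_eq_ramificationIdx (p := (w.under (𝓞 K)).asIdeal) w.asIdeal
      (w.under (𝓞 K)).ne_bot, Ideal.ramificationIdx_eq_one_of_isUnramifiedAt, pow_one]

theorem ord_algebraMap (h : differentIdeal (𝓞 K) (𝓞 L) = ⊤) (w : HeightOneSpectrum (𝓞 L))
    (x : Kˣ) : w.ord (Units.map (algebraMap K L : K →* L) x) = (w.under (𝓞 K)).ord x := by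
  refine ord_algebraMap_of_not_dvd (fun h' ↦ ?_) x
  rw [h] at h'
  exact w.isPrime.ne_top (top_le_iff.1 (Ideal.le_of_dvd h'))

theorem ramificationIdx_eq_one_of_differentIdeal_eq_top
    (h : differentIdeal (𝓞 K) (𝓞 L) = ⊤) (w : HeightOneSpectrum (𝓞 L)) :
    w.asIdeal.ramificationIdx (𝓞 K) = 1 := by
  have : Algebra.IsUnramifiedAt (𝓞 K) w.asIdeal := by
    rw [← not_dvd_differentIdeal_iff, h]
    intro h'
    exact w.isPrime.ne_top (top_le_iff.1 (Ideal.le_of_dvd h'))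
  exact Ideal.ramificationIdx_eq_one_of_isUnramifiedAt

variable [IsGalois K L]

theorem exists_smul_eq_of_under_eq {w w' : HeightOneSpectrum (𝓞 L)}
    (h : w.under (𝓞 K) = w'.under (𝓞 K)) : ∃ g : Gal(L/K), g • w = w' := by
  have : w'.asIdeal.LiesOver (w.under (𝓞 K)).asIdeal := by rw [h]; infer_instance
  obtain ⟨g, hg⟩ := Ideal.exists_smul_eq_of_isGaloisGroup (w.under (𝓞 K)).asIdeal
    w.asIdeal w'.asIdeal Gal(L/K)
  exact ⟨g, HeightOneSpectrum.ext hg⟩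

theorem smul_under (g : Gal(L/K)) (w : HeightOneSpectrum (𝓞 L)) :
    (g • w).under (𝓞 K) = w.under (𝓞 K) := by
  have : SMulCommClass Gal(L/K) (𝓞 K) (𝓞 L) := (IsGaloisGroup.commutes : _)
  apply HeightOneSpectrum.ext
  change Ideal.under _ (g • w.asIdeal) = Ideal.under _ w.asIdeal
  exact Ideal.under_smul _ _ _

end

end NumberField

/-! ### Euler products over the ideals of a number field -/

namespace NumberField

open IsDedekindDomain Filter Topology

section Euler

variable {R : Type*} [CommRing R] [IsDedekindDomain R]

theorem hasSum_ideal_finset {g : Ideal R →*₀ ℝ} (hs : Summable fun I ↦ ‖g I‖)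
    (hlt : ∀ v : HeightOneSpectrum R, ‖g v.asIdeal‖ < 1) (S : Finset (HeightOneSpectrum R)) :
    ∑' I : {I : Ideal R | I ≠ ⊥ ∧ ∀ v : HeightOneSpectrum R, v.asIdeal ∣ I → v ∈ S}, g I =
      ∏ v ∈ S, (1 - g v.asIdeal)⁻¹ := by
  classical
  induction S using Finset.induction_on with
  | empty =>
    have : {I : Ideal R | I ≠ ⊥ ∧ ∀ v : HeightOneSpectrum R, v.asIdeal ∣ I → v ∈
        (∅ : Finset (HeightOneSpectrum R))} = {1} := by
      ext I
      simp only [Set.mem_ofPred_eq, Finset.notMem_empty, imp_false, Set.mem_singleton_iff]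
      constructor
      · rintro ⟨h0, h⟩
        by_contra h1
        obtain ⟨P, hP, hle⟩ := Ideal.exists_le_maximal I (by rwa [Ideal.one_eq_top] at h1)
        exact h ⟨P, hP.isPrime, fun h' ↦ h0 (le_bot_iff.1 (h' ▸ hle))⟩ (Ideal.dvd_iff_le.2 hle)
      · rintro rfl
        exact ⟨one_ne_zero, fun v hv ↦ v.isPrime.ne_top
          (by rw [← Ideal.one_eq_top]; exact isUnit_iff_eq_one.1 (isUnit_of_dvd_one hv))⟩
    rw [this]
    rw [tsum_singleton (1 : Ideal R) fun I ↦ g I, map_one, Finset.prod_empty]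
  | insert p S hp ih =>
    have hpp : Prime p.asIdeal := p.prime
    have hndvd (J : {I : Ideal R | I ≠ ⊥ ∧ ∀ v : HeightOneSpectrum R, v.asIdeal ∣ I → v ∈ S}) :
        ¬ p.asIdeal ∣ J := fun h ↦ hp (J.2.2 p h)
    let F : ℕ × {I : Ideal R | I ≠ ⊥ ∧ ∀ v : HeightOneSpectrum R, v.asIdeal ∣ I → v ∈ S} →
        {I : Ideal R | I ≠ ⊥ ∧ ∀ v : HeightOneSpectrum R, v.asIdeal ∣ I → v ∈ insert p S} :=
      fun x ↦ ⟨p.asIdeal ^ x.1 * x.2.1, mul_ne_zero (pow_ne_zero _ hpp.ne_zero) x.2.2.1,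
        fun v hv ↦ by
          rcases v.prime.dvd_or_dvd hv with h | h
          · have := v.prime.dvd_of_dvd_pow h
            rw [Finset.mem_insert]
            left
            have hle := Ideal.dvd_iff_le.1 this
            exact HeightOneSpectrum.ext (p.isMaximal.eq_of_le v.isPrime.ne_top hle).symm
          · exact Finset.mem_insert_of_mem (x.2.2.2 v h)⟩
    have hF : Function.Bijective F := by
      constructor
      · rintro ⟨n, J⟩ ⟨m, J'⟩ h
        have h : p.asIdeal ^ n * J.1 = p.asIdeal ^ m * J'.1 := congrArg Subtype.val h
        have key : n = m := by
          have e1 := emultiplicity_mul hpp (a := p.asIdeal ^ n) (b := J.1)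
          have e2 := emultiplicity_mul hpp (a := p.asIdeal ^ m) (b := J'.1)
          rw [emultiplicity_eq_zero.2 (hndvd J),
            emultiplicity_pow_self hpp.ne_zero hpp.not_isUnit] at e1
          rw [emultiplicity_eq_zero.2 (hndvd J'),
            emultiplicity_pow_self hpp.ne_zero hpp.not_isUnit] at e2
          rw [h, e2] at e1
          simpa using e1.symm
        subst key
        rw [mul_right_inj' (pow_ne_zero _ hpp.ne_zero)] at h
        rw [Subtype.ext h]
      · rintro ⟨I, h0, hI⟩
        have hfin : FiniteMultiplicity p.asIdeal I :=
          FiniteMultiplicity.of_not_isUnit hpp.not_isUnit h0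
        obtain ⟨c, hc, hnd⟩ := hfin.exists_eq_pow_mul_and_not_dvd
        refine ⟨⟨_, c, ?_, fun v hv ↦ ?_⟩, Subtype.ext hc.symm⟩
        · rintro rfl
          exact hnd (dvd_zero _)
        · have := hI v (hc ▸ hv.mul_left _)
          rcases Finset.mem_insert.1 this with rfl | h
          · exact absurd hv hnd
          · exact h
    rw [Finset.prod_insert hp, ← ih, ← (Equiv.ofBijective F hF).tsum_eq,
      ← tsum_geometric_of_norm_lt_one (hlt p),
      tsum_mul_tsum_of_summable_norm (summable_geometric_of_lt_one (norm_nonneg _) (hlt p) |>.congr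
        fun n ↦ (norm_pow _ _).symm) (hs.subtype _)]
    refine tsum_congr fun x ↦ ?_
    change g (p.asIdeal ^ x.1 * x.2.1) = _
    rw [map_mul, map_pow]

theorem tendsto_eulerProduct {g : Ideal R →*₀ ℝ} (hs : Summable fun I ↦ ‖g I‖)
    (hlt : ∀ v : HeightOneSpectrum R, ‖g v.asIdeal‖ < 1) :
    Tendsto (fun S : Finset (HeightOneSpectrum R) ↦ ∏ v ∈ S, (1 - g v.asIdeal)⁻¹) atTop
      (𝓝 (∑' I, g I)) := by
  classical
  simp_rw [← hasSum_ideal_finset hs hlt]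
  rw [Metric.tendsto_atTop]
  intro ε hε
  obtain ⟨T, hT⟩ := Metric.tendsto_atTop.1 (tendsto_tsum_compl_atTop_zero fun I ↦ ‖g I‖) ε hε
  have hfin (I : Ideal R) (h : I ≠ ⊥) : {v : HeightOneSpectrum R | v.asIdeal ∣ I}.Finite :=
    I.finite_factors h
  refine ⟨T.biUnion fun I ↦ if h : I ≠ ⊥ then (hfin I h).toFinset else ∅, fun S hS ↦ ?_⟩
  set A := {I : Ideal R | I ≠ ⊥ ∧ ∀ v : HeightOneSpectrum R, v.asIdeal ∣ I → v ∈ S} with hA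
  have hsum := hs.of_norm
  have hadd : ∑' I : A, g I + ∑' I : ↑Aᶜ, g I = ∑' I, g I :=
    (hsum.subtype A).tsum_add_tsum_compl (hsum.subtype Aᶜ)
  rw [dist_comm, dist_eq_norm, ← hadd, add_sub_cancel_left]
  have hT' := hT T le_rfl
  rw [dist_zero_right, Real.norm_of_nonneg (tsum_nonneg fun _ ↦ norm_nonneg _)] at hT'
  refine lt_of_le_of_lt ?_ hT'
  have hle : ‖∑' I : ↑Aᶜ, g I‖ ≤ ∑' I : ↑Aᶜ, ‖g I‖ := norm_tsum_le_tsum_norm (hs.subtype Aᶜ)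
  rw [tsum_subtype Aᶜ fun I ↦ ‖g I‖] at hle
  refine hle.trans ?_
  have : ∑' I : {I // I ∉ T}, ‖g I‖ = ∑' I, ({I | I ∉ T}).indicator (fun I ↦ ‖g I‖) I :=
    tsum_subtype {I | I ∉ T} fun I ↦ ‖g I‖
  rw [this]
  refine Summable.tsum_le_tsum (fun I ↦ ?_) (hs.indicator _) (hs.indicator _)
  by_cases h0 : I = ⊥
  · have : g I = 0 := by rw [h0]; exact map_zero g
    simp [Set.indicator_apply, this]
  · by_cases hIT : I ∈ T
    · have : I ∈ A := ⟨h0, fun v hv ↦ hS (Finset.mem_biUnion.2 ⟨I, hIT, by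
        simpa [h0] using hv⟩)⟩
      simp [this, hIT]
    · simp only [Set.indicator_apply, Set.mem_ofPred_eq, hIT, not_false_eq_true, if_true]
      split_ifs <;> simp

end Euler

section Zeta

open _root_.Ideal NumberField.Ideal

variable (K : Type*) [Field K] [NumberField K]

theorem summable_card_absNorm_mul_rpow {s : ℝ} (hs : 1 < s) :
    Summable fun n : ℕ ↦ (Nat.card {I : Ideal (𝓞 K) // absNorm I = n} : ℝ) * (n : ℝ) ^ (-s) := by
  have hlim : Tendsto (fun n : ℕ ↦ (∑ k ∈ Finset.Icc 1 n,
      (Nat.card {I : Ideal (𝓞 K) // absNorm I = k} : ℝ)) / n) atTop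
      (𝓝 (dedekindZeta_residue K)) := by
    refine ((Ideal.tendsto_norm_le_div_atTop₀ K).comp tendsto_natCast_atTop_atTop).congr fun n ↦ ?_
    simp only [Function.comp_apply, Nat.cast_le, ← Nat.cast_sum]
    congr
    rw [← add_left_inj 1, ← card_norm_le_eq_card_norm_le_add_one,
      show Finset.Icc 1 n = Finset.Ioc 0 n from Finset.Icc_succ_left_eq_Ioc _ _,
      show 1 = Nat.card {I : Ideal (𝓞 K) // absNorm I = 0} by simp [Ideal.absNorm_eq_zero_iff],
      Finset.sum_Ioc_add_eq_sum_Icc (n.zero_le),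
      ← Finset.card_preimage_eq_sum_card_image_eq (fun k _ ↦ finite_setOfPred_absNorm_eq k)]
    simp [Set.coe_eq_subtype]
  have hO : (fun n : ℕ ↦ ∑ k ∈ Finset.Icc 1 n,
      (Nat.card {I : Ideal (𝓞 K) // absNorm I = k} : ℝ)) =O[atTop] fun n ↦ (n : ℝ) ^ (1 : ℝ) := by
    simp_rw [Real.rpow_one]
    refine Asymptotics.isBigO_of_div_tendsto_nhds ?_ _ hlim
    filter_upwards [eventually_ne_atTop 0] with n hn h
    exact absurd (Nat.cast_eq_zero.1 h) hn
  have := LSeriesSummable_of_sum_norm_bigO_and_nonneg hO (fun _ ↦ Nat.cast_nonneg _) zero_le_one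
    (s := (s : ℂ)) (by simpa using hs)
  refine this.norm.congr fun n ↦ ?_
  rw [LSeries.norm_term_eq]
  split_ifs with h
  · rw [h, Nat.cast_zero, Real.zero_rpow (by linarith), mul_zero]
  · rw [Complex.ofReal_re, Real.rpow_neg (Nat.cast_nonneg _), div_eq_mul_inv]
    simp

theorem tsum_fiber_absNorm_rpow (s : ℝ) (n : ℕ) :
    ∑' I : {I : Ideal (𝓞 K) // absNorm I = n}, (absNorm I.1 : ℝ) ^ (-s) =
      Nat.card {I : Ideal (𝓞 K) // absNorm I = n} * (n : ℝ) ^ (-s) := by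
  rw [tsum_congr fun I : {I : Ideal (𝓞 K) // absNorm I = n} ↦
    show (absNorm I.1 : ℝ) ^ (-s) = (n : ℝ) ^ (-s) by rw [I.2], tsum_const, nsmul_eq_mul]

theorem summable_absNorm_rpow {s : ℝ} (hs : 1 < s) :
    Summable fun I : Ideal (𝓞 K) ↦ (absNorm I : ℝ) ^ (-s) := by
  rw [← (Equiv.sigmaFiberEquiv fun I : Ideal (𝓞 K) ↦ absNorm I).summable_iff,
    summable_sigma_of_nonneg fun _ ↦ by simp only [Function.comp_apply]; positivity]
  refine ⟨fun n ↦ ?_, ?_⟩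
  · have : Finite {I : Ideal (𝓞 K) // absNorm I = n} := finite_setOfPred_absNorm_eq n
    exact Summable.of_finite
  · exact (summable_card_absNorm_mul_rpow K hs).congr fun n ↦
      (tsum_fiber_absNorm_rpow K s n).symm

theorem tsum_absNorm_rpow_eq {s : ℝ} (hs : 1 < s) :
    (∑' I : Ideal (𝓞 K), (absNorm I : ℝ) ^ (-s) : ℝ) = dedekindZeta K s := by
  have h : ∑' I : Ideal (𝓞 K), (absNorm I : ℝ) ^ (-s) =
      ∑' n : ℕ, Nat.card {I : Ideal (𝓞 K) // absNorm I = n} * (n : ℝ) ^ (-s) := by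
    rw [← (Equiv.sigmaFiberEquiv fun I : Ideal (𝓞 K) ↦ absNorm I).tsum_eq]
    refine (Summable.tsum_sigma ((Equiv.sigmaFiberEquiv fun I : Ideal (𝓞 K) ↦
      absNorm I).summable_iff.2 (summable_absNorm_rpow K hs))).trans ?_
    exact tsum_congr fun n ↦ tsum_fiber_absNorm_rpow K s n
  rw [h, dedekindZeta, LSeries, Complex.ofReal_tsum]
  refine tsum_congr fun n ↦ ?_
  rw [LSeries.term_def]
  split_ifs with h
  · rw [h, Nat.cast_zero, Real.zero_rpow (by linarith), mul_zero, Complex.ofReal_zero]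
  · rw [Real.rpow_neg (Nat.cast_nonneg _), div_eq_mul_inv, Complex.ofReal_mul, Complex.ofReal_inv,
      Complex.ofReal_cpow (Nat.cast_nonneg _)]
    simp

theorem tendsto_sub_one_mul_tsum_absNorm_rpow :
    Tendsto (fun s : ℝ ↦ (s - 1) * ∑' I : Ideal (𝓞 K), (absNorm I : ℝ) ^ (-s)) (𝓝[>] 1)
      (𝓝 (dedekindZeta_residue K)) := by
  have := (Complex.continuous_re.tendsto _).comp (tendsto_sub_one_mul_dedekindZeta_nhdsGT K)
  rw [Complex.ofReal_re] at this
  refine this.congr' ?_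
  filter_upwards [self_mem_nhdsWithin] with s hs
  rw [Function.comp_apply, ← tsum_absNorm_rpow_eq K hs]
  norm_cast

end Zeta

end NumberField

/-! ### Comparison of the zeta functions of ideal classes -/

namespace NumberField

open Filter Topology MeasureTheory InfinitePlace NumberField.Units Units.dirichletUnitTheorem Module
open scoped ENNReal nonZeroDivisors

variable (K : Type*) [Field K] [NumberField K]

noncomputable section

open scoped Classical in
/-- The exponents at all infinite places described by a point of `logSpace K`. -/
def logWeight (w : InfinitePlace K) : logSpace K →ₗ[ℝ] ℝ :=
  (mult w : ℝ)⁻¹ • if h : w = w₀ then -∑ w', LinearMap.proj w' else LinearMap.proj ⟨w, h⟩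

variable {K}

theorem sum_mult_mul_logWeight (a : logSpace K) : ∑ w, (mult w : ℝ) * logWeight K w a = 0 := by
  classical
  have h (w : InfinitePlace K) : (mult w : ℝ) ≠ 0 := Nat.cast_ne_zero.2 mult_ne_zero
  rw [← Fintype.sum_subtype_add_sum_subtype (fun w ↦ w ≠ w₀) fun w ↦ (mult w : ℝ) * logWeight K w a,
    add_comm]
  have h1 : ∑ w : {w : InfinitePlace K // ¬ w ≠ w₀}, (mult w.1 : ℝ) * logWeight K w a =
      - ∑ w, a w := by
    have : Unique {w : InfinitePlace K // ¬ w ≠ w₀} :=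
      ⟨⟨⟨w₀, by simp⟩⟩, fun x ↦ Subtype.ext (not_not.1 x.2)⟩
    rw [Fintype.sum_unique]
    have : ((default : {w : InfinitePlace K // ¬ w ≠ w₀}) : InfinitePlace K) = w₀ :=
      not_not.1 (default : {w : InfinitePlace K // ¬ w ≠ w₀}).2
    rw [this]
    simp [logWeight, h]
  rw [h1, neg_add_eq_zero]
  refine Finset.sum_congr rfl fun w _ ↦ ?_
  simp [logWeight, h, w.2]

theorem exists_logWeight_eq (b : InfinitePlace K → ℝ) (hb : ∑ w, (mult w : ℝ) * b w = 0) :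
    ∃ a : logSpace K, ∀ w, logWeight K w a = b w := by
  classical
  have h (w : InfinitePlace K) : (mult w : ℝ) ≠ 0 := Nat.cast_ne_zero.2 mult_ne_zero
  refine ⟨fun w ↦ mult w.1 * b w.1, fun w ↦ ?_⟩
  by_cases hw : w = w₀
  · subst hw
    have := sum_mult_mul_logWeight (K := K) fun w ↦ mult w.1 * b w.1
    rw [← hb, ← Finset.add_sum_erase _ _ (Finset.mem_univ w₀),
      ← Finset.add_sum_erase _ (fun w ↦ (mult w : ℝ) * b w) (Finset.mem_univ w₀)] at this
    have h2 : ∀ w ∈ Finset.univ.erase (w₀ : InfinitePlace K),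
        (mult w : ℝ) * logWeight K w (fun w ↦ mult w.1 * b w.1) = mult w * b w := by
      intro w hw
      simp [logWeight, Finset.ne_of_mem_erase hw, h]
    rw [Finset.sum_congr rfl h2, add_left_inj, mul_right_inj' (h _)] at this
    exact this
  · simp [logWeight, hw, h]

/-- The sum of the absolute values of `x` at all infinite places, weighted by `a`. -/
def weightedNorm (a : logSpace K) (x : K) : ℝ := ∑ w, Real.exp (logWeight K w a) * w x

theorem weightedNorm_nonneg (a : logSpace K) (x : K) : 0 ≤ weightedNorm a x :=
  Finset.sum_nonneg fun w _ ↦ mul_nonneg (Real.exp_nonneg _) (apply_nonneg w x)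

theorem weightedNorm_zero (a : logSpace K) : weightedNorm a (0 : K) = 0 := by
  simp [weightedNorm]

theorem weightedNorm_pos (a : logSpace K) {x : K} (hx : x ≠ 0) : 0 < weightedNorm a x :=
  Finset.sum_pos (fun _ _ ↦ mul_pos (Real.exp_pos _) (pos_iff.2 hx)) Finset.univ_nonempty

theorem weightedNorm_add_le (a : logSpace K) (x y : K) :
    weightedNorm a (x + y) ≤ weightedNorm a x + weightedNorm a y := by
  simp_rw [weightedNorm, ← Finset.sum_add_distrib, ← mul_add]
  gcongr with w
  exact w.1.add_le x y

theorem weightedNorm_neg (a : logSpace K) (x : K) : weightedNorm a (-x) = weightedNorm a x := by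
  exact Finset.sum_congr rfl fun w _ ↦ by rw [show w (-x) = w x from w.1.map_neg x]

theorem abs_weightedNorm_add_sub_le (a : logSpace K) (x y : K) :
    |weightedNorm a (x + y) - weightedNorm a y| ≤ weightedNorm a x := by
  rw [abs_le]
  constructor
  · have := weightedNorm_add_le a (x + y) (-x)
    rw [weightedNorm_neg, add_neg_cancel_comm] at this
    linarith
  · linarith [weightedNorm_add_le a x y]

theorem exists_weightedNorm_eq {x : K} (hx : x ≠ 0) : ∃ b : logSpace K, ∀ a,
    weightedNorm a x = |(Algebra.norm ℚ x : ℝ)| ^ ((finrank ℚ K : ℝ)⁻¹) * weightedNorm (a + b) 1 := by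
  have hN : 0 < |(Algebra.norm ℚ x : ℝ)| := by
    rw [abs_pos, Rat.cast_ne_zero]
    exact Algebra.norm_ne_zero_iff.2 hx
  obtain ⟨b, hb⟩ := exists_logWeight_eq (K := K)
    (fun w ↦ Real.log (w x) - Real.log |(Algebra.norm ℚ x : ℝ)| * (finrank ℚ K : ℝ)⁻¹) (by
      simp_rw [mul_sub, Finset.sum_sub_distrib, ← Finset.sum_mul, sub_eq_zero]
      have h1 : ((∑ w : InfinitePlace K, mult w : ℕ) : ℝ) = finrank ℚ K := by rw [sum_mult_eq]
      push_cast at h1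
      have h3 := prod_eq_abs_norm x
      rw [h1, mul_left_comm, mul_inv_cancel₀ (Nat.cast_ne_zero.2 finrank_pos.ne'), mul_one]
      have h4 := congrArg Real.log h3
      rw [Real.log_prod fun w _ ↦ pow_ne_zero _ (by simpa using hx)] at h4
      simp_rw [Real.log_pow] at h4
      rw [h4]
      push_cast
      rfl)
  refine ⟨b, fun a ↦ ?_⟩
  simp_rw [weightedNorm, Finset.mul_sum, map_add, hb]
  refine Finset.sum_congr rfl fun w _ ↦ ?_
  rw [← add_sub_assoc, Real.exp_sub, Real.exp_add, Real.exp_log (pos_iff.2 hx),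
    ← Real.rpow_def_of_pos hN, map_one]
  field_simp

theorem weightedNorm_mul_unit (a : logSpace K) (x : K) (u : (𝓞 K)ˣ) :
    weightedNorm a (u * x) = weightedNorm (a + logEmbedding K (Additive.ofMul u)) x := by
  have hu (w : InfinitePlace K) : logWeight K w (logEmbedding K (Additive.ofMul u)) =
      Real.log (w u) := by
    obtain ⟨b, hb⟩ := exists_logWeight_eq (K := K) (fun w ↦ Real.log (w u)) (by
      have := Units.sum_mult_mul_log u
      simpa using this)
    have : logEmbedding K (Additive.ofMul u) = b := by
      funext v
      have h (w : InfinitePlace K) : (mult w : ℝ) ≠ 0 := Nat.cast_ne_zero.2 mult_ne_zero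
      have := hb v.1
      rw [logEmbedding_component]
      simp only [logWeight, v.2, dite_false] at this
      simp only [LinearMap.smul_apply, LinearMap.coe_proj, Function.eval, smul_eq_mul] at this
      rw [← this, mul_inv_cancel_left₀ (h _)]
    rw [this, hb]
  simp_rw [weightedNorm, map_add, hu, Real.exp_add, map_mul, mul_assoc]
  refine Finset.sum_congr rfl fun w _ ↦ ?_
  rw [Real.exp_log (pos_iff.2 (by simp))]

theorem continuous_weightedNorm (x : K) : Continuous fun a : logSpace K ↦ weightedNorm a x := by
  unfold weightedNorm
  have (w : InfinitePlace K) : Continuous (logWeight K w) :=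
    LinearMap.continuous_of_finiteDimensional _
  fun_prop

open scoped Classical in
theorem exists_weightedNorm_le {D : Set (logSpace K)} (hD : Bornology.IsBounded D) :
    ∃ c : ℝ, 0 < c ∧ ∀ a ∈ D, ∀ x : K, weightedNorm a x ≤ c * weightedNorm 0 x ∧
      weightedNorm 0 x ≤ c * weightedNorm a x := by
  have hb (w : InfinitePlace K) : ∃ B, ∀ a ∈ D, |logWeight K w a| ≤ B := by
    obtain ⟨B, hB⟩ := hD.exists_norm_le
    refine ⟨‖(logWeight K w).toContinuousLinearMap‖ * B, fun a ha ↦ ?_⟩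
    exact ((logWeight K w).toContinuousLinearMap.le_opNorm a).trans (by gcongr; exact hB a ha)
  choose B hB using hb
  obtain ⟨C, hC⟩ := (Set.finite_range B).bddAbove
  have hBC (w) : B w ≤ C := hC ⟨w, rfl⟩
  refine ⟨Real.exp C, Real.exp_pos _, fun a ha x ↦ ?_⟩
  simp only [weightedNorm, map_zero, Real.exp_zero, one_mul, Finset.mul_sum, ← mul_assoc,
    ← Real.exp_add]
  constructor <;> refine Finset.sum_le_sum fun w _ ↦ ?_
  · gcongr
    exact (le_abs_self _).trans ((hB w a ha).trans (hBC w))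
  · have := (neg_abs_le (logWeight K w a))
    exact le_mul_of_one_le_left (apply_nonneg w x) (Real.one_le_exp
      (by linarith [hB w a ha, hBC w]))

open scoped Classical in
theorem summable_weightedNorm_rpow {r : ℝ} (hr : finrank ℚ K < r) :
    Summable fun x : 𝓞 K ↦ weightedNorm 0 (x : K) ^ (-r) := by
  have hr0 : 0 < r := (Nat.cast_nonneg _).trans_lt hr
  have h := ZLattice.summable_norm_rpow (E := mixedEmbedding.mixedSpace K) (mixedEmbedding.integerLattice K)
    (-r) (by rw [ZLattice.rank ℝ, mixedEmbedding.finrank]; linarith)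
  let f : 𝓞 K → mixedEmbedding.integerLattice K := fun x ↦
    ⟨mixedEmbedding K x, by simp⟩
  have hf : Function.Injective f := fun x y hxy ↦ by
    have := (mixedEmbedding K).injective (congrArg Subtype.val hxy)
    exact_mod_cast this
  refine Summable.of_nonneg_of_le (fun x ↦ Real.rpow_nonneg (weightedNorm_nonneg _ _) _)
    (fun x ↦ ?_) (h.comp_injective hf)
  by_cases hx : x = 0
  · simp only [hx, map_zero, weightedNorm_zero, Function.comp_apply]
    rw [Real.zero_rpow (by linarith)]
    exact Real.rpow_nonneg (norm_nonneg _) _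
  · have hx' : (x : K) ≠ 0 := by simpa using hx
    refine Real.rpow_le_rpow_of_nonpos (norm_pos_iff.2 ?_) ?_ (by linarith)
    · intro h0
      exact hx (hf (by rw [h0]; exact Subtype.ext (by simp [f])))
    · change ‖mixedEmbedding K x‖ ≤ _
      rw [mixedEmbedding.norm_eq_sup'_normAtPlace, Finset.sup'_le_iff]
      intro w _
      rw [mixedEmbedding.normAtPlace_apply]
      simp only [weightedNorm, map_zero, Real.exp_zero, one_mul]
      exact Finset.single_le_sum (f := fun w : InfinitePlace K ↦ w (x : K))
        (fun w _ ↦ apply_nonneg w _) (Finset.mem_univ w)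

theorem one_le_weightedNorm {x : 𝓞 K} (hx : x ≠ 0) : 1 ≤ weightedNorm 0 (x : K) := by
  have hx' : (x : K) ≠ 0 := by simpa using hx
  have : ∃ w : InfinitePlace K, 1 ≤ w (x : K) := by
    by_contra! h
    have h1 := prod_eq_abs_norm (x : K)
    have h2 : ∏ w : InfinitePlace K, w (x : K) ^ mult w < 1 := by
      have hlt := Finset.prod_lt_prod_of_nonempty (s := Finset.univ)
        (f := fun w : InfinitePlace K ↦ w (x : K) ^ mult w) (g := fun _ ↦ 1)
        (fun w _ ↦ pow_pos (pos_iff.2 hx') _)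
        (fun w _ ↦ pow_lt_one₀ (apply_nonneg w _) (h w) mult_ne_zero) Finset.univ_nonempty
      simpa using hlt
    rw [h1, ← Algebra.coe_norm_int] at h2
    have h3 : (1 : ℤ) ≤ |Algebra.norm ℤ x| := Int.one_le_abs (Algebra.norm_ne_zero_iff.2 hx)
    have h4 : ((1 : ℤ) : ℝ) ≤ (|Algebra.norm ℤ x| : ℤ) := by exact_mod_cast h3
    push_cast at h2 h4
    linarith
  obtain ⟨w, hw⟩ := this
  simp only [weightedNorm, map_zero, Real.exp_zero, one_mul]
  exact hw.trans (Finset.single_le_sum (f := fun w : InfinitePlace K ↦ w (x : K))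
        (fun w _ ↦ apply_nonneg w _) (Finset.mem_univ w))

theorem rpow_neg_le_add {u v δ t : ℝ} (hu : 0 ≤ u) (hv : 0 ≤ v) (h : |u - v| ≤ δ) (ht : 1 ≤ t) :
    u ^ (-t) ≤ v ^ (-t) + t * δ * u ^ (-t - 1) := by
  have hδ : 0 ≤ δ := (abs_nonneg _).trans h
  rcases hu.eq_or_lt with rfl | hu
  · rw [Real.zero_rpow (by linarith)]
    positivity
  have e : u ^ (-t) = u * u ^ (-t - 1) := by
    rw [mul_comm, ← Real.rpow_add_one hu.ne']; ring_nf
  rcases hv.eq_or_lt with rfl | hv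
  · rw [Real.zero_rpow (by linarith), zero_add, e]
    gcongr
    rw [sub_zero, abs_of_pos hu] at h
    nlinarith
  rcases le_total v u with hvu | huv
  · have : u ^ (-t) ≤ v ^ (-t) := Real.rpow_le_rpow_of_nonpos hv hvu (by linarith)
    have : 0 ≤ t * δ * u ^ (-t - 1) := by positivity
    linarith
  · have h1 : (v / u) ^ (-t) ≥ 1 - t * (v / u - 1) := by
      rw [Real.rpow_def_of_pos (by positivity)]
      have h2 := Real.add_one_le_exp (Real.log (v / u) * -t)
      have h3 := Real.log_le_sub_one_of_pos (show 0 < v / u by positivity)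
      nlinarith
    have h4 : v ^ (-t) = (v / u) ^ (-t) * u ^ (-t) := by
      rw [← Real.mul_rpow (by positivity) hu.le, div_mul_cancel₀ _ hu.ne']
    have h5 : v - u ≤ δ := by linarith [neg_abs_le (u - v)]
    have h6 : u ^ (-t) * (1 - t * (v / u - 1)) = u ^ (-t) - t * (v - u) * u ^ (-t - 1) := by
      rw [e]; field_simp
    have h7 : t * (v - u) * u ^ (-t - 1) ≤ t * δ * u ^ (-t - 1) := by gcongr
    have h8 : u ^ (-t) * (1 - t * (v / u - 1)) ≤ u ^ (-t) * (v / u) ^ (-t) := by gcongr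
    rw [h4, mul_comm]
    linarith

end

end NumberField

namespace NumberField

open Filter Topology MeasureTheory InfinitePlace NumberField.Units Units.dirichletUnitTheorem Module
open scoped ENNReal nonZeroDivisors

variable (K : Type*) [Field K] [NumberField K]

noncomputable section

/-- The power of `weightedNorm a x` of exponent `-(finrank ℚ K * s)`. -/
def epsteinTerm (s : ℝ) (a : logSpace K) (x : K) : ℝ≥0∞ :=
  ENNReal.ofReal (weightedNorm a x ^ (-(finrank ℚ K * s)))

open scoped Classical in
/-- A fundamental domain of the unit lattice. -/
def unitDomain : Set (logSpace K) :=
  ZSpan.fundamentalDomain ((basisUnitLattice K).ofZLatticeBasis ℝ (unitLattice K))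

open scoped Classical in
/-- The integral of `epsteinTerm K s a 1` over `logSpace K`. -/
def epsteinIntegral (s : ℝ) : ℝ≥0∞ := ∫⁻ a : logSpace K, epsteinTerm K s a 1

/-- The zeta function of an ideal class. -/
def classZeta (c : ClassGroup (𝓞 K)) (s : ℝ) : ℝ≥0∞ :=
  ∑' I : {I : (Ideal (𝓞 K))⁰ // ClassGroup.mk0 I = c},
    ENNReal.ofReal ((Ideal.absNorm (I : Ideal (𝓞 K)) : ℝ) ^ (-s))

variable {K}

theorem epsteinTerm_zero {s : ℝ} (hs : 0 < s) (a : logSpace K) : epsteinTerm K s a 0 = 0 := by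
  have : (finrank ℚ K : ℝ) ≠ 0 := Nat.cast_ne_zero.2 finrank_pos.ne'
  rw [epsteinTerm, weightedNorm_zero, Real.zero_rpow (by simp [hs.ne', this]), ENNReal.ofReal_zero]

theorem measurable_epsteinTerm (s : ℝ) (x : K) :
    Measurable fun a : logSpace K ↦ epsteinTerm K s a x := by
  unfold epsteinTerm
  have := (continuous_weightedNorm x).measurable
  fun_prop

open scoped Classical in
theorem lintegral_epsteinTerm (s : ℝ) {x : K} (hx : x ≠ 0) :
    ∫⁻ a : logSpace K, epsteinTerm K s a x =
      ENNReal.ofReal (|(Algebra.norm ℚ x : ℝ)| ^ (-s)) * epsteinIntegral K s := by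
  obtain ⟨b, hb⟩ := exists_weightedNorm_eq hx
  have h0 : (finrank ℚ K : ℝ) ≠ 0 := Nat.cast_ne_zero.2 finrank_pos.ne'
  have h (a) : epsteinTerm K s a x =
      ENNReal.ofReal (|(Algebra.norm ℚ x : ℝ)| ^ (-s)) * epsteinTerm K s (a + b) 1 := by
    rw [epsteinTerm, epsteinTerm, ← ENNReal.ofReal_mul (by positivity), hb,
      Real.mul_rpow (by positivity) (weightedNorm_nonneg _ _), ← Real.rpow_mul (by positivity)]
    congr 3
    field_simp
  simp_rw [h]
  rw [lintegral_const_mul, epsteinIntegral,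
    lintegral_add_right_eq_self (fun a ↦ epsteinTerm K s a 1) b]
  exact (measurable_epsteinTerm s 1).comp (measurable_add_const b)

open scoped Classical in
theorem tsum_units_epsteinTerm (s : ℝ) {x : K} (hx : x ≠ 0) :
    ∑' u : (𝓞 K)ˣ, ∫⁻ a in unitDomain K, epsteinTerm K s a (u * x) =
      torsionOrder K * (ENNReal.ofReal (|(Algebra.norm ℚ x : ℝ)| ^ (-s)) * epsteinIntegral K s) := by
  have h1 : ∫⁻ a : logSpace K, epsteinTerm K s a x =
      ∑' l : unitLattice K, ∫⁻ a in unitDomain K, epsteinTerm K s (a + l) x := by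
    have : VAddInvariantMeasure (unitLattice K) (logSpace K) volume :=
      inferInstanceAs (VAddInvariantMeasure (unitLattice K).toAddSubgroup (logSpace K) volume)
    rw [(ZLattice.isAddFundamentalDomain (basisUnitLattice K) volume).lintegral_eq_tsum'']
    refine tsum_congr fun l ↦ lintegral_congr fun a ↦ ?_
    rw [add_comm]
    rfl
  have h2 (u : (𝓞 K)ˣ) : ∫⁻ a in unitDomain K, epsteinTerm K s a (u * x) =
      (fun l : unitLattice K ↦ ∫⁻ a in unitDomain K, epsteinTerm K s (a + l) x)
        (logEmbeddingEquiv K (Additive.ofMul (QuotientGroup.mk u))) := by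
    refine lintegral_congr fun a ↦ ?_
    rw [epsteinTerm, weightedNorm_mul_unit, epsteinTerm, logEmbeddingEquiv_apply]
  simp_rw [h2]
  rw [← lintegral_epsteinTerm s hx, h1,
    ← (Subgroup.groupEquivQuotientProdSubgroup (s := torsion K)).symm.tsum_eq, ENNReal.tsum_prod',
    ← (logEmbeddingEquiv K).toEquiv.tsum_eq, ← Additive.ofMul.tsum_eq, ← ENNReal.tsum_mul_left]
  refine tsum_congr fun q ↦ ?_
  have (t : torsion K) : (QuotientGroup.mk
      (Subgroup.groupEquivQuotientProdSubgroup.symm (q, t)) : (𝓞 K)ˣ ⧸ torsion K) = q := by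
    have := Subgroup.groupEquivQuotientProdSubgroup.apply_symm_apply (q, t)
    exact congrArg Prod.fst this
  simp_rw [this]
  have := Fintype.ofFinite (torsion K)
  rw [tsum_fintype, Finset.sum_const, nsmul_eq_mul, torsionOrder, Nat.card_eq_fintype_card,
    Finset.card_univ]
  rfl

open scoped Classical in
theorem tsum_ideal_epsteinTerm {s : ℝ} (hs : 0 < s) (J : (Ideal (𝓞 K))⁰) :
    ∑' x : (J : Ideal (𝓞 K)), ∫⁻ a in unitDomain K, epsteinTerm K s a (x : 𝓞 K) =
      torsionOrder K * epsteinIntegral K s *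
        (ENNReal.ofReal ((Ideal.absNorm (J : Ideal (𝓞 K)) : ℝ) ^ (-s)) *
          classZeta K (ClassGroup.mk0 J)⁻¹ s) := by
  have hg (I : {I : (Ideal (𝓞 K))⁰ // ClassGroup.mk0 I = (ClassGroup.mk0 J)⁻¹}) :
      ∃ g : 𝓞 K, (I : Ideal (𝓞 K)) * J = Ideal.span {g} := by
    have h : ClassGroup.mk0 (I.1 * J) = 1 := by rw [map_mul, I.2, inv_mul_cancel]
    exact ((ClassGroup.mk0_eq_one_iff (I.1 * J).2).1 h).principal
  choose g hg using hg
  have hg0 (I) : g I ≠ 0 := fun h ↦ by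
    have := hg I
    rw [h, Ideal.span_singleton_zero] at this
    exact (nonZeroDivisors.coe_ne_zero (I.1 * J)) this
  have hgJ (I) : g I ∈ (J : Ideal (𝓞 K)) := by
    rw [← Ideal.span_singleton_le_iff_mem, ← hg I]
    exact Ideal.mul_le.2 fun r _ s hs ↦ Ideal.mul_mem_left _ r hs
  let φ : {I : (Ideal (𝓞 K))⁰ // ClassGroup.mk0 I = (ClassGroup.mk0 J)⁻¹} × (𝓞 K)ˣ →
      {x : (J : Ideal (𝓞 K)) // (x : 𝓞 K) ≠ 0} := fun p ↦
    ⟨⟨p.2 * g p.1, Ideal.mul_mem_left _ _ (hgJ p.1)⟩, by simp [hg0]⟩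
  have hφ : Function.Bijective φ := by
    constructor
    · rintro ⟨I, u⟩ ⟨I', u'⟩ h
      have h : (u : 𝓞 K) * g I = u' * g I' := congrArg (fun x ↦ ((x.1 : (J : Ideal (𝓞 K))) : 𝓞 K)) h
      have h1 : (I : Ideal (𝓞 K)) * J = I' * J := by
        rw [hg, hg, Ideal.span_singleton_eq_span_singleton]
        exact ⟨u * u'⁻¹, by
          rw [Units.val_mul]
          linear_combination (↑u'⁻¹ : 𝓞 K) * h + g I' * Units.mul_inv u'⟩
      have h2 : I = I' := Subtype.ext (Subtype.ext
        (mul_right_cancel₀ (nonZeroDivisors.coe_ne_zero J) h1))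
      subst h2
      rw [Units.ext (mul_right_cancel₀ (hg0 I) h)]
    · rintro ⟨⟨x, hx⟩, h0⟩
      obtain ⟨I, hI⟩ := Ideal.dvd_iff_le.2 ((Ideal.span_singleton_le_iff_mem _).2 hx)
      have hI0 : I ≠ ⊥ := by
        rintro rfl
        rw [Ideal.mul_bot, Ideal.span_singleton_eq_bot] at hI
        exact h0 hI
      have hIc : ClassGroup.mk0 ⟨I, mem_nonZeroDivisors_iff_ne_zero.2 hI0⟩ =
          (ClassGroup.mk0 J)⁻¹ := by
        rw [eq_inv_iff_mul_eq_one, mul_comm, ← map_mul]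
        exact (ClassGroup.mk0_eq_one_iff _).2 ⟨⟨x, hI.symm⟩⟩
      have h1 := hg ⟨⟨I, mem_nonZeroDivisors_iff_ne_zero.2 hI0⟩, hIc⟩
      change I * J = _ at h1
      rw [mul_comm, ← hI, eq_comm, Ideal.span_singleton_eq_span_singleton] at h1
      obtain ⟨u, hu⟩ := h1
      exact ⟨(⟨⟨I, mem_nonZeroDivisors_iff_ne_zero.2 hI0⟩, hIc⟩, u), Subtype.ext (Subtype.ext
        (by rw [mul_comm] at hu; exact hu))⟩
  have h3 : ∑' x : (J : Ideal (𝓞 K)), ∫⁻ a in unitDomain K, epsteinTerm K s a (x : 𝓞 K) =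
      ∑' x : {x : (J : Ideal (𝓞 K)) // (x : 𝓞 K) ≠ 0},
        ∫⁻ a in unitDomain K, epsteinTerm K s a (x.1 : 𝓞 K) := by
    refine (tsum_subtype_eq_of_support_subset (s := {x : (J : Ideal (𝓞 K)) | (x : 𝓞 K) ≠ 0})
      fun x hx h0 ↦ hx ?_).symm
    rw [h0]
    simp [epsteinTerm_zero hs]
  rw [h3, ← (Equiv.ofBijective φ hφ).tsum_eq, ENNReal.tsum_prod', classZeta,
    ← ENNReal.tsum_mul_left, ← ENNReal.tsum_mul_left]
  refine tsum_congr fun I ↦ ?_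
  have h4 : |(Algebra.norm ℚ (g I : K) : ℝ)| ^ (-s) =
      (Ideal.absNorm (J : Ideal (𝓞 K)) : ℝ) ^ (-s) * (Ideal.absNorm (I : Ideal (𝓞 K)) : ℝ) ^ (-s) := by
    rw [← Real.mul_rpow (by positivity) (by positivity), mul_comm, ← Nat.cast_mul, ← map_mul, hg,
      Ideal.absNorm_span_singleton, ← Algebra.coe_norm_int, Nat.cast_natAbs]
    norm_cast
  have := tsum_units_epsteinTerm s (x := (g I : K)) (by simpa using hg0 I)
  rw [h4, ENNReal.ofReal_mul (by positivity), mul_comm _ (epsteinIntegral K s), ← mul_assoc] at this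
  rw [← this]
  refine tsum_congr fun u ↦ ?_
  simp [φ]

end

end NumberField

namespace NumberField

open Filter Topology MeasureTheory InfinitePlace NumberField.Units Units.dirichletUnitTheorem Module
open scoped ENNReal nonZeroDivisors

variable {K : Type*} [Field K] [NumberField K]

theorem isBounded_unitDomain : Bornology.IsBounded (unitDomain K) := by
  classical exact ZSpan.fundamentalDomain_isBounded _

open scoped Classical in
theorem volume_unitDomain_ne_top : volume (unitDomain K) ≠ ∞ :=
  isBounded_unitDomain.measure_lt_top.ne

theorem finrank_pos_real : 1 ≤ (finrank ℚ K : ℝ) := Nat.one_le_cast.2 finrank_pos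

theorem exists_one_le_weightedNorm_le {D : Set (logSpace K)} (hD : Bornology.IsBounded D) :
    ∃ c : ℝ, 1 ≤ c ∧ ∀ a ∈ D, ∀ x : K, weightedNorm a x ≤ c * weightedNorm 0 x ∧
      weightedNorm 0 x ≤ c * weightedNorm a x := by
  obtain ⟨c, hc, h⟩ := exists_weightedNorm_le (K := K) hD
  refine ⟨max c 1, le_max_right _ _, fun a ha x ↦ ⟨(h a ha x).1.trans ?_, (h a ha x).2.trans ?_⟩⟩
  · exact mul_le_mul_of_nonneg_right (le_max_left _ _) (weightedNorm_nonneg _ _)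
  · exact mul_le_mul_of_nonneg_right (le_max_left _ _) (weightedNorm_nonneg _ _)

theorem exists_weightedNorm_rpow_le {D : Set (logSpace K)} (hD : Bornology.IsBounded D) (T : ℝ) :
    ∃ C : ℝ, 0 ≤ C ∧ ∀ a ∈ D, ∀ t ∈ Set.Icc 0 T, ∀ r ∈ Set.Icc 0 t, ∀ x : 𝓞 K, r ≠ 0 →
      weightedNorm a (x : K) ^ (-t) ≤ C * weightedNorm 0 (x : K) ^ (-r) := by
  obtain ⟨c, hc, h⟩ := exists_one_le_weightedNorm_le (K := K) hD
  refine ⟨c ^ T, by positivity, fun a ha t ht r hr x hr0 ↦ ?_⟩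
  by_cases hx : x = 0
  · have : t ≠ 0 := fun h ↦ hr0 (le_antisymm (h ▸ hr.2) hr.1)
    simp [hx, weightedNorm_zero, Real.zero_rpow, this, hr0]
  · have h1 := one_le_weightedNorm hx
    have h2 : 0 < weightedNorm a (x : K) := weightedNorm_pos a (by simpa using hx)
    calc weightedNorm a (x : K) ^ (-t) ≤ (weightedNorm 0 (x : K) / c) ^ (-t) :=
          Real.rpow_le_rpow_of_nonpos (by positivity)
            (by rw [div_le_iff₀' (by positivity)]; exact (h a ha x).2) (by linarith [ht.1])
      _ = c ^ t * weightedNorm 0 (x : K) ^ (-t) := by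
          rw [Real.div_rpow (by positivity) (by positivity), Real.rpow_neg (by positivity : 0 ≤ c),
            div_inv_eq_mul, mul_comm]
      _ ≤ c ^ T * weightedNorm 0 (x : K) ^ (-r) := by
          gcongr
          · exact ht.2
          · exact hr.2

theorem exists_epsteinTerm_le_add (R : ℝ) : ∃ g : 𝓞 K → ℝ≥0∞, ∑' x, g x ≠ ∞ ∧
    ∀ s ∈ Set.Ioc (1 : ℝ) 2, ∀ a ∈ unitDomain K, ∀ x y : 𝓞 K,
        weightedNorm 0 ((x - y : 𝓞 K) : K) ≤ R →
      epsteinTerm K s a (x : K) ≤ epsteinTerm K s a (y : K) + g x := by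
  obtain ⟨c, hc, hcD⟩ := exists_one_le_weightedNorm_le (K := K) isBounded_unitDomain
  set n : ℝ := (finrank ℚ K : ℝ) with hn
  have hn1 : 1 ≤ n := finrank_pos_real
  obtain ⟨C, hC, hCD⟩ := exists_weightedNorm_rpow_le (K := K) isBounded_unitDomain (2 * n + 1)
  refine ⟨fun x ↦ ENNReal.ofReal ((2 * n) * (c * |R|) * (C * weightedNorm 0 (x : K) ^ (-(n + 1)))),
    ?_, fun s hs a ha x y hxy ↦ ?_⟩
  · have h := summable_weightedNorm_rpow (K := K) (r := n + 1) (by linarith)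
    exact ((h.mul_left C).mul_left _).tsum_ofReal_ne_top
  · have hs0 : 0 < s := by linarith [hs.1]
    have h2 : n * s ≤ 2 * n := by nlinarith [hs.2]
    have h3 : n ≤ n * s := by nlinarith [hs.1]
    have h1 := rpow_neg_le_add (u := weightedNorm a (x : K)) (v := weightedNorm a (y : K))
      (δ := c * |R|) (t := n * s) (weightedNorm_nonneg _ _) (weightedNorm_nonneg _ _) (by
        have := abs_weightedNorm_add_sub_le a (((x - y : 𝓞 K)) : K) (y : K)
        rw [show ((x - y : 𝓞 K) : K) + y = x from sub_add_cancel (x : K) y] at this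
        refine this.trans ((hcD a ha _).1.trans ?_)
        gcongr
        exact hxy.trans (le_abs_self R)) (by linarith)
    unfold epsteinTerm
    rw [← ENNReal.ofReal_add (Real.rpow_nonneg (weightedNorm_nonneg _ _) _)
      (mul_nonneg (by positivity) (mul_nonneg hC (Real.rpow_nonneg (weightedNorm_nonneg _ _) _)))]
    refine ENNReal.ofReal_le_ofReal (h1.trans ?_)
    have h4 := hCD a ha (n * s + 1) ⟨by positivity, by linarith⟩ (n + 1)
      ⟨by linarith, by linarith⟩ x (by linarith)
    rw [neg_add'] at h4
    have := Real.rpow_nonneg (weightedNorm_nonneg a (x : K)) (-(n * s) - 1)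
    gcongr

open scoped Classical in
theorem exists_lintegral_epsteinTerm_le_add (R : ℝ) : ∃ g : 𝓞 K → ℝ≥0∞, ∑' x, g x ≠ ∞ ∧
    ∀ s ∈ Set.Ioc (1 : ℝ) 2, ∀ x y : 𝓞 K, weightedNorm 0 ((x - y : 𝓞 K) : K) ≤ R →
      (∫⁻ a in unitDomain K, epsteinTerm K s a (x : K)) ≤
        (∫⁻ a in unitDomain K, epsteinTerm K s a (y : K)) + g x := by
  obtain ⟨g, hg, h⟩ := exists_epsteinTerm_le_add (K := K) R
  refine ⟨fun x ↦ g x * volume (unitDomain K), ?_, fun s hs x y hxy ↦ ?_⟩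
  · rw [ENNReal.tsum_mul_right]
    exact ENNReal.mul_ne_top hg volume_unitDomain_ne_top
  · calc (∫⁻ a in unitDomain K, epsteinTerm K s a (x : K)) ≤
          ∫⁻ a in unitDomain K, (epsteinTerm K s a (y : K) + g x) :=
        setLIntegral_mono ((measurable_epsteinTerm s _).add_const _) fun a ha ↦ h s hs a ha x y hxy
      _ = _ := by
        rw [lintegral_add_right _ measurable_const, setLIntegral_const]

omit [NumberField K] in
theorem tsum_eq_tsum_quotient_mul_ideal (J : Ideal (𝓞 K)) (f : 𝓞 K → ℝ≥0∞) :
    ∑' x, f x = ∑' q : 𝓞 K ⧸ J, ∑' y : J, f (Quotient.out q + y) := by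
  have h : Function.Bijective fun p : (𝓞 K ⧸ J) × J ↦ (Quotient.out p.1 + p.2 : 𝓞 K) := by
    have hq (q : 𝓞 K ⧸ J) : Ideal.Quotient.mk J (Quotient.out q) = q := Quotient.out_eq' q
    have hy (y : J) : Ideal.Quotient.mk J y = 0 := Ideal.Quotient.eq_zero_iff_mem.2 y.2
    constructor
    · rintro ⟨q, y⟩ ⟨q', y'⟩ h
      have h1 := congrArg (Ideal.Quotient.mk J) h
      simp only [map_add, hq, hy, add_zero] at h1
      subst h1
      have : y = y' := Subtype.ext (add_left_cancel h)
      rw [this]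
    · intro x
      refine ⟨⟨Ideal.Quotient.mk J x, ⟨x - Quotient.out (Ideal.Quotient.mk J x), ?_⟩⟩, by simp⟩
      rw [← Ideal.Quotient.eq_zero_iff_mem, map_sub, hq, sub_self]
  rw [← (Equiv.ofBijective _ h).tsum_eq, ENNReal.tsum_prod']
  rfl

open scoped Classical in
theorem exists_tsum_lintegral_epsteinTerm_le (J : (Ideal (𝓞 K))⁰) : ∃ B : ℝ≥0∞, B ≠ ∞ ∧
    ∀ s ∈ Set.Ioc (1 : ℝ) 2,
      ∑' x : 𝓞 K, (∫⁻ a in unitDomain K, epsteinTerm K s a (x : K)) ≤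
        Ideal.absNorm (J : Ideal (𝓞 K)) * ∑' x : (J : Ideal (𝓞 K)),
          (∫⁻ a in unitDomain K, epsteinTerm K s a (x : 𝓞 K)) + B ∧
      Ideal.absNorm (J : Ideal (𝓞 K)) * ∑' x : (J : Ideal (𝓞 K)),
          (∫⁻ a in unitDomain K, epsteinTerm K s a (x : 𝓞 K)) ≤
        ∑' x : 𝓞 K, (∫⁻ a in unitDomain K, epsteinTerm K s a (x : K)) + B := by
  have : Finite (𝓞 K ⧸ (J : Ideal (𝓞 K))) :=
    Ideal.finiteQuotientOfFreeOfNeBot _ (nonZeroDivisors.coe_ne_zero J)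
  have := Fintype.ofFinite (𝓞 K ⧸ (J : Ideal (𝓞 K)))
  have hcard (z : ℝ≥0∞) : ∑' _ : 𝓞 K ⧸ (J : Ideal (𝓞 K)),
      z = Ideal.absNorm (J : Ideal (𝓞 K)) * z := by
    rw [tsum_fintype, Finset.sum_const, nsmul_eq_mul, Ideal.absNorm_apply, Submodule.cardQuot_apply,
      Nat.card_eq_fintype_card, Finset.card_univ]
  obtain ⟨R, hR⟩ : ∃ R, ∀ q : 𝓞 K ⧸ (J : Ideal (𝓞 K)),
      weightedNorm 0 ((Quotient.out q : 𝓞 K) : K) ≤ R :=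
    (Set.finite_range fun q : 𝓞 K ⧸ (J : Ideal (𝓞 K)) ↦
      weightedNorm 0 ((Quotient.out q : 𝓞 K) : K)).bddAbove.imp fun R hR q ↦ hR ⟨q, rfl⟩
  obtain ⟨g, hg, h⟩ := exists_lintegral_epsteinTerm_le_add (K := K) R
  refine ⟨Ideal.absNorm (J : Ideal (𝓞 K)) * ∑' x, g x, ENNReal.mul_ne_top (by simp) hg,
    fun s hs ↦ ⟨?_, ?_⟩⟩
  · rw [tsum_eq_tsum_quotient_mul_ideal J, ← hcard]
    calc _ ≤ ∑' q : 𝓞 K ⧸ (J : Ideal (𝓞 K)), ∑' y : (J : Ideal (𝓞 K)),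
          ((∫⁻ a in unitDomain K, epsteinTerm K s a (y : 𝓞 K)) + g (Quotient.out q + y)) := by
          gcongr with q y
          exact h s hs _ _ (by simpa using hR q)
      _ = ∑' q : 𝓞 K ⧸ (J : Ideal (𝓞 K)), ∑' y : (J : Ideal (𝓞 K)),
            (∫⁻ a in unitDomain K, epsteinTerm K s a (y : 𝓞 K)) + ∑' x, g x := by
          rw [tsum_eq_tsum_quotient_mul_ideal J g, ← ENNReal.tsum_add]
          simp_rw [ENNReal.tsum_add]
      _ ≤ _ := by
          gcongr
          have : Ideal.absNorm (J : Ideal (𝓞 K)) ≠ 0 :=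
            Ideal.absNorm_ne_zero_of_nonZeroDivisors J
          exact le_mul_of_one_le_left (zero_le) (by exact_mod_cast Nat.one_le_iff_ne_zero.2 this)
  · rw [tsum_eq_tsum_quotient_mul_ideal J, ← hcard, ← hcard, ← ENNReal.tsum_add]
    refine ENNReal.tsum_le_tsum fun q ↦ ?_
    calc _ ≤ ∑' y : (J : Ideal (𝓞 K)),
          ((∫⁻ a in unitDomain K, epsteinTerm K s a ((Quotient.out q + y : 𝓞 K) : K)) + g y) := by
          gcongr with y
          refine h s hs _ _ ?_
          rw [sub_add_cancel_right]
          exact (weightedNorm_neg 0 _).trans_le (hR q)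
      _ ≤ _ := by
          rw [ENNReal.tsum_add]
          gcongr
          exact ENNReal.tsum_comp_le_tsum_of_injective Subtype.val_injective g

end NumberField

namespace NumberField

open Filter Topology MeasureTheory InfinitePlace NumberField.Units Units.dirichletUnitTheorem Module
open scoped ENNReal nonZeroDivisors

variable {K : Type*} [Field K] [NumberField K]

open scoped Classical in
theorem tsum_lintegral_epsteinTerm {s : ℝ} (hs : 0 < s) :
    ∑' x : 𝓞 K, (∫⁻ a in unitDomain K, epsteinTerm K s a (x : K)) =
      torsionOrder K * epsteinIntegral K s * classZeta K 1 s := by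
  have h := tsum_ideal_epsteinTerm (K := K) hs 1
  have h1 : ClassGroup.mk0 (1 : (Ideal (𝓞 K))⁰) = 1 := map_one _
  rw [h1, inv_one] at h
  simp only [OneMemClass.coe_one, map_one, Nat.cast_one, Real.one_rpow, ENNReal.ofReal_one,
    one_mul] at h
  rw [← h]
  exact (((Equiv.Set.univ (𝓞 K)).symm.trans (Equiv.setCongr (by simp))).tsum_eq
    fun x : (1 : Ideal (𝓞 K)) ↦ ∫⁻ a in unitDomain K, epsteinTerm K s a (x : 𝓞 K))

open scoped Classical in
theorem tsum_lintegral_epsteinTerm_ne_top {s : ℝ} (hs : 1 < s) :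
    ∑' x : 𝓞 K, (∫⁻ a in unitDomain K, epsteinTerm K s a (x : K)) ≠ ∞ := by
  set n : ℝ := (finrank ℚ K : ℝ) with hn
  have hn1 : 1 ≤ n := finrank_pos_real
  obtain ⟨C, hC, h⟩ := exists_weightedNorm_rpow_le (K := K) isBounded_unitDomain (n * s)
  have h1 (x : 𝓞 K) : (∫⁻ a in unitDomain K, epsteinTerm K s a (x : K)) ≤
      ENNReal.ofReal (C * weightedNorm 0 (x : K) ^ (-(n * s))) * volume (unitDomain K) := by
    rw [← setLIntegral_const]
    refine setLIntegral_mono measurable_const fun a ha ↦ ENNReal.ofReal_le_ofReal ?_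
    exact h a ha (n * s) ⟨by positivity, le_rfl⟩ _ ⟨by positivity, le_rfl⟩ x (by positivity)
  refine ne_top_of_le_ne_top ?_ (ENNReal.tsum_le_tsum h1)
  rw [ENNReal.tsum_mul_right]
  exact ENNReal.mul_ne_top
    ((summable_weightedNorm_rpow (K := K) (by nlinarith)).mul_left C).tsum_ofReal_ne_top
    volume_unitDomain_ne_top

theorem one_le_classZeta_one (s : ℝ) : 1 ≤ classZeta K 1 s := by
  have h1 : ClassGroup.mk0 (1 : (Ideal (𝓞 K))⁰) = 1 := map_one _
  refine le_trans ?_ (ENNReal.le_tsum ⟨1, h1⟩)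
  simp

theorem epsteinIntegral_ne_top {s : ℝ} (hs : 1 < s) : epsteinIntegral K s ≠ ∞ := by
  intro h
  have h1 := tsum_lintegral_epsteinTerm_ne_top (K := K) hs
  rw [tsum_lintegral_epsteinTerm (by linarith), h,
    ENNReal.mul_top (by simpa using torsionOrder_ne_zero K),
    ENNReal.top_mul (one_pos.trans_le (one_le_classZeta_one s)).ne'] at h1
  exact h1 rfl

open scoped Classical in
theorem exists_le_epsteinIntegral :
    ∃ j : ℝ≥0∞, j ≠ 0 ∧ ∀ s ∈ Set.Ioc (1 : ℝ) 2, j ≤ epsteinIntegral K s := by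
  obtain ⟨c, hc, h⟩ := exists_one_le_weightedNorm_le (K := K)
    (Metric.isBounded_ball (x := (0 : logSpace K)) (r := 1))
  set n : ℝ := (finrank ℚ K : ℝ) with hn
  have hn1 : 1 ≤ n := finrank_pos_real
  set w := c * max (weightedNorm 0 (1 : K)) 1
  have hw : 1 ≤ w := one_le_mul_of_one_le_of_one_le hc (le_max_right _ _)
  refine ⟨ENNReal.ofReal (w ^ (-(n * 2))) * volume (Metric.ball (0 : logSpace K) 1), ?_,
    fun s hs ↦ ?_⟩
  · refine mul_ne_zero ?_ (Metric.measure_ball_pos _ _ one_pos).ne'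
    simpa using Real.rpow_pos_of_pos (by positivity) _
  · rw [← setLIntegral_const]
    refine (setLIntegral_mono (measurable_epsteinTerm s 1) fun a ha ↦ ?_).trans
      (setLIntegral_le_lintegral _ _)
    refine ENNReal.ofReal_le_ofReal ?_
    calc w ^ (-(n * 2)) ≤ w ^ (-(n * s)) := by gcongr; exact hs.2
      _ ≤ _ := Real.rpow_le_rpow_of_nonpos (weightedNorm_pos _ one_ne_zero)
        ((h a ha 1).1.trans (mul_le_mul_of_nonneg_left (le_max_left _ _) (by linarith))) (by nlinarith [hs.1])

theorem summable_classZeta (c : ClassGroup (𝓞 K)) {s : ℝ} (hs : 1 < s) :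
    Summable fun I : {I : (Ideal (𝓞 K))⁰ // ClassGroup.mk0 I = c} ↦
      (Ideal.absNorm (I : Ideal (𝓞 K)) : ℝ) ^ (-s) :=
  (summable_absNorm_rpow K hs).comp_injective (i := fun I : {I : (Ideal (𝓞 K))⁰ //
    ClassGroup.mk0 I = c} ↦ (I : Ideal (𝓞 K))) (Subtype.val_injective.comp Subtype.val_injective)

theorem toReal_classZeta (c : ClassGroup (𝓞 K)) {s : ℝ} (hs : 1 < s) :
    (classZeta K c s).toReal = ∑' I : {I : (Ideal (𝓞 K))⁰ // ClassGroup.mk0 I = c},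
      (Ideal.absNorm (I : Ideal (𝓞 K)) : ℝ) ^ (-s) := by
  rw [classZeta, ← ENNReal.ofReal_tsum_of_nonneg (fun _ ↦ by positivity) (summable_classZeta c hs),
    ENNReal.toReal_ofReal (tsum_nonneg fun _ ↦ by positivity)]

theorem classZeta_ne_top (c : ClassGroup (𝓞 K)) {s : ℝ} (hs : 1 < s) : classZeta K c s ≠ ∞ :=
  (summable_classZeta c hs).tsum_ofReal_ne_top

theorem toReal_classZeta_le (c : ClassGroup (𝓞 K)) {s : ℝ} (hs : 1 < s) :
    (classZeta K c s).toReal ≤ ∑' I : Ideal (𝓞 K), (Ideal.absNorm I : ℝ) ^ (-s) := by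
  rw [toReal_classZeta c hs]
  exact tsum_comp_le_tsum_of_inj (summable_absNorm_rpow K hs) (fun _ ↦ by positivity)
    (i := fun I : {I : (Ideal (𝓞 K))⁰ // ClassGroup.mk0 I = c} ↦ (I : Ideal (𝓞 K)))
    (Subtype.val_injective.comp Subtype.val_injective)

theorem exists_classZeta_one_le (c : ClassGroup (𝓞 K)) : ∃ N B : ℝ, 1 ≤ N ∧
    ∀ s ∈ Set.Ioc (1 : ℝ) 2,
      (classZeta K 1 s).toReal ≤ N ^ (1 - s) * (classZeta K c s).toReal + B ∧
      N ^ (1 - s) * (classZeta K c s).toReal ≤ (classZeta K 1 s).toReal + B := by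
  classical
  obtain ⟨J, hJ⟩ := ClassGroup.mk0_surjective c⁻¹
  have hc : c = (ClassGroup.mk0 J)⁻¹ := by rw [hJ, inv_inv]
  obtain ⟨B, hB, h⟩ := exists_tsum_lintegral_epsteinTerm_le J
  obtain ⟨j, hj, hj'⟩ := exists_le_epsteinIntegral (K := K)
  have hN : 1 ≤ Ideal.absNorm (J : Ideal (𝓞 K)) :=
    Nat.one_le_iff_ne_zero.2 (Ideal.absNorm_ne_zero_of_nonZeroDivisors J)
  have hN' : (0 : ℝ) < Ideal.absNorm (J : Ideal (𝓞 K)) := by positivity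
  have hBj : B / j ≠ ∞ := ENNReal.div_ne_top hB hj
  refine ⟨Ideal.absNorm (J : Ideal (𝓞 K)), (B / j).toReal, by exact_mod_cast hN, fun s hs ↦ ?_⟩
  set Ni : ℝ := (Ideal.absNorm (J : Ideal (𝓞 K)) : ℝ) ^ (1 - s) with hNi
  have hs0 : 0 < s := by linarith [hs.1]
  set T : ℝ≥0∞ := torsionOrder K * epsteinIntegral K s with hT
  have hT0 : T ≠ 0 := mul_ne_zero (by simpa using torsionOrder_ne_zero K)
    ((pos_iff_ne_zero.2 hj).trans_le (hj' s hs)).ne'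
  have hTt : T ≠ ∞ := ENNReal.mul_ne_top (by simp) (epsteinIntegral_ne_top hs.1)
  have hjT : j ≤ T := by
    rw [hT]
    refine (hj' s hs).trans (le_mul_of_one_le_left zero_le ?_)
    exact_mod_cast Nat.one_le_iff_ne_zero.2 (torsionOrder_ne_zero K)
  have hB' : B ≤ T * (B / j) := by
    calc B = j * (B / j) := (ENNReal.mul_div_cancel hj ?_).symm
      _ ≤ _ := by gcongr
    exact ne_top_of_le_ne_top hTt hjT
  have key : (Ideal.absNorm (J : Ideal (𝓞 K)) : ℝ≥0∞) * (T * (ENNReal.ofReal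
      ((Ideal.absNorm (J : Ideal (𝓞 K)) : ℝ) ^ (-s)) * classZeta K c s)) =
      T * (ENNReal.ofReal Ni * classZeta K c s) := by
    rw [hNi, sub_eq_add_neg, Real.rpow_add hN', Real.rpow_one, ENNReal.ofReal_mul hN'.le,
      ENNReal.ofReal_natCast]
    ring
  obtain ⟨h1, h2⟩ := h s hs
  rw [tsum_lintegral_epsteinTerm hs0, tsum_ideal_epsteinTerm hs0, ← hc, ← hT, key] at h1 h2
  replace h1 := h1.trans (add_le_add_right hB' _)
  replace h2 := h2.trans (add_le_add_right hB' _)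
  rw [← mul_add, ENNReal.mul_le_mul_iff_right hT0 hTt] at h1 h2
  have hZ1 := classZeta_ne_top (K := K) 1 hs.1
  have hZc := classZeta_ne_top (K := K) c hs.1
  have hm : (ENNReal.ofReal Ni * classZeta K c s).toReal = Ni * (classZeta K c s).toReal := by
    rw [ENNReal.toReal_mul, ENNReal.toReal_ofReal (by positivity)]
  have hmt : ENNReal.ofReal Ni * classZeta K c s ≠ ∞ := ENNReal.mul_ne_top (by simp) hZc
  rw [← hm]
  rw [← ENNReal.toReal_add hmt hBj, ← ENNReal.toReal_add hZ1 hBj]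
  exact ⟨ENNReal.toReal_mono (ENNReal.add_ne_top.2 ⟨hmt, hBj⟩) h1,
    ENNReal.toReal_mono (ENNReal.add_ne_top.2 ⟨hZ1, hBj⟩) h2⟩

theorem exists_abs_classZeta_sub_le (c : ClassGroup (𝓞 K)) : ∃ B : ℝ, ∀ᶠ s in 𝓝[>] (1 : ℝ),
    |(classZeta K c s).toReal - (classZeta K 1 s).toReal| ≤ B := by
  obtain ⟨N, B, hN, h⟩ := exists_classZeta_one_le c
  have hB : 0 ≤ B := by
    have := h 2 ⟨by norm_num, le_rfl⟩
    linarith [this.1, this.2]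
  have hlog : 0 ≤ Real.log N := Real.log_nonneg hN
  set ρ := dedekindZeta_residue K
  have hev : ∀ᶠ s in 𝓝[>] (1 : ℝ),
      (s - 1) * ∑' I : Ideal (𝓞 K), (Ideal.absNorm I : ℝ) ^ (-s) ≤ ρ + 1 :=
    (tendsto_sub_one_mul_tsum_absNorm_rpow K).eventually_le_const (by simp [ρ])
  refine ⟨Real.log N * (ρ + 1) + B, ?_⟩
  filter_upwards [hev, Ioc_mem_nhdsGT (show (1 : ℝ) < 2 by norm_num)] with s hs hs'
  obtain ⟨h1, h2⟩ := h s hs'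
  have hz := toReal_classZeta_le c hs'.1
  have hz0 : 0 ≤ (classZeta K c s).toReal := ENNReal.toReal_nonneg
  have h3 : N ^ (1 - s) ≤ 1 := Real.rpow_le_one_of_one_le_of_nonpos hN (by linarith [hs'.1])
  have h4 : 1 - N ^ (1 - s) ≤ (s - 1) * Real.log N := by
    have := Real.add_one_le_exp (Real.log N * (1 - s))
    rw [← Real.rpow_def_of_pos (by linarith)] at this
    linarith
  have h5 : (1 - N ^ (1 - s)) * (classZeta K c s).toReal ≤ Real.log N * (ρ + 1) := by
    calc _ ≤ ((s - 1) * Real.log N) * (classZeta K c s).toReal := by gcongr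
      _ = Real.log N * ((s - 1) * (classZeta K c s).toReal) := by ring
      _ ≤ _ := by
        gcongr
        refine le_trans ?_ hs
        have := hs'.1
        gcongr
  rw [abs_le]
  constructor
  · have h6 : N ^ (1 - s) * (classZeta K c s).toReal ≤ (classZeta K c s).toReal :=
      mul_le_of_le_one_left hz0 h3
    have h7 : 0 ≤ (1 - N ^ (1 - s)) * (classZeta K c s).toReal :=
      mul_nonneg (by linarith) hz0
    linarith
  · linarith

end NumberField

theorem CommGroup.exists_intUnits_apply_ne_one {G : Type*} [CommGroup G] [Finite G]
    (hG : ∀ g : G, g ^ 2 = 1) {a : G} (ha : a ≠ 1) : ∃ φ : G →* ℤˣ, φ a ≠ 1 := by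
  have h2 : HasEnoughRootsOfUnity ℤ 2 :=
    ⟨⟨-1, IsPrimitiveRoot.neg_one 0 (by norm_num)⟩, inferInstance⟩
  have : HasEnoughRootsOfUnity ℤ (Monoid.exponent G) :=
    HasEnoughRootsOfUnity.of_dvd ℤ (Monoid.exponent_dvd_of_forall_pow_eq_one hG)
  exact CommGroup.exists_apply_ne_one_of_hasEnoughRootsOfUnity G ℤ ha

theorem CommGroup.exists_pair_intUnits {G : Type*} [CommGroup G] [Finite G]
    (hG : ∀ g : G, g ^ 2 = 1) (h : 2 < Nat.card G) :
    ∃ φ ψ : G →* ℤˣ, φ ≠ 1 ∧ ψ ≠ 1 ∧ φ * ψ ≠ 1 := by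
  have : Nontrivial G := (Finite.one_lt_card_iff_nontrivial).1 (by omega)
  obtain ⟨a, ha⟩ := exists_ne (1 : G)
  obtain ⟨φ, hφ⟩ := exists_intUnits_apply_ne_one hG ha
  have hk : ∃ b, φ b = 1 ∧ b ≠ 1 := by
    by_contra! hb
    have hi : Function.Injective φ := (injective_iff_map_eq_one φ).2 hb
    have := Nat.card_le_card_of_injective φ hi
    rw [Nat.card_eq_fintype_card (α := ℤˣ)] at this
    simp at this
    omega
  obtain ⟨b, hb, hb1⟩ := hk
  obtain ⟨ψ, hψ⟩ := exists_intUnits_apply_ne_one hG hb1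
  refine ⟨φ, ψ, fun h ↦ hφ (by rw [h]; rfl), fun h ↦ hψ (by rw [h]; rfl), fun h ↦ hψ ?_⟩
  have := DFunLike.congr_fun h b
  rwa [MonoidHom.mul_apply, hb, one_mul, MonoidHom.one_apply] at this

namespace NumberField

open Filter Topology IsDedekindDomain
open scoped nonZeroDivisors

variable {F : Type*} [Field F] [NumberField F]

noncomputable section

open scoped Classical in
/-- The term of the `L`-series of a quadratic character of the class group. -/
def idealChar (χ : ClassGroup (𝓞 F) →* ℤˣ) (s : ℝ) (hs : s ≠ 0) : Ideal (𝓞 F) →*₀ ℝ where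
  toFun I := if h : I = 0 then 0 else
    ((χ (ClassGroup.mk0 ⟨I, mem_nonZeroDivisors_of_ne_zero h⟩) : ℤ) : ℝ) *
      (Ideal.absNorm I : ℝ) ^ (-s)
  map_zero' := by simp
  map_one' := by
    have : (⟨1, mem_nonZeroDivisors_of_ne_zero one_ne_zero⟩ : (Ideal (𝓞 F))⁰) = 1 := rfl
    rw [dif_neg one_ne_zero, this, map_one, map_one, map_one]
    simp
  map_mul' I J := by
    by_cases hI : I = 0
    · simp [hI]
    by_cases hJ : J = 0
    · simp [hJ]
    have : (⟨I * J, mem_nonZeroDivisors_of_ne_zero (mul_ne_zero hI hJ)⟩ : (Ideal (𝓞 F))⁰) =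
      ⟨I, mem_nonZeroDivisors_of_ne_zero hI⟩ * ⟨J, mem_nonZeroDivisors_of_ne_zero hJ⟩ := rfl
    rw [dif_neg (mul_ne_zero hI hJ), dif_neg hI, dif_neg hJ, this, map_mul, map_mul, map_mul,
      Nat.cast_mul, Real.mul_rpow (by positivity) (by positivity), Units.val_mul, Int.cast_mul]
    ring

theorem idealChar_coe (χ : ClassGroup (𝓞 F) →* ℤˣ) {s : ℝ} (hs : s ≠ 0) (I : (Ideal (𝓞 F))⁰) :
    idealChar χ s hs I =
      ((χ (ClassGroup.mk0 I) : ℤ) : ℝ) * (Ideal.absNorm (I : Ideal (𝓞 F)) : ℝ) ^ (-s) :=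
  dif_neg (nonZeroDivisors.coe_ne_zero I)

theorem idealChar_asIdeal (χ : ClassGroup (𝓞 F) →* ℤˣ) {s : ℝ} (hs : s ≠ 0)
    (v : HeightOneSpectrum (𝓞 F)) : idealChar χ s hs v.asIdeal =
      ((χ v.idealClass : ℤ) : ℝ) * (Ideal.absNorm v.asIdeal : ℝ) ^ (-s) :=
  idealChar_coe χ hs ⟨v.asIdeal, mem_nonZeroDivisors_of_ne_zero v.ne_bot⟩

theorem abs_intUnits_cast (u : ℤˣ) : |((u : ℤ) : ℝ)| = 1 := by
  rcases Int.units_eq_one_or u with rfl | rfl <;> simp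

theorem abs_idealChar (χ : ClassGroup (𝓞 F) →* ℤˣ) {s : ℝ} (hs : s ≠ 0) (I : Ideal (𝓞 F)) :
    ‖idealChar χ s hs I‖ = (Ideal.absNorm I : ℝ) ^ (-s) := by
  by_cases h : I = 0
  · rw [h, map_zero, map_zero]
    simp [Real.zero_rpow, hs]
  · rw [idealChar_coe χ hs ⟨I, mem_nonZeroDivisors_of_ne_zero h⟩, norm_mul, Real.norm_eq_abs,
      abs_intUnits_cast, one_mul, Real.norm_of_nonneg (by positivity)]

theorem summable_idealChar (χ : ClassGroup (𝓞 F) →* ℤˣ) {s : ℝ} (hs : 1 < s) :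
    Summable fun I ↦ ‖idealChar χ s (by positivity) I‖ := by
  simp_rw [abs_idealChar]
  exact summable_absNorm_rpow F hs

theorem tsum_idealChar (χ : ClassGroup (𝓞 F) →* ℤˣ) {s : ℝ} (hs : 1 < s) :
    ∑' I, idealChar χ s (by positivity) I =
      ∑ c, ((χ c : ℤ) : ℝ) * (classZeta F c s).toReal := by
  have hs0 : s ≠ 0 := by positivity
  have h1 : ∑' I, idealChar χ s hs0 I = ∑' I : (Ideal (𝓞 F))⁰, idealChar χ s hs0 I := by
    refine (tsum_subtype_eq_of_support_subset (s := {I | I ∈ (Ideal (𝓞 F))⁰}) fun I hI ↦ ?_).symm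
    exact mem_nonZeroDivisors_of_ne_zero fun h ↦ hI (by rw [h, map_zero])
  have h2 : Summable fun I : (Ideal (𝓞 F))⁰ ↦ idealChar χ s hs0 I :=
    (summable_idealChar χ hs).of_norm.comp_injective Subtype.val_injective
  rw [h1, ← (Equiv.sigmaFiberEquiv fun I : (Ideal (𝓞 F))⁰ ↦ ClassGroup.mk0 I).tsum_eq]
  refine (Summable.tsum_sigma ((Equiv.sigmaFiberEquiv fun I : (Ideal (𝓞 F))⁰ ↦
      ClassGroup.mk0 I).summable_iff.2 h2)).trans ?_
  rw [tsum_fintype]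
  refine Finset.sum_congr rfl fun c _ ↦ ?_
  rw [toReal_classZeta c hs, ← tsum_mul_left]
  refine tsum_congr fun I ↦ ?_
  change idealChar χ s hs0 (I.1 : Ideal (𝓞 F)) = _
  rw [idealChar_coe, I.2]

theorem exists_abs_tsum_idealChar_le {χ : ClassGroup (𝓞 F) →* ℤˣ} (hχ : χ ≠ 1) :
    ∃ B : ℝ, ∀ᶠ s in 𝓝[>] (1 : ℝ), ∀ hs : s ≠ 0, |∑' I, idealChar χ s hs I| ≤ B := by
  choose B hB using exists_abs_classZeta_sub_le (K := F)
  refine ⟨∑ c, B c, ?_⟩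
  filter_upwards [eventually_all.2 hB, self_mem_nhdsWithin] with s hs hs1 hs0
  have h0 : ∑ c, ((χ c : ℤ) : ℝ) = 0 := by
    have := sum_hom_units_eq_zero ((Int.castRingHom ℝ : ℤ →* ℝ).comp ((Units.coeHom ℤ).comp χ))
      (fun h ↦ hχ (MonoidHom.ext fun c ↦ Units.ext ?_))
    · simpa using this
    · simpa using DFunLike.congr_fun h c
  rw [tsum_idealChar χ hs1]
  calc |∑ c, ((χ c : ℤ) : ℝ) * (classZeta F c s).toReal| =
        |∑ c, ((χ c : ℤ) : ℝ) * ((classZeta F c s).toReal - (classZeta F 1 s).toReal)| := by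
        simp_rw [mul_sub, Finset.sum_sub_distrib, ← Finset.sum_mul, h0, zero_mul, sub_zero]
    _ ≤ ∑ c, |((χ c : ℤ) : ℝ) * ((classZeta F c s).toReal - (classZeta F 1 s).toReal)| :=
        Finset.abs_sum_le_sum_abs _ _
    _ ≤ ∑ c, B c := Finset.sum_le_sum fun c _ ↦ by
        rw [abs_mul, abs_intUnits_cast, one_mul]
        exact hs c

theorem absNorm_rpow_lt_one (v : HeightOneSpectrum (𝓞 F)) {s : ℝ} (hs : 0 < s) :
    (Ideal.absNorm v.asIdeal : ℝ) ^ (-s) < 1 := by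
  refine Real.rpow_lt_one_of_one_lt_of_neg ?_ (by linarith)
  have h0 : Ideal.absNorm v.asIdeal ≠ 0 := Ideal.absNorm_eq_zero_iff.not.2 v.ne_bot
  have h1 : Ideal.absNorm v.asIdeal ≠ 1 := Ideal.absNorm_eq_one_iff.not.2 v.isPrime.ne_top
  exact_mod_cast (by omega : 1 < Ideal.absNorm v.asIdeal)

theorem absNorm_rpow_pos (v : HeightOneSpectrum (𝓞 F)) (s : ℝ) :
    0 < (Ideal.absNorm v.asIdeal : ℝ) ^ s := by
  have h0 : Ideal.absNorm v.asIdeal ≠ 0 := Ideal.absNorm_eq_zero_iff.not.2 v.ne_bot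
  positivity

theorem tendsto_prod_idealChar (χ : ClassGroup (𝓞 F) →* ℤˣ) {s : ℝ} (hs : 1 < s) :
    Tendsto (fun S : Finset (HeightOneSpectrum (𝓞 F)) ↦ ∏ v ∈ S,
      (1 - ((χ v.idealClass : ℤ) : ℝ) * (Ideal.absNorm v.asIdeal : ℝ) ^ (-s))⁻¹) atTop
      (𝓝 (∑' I, idealChar χ s (by positivity) I)) := by
  refine (tendsto_eulerProduct (summable_idealChar χ hs) fun v ↦ ?_).congr fun S ↦ ?_
  · rw [abs_idealChar]
    exact absNorm_rpow_lt_one v (by positivity)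
  · simp_rw [idealChar_asIdeal]

theorem tsum_idealChar_one {s : ℝ} (hs : 1 < s) :
    ∑' I : Ideal (𝓞 F), idealChar 1 s (by positivity) I =
      ∑' I : Ideal (𝓞 F), (Ideal.absNorm I : ℝ) ^ (-s) := by
  refine tsum_congr fun I ↦ ?_
  by_cases h : I = 0
  · have : s ≠ 0 := by positivity
    rw [h, map_zero, map_zero]
    simp [Real.zero_rpow, this]
  · rw [idealChar_coe 1 _ ⟨I, mem_nonZeroDivisors_of_ne_zero h⟩]
    simp

theorem tendsto_prod_absNorm {s : ℝ} (hs : 1 < s) :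
    Tendsto (fun S : Finset (HeightOneSpectrum (𝓞 F)) ↦ ∏ v ∈ S,
      (1 - (Ideal.absNorm v.asIdeal : ℝ) ^ (-s))⁻¹) atTop
      (𝓝 (∑' I : Ideal (𝓞 F), (Ideal.absNorm I : ℝ) ^ (-s))) := by
  simpa [tsum_idealChar_one hs] using tendsto_prod_idealChar (F := F) 1 hs

theorem prod_absNorm_le {s : ℝ} (hs : 1 < s) (S : Finset (HeightOneSpectrum (𝓞 F))) :
    ∏ v ∈ S, (1 - (Ideal.absNorm v.asIdeal : ℝ) ^ (-s))⁻¹ ≤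
      ∑' I : Ideal (𝓞 F), (Ideal.absNorm I : ℝ) ^ (-s) := by
  refine ge_of_tendsto (tendsto_prod_absNorm hs) ?_
  filter_upwards [eventually_ge_atTop S] with T hT
  have h1 (v : HeightOneSpectrum (𝓞 F)) : 1 ≤ (1 - (Ideal.absNorm v.asIdeal : ℝ) ^ (-s))⁻¹ := by
    have := absNorm_rpow_lt_one v (s := s) (by linarith)
    have := absNorm_rpow_pos v (-s)
    exact (one_le_inv₀ (by linarith)).2 (by linarith)
  exact Finset.prod_mono_set_of_one_le h1 hT

theorem one_le_eulerFactor {x : ℝ} (h0 : 0 < x) (h1 : x < 1) (a b : ℤˣ) :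
    1 ≤ (1 - x)⁻¹ * (1 - ((a : ℤ) : ℝ) * x)⁻¹ * (1 - ((b : ℤ) : ℝ) * x)⁻¹ *
      (1 - (((a * b : ℤˣ) : ℤ) : ℝ) * x)⁻¹ := by
  have h2 : 1 - x ^ 2 ≤ 1 := by nlinarith
  have h3 : 0 < 1 - x := by linarith
  have h4 : 0 < 1 + x := by linarith
  rw [← mul_inv, ← mul_inv, ← mul_inv]
  rcases Int.units_eq_one_or a with rfl | rfl <;> rcases Int.units_eq_one_or b with rfl | rfl <;>
    simp only [mul_one, one_mul, Units.val_one, Units.val_neg, Int.cast_one, Int.cast_neg,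
      neg_mul, sub_neg_eq_add, mul_neg, neg_neg]
  · refine (one_le_inv₀ (by positivity)).2 ?_
    have : (1 - x) * (1 - x) ≤ 1 := by nlinarith
    nlinarith [mul_pos h3 h3]
  all_goals
    refine (one_le_inv₀ (by positivity)).2 ?_
    have : (1 - x) * (1 + x) ≤ 1 := by nlinarith
    have : 0 < (1 - x) * (1 + x) := by positivity
    nlinarith

end

end NumberField

namespace NumberField

open Filter Topology IsDedekindDomain HeightOneSpectrum
open scoped nonZeroDivisors Pointwise

variable {F : Type*} [Field F] [NumberField F] (M : Type*) [Field M] [NumberField M] [Algebra F M]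

/-- At least two primes of `M` lie over `v`. -/
def IsSplit (v : HeightOneSpectrum (𝓞 F)) : Prop :=
  ∃ w w' : HeightOneSpectrum (𝓞 M), w ≠ w' ∧ w.under (𝓞 F) = v ∧ w'.under (𝓞 F) = v

variable {M}

theorem absNorm_under_le (w : HeightOneSpectrum (𝓞 M)) :
    Ideal.absNorm (w.under (𝓞 F)).asIdeal ≤ Ideal.absNorm w.asIdeal := by
  have hm : (w.under (𝓞 F)).asIdeal.IsMaximal := (w.under (𝓞 F)).isMaximal
  rw [Ideal.absNorm_eq_pow_inertiaDeg'_of_liesOver w.asIdeal (w.under (𝓞 F)).asIdeal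
    (w.under (𝓞 F)).isPrime (w.under (𝓞 F)).ne_bot]
  exact Nat.le_self_pow (Ideal.inertiaDeg'_pos _ _).ne' _

section Quadratic

variable [IsGalois F M] (h2 : Module.finrank F M = 2)
include h2

theorem card_under_le (v : HeightOneSpectrum (𝓞 F)) (T : Finset (HeightOneSpectrum (𝓞 M)))
    (hT : ∀ w ∈ T, w.under (𝓞 F) = v) : T.card ≤ 2 := by
  classical
  rcases T.eq_empty_or_nonempty with rfl | ⟨w, hw⟩
  · simp
  have hc : Fintype.card Gal(M/F) = 2 := by
    rw [← Nat.card_eq_fintype_card, IsGalois.card_aut_eq_finrank, h2]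
  rw [← hc, ← Finset.card_univ]
  refine (Finset.card_le_card fun w' hw' ↦ ?_).trans
    (Finset.card_image_le (f := fun g : Gal(M/F) ↦ g • w))
  obtain ⟨g, hg⟩ := exists_smul_eq_of_under_eq (w := w) (w' := w')
    ((hT w hw).trans (hT w' hw').symm)
  exact Finset.mem_image.2 ⟨g, Finset.mem_univ _, hg⟩

theorem absNorm_eq_sq (hd : differentIdeal (𝓞 F) (𝓞 M) = ⊤) (w : HeightOneSpectrum (𝓞 M))
    (hw : ¬ IsSplit M (w.under (𝓞 F))) :
    Ideal.absNorm w.asIdeal = Ideal.absNorm (w.under (𝓞 F)).asIdeal ^ 2 := by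
  have hm : (w.under (𝓞 F)).asIdeal.IsMaximal := (w.under (𝓞 F)).isMaximal
  have hm' : w.asIdeal.IsMaximal := w.isMaximal
  rw [Ideal.absNorm_eq_pow_inertiaDeg'_of_liesOver w.asIdeal (w.under (𝓞 F)).asIdeal
    (w.under (𝓞 F)).isPrime (w.under (𝓞 F)).ne_bot]
  congr 1
  have h := Ideal.ncard_primesOver_mul_ramificationIdxIn_mul_inertiaDegIn
    (w.under (𝓞 F)).asIdeal (𝓞 M) Gal(M/F)
  rw [Ideal.ramificationIdxIn_eq_ramificationIdx _ w.asIdeal Gal(M/F),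
    Ideal.inertiaDegIn_eq_inertiaDeg _ w.asIdeal Gal(M/F),
    ramificationIdx_eq_one_of_differentIdeal_eq_top hd, ← Ideal.inertiaDeg'_eq_inertiaDeg
    (w.under (𝓞 F)).asIdeal, IsGalois.card_aut_eq_finrank, h2] at h
  have h1 : (w.under (𝓞 F)).asIdeal.primesOver (𝓞 M) = {w.asIdeal} := by
    refine Set.eq_singleton_iff_unique_mem.2 ⟨⟨w.isPrime, inferInstance⟩, fun P hP ↦ ?_⟩
    have hP1 := hP.1
    have hP2 := hP.2
    have hne : P ≠ ⊥ := Ideal.ne_bot_of_liesOver_of_ne_bot (w.under (𝓞 F)).ne_bot P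
    by_contra hPw
    exact hw ⟨⟨P, hP1, hne⟩, w, fun h ↦ hPw (congrArg HeightOneSpectrum.asIdeal h),
      HeightOneSpectrum.ext hP2.over.symm, rfl⟩
  rw [h1, Set.ncard_singleton] at h
  omega

open scoped Classical in
theorem prod_under_le (hd : differentIdeal (𝓞 F) (𝓞 M) = ⊤) (v : HeightOneSpectrum (𝓞 F))
    (T : Finset (HeightOneSpectrum (𝓞 M))) (hT : ∀ w ∈ T, w.under (𝓞 F) = v) {s : ℝ}
    (hs : 1 < s) :
    ∏ w ∈ T, (1 - (Ideal.absNorm w.asIdeal : ℝ) ^ (-s))⁻¹ ≤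
      (if IsSplit M v then ((1 - (Ideal.absNorm v.asIdeal : ℝ) ^ (-s))⁻¹) ^ 2 else 1) *
        (1 - (Ideal.absNorm v.asIdeal : ℝ) ^ (-2 : ℝ))⁻¹ := by
  have hx0 := absNorm_rpow_pos v (-s)
  have hx1 := absNorm_rpow_lt_one v (s := s) (by linarith)
  have hy0 := absNorm_rpow_pos v (-2)
  have hy1 := absNorm_rpow_lt_one v (s := 2) (by norm_num)
  have hv0 : 1 ≤ Ideal.absNorm v.asIdeal :=
    Nat.one_le_iff_ne_zero.2 (Ideal.absNorm_eq_zero_iff.not.2 v.ne_bot)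
  have hy2 : 1 ≤ (1 - (Ideal.absNorm v.asIdeal : ℝ) ^ (-2 : ℝ))⁻¹ :=
    (one_le_inv₀ (by linarith)).2 (by linarith)
  have hx2 : 1 ≤ (1 - (Ideal.absNorm v.asIdeal : ℝ) ^ (-s))⁻¹ :=
    (one_le_inv₀ (by linarith)).2 (by linarith)
  have hw1 (w : HeightOneSpectrum (𝓞 M)) := absNorm_rpow_lt_one w (s := s) (by linarith)
  split_ifs with hv
  · calc ∏ w ∈ T, (1 - (Ideal.absNorm w.asIdeal : ℝ) ^ (-s))⁻¹
        ≤ ∏ w ∈ T, (1 - (Ideal.absNorm v.asIdeal : ℝ) ^ (-s))⁻¹ := by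
          refine Finset.prod_le_prod (fun w _ ↦ inv_nonneg.2 (by linarith [hw1 w]))
            fun w hw ↦ inv_anti₀ (by linarith) ?_
          refine sub_le_sub_left (Real.rpow_le_rpow_of_nonpos (by exact_mod_cast hv0) ?_
            (by linarith)) _
          rw [← hT w hw]
          exact_mod_cast absNorm_under_le w
      _ = ((1 - (Ideal.absNorm v.asIdeal : ℝ) ^ (-s))⁻¹) ^ T.card := Finset.prod_const _
      _ ≤ ((1 - (Ideal.absNorm v.asIdeal : ℝ) ^ (-s))⁻¹) ^ 2 :=
          pow_le_pow_right₀ hx2 (card_under_le h2 v T hT)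
      _ ≤ _ := le_mul_of_one_le_right (by positivity) hy2
  · rw [one_mul]
    have hc : T.card ≤ 1 := Finset.card_le_one.2 fun w hw w' hw' ↦ by
      by_contra hne
      exact hv ⟨w, w', hne, hT w hw, hT w' hw'⟩
    rcases Nat.le_one_iff_eq_zero_or_eq_one.1 hc with hc | hc
    · rw [Finset.card_eq_zero.1 hc, Finset.prod_empty]
      exact hy2
    · obtain ⟨w, rfl⟩ := Finset.card_eq_one.1 hc
      obtain rfl := hT w (by simp)
      rw [Finset.prod_singleton, absNorm_eq_sq h2 hd w hv]
      refine inv_anti₀ (by linarith) (sub_le_sub_left ?_ _)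
      rw [Nat.cast_pow, ← Real.rpow_natCast, ← Real.rpow_mul (by positivity)]
      exact Real.rpow_le_rpow_of_exponent_le (by exact_mod_cast hv0) (by push_cast; linarith)

open scoped Classical in
theorem prod_absNorm_le_prod_split (hd : differentIdeal (𝓞 F) (𝓞 M) = ⊤)
    (T : Finset (HeightOneSpectrum (𝓞 M))) {s : ℝ} (hs : 1 < s) :
    ∃ S : Finset (HeightOneSpectrum (𝓞 F)),
      ∏ w ∈ T, (1 - (Ideal.absNorm w.asIdeal : ℝ) ^ (-s))⁻¹ ≤
      (∏ v ∈ S, if IsSplit M v then ((1 - (Ideal.absNorm v.asIdeal : ℝ) ^ (-s))⁻¹) ^ 2 else 1) *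
        ∑' I : Ideal (𝓞 F), (Ideal.absNorm I : ℝ) ^ (-2 : ℝ) := by
  refine ⟨T.image fun w ↦ w.under (𝓞 F), ?_⟩
  rw [← Finset.prod_fiberwise_of_maps_to (t := T.image fun w ↦ w.under (𝓞 F))
    (g := fun w ↦ w.under (𝓞 F)) (fun w hw ↦ Finset.mem_image_of_mem _ hw)]
  have h1 (v : HeightOneSpectrum (𝓞 F)) : 0 ≤ if IsSplit M v then
      ((1 - (Ideal.absNorm v.asIdeal : ℝ) ^ (-s))⁻¹) ^ 2 else 1 := by split_ifs <;> positivity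
  refine (Finset.prod_le_prod (fun v _ ↦ Finset.prod_nonneg fun w _ ↦ inv_nonneg.2 ?_) fun v _ ↦
    prod_under_le h2 hd v _ (fun w hw ↦ (Finset.mem_filter.1 hw).2) hs).trans ?_
  · linarith [absNorm_rpow_lt_one w (s := s) (by linarith)]
  · rw [Finset.prod_mul_distrib]
    exact mul_le_mul_of_nonneg_left (prod_absNorm_le one_lt_two _)
      (Finset.prod_nonneg fun v _ ↦ h1 v)

open scoped Classical in
omit h2 [NumberField M] [IsGalois F M] in
theorem prod_split_sq_le {χ ψ : ClassGroup (𝓞 F) →* ℤˣ}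
    (hχ : ∀ v : HeightOneSpectrum (𝓞 F), IsSplit M v → χ v.idealClass = 1)
    (hψ : ∀ v : HeightOneSpectrum (𝓞 F), IsSplit M v → ψ v.idealClass = 1)
    (S : Finset (HeightOneSpectrum (𝓞 F))) {s : ℝ} (hs : 1 < s) :
    (∏ v ∈ S, if IsSplit M v then
        ((1 - (Ideal.absNorm v.asIdeal : ℝ) ^ (-s))⁻¹) ^ 2 else 1) ^ 2 ≤
      (∑' I : Ideal (𝓞 F), (Ideal.absNorm I : ℝ) ^ (-s)) *
        (∑' I, idealChar χ s (by positivity) I) * (∑' I, idealChar ψ s (by positivity) I) *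
          (∑' I, idealChar (χ * ψ) s (by positivity) I) := by
  refine ge_of_tendsto ((((tendsto_prod_absNorm hs).mul (tendsto_prod_idealChar χ hs)).mul
    (tendsto_prod_idealChar ψ hs)).mul (tendsto_prod_idealChar (χ * ψ) hs)) ?_
  filter_upwards [eventually_ge_atTop S] with T hT
  simp_rw [← Finset.prod_mul_distrib, ← Finset.prod_pow]
  have h1 (v : HeightOneSpectrum (𝓞 F)) := one_le_eulerFactor (absNorm_rpow_pos v (-s))
    (absNorm_rpow_lt_one v (s := s) (by linarith)) (χ v.idealClass) (ψ v.idealClass)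
  refine le_trans ?_ (Finset.prod_mono_set_of_one_le h1 hT)
  refine Finset.prod_le_prod (fun v _ ↦ by positivity) fun v _ ↦ ?_
  split_ifs with hv
  · rw [hχ v hv, hψ v hv]
    simp only [mul_one, Units.val_one, Int.cast_one, one_mul]
    exact le_of_eq (by ring)
  · simpa using h1 v

/-- The classes of the split primes and the squares generate a subgroup of index at most two. -/
theorem index_le_two (hd : differentIdeal (𝓞 F) (𝓞 M) = ⊤) (Q : Subgroup (ClassGroup (𝓞 F)))
    (hsq : ∀ c, c ^ 2 ∈ Q)
    (hQ : ∀ v : HeightOneSpectrum (𝓞 F), IsSplit M v → v.idealClass ∈ Q) : Q.index ≤ 2 := by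
  by_contra! hlt
  obtain ⟨φ, ψ, hφ, hψ, hφψ⟩ := CommGroup.exists_pair_intUnits
    (G := ClassGroup (𝓞 F) ⧸ Q) (fun g ↦ by
      induction g using QuotientGroup.induction_on with
      | H c => exact (QuotientGroup.eq_one_iff _).2 (hsq c)) hlt
  have hne (χ : (ClassGroup (𝓞 F) ⧸ Q) →* ℤˣ) (h : χ ≠ 1) :
      χ.comp (QuotientGroup.mk' Q) ≠ 1 := fun h' ↦ h <| by
    refine MonoidHom.ext fun g ↦ ?_
    induction g using QuotientGroup.induction_on with
    | H c => exact DFunLike.congr_fun h' c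
  have htriv (χ : (ClassGroup (𝓞 F) ⧸ Q) →* ℤˣ) (v : HeightOneSpectrum (𝓞 F))
      (hv : IsSplit M v) : χ.comp (QuotientGroup.mk' Q) v.idealClass = 1 := by
    rw [MonoidHom.comp_apply, QuotientGroup.mk'_apply, (QuotientGroup.eq_one_iff _).2 (hQ v hv),
      map_one]
  obtain ⟨B₁, h₁⟩ := exists_abs_tsum_idealChar_le (hne φ hφ)
  obtain ⟨B₂, h₂⟩ := exists_abs_tsum_idealChar_le (hne ψ hψ)
  obtain ⟨B₃, h₃⟩ := exists_abs_tsum_idealChar_le (hne _ hφψ)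
  rw [MonoidHom.mul_comp] at h₃
  set Z := ∑' I : Ideal (𝓞 F), (Ideal.absNorm I : ℝ) ^ (-2 : ℝ) with hZ
  have hZ0 : 0 ≤ Z := tsum_nonneg fun I ↦ by positivity
  have key : ∀ᶠ s in 𝓝[>] (1 : ℝ), (∑' I : Ideal (𝓞 M), (Ideal.absNorm I : ℝ) ^ (-s)) ^ 2 ≤
      Z ^ 2 * ((∑' I : Ideal (𝓞 F), (Ideal.absNorm I : ℝ) ^ (-s)) * B₁ * B₂ * B₃) := by
    filter_upwards [h₁, h₂, h₃, self_mem_nhdsWithin] with s h₁ h₂ h₃ hs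
    have hs : 1 < s := hs
    have hs0 : s ≠ 0 := by positivity
    refine le_of_tendsto ((tendsto_prod_absNorm hs).pow 2) (Eventually.of_forall fun T ↦ ?_)
    obtain ⟨S, hS⟩ := prod_absNorm_le_prod_split h2 hd T hs
    have hA := prod_split_sq_le (htriv φ) (htriv ψ) S hs
    have hT0 : 0 ≤ ∏ w ∈ T, (1 - (Ideal.absNorm w.asIdeal : ℝ) ^ (-s))⁻¹ :=
      Finset.prod_nonneg fun w _ ↦ inv_nonneg.2
        (by linarith [absNorm_rpow_lt_one w (s := s) (by linarith)])
    have hF0 : 0 ≤ ∑' I : Ideal (𝓞 F), (Ideal.absNorm I : ℝ) ^ (-s) :=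
      tsum_nonneg fun I ↦ by positivity
    refine (pow_le_pow_left₀ hT0 hS 2).trans ?_
    rw [mul_pow, mul_comm]
    refine mul_le_mul_of_nonneg_left (hA.trans ?_) (by positivity)
    refine (le_abs_self _).trans ?_
    rw [abs_mul, abs_mul, abs_mul, abs_of_nonneg hF0]
    have := h₁ hs0
    have := h₂ hs0
    have := h₃ hs0
    have := (abs_nonneg _).trans (h₁ hs0)
    have := (abs_nonneg _).trans (h₂ hs0)
    gcongr
  have hlim1 := (tendsto_sub_one_mul_tsum_absNorm_rpow M).pow 2
  have hlim2 : Tendsto (fun s : ℝ ↦ (s - 1) * (Z ^ 2 * (((s - 1) *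
      ∑' I : Ideal (𝓞 F), (Ideal.absNorm I : ℝ) ^ (-s)) * B₁ * B₂ * B₃))) (𝓝[>] 1)
      (𝓝 (0 * (Z ^ 2 * (dedekindZeta_residue F * B₁ * B₂ * B₃)))) := by
    refine Tendsto.mul ?_ (((((tendsto_sub_one_mul_tsum_absNorm_rpow F).mul_const _).mul_const
      _).mul_const _).const_mul _)
    have : Tendsto (fun s : ℝ ↦ s - 1) (𝓝 1) (𝓝 (1 - 1)) := tendsto_id.sub_const 1
    rw [sub_self] at this
    exact this.mono_left nhdsWithin_le_nhds
  have := le_of_tendsto_of_tendsto hlim1 hlim2 (by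
    filter_upwards [key] with s hs
    rw [mul_pow]
    calc _ ≤ (s - 1) ^ 2 * _ := mul_le_mul_of_nonneg_left hs (sq_nonneg _)
      _ = _ := by ring)
  rw [zero_mul] at this
  have := pow_pos (dedekindZeta_residue_pos M) 2
  linarith

end Quadratic

end NumberField

/-! ### Herbrand quotients for an involution -/

namespace AddSubgroup

open Module

theorem index_range_nsmul_of_finite (G : Type*) [AddCommGroup G] [Module.Finite ℤ G] {n : ℕ}
    (hn : n ≠ 0) : (nsmulAddMonoidHom (α := G) n).range.index =
      n ^ finrank ℤ G * Nat.card (nsmulAddMonoidHom (α := G) n).ker := by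
  set f := nsmulAddMonoidHom (α := G) n with hf
  set T := (Submodule.torsion ℤ G).toAddSubgroup with hT
  set q : G →+ G ⧸ Submodule.torsion ℤ G := (Submodule.mkQ _).toAddMonoidHom with hq
  have hqs : Function.Surjective q := Submodule.mkQ_surjective _
  have hqk : q.ker = T := by
    ext x
    simp [hq, hT]
  have hmem (x : G) (h : n • x ∈ T) : x ∈ T := by
    rw [← hqk, AddMonoidHom.mem_ker, map_nsmul] at h
    rw [← hqk, AddMonoidHom.mem_ker]
    rw [← natCast_zsmul] at h
    exact (smul_eq_zero.1 h).resolve_left (by exact_mod_cast hn)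
  have hker (x : G) (h : n • x = 0) : x ∈ T := hmem x (by rw [h]; exact T.zero_mem)
  have h1 : (f.range ⊔ T).index = n ^ finrank ℤ G := by
    rw [← finrank_quotient_eq_of_le_torsion (le_refl (Submodule.torsion ℤ G)),
      ← index_range_nsmul (G ⧸ Submodule.torsion ℤ G), ← hqk, ← AddSubgroup.comap_map_eq,
      AddSubgroup.index_comap_of_surjective _ hqs]
    congr 1
    ext x
    obtain ⟨x, rfl⟩ := hqs x
    simp only [AddSubgroup.mem_map, AddMonoidHom.mem_range]
    constructor
    · rintro ⟨_, ⟨y, rfl⟩, h⟩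
      exact ⟨q y, by rw [← h, hf]; simp⟩
    · rintro ⟨y, h⟩
      obtain ⟨y, rfl⟩ := hqs y
      exact ⟨f y, ⟨y, rfl⟩, by rw [← h, hf]; simp⟩
  have hfin : Finite (Submodule.torsion ℤ G) := Module.finite_of_fg_torsion _ (Submodule.torsion_isTorsion)
  have hfin' : Finite T := hfin
  have h2 : f.range.relIndex (f.range ⊔ T) = Nat.card f.ker := by
    rw [AddSubgroup.relIndex_sup_left]
    have h3 : f.range.addSubgroupOf T = (nsmulAddMonoidHom (α := T) n).range := by
      ext ⟨x, hx⟩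
      simp only [AddSubgroup.mem_addSubgroupOf, AddMonoidHom.mem_range]
      constructor
      · rintro ⟨y, hy⟩
        exact ⟨⟨y, hmem y (by rwa [← show f y = n • y from rfl, hy])⟩, Subtype.ext hy⟩
      · rintro ⟨y, hy⟩
        exact ⟨y, congrArg Subtype.val hy⟩
    rw [AddSubgroup.relIndex, h3, AddSubgroup.index_range]
    refine Nat.card_congr ⟨fun x ↦ ⟨x.1, congrArg Subtype.val x.2⟩,
      fun x ↦ ⟨⟨x.1, hker _ x.2⟩, Subtype.ext x.2⟩, fun _ ↦ rfl, fun _ ↦ rfl⟩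
  rw [← AddSubgroup.relIndex_mul_index (le_sup_left : f.range ≤ f.range ⊔ T), h1, h2, mul_comm]

theorem relIndex_map_nsmul_of_finite {A : Type*} [AddCommGroup A] (B : AddSubgroup A)
    [Module.Finite ℤ B] {n : ℕ} (hn : n ≠ 0) :
    (B.map (nsmulAddMonoidHom n)).relIndex B =
      n ^ finrank ℤ B * Nat.card (B ⊓ (nsmulAddMonoidHom n : A →+ A).ker : AddSubgroup A) := by
  rw [AddSubgroup.relIndex, addSubgroupOf_map_nsmulAddMonoidHom_eq_range,
    index_range_nsmul_of_finite B hn]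
  congr 1
  exact Nat.card_congr ⟨fun x ↦ ⟨x.1.1, x.1.2, congrArg Subtype.val x.2⟩,
      fun x ↦ ⟨⟨x.1, x.2.1⟩, Subtype.ext x.2.2⟩, fun _ ↦ rfl, fun _ ↦ rfl⟩

end AddSubgroup

namespace Involution

variable {A : Type*} [AddCommGroup A] (σ : A →+ A)

/-- The norm of an involution. -/
def norm : A →+ A := AddMonoidHom.id A + σ

/-- The difference of an involution and the identity. -/
def diff : A →+ A := σ - AddMonoidHom.id A

@[simp] theorem norm_apply (x : A) : norm σ x = x + σ x := rfl

@[simp] theorem diff_apply (x : A) : diff σ x = σ x - x := rfl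

variable {σ} (hσ : ∀ x, σ (σ x) = x) (E : AddSubgroup A) (hE : ∀ x ∈ E, σ x ∈ E)

theorem mem_ker_norm {x : A} : x ∈ (norm σ).ker ↔ σ x = -x := by
  rw [AddMonoidHom.mem_ker, norm_apply, add_comm, add_eq_zero_iff_eq_neg]

theorem mem_ker_diff {x : A} : x ∈ (diff σ).ker ↔ σ x = x := by
  rw [AddMonoidHom.mem_ker, diff_apply, sub_eq_zero]

include hσ

theorem norm_mem_ker_diff (x : A) : norm σ x ∈ (diff σ).ker := by
  rw [mem_ker_diff, norm_apply, map_add, hσ, add_comm]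

theorem diff_mem_ker_norm (x : A) : diff σ x ∈ (norm σ).ker := by
  rw [mem_ker_norm, diff_apply, map_sub, hσ, neg_sub]

include hE

open Module in
theorem two_mul_relIndex_le [Module.Finite ℤ E]
    (hr : 2 * finrank ℤ (E ⊓ (diff σ).ker : AddSubgroup A) + 1 ≤ finrank ℤ E) :
    (E.map (norm σ)).relIndex (E ⊓ (diff σ).ker) ≠ 0 ∧
    (E.map (diff σ)).relIndex (E ⊓ (norm σ).ker) ≠ 0 ∧
    2 * (E.map (norm σ)).relIndex (E ⊓ (diff σ).ker) ≤
      (E.map (diff σ)).relIndex (E ⊓ (norm σ).ker) := by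
  set S := E ⊓ (diff σ).ker with hS
  set B := E ⊓ (norm σ).ker with hB
  have hSE : S ≤ E := inf_le_left
  have hBE : B ≤ E := inf_le_left
  have fS : Module.Finite ℤ S := Module.Finite.of_injective
    (AddSubgroup.inclusion hSE).toIntLinearMap (AddSubgroup.inclusion_injective hSE)
  have fB : Module.Finite ℤ B := Module.Finite.of_injective
    (AddSubgroup.inclusion hBE).toIntLinearMap (AddSubgroup.inclusion_injective hBE)
  have hNE : E.map (norm σ) ≤ S := by
    rintro _ ⟨x, hx, rfl⟩
    exact ⟨E.add_mem hx (hE x hx), norm_mem_ker_diff hσ x⟩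
  have hDE : E.map (diff σ) ≤ B := by
    rintro _ ⟨x, hx, rfl⟩
    exact ⟨E.sub_mem (hE x hx) hx, diff_mem_ker_norm hσ x⟩
  have h2S : S.map (nsmulAddMonoidHom 2) = S.map (norm σ) := by
    refine AddSubgroup.ext fun x ↦ exists_congr fun y ↦ and_congr_right fun hy ↦ ?_
    rw [norm_apply, mem_ker_diff.1 hy.2, ← two_nsmul]
    rfl
  have h2B : B.map (nsmulAddMonoidHom 2) = B.map (diff σ) := by
    ext x
    constructor
    · rintro ⟨y, hy, rfl⟩
      refine ⟨-y, B.neg_mem hy, ?_⟩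
      rw [map_neg, diff_apply, mem_ker_norm.1 hy.2]
      change _ = 2 • y
      abel
    · rintro ⟨y, hy, rfl⟩
      refine ⟨-y, B.neg_mem hy, ?_⟩
      rw [diff_apply, mem_ker_norm.1 hy.2]
      change 2 • (-y) = _
      abel
  have hsup1 : (S ⊔ (norm σ).ker) ⊓ E = S ⊔ B := by
    rw [sup_inf_assoc_of_le _ hSE, inf_comm]
  have hsup2 : (B ⊔ (diff σ).ker) ⊓ E = S ⊔ B := by
    rw [sup_inf_assoc_of_le _ hBE, inf_comm, sup_comm]
  have e1 := AddSubgroup.relIndex_mul_relIndex (S.map (norm σ)) (E.map (norm σ)) S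
    (AddSubgroup.map_mono hSE) hNE
  have e2 := AddSubgroup.relIndex_mul_relIndex (B.map (diff σ)) (E.map (diff σ)) B
    (AddSubgroup.map_mono hBE) hDE
  rw [← AddSubgroup.relIndex_comap, AddSubgroup.comap_map_eq, ← AddSubgroup.inf_relIndex_right,
    hsup1, ← h2S, AddSubgroup.relIndex_map_nsmul_of_finite S two_ne_zero] at e1
  rw [← AddSubgroup.relIndex_comap, AddSubgroup.comap_map_eq, ← AddSubgroup.inf_relIndex_right,
    hsup2, ← h2B, AddSubgroup.relIndex_map_nsmul_of_finite B two_ne_zero] at e2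
  have htor : S ⊓ (nsmulAddMonoidHom 2 : A →+ A).ker =
      B ⊓ (nsmulAddMonoidHom 2 : A →+ A).ker := by
    ext x
    simp only [hS, hB, AddSubgroup.mem_inf, mem_ker_norm, mem_ker_diff]
    refine and_congr_left fun hx ↦ ?_
    have hx : 2 • x = 0 := hx
    rw [two_nsmul, add_eq_zero_iff_eq_neg] at hx
    rw [← hx]
  have hpos : Nat.card (B ⊓ (nsmulAddMonoidHom 2 : A →+ A).ker : AddSubgroup A) ≠ 0 := by
    intro h0
    have h3 := AddSubgroup.relIndex_map_nsmul_of_finite B two_ne_zero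
    rw [h0, mul_zero] at h3
    exact (AddSubgroup.isFiniteRelIndex_map_nsmulAddMonoidHom_of_fg
      ((AddGroup.fg_iff_addSubgroup_fg B).1 (Module.Finite.iff_addGroup_fg.1 fB))
      two_ne_zero).relIndex_ne_zero h3
  have hrank : finrank ℤ E ≤ finrank ℤ S + finrank ℤ B := by
    let f : E →ₗ[ℤ] B := ((diff σ).comp E.subtype).codRestrict B
      (fun x ↦ hDE ⟨x, x.2, rfl⟩) |>.toIntLinearMap
    have h1 := (LinearMap.ker f).finrank_quotient_add_finrank
    rw [f.quotKerEquivRange.finrank_eq] at h1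
    have h2 : finrank ℤ (LinearMap.range f) ≤ finrank ℤ B := Submodule.finrank_le _
    have h3 : finrank ℤ (LinearMap.ker f) ≤ finrank ℤ S := by
      let g : LinearMap.ker f →ₗ[ℤ] S := AddMonoidHom.toIntLinearMap
        { toFun := fun x ↦ ⟨x.1.1, x.1.2, congrArg Subtype.val x.2⟩
          map_zero' := rfl
          map_add' := fun _ _ ↦ rfl }
      refine LinearMap.finrank_le_finrank_of_injective (f := g) fun x y h ↦ ?_
      have h' : ((g x : S) : A) = g y := congrArg Subtype.val h
      exact Subtype.ext (Subtype.ext h')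
    omega
  rw [htor] at e1
  set t := Nat.card (B ⊓ (nsmulAddMonoidHom 2 : A →+ A).ker : AddSubgroup A)
  have hi : (S ⊔ B).relIndex E ≠ 0 := by
    intro h0
    rw [h0, zero_mul] at e1
    exact mul_ne_zero (pow_ne_zero _ two_ne_zero) hpos e1.symm
  refine ⟨?_, ?_, ?_⟩
  · intro h0
    rw [h0, mul_zero] at e1
    exact mul_ne_zero (pow_ne_zero _ two_ne_zero) hpos e1.symm
  · intro h0
    rw [h0, mul_zero] at e2
    exact mul_ne_zero (pow_ne_zero _ two_ne_zero) hpos e2.symm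
  · have hle : 2 * 2 ^ finrank ℤ S ≤ 2 ^ finrank ℤ B := by
      rw [← pow_succ']
      exact Nat.pow_le_pow_right two_pos (by omega)
    refine Nat.le_of_mul_le_mul_left ?_ (Nat.pos_of_ne_zero hi)
    rw [mul_left_comm, e1, e2, ← mul_assoc]
    exact Nat.mul_le_mul_right _ hle

end Involution

namespace Involution

open AddSubgroup

variable {A D : Type*} [AddCommGroup A] [AddCommGroup D] {σ : A →+ A} {τ : D →+ D} {δ : A →+ D}

/-- A Hasse principle for involutions: if `E = ker δ` has Herbrand quotient at most `1 / 2` and the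
norms have index at most two among the invariant classes, then an invariant element whose image is
a norm is a norm. -/
theorem mem_range_norm (hσ : ∀ x, σ (σ x) = x) (hτ : ∀ x, τ (τ x) = x)
    (hδ : ∀ x, δ (σ x) = τ (δ x))
    (hA : (norm σ).ker ≤ (diff σ).range) (hD : (norm τ).ker ≤ (diff τ).range)
    (hC : δ.range.index ≠ 0) (hF : ((diff σ).ker.map δ).relIndex (diff τ).ker ≠ 0)
    (hq : (((diff σ).ker.map δ) ⊔ (norm τ).range).relIndex (diff τ).ker ≤ 2)
    (h0 : (δ.ker.map (norm σ)).relIndex (δ.ker ⊓ (diff σ).ker) ≠ 0)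
    (h1 : (δ.ker.map (diff σ)).relIndex (δ.ker ⊓ (norm σ).ker) ≠ 0)
    (h01 : 2 * (δ.ker.map (norm σ)).relIndex (δ.ker ⊓ (diff σ).ker) ≤
      (δ.ker.map (diff σ)).relIndex (δ.ker ⊓ (norm σ).ker))
    {b : A} (hb : b ∈ (diff σ).ker) (hbD : δ b ∈ (norm τ).range) : b ∈ (norm σ).range := by
  have hδN (x : A) : δ (norm σ x) = norm τ (δ x) := by simp [hδ]
  have hδD (x : A) : δ (diff σ x) = diff τ (δ x) := by simp [hδ]
  have hA' : (norm σ).ker = (diff σ).range := le_antisymm hA <| by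
    rintro _ ⟨x, rfl⟩
    exact diff_mem_ker_norm hσ x
  have hD' : (norm τ).ker = (diff τ).range := le_antisymm hD <| by
    rintro _ ⟨x, rfl⟩
    exact diff_mem_ker_norm hτ x
  set E := δ.ker with hE
  set P := δ.range with hP
  set F := (diff σ).ker with hF'
  set Dσ := (diff τ).ker with hDσ
  set PF := F.map δ with hPF
  have hPFP : PF ≤ P := by
    rintro _ ⟨x, _, rfl⟩
    exact ⟨x, rfl⟩
  have hPFD : PF ≤ Dσ := by
    rintro _ ⟨x, hx, rfl⟩
    rw [hDσ, AddMonoidHom.mem_ker, ← hδD, AddMonoidHom.mem_ker.1 hx, map_zero]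
  have hND : (norm τ).range ≤ Dσ := by
    rintro _ ⟨x, rfl⟩
    exact norm_mem_ker_diff hτ x
  -- the index of the classes whose norm is trivial
  set T := PF.comap (norm τ) with hT
  have c1 : T.index * (PF ⊔ (norm τ).range).relIndex Dσ = PF.relIndex Dσ := by
    rw [← relIndex_mul_relIndex PF (PF ⊔ (norm τ).range) Dσ le_sup_left (sup_le hPFD hND),
      sup_comm PF, relIndex_sup_right, ← relIndex_top_right, hT, relIndex_comap,
      ← AddMonoidHom.range_eq_map]
  -- the invariant classes
  set R := P.comap (diff τ) with hR
  have hPR : P ≤ R := by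
    rintro _ ⟨x, rfl⟩
    exact ⟨diff σ x, hδD x⟩
  have c2 : (P ⊔ (diff τ).range).index = P.relIndex R := by
    have e1 := relIndex_mul_index (le_sup_left : P ≤ P ⊔ (diff τ).range)
    rw [relIndex_sup_left] at e1
    have e2 := relIndex_mul_index hPR
    rw [← relIndex_top_right, hR, relIndex_comap, ← AddMonoidHom.range_eq_map, ← hR] at e2
    have e3 : P.relIndex (diff τ).range ≠ 0 := by
      intro h
      rw [h, zero_mul] at e1
      exact hC e1.symm
    rw [← e2, mul_comm] at e1
    exact Nat.eq_of_mul_eq_mul_right (Nat.pos_of_ne_zero e3) e1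
  have hDR : Dσ ≤ R := fun x hx ↦ by
    rw [hR, mem_comap, AddMonoidHom.mem_ker.1 hx]
    exact P.zero_mem
  -- norms of ideal classes
  set Z := E.comap (norm σ) with hZ
  have hDR' : R.map (diff τ) = Z.map δ := by
    ext x
    constructor
    · rintro ⟨d, ⟨x, hx⟩, rfl⟩
      refine ⟨x, ?_, hx⟩
      change δ (norm σ x) = 0
      rw [hδN, hx]
      exact AddMonoidHom.mem_ker.1 (diff_mem_ker_norm hτ d)
    · rintro ⟨x, hx, rfl⟩
      have hx : δ (norm σ x) = 0 := hx
      rw [hδN] at hx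
      obtain ⟨d, hd⟩ := hD hx
      exact ⟨d, ⟨x, hd.symm⟩, hd⟩
  have c3 : (P ⊔ Dσ).relIndex R = (E.map (norm σ)).relIndex (Z.map (norm σ)) := by
    rw [hDσ, ← comap_map_eq, relIndex_comap, hDR', ← relIndex_comap, ← relIndex_comap,
      comap_map_eq, hA']
    congr 1
    ext x
    rw [mem_comap]
    constructor
    · rintro ⟨_, ⟨y, rfl⟩, h⟩
      refine mem_sup.2 ⟨x - diff σ y, ?_, diff σ y, ⟨y, rfl⟩, by abel⟩
      rw [hE, AddMonoidHom.mem_ker, map_sub, hδD, h, sub_self]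
    · intro hx
      obtain ⟨e, he, _, ⟨y, rfl⟩, rfl⟩ := mem_sup.1 hx
      exact ⟨δ y, ⟨y, rfl⟩, by rw [map_add, AddMonoidHom.mem_ker.1 he, zero_add, hδD]⟩
  have c4 : P.relIndex R = (E.map (norm σ)).relIndex (Z.map (norm σ)) * P.relIndex Dσ := by
    rw [← c3, mul_comm, ← relIndex_mul_relIndex P (P ⊔ Dσ) R le_sup_left (sup_le hPR hDR),
      relIndex_sup_left]
  -- capitulation
  set Y := Dσ.comap δ with hY
  have hYm : Y.map δ = P ⊓ Dσ := by
    ext x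
    constructor
    · rintro ⟨x, hx, rfl⟩
      exact ⟨⟨x, rfl⟩, hx⟩
    · rintro ⟨⟨x, rfl⟩, hx⟩
      exact ⟨x, hx, rfl⟩
  have hYd : Y.map (diff σ) = E ⊓ (norm σ).ker := by
    ext x
    constructor
    · rintro ⟨x, hx, rfl⟩
      exact ⟨(hδD x).trans hx, diff_mem_ker_norm hσ x⟩
    · rintro ⟨hx, hx'⟩
      obtain ⟨y, rfl⟩ := hA hx'
      exact ⟨y, (hδD y).symm.trans hx, rfl⟩
  have c5 : PF.relIndex (P ⊓ Dσ) = (E.map (diff σ)).relIndex (E ⊓ (norm σ).ker) := by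
    rw [← hYm, ← hYd, ← relIndex_comap, ← relIndex_comap, comap_map_eq, comap_map_eq, sup_comm]
  have c6 : PF.relIndex Dσ =
      (E.map (diff σ)).relIndex (E ⊓ (norm σ).ker) * P.relIndex Dσ := by
    rw [← c5, relIndex_inf_mul_relIndex, inf_of_le_left hPFP]
  -- units
  have hNZ : Z.map (norm σ) ≤ E ⊓ F := by
    rintro _ ⟨x, hx, rfl⟩
    exact ⟨hx, norm_mem_ker_diff hσ x⟩
  have c7 := relIndex_mul_relIndex (E.map (norm σ)) (Z.map (norm σ)) (E ⊓ F)
    (map_mono fun x hx ↦ by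
      change δ (norm σ x) = 0
      rw [hδN, AddMonoidHom.mem_ker.1 hx, map_zero]) hNZ
  have hPT : P ⊔ (diff τ).range ≤ T := by
    refine sup_le ?_ ?_
    · rintro _ ⟨x, rfl⟩
      exact ⟨norm σ x, norm_mem_ker_diff hσ x, hδN x⟩
    · rintro _ ⟨x, rfl⟩
      rw [hT, mem_comap, AddMonoidHom.mem_ker.1 (diff_mem_ker_norm hτ x)]
      exact PF.zero_mem
  have c8 := relIndex_mul_index hPT
  have hTi : T.index ≠ 0 := by
    intro h
    rw [h, zero_mul] at c1
    exact hF c1.symm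
  have hPD : P.relIndex Dσ ≠ 0 := by
    intro h
    rw [h, mul_zero] at c6
    exact hF c6
  rw [c2, c4] at c8
  have c9 : (Z.map (norm σ)).relIndex (E ⊓ F) * (P ⊔ (diff τ).range).relIndex T ≤ 1 := by
    refine Nat.le_of_mul_le_mul_left ?_ (Nat.pos_of_ne_zero (mul_ne_zero hTi h1))
    refine Nat.le_of_mul_le_mul_left ?_ (Nat.pos_of_ne_zero hPD)
    generalize (Z.map (norm σ)).relIndex (E ⊓ F) = u at *
    generalize (P ⊔ (diff τ).range).relIndex T = t at *
    generalize (E.map (norm σ)).relIndex (Z.map (norm σ)) = z at *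
    generalize (E.map (norm σ)).relIndex (E ⊓ F) = n0 at *
    generalize (E.map (diff σ)).relIndex (E ⊓ (norm σ).ker) = g at *
    generalize (PF ⊔ (norm τ).range).relIndex Dσ = q at *
    generalize P.relIndex Dσ = p at *
    generalize T.index = i at *
    calc p * (i * g * (u * t)) = (t * i) * p * g * u := by ring
      _ = (z * u) * p * p * g := by rw [c8]; ring
      _ = n0 * p * (g * p) := by rw [c7]; ring
      _ = n0 * p * (i * q) := by rw [← c6, c1]
      _ ≤ n0 * p * (i * 2) := by gcongr
      _ = p * i * (2 * n0) := by ring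
      _ ≤ p * i * g := by gcongr
      _ = p * (i * g * 1) := by ring
  have hu : (Z.map (norm σ)).relIndex (E ⊓ F) ≠ 0 := fun h ↦ h0 (by rw [← c7, h, mul_zero])
  have ht : (P ⊔ (diff τ).range).relIndex T ≠ 0 := fun h ↦ by
    rw [h, zero_mul] at c8
    exact mul_ne_zero (fun h' ↦ h0 (by rw [← c7, h', zero_mul])) hPD c8.symm
  have hu1 := Nat.eq_one_of_mul_eq_one_right (le_antisymm c9 (Nat.pos_of_ne_zero
    (mul_ne_zero hu ht)))
  have ht1 := Nat.eq_one_of_mul_eq_one_left (le_antisymm c9 (Nat.pos_of_ne_zero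
    (mul_ne_zero hu ht)))
  rw [relIndex_eq_one] at hu1 ht1
  obtain ⟨d, hd⟩ := hbD
  obtain ⟨_, ⟨a, rfl⟩, _, ⟨d', rfl⟩, hd'⟩ := mem_sup.1 (ht1 (show d ∈ T from ⟨b, hb, hd.symm⟩))
  have hbu : b - norm σ a ∈ E ⊓ F := by
    refine ⟨?_, F.sub_mem hb (norm_mem_ker_diff hσ a)⟩
    change δ _ = 0
    rw [map_sub, hδN, ← hd, ← hd', map_add, AddMonoidHom.mem_ker.1 (diff_mem_ker_norm hτ d')]
    abel
  obtain ⟨z, -, hz⟩ := hu1 hbu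
  exact ⟨z + a, by rw [map_add, hz]; abel⟩

end Involution

namespace Involution

section Finsupp

variable {ι : Type*} {e : Equiv.Perm ι}

/-- The action of a permutation on the free abelian group. -/
noncomputable def domCongr (e : Equiv.Perm ι) : (ι →₀ ℤ) →+ (ι →₀ ℤ) :=
    (Finsupp.domCongr e).toAddMonoidHom

theorem domCongr_apply (he : ∀ i, e (e i) = i) (d : ι →₀ ℤ) (i : ι) :
    domCongr e d i = d (e i) := by
  change d (e.symm i) = d (e i)
  rw [e.symm_apply_eq.2 (he i).symm]

theorem ker_norm_domCongr_le (he : ∀ i, e (e i) = i) :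
    (norm (domCongr e)).ker ≤ (diff (domCongr e)).range := by
  classical
  obtain ⟨_, -⟩ := exists_wellFoundedLT ι
  intro d hd
  have hd' (i : ι) : d i + d (e i) = 0 := by
    rw [← domCongr_apply he]
    exact DFunLike.congr_fun (AddMonoidHom.mem_ker.1 hd) i
  refine ⟨-(d.filter fun i ↦ e i < i), ?_⟩
  ext i
  rw [diff_apply, Finsupp.sub_apply, domCongr_apply he, Finsupp.neg_apply, Finsupp.neg_apply,
    Finsupp.filter_apply, Finsupp.filter_apply, he]
  have := hd' i
  rcases lt_trichotomy i (e i) with h | h | h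
  · rw [if_pos h, if_neg h.not_gt]; omega
  · rw [← h, if_neg (lt_irrefl _)]; rw [← h] at this; omega
  · rw [if_neg h.not_gt, if_pos h]; omega

theorem mem_range_norm_domCongr (he : ∀ i, e (e i) = i) {d : ι →₀ ℤ} (hd : ∀ i, d (e i) = d i)
    (hev : ∀ i, e i = i → Even (d i)) : d ∈ (norm (domCongr e)).range := by
  classical
  obtain ⟨_, -⟩ := exists_wellFoundedLT ι
  refine ⟨Finsupp.onFinset d.support (fun i ↦ if e i < i then d i else if e i = i then d i / 2
    else 0) fun i hi ↦ ?_, ?_⟩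
  · rw [Finsupp.mem_support_iff]
    intro h
    simp [h] at hi
  ext i
  rw [norm_apply, Finsupp.add_apply, domCongr_apply he, Finsupp.onFinset_apply,
    Finsupp.onFinset_apply, he, hd]
  rcases lt_trichotomy i (e i) with h | h | h
  · rw [if_pos h, if_neg h.not_gt, if_neg h.ne', zero_add]
  · obtain ⟨k, hk⟩ := hev i h.symm
    rw [← h]
    simp only [lt_irrefl, if_false, if_true]
    omega
  · rw [if_neg h.not_gt, if_pos h, if_neg h.ne', add_zero]

end Finsupp

end Involution

theorem AddMonoidHom.finrank_range_of_injective {A B : Type*} [AddCommGroup A] [AddCommGroup B]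
    {f : A →+ B} (hf : Function.Injective f) :
    Module.finrank ℤ f.range = Module.finrank ℤ A :=
  (f.ofInjective hf).toIntLinearEquiv.finrank_eq.symm

namespace NumberField

open IsDedekindDomain HeightOneSpectrum Involution
open scoped Pointwise

variable {F M : Type*} [Field F] [Field M] [NumberField M] [Algebra F M]

/-- The divisor of an element, as a homomorphism. -/
noncomputable def divisorHom (M : Type*) [Field M] [NumberField M] :
    Additive Mˣ →+ (HeightOneSpectrum (𝓞 M) →₀ ℤ) where
  toFun x := divisor x.toMul
  map_zero' := by ext; simp
  map_add' x y := by ext v; simp [ord_mul]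

@[simp] theorem divisorHom_apply (x : Additive Mˣ) (v : HeightOneSpectrum (𝓞 M)) :
    divisorHom M x v = v.ord x.toMul := rfl

theorem range_divisorHom : (divisorHom M).range = (divisorClass (R := 𝓞 M)).ker := by
  ext d
  rw [AddMonoidHom.mem_ker, divisorClass_eq_zero_iff M]
  constructor
  · rintro ⟨x, rfl⟩
    exact ⟨x.toMul, fun _ ↦ rfl⟩
  · rintro ⟨x, hx⟩
    exact ⟨Additive.ofMul x, by ext v; exact hx v⟩

theorem index_range_divisorHom_ne_zero : (divisorHom M).range.index ≠ 0 := by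
  rw [range_divisorHom, AddSubgroup.index_ker]
  exact Nat.card_pos.ne'

/-- The units, as a group of elements of the field. -/
noncomputable def unitsHom (M : Type*) [Field M] [NumberField M] :
    Additive (𝓞 M)ˣ →+ Additive Mˣ := (Units.map (algebraMap (𝓞 M) M : 𝓞 M →* M)).toAdditive

theorem unitsHom_injective : Function.Injective (unitsHom M) := by
  intro x y h
  exact Units.map_injective (f := (algebraMap (𝓞 M) M : 𝓞 M →* M))
    (FaithfulSMul.algebraMap_injective (𝓞 M) M) h

theorem ker_divisorHom : (divisorHom M).ker = (unitsHom M).range := by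
  ext x
  constructor
  · intro hx
    obtain ⟨u, hu⟩ := exists_units_map_eq_of_ord_eq_zero (R := 𝓞 M) (x := x.toMul) fun v ↦
      DFunLike.congr_fun (AddMonoidHom.mem_ker.1 hx) v
    exact ⟨Additive.ofMul u, hu⟩
  · rintro ⟨u, rfl⟩
    rw [AddMonoidHom.mem_ker]
    ext v
    exact ord_units_map v u.toMul

/-- The Galois action on the multiplicative group. -/
def galHom (g : Gal(M/F)) : Additive Mˣ →+ Additive Mˣ :=
  (MulDistribMulAction.toMonoidHom Mˣ g).toAdditive

theorem finrank_units_eq [IsTotallyReal M] :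
    Module.finrank ℤ (Additive (𝓞 M)ˣ) = Module.finrank ℚ M - 1 := by
  classical
  rw [Units.finrank_eq, Units.rank, IsTotallyReal.finrank,
    InfinitePlace.card_eq_nrRealPlaces_add_nrComplexPlaces,
    IsTotallyReal.nrComplexPlaces_eq_zero, add_zero]

end NumberField

namespace NumberField

open IsDedekindDomain HeightOneSpectrum Involution
open scoped Pointwise

variable {F M : Type*} [Field F] [NumberField F] [Field M] [NumberField M] [Algebra F M]
  [IsGalois F M]

theorem eq_one_or_eq_of_finrank_eq_two (h2 : Module.finrank F M = 2) {g : Gal(M/F)} (hg : g ≠ 1)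
    (h : Gal(M/F)) : h = 1 ∨ h = g := by
  have hc : Nat.card Gal(M/F) = 2 := by rw [IsGalois.card_aut_eq_finrank, h2]
  obtain ⟨y, -, hy⟩ := (Nat.card_eq_two_iff' (1 : Gal(M/F))).1 hc
  by_cases h1 : h = 1
  · exact Or.inl h1
  · exact Or.inr ((hy h h1).trans (hy g hg).symm)

theorem mul_self_of_finrank_eq_two (h2 : Module.finrank F M = 2) {g : Gal(M/F)} (hg : g ≠ 1) :
    g * g = 1 :=
  (eq_one_or_eq_of_finrank_eq_two h2 hg (g * g)).resolve_right fun h ↦ hg (mul_eq_left.1 h)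

theorem exists_map_eq_of_smul_eq {x : Mˣ} (hx : ∀ g : Gal(M/F), g • x = x) :
    ∃ y : Fˣ, Units.map (algebraMap F M : F →* M) y = x := by
  obtain ⟨y, hy⟩ := (IsGalois.mem_range_algebraMap_iff_fixed (F := F) (x : M)).2 fun g ↦
    congrArg Units.val (hx g)
  have h0 : y ≠ 0 := by
    rintro rfl
    exact x.ne_zero (by rw [← hy, map_zero])
  exact ⟨Units.mk0 y h0, Units.ext hy⟩

/-- Hilbert's theorem 90 for a quadratic extension. -/
theorem ker_norm_galHom_le (h2 : Module.finrank F M = 2) {g : Gal(M/F)} (hg : g ≠ 1) :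
    (norm (galHom g)).ker ≤ (diff (galHom g)).range := by
  classical
  have hgg := mul_self_of_finrank_eq_two h2 hg
  intro x hx
  have hx' : x.toMul * g • x.toMul = 1 := AddMonoidHom.mem_ker.1 hx
  obtain ⟨y, hy⟩ := groupCohomology.isMulCoboundary₁_of_isMulCocycle₁_of_aut_to_units
    (fun h : Gal(M/F) ↦ if h = 1 then 1 else x.toMul) (fun a b ↦ by
      rcases eq_one_or_eq_of_finrank_eq_two h2 hg a with rfl | rfl <;>
      rcases eq_one_or_eq_of_finrank_eq_two h2 hg b with rfl | rfl
      · simp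
      · simp
      · simp [hg]
      · simp only [hgg, if_true, hg, if_false]
        rw [mul_comm]; exact hx'.symm)
  refine ⟨Additive.ofMul y, ?_⟩
  have := hy g
  simp only [hg, if_false] at this
  exact this

/-- A section of the restriction of primes. -/
noncomputable def lift (v : HeightOneSpectrum (𝓞 F)) : HeightOneSpectrum (𝓞 M) :=
  (exists_under_eq F v).choose

omit [NumberField F] [NumberField M] [IsGalois F M] in
theorem lift_under (v : HeightOneSpectrum (𝓞 F)) :
    (lift v : HeightOneSpectrum (𝓞 M)).under (𝓞 F) = v :=
  (exists_under_eq F v).choose_spec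

omit [NumberField F] [NumberField M] [IsGalois F M] in
theorem lift_injective :
    Function.Injective (lift : HeightOneSpectrum (𝓞 F) → HeightOneSpectrum (𝓞 M)) :=
  Function.LeftInverse.injective lift_under

/-- Restriction of divisors along a section. -/
noncomputable def push : (HeightOneSpectrum (𝓞 M) →₀ ℤ) →+ (HeightOneSpectrum (𝓞 F) →₀ ℤ) :=
  Finsupp.comapDomain.addMonoidHom lift_injective

omit [NumberField F] [NumberField M] [IsGalois F M] in
@[simp] theorem push_apply (d : HeightOneSpectrum (𝓞 M) →₀ ℤ) (v : HeightOneSpectrum (𝓞 F)) :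
    push d v = d (lift v) := rfl

theorem exists_pull (d : HeightOneSpectrum (𝓞 F) →₀ ℤ) :
    ∃ D : HeightOneSpectrum (𝓞 M) →₀ ℤ, ∀ w, D w = d (w.under (𝓞 F)) := by
  refine ⟨Finsupp.ofSupportFinite (fun w ↦ d (w.under (𝓞 F))) ?_, fun _ ↦ rfl⟩
  refine Set.Finite.subset ((d.support.finite_toSet).biUnion fun v _ ↦
    Set.finite_range fun g : Gal(M/F) ↦ g • lift v) fun w hw ↦ ?_
  obtain ⟨g, hg⟩ := exists_smul_eq_of_under_eq (lift_under (M := M) (w.under (𝓞 F)))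
  exact Set.mem_biUnion (Finset.mem_coe.2 (Finsupp.mem_support_iff.2 hw)) ⟨g, hg⟩

/-- The invariant classes modulo a subgroup containing the principal ones. -/
theorem mem_of_smul_eq (hd : differentIdeal (𝓞 F) (𝓞 M) = ⊤)
    {d : HeightOneSpectrum (𝓞 M) →₀ ℤ} (h : ∀ (g : Gal(M/F)) w, d (g • w) = d w)
    (h0 : divisorClass (push d : HeightOneSpectrum (𝓞 F) →₀ ℤ) = 0) :
    ∃ x : Fˣ, d = divisor (Units.map (algebraMap F M : F →* M) x) := by
  obtain ⟨x, hx⟩ := (divisorClass_eq_zero_iff F).1 h0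
  refine ⟨x, ?_⟩
  ext w
  obtain ⟨g, hg⟩ := exists_smul_eq_of_under_eq (lift_under (M := M) (w.under (𝓞 F)))
  rw [divisor_apply, ord_algebraMap hd, hx, push_apply, ← h g (lift _), hg]

/-- The Hasse norm principle for an unramified quadratic extension of totally real fields. -/
theorem exists_norm_eq [IsTotallyReal M] (h2 : Module.finrank F M = 2)
    (hd : differentIdeal (𝓞 F) (𝓞 M) = ⊤) {g : Gal(M/F)} (hg : g ≠ 1) {b : Mˣ} (hb : g • b = b)
    (hev : ∀ w : HeightOneSpectrum (𝓞 M), g • w = w → Even (w.ord b)) :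
    ∃ f : Mˣ, b = f * g • f := by
  classical
  have hgg := mul_self_of_finrank_eq_two h2 hg
  have hgal := eq_one_or_eq_of_finrank_eq_two h2 hg
  have hginv : g⁻¹ = g := inv_eq_of_mul_eq_one_left hgg
  set e : Equiv.Perm (HeightOneSpectrum (𝓞 M)) := MulAction.toPerm g with he'
  have he (w) : e (e w) = w := by
    change g • g • w = w
    rw [smul_smul, hgg, one_smul]
  have hσ (x : Additive Mˣ) : galHom g (galHom g x) = x := by
    change Additive.ofMul (g • g • x.toMul) = x
    rw [smul_smul, hgg, one_smul]; rfl
  have hτ (d : HeightOneSpectrum (𝓞 M) →₀ ℤ) : domCongr e (domCongr e d) = d := by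
    ext w
    rw [domCongr_apply he, domCongr_apply he, he]
  have hδ (x : Additive Mˣ) : divisorHom M (galHom g x) = domCongr e (divisorHom M x) := by
    ext w
    rw [domCongr_apply he]
    change w.ord (g • x.toMul) = (g • w).ord x.toMul
    rw [ord_smul, hginv]
  have hker {x : Additive Mˣ} : x ∈ (diff (galHom g)).ker ↔ ∀ h : Gal(M/F),
      h • x.toMul = x.toMul := by
    rw [mem_ker_diff]
    constructor
    · intro h k
      rcases hgal k with rfl | rfl
      · rw [one_smul]
      · exact h
    · exact fun h ↦ h g
  have hDker {d : HeightOneSpectrum (𝓞 M) →₀ ℤ} :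
      d ∈ (diff (domCongr e)).ker ↔ ∀ (h : Gal(M/F)) w, d (h • w) = d w := by
    rw [mem_ker_diff]
    constructor
    · intro h k w
      rcases hgal k with rfl | rfl
      · rw [one_smul]
      · rw [← DFunLike.congr_fun h w, domCongr_apply he]; rfl
    · intro h
      ext w
      rw [domCongr_apply he]
      exact h g w
  set Θ : (HeightOneSpectrum (𝓞 M) →₀ ℤ) →+ Additive (ClassGroup (𝓞 F)) :=
    divisorClass.comp push with hΘ
  have hPF {d} (h : d ∈ (diff (domCongr e)).ker) (h0 : Θ d = 0) :
      d ∈ (diff (galHom g)).ker.map (divisorHom M) := by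
    obtain ⟨x, rfl⟩ := mem_of_smul_eq hd (hDker.1 h) h0
    refine ⟨Additive.ofMul (Units.map (algebraMap F M : F →* M) x), hker.2 fun k ↦ ?_, rfl⟩
    exact Units.ext (k.commutes _)
  set X := (diff (galHom g)).ker.map (divisorHom M) ⊔ (norm (domCongr e)).range with hX
  have hXD : X ≤ (diff (domCongr e)).ker := by
    refine sup_le ?_ ?_
    · rintro _ ⟨x, hx, rfl⟩
      rw [mem_ker_diff, ← hδ, mem_ker_diff.1 hx]
    · rintro _ ⟨x, rfl⟩
      exact norm_mem_ker_diff hτ x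
  have hQ : (AddSubgroup.toSubgroup' (X.map Θ)).index ≤ 2 := by
    refine index_le_two h2 hd _ (fun c ↦ ?_) fun v hv ↦ ?_
    · obtain ⟨d, hd'⟩ := divisorClass_surjective (𝓞 F) (Additive.ofMul c)
      obtain ⟨D, hD⟩ := exists_pull (M := M) d
      refine ⟨norm (domCongr e) D, AddSubgroup.mem_sup_right ⟨D, rfl⟩, ?_⟩
      have : push (norm (domCongr e) D) = 2 • d := by
        ext v
        rw [push_apply, norm_apply, Finsupp.add_apply, domCongr_apply he, hD, hD, lift_under]
        change _ + d ((g • _ : HeightOneSpectrum (𝓞 M)).under (𝓞 F)) = 2 • d v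
        rw [smul_under, lift_under, two_nsmul]
      rw [hΘ, AddMonoidHom.comp_apply, this, map_nsmul, hd']
      rfl
    · obtain ⟨w, w', hww, hw, hw'⟩ := hv
      obtain ⟨k, hk⟩ := exists_smul_eq_of_under_eq (hw.trans hw'.symm)
      have hk : g • w = w' := by
        rcases hgal k with rfl | rfl
        · exact absurd ((one_smul _ w).symm.trans hk) hww
        · exact hk
      refine ⟨norm (domCongr e) (Finsupp.single w 1), AddSubgroup.mem_sup_right ⟨_, rfl⟩, ?_⟩
      have : push (norm (domCongr e) (Finsupp.single w 1)) = Finsupp.single v 1 := by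
        ext u
        rw [push_apply, norm_apply, Finsupp.add_apply, domCongr_apply he]
        change _ + Finsupp.single w 1 (g • _) = _
        by_cases huv : v = u
        · obtain ⟨k, hk'⟩ := exists_smul_eq_of_under_eq (hw.trans (huv.trans (lift_under u).symm))
          rcases hgal k with rfl | rfl
          · rw [one_smul] at hk'
            rw [← hk', hk, huv, Finsupp.single_eq_same, Finsupp.single_eq_same,
              Finsupp.single_eq_of_ne hww.symm, add_zero]
          · have : k • lift u = w := by rw [← hk', smul_smul, hgg, one_smul]
            rw [this, ← hk', hk, huv, Finsupp.single_eq_same, Finsupp.single_eq_same,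
              Finsupp.single_eq_of_ne hww.symm, zero_add]
        · rw [Finsupp.single_eq_of_ne (Ne.symm huv), Finsupp.single_eq_of_ne,
            Finsupp.single_eq_of_ne, add_zero]
          · intro h
            exact huv (by rw [← hw, ← h, smul_under, lift_under])
          · intro h
            exact huv (by rw [← hw, ← h, lift_under])
      rw [hΘ, AddMonoidHom.comp_apply, this, divisorClass_single, one_smul]
      rfl
  have hX' : (X.map Θ).comap Θ ⊓ (diff (domCongr e)).ker ≤ X := by
    rintro d ⟨⟨x, hx, hxd⟩, hd'⟩
    have := hPF (sub_mem hd' (hXD hx)) (by rw [map_sub, hxd, sub_self])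
    rw [← sub_add_cancel d x]
    exact add_mem (AddSubgroup.mem_sup_left this) hx
  have hq : X.relIndex (diff (domCongr e)).ker ≤ 2 := by
    refine (Nat.le_of_dvd ?_ (AddSubgroup.relIndex_dvd_of_le_left _ hX')).trans ?_
    · rw [AddSubgroup.inf_relIndex_right, AddSubgroup.relIndex_comap]
      exact Nat.pos_of_ne_zero AddSubgroup.FiniteIndex.index_ne_zero
    · rw [AddSubgroup.inf_relIndex_right, AddSubgroup.relIndex_comap]
      refine (Nat.le_of_dvd ?_ (AddSubgroup.relIndex_dvd_index_of_normal _ _)).trans hQ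
      exact Nat.pos_of_ne_zero AddSubgroup.FiniteIndex.index_ne_zero
  have hF : ((diff (galHom g)).ker.map (divisorHom M)).relIndex (diff (domCongr e)).ker ≠ 0 := by
    have : Θ.ker ⊓ (diff (domCongr e)).ker ≤ (diff (galHom g)).ker.map (divisorHom M) :=
      fun d h ↦ hPF h.2 h.1
    refine ne_zero_of_dvd_ne_zero ?_ (AddSubgroup.relIndex_dvd_of_le_left _ this)
    rw [AddSubgroup.inf_relIndex_right]
    refine ne_zero_of_dvd_ne_zero ?_ (AddSubgroup.relIndex_dvd_index_of_normal _ _)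
    rw [AddSubgroup.index_ker]
    exact Nat.card_pos.ne'
  have : IsTotallyReal F := IsTotallyReal.of_algebra F M
  set E := (divisorHom M).ker with hE
  have hEf : Module.finrank ℤ E = Module.finrank ℚ M - 1 := by
    rw [hE, ker_divisorHom, AddMonoidHom.finrank_range_of_injective unitsHom_injective,
      finrank_units_eq]
  have : Module.Finite ℤ E := by
    rw [hE, ker_divisorHom]
    exact Module.Finite.equiv
      ((unitsHom M).ofInjective unitsHom_injective).toIntLinearEquiv
  set j : Additive Fˣ →+ Additive Mˣ := (Units.map (algebraMap F M : F →* M)).toAdditive with hj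
  have hji : Function.Injective j := by
    intro x y h
    exact Units.map_injective (f := (algebraMap F M : F →* M)) (algebraMap F M).injective h
  have hEF : E ⊓ (diff (galHom g)).ker = (j.comp (unitsHom F)).range := by
    ext x
    constructor
    · rintro ⟨hx, hx'⟩
      obtain ⟨y, hy⟩ := exists_map_eq_of_smul_eq (hker.1 hx')
      have : Additive.ofMul y ∈ (divisorHom F).ker := by
        rw [AddMonoidHom.mem_ker]
        ext v
        have := DFunLike.congr_fun (AddMonoidHom.mem_ker.1 hx) (lift v)
        rw [divisorHom_apply, ← hy, ord_algebraMap hd, lift_under] at this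
        exact this
      rw [ker_divisorHom] at this
      obtain ⟨u, hu⟩ := this
      exact ⟨u, by rw [AddMonoidHom.comp_apply, hu]; exact hy⟩
    · rintro ⟨u, rfl⟩
      refine ⟨?_, hker.2 fun k ↦ Units.ext (k.commutes _)⟩
      change _ = _
      ext w
      exact (ord_algebraMap hd w _).trans (ord_units_map _ u.toMul)
  have hr : 2 * Module.finrank ℤ (E ⊓ (diff (galHom g)).ker : AddSubgroup (Additive Mˣ)) + 1 ≤
      Module.finrank ℤ E := by
    rw [hEF, hEf, AddMonoidHom.finrank_range_of_injective
      (f := j.comp (unitsHom F)) (hji.comp unitsHom_injective),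
      finrank_units_eq, ← Module.finrank_mul_finrank ℚ F M, h2]
    have := Module.finrank_pos (R := ℚ) (M := F)
    omega
  obtain ⟨h0, h1, h01⟩ := two_mul_relIndex_le hσ E (fun x hx ↦ by
    rw [hE, AddMonoidHom.mem_ker] at hx ⊢
    rw [hδ, hx, map_zero]) hr
  obtain ⟨f, hf⟩ := mem_range_norm hσ hτ hδ (ker_norm_galHom_le h2 hg) (ker_norm_domCongr_le he)
    index_range_divisorHom_ne_zero hF hq h0 h1 h01 (b := Additive.ofMul b)
    (mem_ker_diff.2 (congrArg Additive.ofMul hb))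
    (mem_range_norm_domCongr he (fun w ↦ by
      change (g • w).ord b = w.ord b
      conv_lhs => rw [← hb]
      exact ord_smul_smul g w b) hev)
  exact ⟨f.toMul, (congrArg Additive.toMul hf).symm⟩

end NumberField

namespace CrossedHom

variable {Γ A : Type*} [Group Γ] [CommGroup A] [MulDistribMulAction Γ A]

section Index2

variable {H : Subgroup Γ} {τ : Γ} {β : Γ → A} {c : A}

theorem apply_conj (hH : H.index = 2)
    (hc : ∀ h ∈ H, τ • β (τ⁻¹ * h * τ) = β h * h • c / c) {h : Γ} (hh : h ∈ H) :
    β (τ * h * τ⁻¹) = τ • β h * c / (τ * h * τ⁻¹) • c := by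
  have := Subgroup.normal_of_index_eq_two hH
  have := hc (τ * h * τ⁻¹) (this.conj_mem h hh τ)
  rw [show τ⁻¹ * (τ * h * τ⁻¹) * τ = h by group] at this
  rw [this]
  simp

theorem apply_sq (hH : H.index = 2) (hβ : ∀ x ∈ H, ∀ y ∈ H, β (x * y) = β x * x • β y)
    (hc : ∀ h ∈ H, τ • β (τ⁻¹ * h * τ) = β h * h • c / c) {b : A} (hb : ∀ x : Γ, x • b = b)
    (hτ : β (τ * τ) = b * (c * τ • c)) {h : Γ} (hh : h ∈ H) :
    β (h * τ * (h * τ)) = b * ((β h * h • c) * (h * τ) • (β h * h • c)) := by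
  have hn := Subgroup.normal_of_index_eq_two hH
  have hτ2 : τ * τ ∈ H := Subgroup.mul_self_mem_of_index_two hH τ
  have hm := hn.conj_mem h hh τ
  rw [show h * τ * (h * τ) = h * ((τ * h * τ⁻¹) * (τ * τ)) by group,
    hβ h hh _ (mul_mem hm hτ2), hβ _ hm _ hτ2, hτ, apply_conj hH hc hh]
  simp only [smul_mul', smul_div', smul_smul, hb]
  rw [show h * (τ * h * τ⁻¹ * τ) = h * τ * h by group]
  generalize (h * (τ * h * τ⁻¹)) • c = u
  rw [div_mul_eq_mul_div, mul_div_assoc', div_eq_iff_eq_mul]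
  ac_rfl

theorem smul_obstruction (hH : H.index = 2) (hτH : τ ∉ H)
    (hβ : ∀ x ∈ H, ∀ y ∈ H, β (x * y) = β x * x • β y)
    (hc : ∀ h ∈ H, τ • β (τ⁻¹ * h * τ) = β h * h • c / c) (x : Γ) :
    x • (β (τ * τ) / (c * τ • c)) = β (τ * τ) / (c * τ • c) := by
  have hn := Subgroup.normal_of_index_eq_two hH
  have hτ2 : τ * τ ∈ H := Subgroup.mul_self_mem_of_index_two hH τ
  set b := β (τ * τ) / (c * τ • c) with hb
  have h1 : τ • b = b := by
    have := hc _ hτ2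
    rw [show τ⁻¹ * (τ * τ) * τ = τ * τ by group] at this
    rw [hb, smul_div', this, smul_mul', smul_smul, div_div, div_eq_div_iff_mul_eq_mul]
    ac_rfl
  have h2 {k : Γ} (hk : k ∈ H) : k • b = b := by
    have hk1 : τ⁻¹ * k * τ ∈ H := hn.conj_mem' k hk τ
    have hk2 : τ⁻¹ * (τ⁻¹ * k * τ) * τ ∈ H := hn.conj_mem' _ hk1 τ
    have e1 := hβ k hk _ hτ2
    have e2 := hβ _ hτ2 _ hk2
    have e3 := hc _ hk1
    have e4 := hc _ hk
    rw [show k * (τ * τ) = τ * τ * (τ⁻¹ * (τ⁻¹ * k * τ) * τ) by group, e2, mul_smul, e3,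
      smul_div', smul_mul', e4, smul_smul, show τ * (τ⁻¹ * k * τ) = k * τ by group] at e1
    have e5 : k • β (τ * τ) = β (τ * τ) * (k • c * (k * τ) • c) / (c * τ • c) := by
      refine mul_left_cancel (a := β k) (e1.symm.trans ?_)
      rw [mul_div_assoc', mul_div_assoc', div_mul_eq_mul_div, mul_div_assoc', div_div,
        div_eq_div_iff_mul_eq_mul]
      ac_rfl
    rw [hb, smul_div', e5, smul_mul', smul_smul, div_div, div_eq_div_iff_mul_eq_mul]
    ac_rfl
  by_cases hx : x ∈ H
  · exact h2 hx
  · have : x * τ⁻¹ ∈ H := by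
      rw [Subgroup.mul_mem_iff_of_index_two hH, inv_mem_iff]
      tauto
    rw [← inv_mul_cancel_right x τ, mul_smul, h1, h2 this]

theorem exists_extension (hH : H.index = 2) (hτH : τ ∉ H)
    (hβ : ∀ x ∈ H, ∀ y ∈ H, β (x * y) = β x * x • β y)
    (hc : ∀ h ∈ H, τ • β (τ⁻¹ * h * τ) = β h * h • c / c)
    (hτ : β (τ * τ) = c * τ • c) :
    ∃ β' : Γ → A, (∀ x y, β' (x * y) = β' x * x • β' y) ∧ ∀ x ∈ H, β' x = β x := by
  classical
  have hn := Subgroup.normal_of_index_eq_two hH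
  have hτ2 : τ * τ ∈ H := Subgroup.mul_self_mem_of_index_two hH τ
  have hmem {x : Γ} (hx : x ∉ H) : ∃ h ∈ H, h * τ = x := by
    refine ⟨x * τ⁻¹, ?_, by group⟩
    rw [Subgroup.mul_mem_iff_of_index_two hH, inv_mem_iff]
    tauto
  set β' : Γ → A := fun x ↦ if x ∈ H then β x else β (x * τ⁻¹) * (x * τ⁻¹) • c with hβ'
  have h1 {h : Γ} (hh : h ∈ H) : β' h = β h := if_pos hh
  have h2 {h : Γ} (hh : h ∈ H) : β' (h * τ) = β h * h • c := by
    have : h * τ ∉ H := by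
      rw [Subgroup.mul_mem_iff_of_index_two hH]
      tauto
    simp only [hβ', if_neg this, mul_inv_cancel_right]
  refine ⟨β', fun x y ↦ ?_, fun x hx ↦ h1 hx⟩
  by_cases hx : x ∈ H
  · by_cases hy : y ∈ H
    · rw [h1 hx, h1 hy, h1 (mul_mem hx hy), hβ x hx y hy]
    · obtain ⟨h, hh, rfl⟩ := hmem hy
      rw [← mul_assoc, h2 (mul_mem hx hh), h1 hx, h2 hh, hβ x hx h hh, smul_mul', smul_smul,
        mul_assoc]
  · obtain ⟨h, hh, rfl⟩ := hmem hx
    by_cases hy : y ∈ H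
    · have hm := hn.conj_mem y hy τ
      rw [show h * τ * y = h * (τ * y * τ⁻¹) * τ by group, h2 (mul_mem hh hm), h2 hh, h1 hy,
        hβ h hh _ hm, apply_conj hH hc hy]
      simp only [smul_mul', smul_div', smul_smul]
      rw [mul_assoc, div_mul_cancel, mul_comm ((h * τ) • β y), mul_assoc]
    · obtain ⟨k, hk, rfl⟩ := hmem hy
      have hm := hn.conj_mem k hk τ
      have hm' := mul_mem hm hτ2
      rw [show h * τ * (k * τ) = h * ((τ * k * τ⁻¹) * (τ * τ)) by group, h1 (mul_mem hh hm'),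
        h2 hh, h2 hk, hβ h hh _ hm', hβ _ hm _ hτ2, apply_conj hH hc hk, hτ]
      simp only [smul_mul', smul_div', smul_smul]
      rw [show h * (τ * k * τ⁻¹ * τ) = h * τ * k by group]
      generalize (h * (τ * k * τ⁻¹)) • c = u
      rw [div_mul_eq_mul_div, mul_div_assoc', div_eq_iff_eq_mul]
      ac_rfl

end Index2

/-- A crossed homomorphism is trivial on an element stabilising `w` some power of which is
trivial, for every invariant family of homomorphisms to a torsion-free group. -/
theorem valuation_eq_zero {ι : Type*} [MulAction Γ ι] (ord : ι → A → ℤ)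
    (hmul : ∀ i x y, ord i (x * y) = ord i x + ord i y)
    (hsmul : ∀ (g : Γ) i x, ord (g • i) (g • x) = ord i x)
    {H : Subgroup Γ} {β : Γ → A} (hβ : ∀ x ∈ H, ∀ y ∈ H, β (x * y) = β x * x • β y)
    {i : ι} {u : Γ} (hu : u ∈ H) (hui : u • i = i) {n : ℕ} (hn : n ≠ 0)
    (h0 : ord i (β (u ^ n)) = 0) : ord i (β u) = 0 := by
  have key (m : ℕ) : ord i (β (u ^ (m + 1))) = (m + 1) * ord i (β u) := by
    induction m with
    | zero => simp
    | succ m ih =>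
      rw [pow_succ', hβ u hu _ (pow_mem hu _), hmul]
      have := hsmul u i (β (u ^ (m + 1)))
      rw [hui] at this
      rw [this, ih]
      push_cast
      ring
  obtain ⟨m, rfl⟩ := Nat.exists_eq_succ_of_ne_zero hn
  have := key m
  rw [h0] at this
  exact (mul_eq_zero.1 this.symm).resolve_left (by positivity)

end CrossedHom

namespace NumberField

open IsDedekindDomain HeightOneSpectrum
open scoped Pointwise

theorem exists_eq_smul_div {K L Γ : Type*} [Field K] [Field L] [Algebra K L] [FiniteDimensional K L]
    [Group Γ] {π : Γ →* Gal(L/K)} (hπ : Function.Surjective π) {r : Γ → Lˣ}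
    (hr : ∀ x y, r (x * y) = r x * π x • r y) (h1 : ∀ x, π x = 1 → r x = 1) :
    ∃ e : Lˣ, ∀ x, r x = π x • e / e := by
  have key {x y : Γ} (h : π x = π y) : r x = r y := by
    rw [← mul_inv_cancel_left x y, hr, h1 (x⁻¹ * y) (by simp [h]), smul_one, mul_one]
  obtain ⟨s, hs⟩ := hπ.hasRightInverse
  obtain ⟨e, he⟩ := groupCohomology.isMulCoboundary₁_of_isMulCocycle₁_of_aut_to_units
    (fun g ↦ r (s g)) (fun g h ↦ by
      change r _ = g • r _ * r _
      rw [key (y := s g * s h) (by simp [hs _]), hr, hs, mul_comm])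
  exact ⟨e, fun x ↦ (key (hs _).symm).trans (he _).symm⟩

section Tower

variable {K L : Type*} [Field K] [NumberField K] [Field L] [NumberField L] [Algebra K L]
  (M : IntermediateField K L)

omit [NumberField K] [NumberField L] in
theorem smul_under_restrictNormalHom [Normal K M] (t : Gal(L/K)) (Q : HeightOneSpectrum (𝓞 L)) :
    (t • Q).under (𝓞 M) = AlgEquiv.restrictNormalHom M t • Q.under (𝓞 M) := by
  apply HeightOneSpectrum.ext
  ext x
  change algebraMap (𝓞 M) (𝓞 L) x ∈ t • Q.asIdeal ↔
    x ∈ AlgEquiv.restrictNormalHom M t • (Q.under (𝓞 M)).asIdeal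
  rw [Ideal.mem_pointwise_smul_iff_inv_smul_mem, Ideal.mem_pointwise_smul_iff_inv_smul_mem,
    ← map_inv]
  change _ ↔ algebraMap (𝓞 M) (𝓞 L) _ ∈ Q.asIdeal
  congr! 1
  apply RingOfIntegers.ext
  exact (AlgEquiv.restrictNormal_commutes t⁻¹ M (x : M)).symm

end Tower

/-- An invariant homomorphism from the kernel of a surjection to the Galois group of an unramified
totally real extension of degree a power of two to `{1, -1}` extends to a crossed homomorphism. -/
theorem exists_crossedHom {L : Type} [Field L] [NumberField L] [IsTotallyReal L] (n : ℕ) :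
    ∀ (K : Type) [Field K] [NumberField K] [Algebra K L] [IsGalois K L],
      Module.finrank K L = 2 ^ n → differentIdeal (𝓞 K) (𝓞 L) = ⊤ →
      ∀ (Γ : Type) [Group Γ] (π : Γ →* Gal(L/K)), Function.Surjective π →
      ∀ φ : π.ker →* Lˣ, (∀ x, φ x * φ x = 1) →
      (∀ (x : Γ) (n m : π.ker), (m : Γ) = x * n * x⁻¹ → φ m = φ n) →
      ∃ β : Γ → Lˣ, (∀ x y, β (x * y) = β x * π x • β y) ∧ ∀ x : π.ker, β x = φ x := by
  induction n with
  | zero =>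
    intro K _ _ _ _ hn hd Γ _ π hπ φ hφ hconj
    have : Subsingleton Gal(L/K) := by
      rw [← Finite.card_le_one_iff_subsingleton, IsGalois.card_aut_eq_finrank, hn, pow_zero]
    have hker (x : Γ) : x ∈ π.ker := Subsingleton.elim _ _
    refine ⟨fun x ↦ φ ⟨x, hker x⟩, fun x y ↦ ?_, fun x ↦ rfl⟩
    rw [Subsingleton.elim (π x) 1, one_smul, ← map_mul]
    rfl
  | succ n ih =>
    intro K _ _ _ _ hn hd Γ _ π hπ φ hφ hconj
    classical
    have hcard : Nat.card Gal(L/K) = 2 ^ (n + 1) := by rw [IsGalois.card_aut_eq_finrank, hn]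
    obtain ⟨H, hH⟩ := Sylow.exists_subgroup_card_pow_prime (G := Gal(L/K)) 2 (n := n)
      (hcard ▸ pow_dvd_pow 2 n.le_succ)
    have hHi : H.index = 2 := by
      have := H.card_mul_index
      rw [hH, hcard, pow_succ] at this
      exact Nat.eq_of_mul_eq_mul_left (by positivity) this
    have hHn : H.Normal := Subgroup.normal_of_index_eq_two hHi
    set M := IntermediateField.fixedField H with hM
    have hfix : M.fixingSubgroup = H := IntermediateField.fixingSubgroup_fixedField H
    have : IsGalois K M := IsGalois.of_fixedField_normal_subgroup H
    have : NumberField M := NumberField.of_module_finite K M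
    have : IsTotallyReal M := IsTotallyReal.of_algebra M L
    have hML : Module.finrank M L = 2 ^ n := by
      rw [IntermediateField.finrank_fixedField_eq_card, hH]
    have hKM : Module.finrank K M = 2 := by
      have := Module.finrank_mul_finrank K M L
      rw [hML, hn, pow_succ, mul_comm] at this
      exact Nat.eq_of_mul_eq_mul_left (by positivity) this
    obtain ⟨hd1, hd2⟩ := (differentIdeal_eq_top_iff K M L).1 hd
    set Γ0 := H.comap π with hΓ0
    have hΓ0i : Γ0.index = 2 := by rw [hΓ0, Subgroup.index_comap_of_surjective _ hπ, hHi]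
    have hΓ0n : Γ0.Normal := Subgroup.normal_of_index_eq_two hΓ0i
    set e : H ≃* Gal(L/M) := IntermediateField.subgroupEquivAlgEquiv H with he
    set π0 : Γ0 →* Gal(L/M) := e.toMonoidHom.comp (π.subgroupComap H) with hπ0
    have hπ0a (x : Γ0) (y : Lˣ) : π0 x • y = π x • y := rfl
    have hπ0s : Function.Surjective π0 :=
      e.surjective.comp (π.subgroupComap_surjective_of_surjective H hπ)
    have hπ0k (x : Γ0) : π0 x = 1 ↔ π x = 1 :=
      (e.map_eq_one_iff (x := ⟨π x, x.2⟩)).trans Subtype.ext_iff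
    set ι : π0.ker →* π.ker := (Γ0.subtype.comp π0.ker.subtype).codRestrict π.ker
      (fun x ↦ (hπ0k x).1 x.2) with hι
    obtain ⟨β0, hβ0, hβ0φ⟩ := ih M hML hd2 Γ0 π0 hπ0s (φ.comp ι) (fun x ↦ hφ _)
      (fun x n m h ↦ hconj x _ _ (congrArg Subtype.val h))
    let _ : MulDistribMulAction Γ Lˣ := MulDistribMulAction.compHom Lˣ π
    let _ : MulAction Γ (HeightOneSpectrum (𝓞 L)) := MulAction.compHom _ π
    set β : Γ → Lˣ := fun x ↦ if h : x ∈ Γ0 then β0 ⟨x, h⟩ else 1 with hβdef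
    have hβm {x : Γ} (h : x ∈ Γ0) : β x = β0 ⟨x, h⟩ := dif_pos h
    have hβ : ∀ x ∈ Γ0, ∀ y ∈ Γ0, β (x * y) = β x * x • β y := by
      intro x hx y hy
      rw [hβm (mul_mem hx hy), hβm hx, hβm hy]
      exact hβ0 ⟨x, hx⟩ ⟨y, hy⟩
    have hkerle {x : Γ} (hx : x ∈ π.ker) : x ∈ Γ0 := by
      change π x ∈ H
      rw [MonoidHom.mem_ker.1 hx]
      exact one_mem H
    have hβφ (x : π.ker) : β x = φ x := by
      rw [hβm (hkerle x.2)]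
      exact hβ0φ ⟨⟨x, hkerle x.2⟩, (hπ0k _).2 x.2⟩
    obtain ⟨τ, hτ⟩ : ∃ τ, τ ∉ Γ0 := by
      by_contra! h
      rw [(Subgroup.eq_top_iff' Γ0).2 h, Subgroup.index_top] at hΓ0i
      omega
    have hφτ (x : π.ker) : π τ • φ x = φ x := by
      have : (φ x : L) = 1 ∨ (φ x : L) = -1 := by
        rw [← mul_self_eq_one_iff, ← Units.val_mul, hφ, Units.val_one]
      apply Units.ext
      change π τ (φ x : L) = φ x
      rcases this with h | h <;> simp [h]
    -- the conjugate crossed homomorphism differs from the original by a coboundary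
    have hconj0 {x : Γ} (hx : x ∈ Γ0) : τ⁻¹ * x * τ ∈ Γ0 := hΓ0n.conj_mem' x hx τ
    obtain ⟨c, hc⟩ := exists_eq_smul_div hπ0s (r := fun x ↦ τ • β (τ⁻¹ * x * τ) / β x) (fun x y ↦ by
      change τ • β (τ⁻¹ * (x * y) * τ) / β (x * y) =
        τ • β (τ⁻¹ * x * τ) / β x * (x : Γ) • (τ • β (τ⁻¹ * y * τ) / β y)
      rw [show τ⁻¹ * (x * y : Γ) * τ = (τ⁻¹ * x * τ) * (τ⁻¹ * y * τ) by group,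
        hβ _ (hconj0 x.2) _ (hconj0 y.2), hβ _ x.2 _ y.2, smul_mul', smul_div', smul_smul,
        smul_smul, show τ * (τ⁻¹ * x * τ) = x * τ by group, mul_div_mul_comm]) (fun x hx ↦ by
      have hx1 : (x : Γ) ∈ π.ker := (hπ0k x).1 hx
      have hx2 : τ⁻¹ * x * τ ∈ π.ker := (inferInstance : π.ker.Normal).conj_mem' x hx1 τ
      change τ • β (τ⁻¹ * x * τ) / β x = 1
      rw [div_eq_one, hβφ ⟨_, hx1⟩, hβφ ⟨_, hx2⟩]
      refine (hφτ _).trans (hconj τ⁻¹ _ _ ?_)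
      simp)
    replace hc : ∀ h ∈ Γ0, τ • β (τ⁻¹ * h * τ) = β h * h • c / c := fun h hh ↦ by
      rw [← mul_div_assoc', ← div_eq_iff_eq_mul']
      exact hc ⟨h, hh⟩
    set b := β (τ * τ) / (c * τ • c) with hb
    have hbfix := CrossedHom.smul_obstruction hΓ0i hτ hβ hc
    rw [← hb] at hbfix
    obtain ⟨b1, hb1⟩ := exists_map_eq_of_smul_eq (F := K) (x := b) fun g ↦ by
      obtain ⟨x, rfl⟩ := hπ g
      exact hbfix x
    set b' : Mˣ := Units.map (algebraMap K M : K →* M) b1 with hb'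
    have hbb : Units.map (algebraMap M L : M →* L) b' = b := by
      rw [← hb1]
      exact Units.ext (IsScalarTower.algebraMap_apply K M L (b1 : K)).symm
    set g := AlgEquiv.restrictNormalHom M (π τ) with hg
    have hga (x : M) : algebraMap M L (g x) = π τ (algebraMap M L x) :=
      AlgEquiv.restrictNormal_commutes _ _ _
    have hg1 : g ≠ 1 := by
      intro h
      apply hτ
      change π τ ∈ H
      rw [← hfix]
      intro x
      have := hga x
      rw [h] at this
      exact this.symm
    obtain ⟨f, hf⟩ := exists_norm_eq hKM hd1 hg1 (b := b') (Units.ext (g.commutes _)) (by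
      intro P hP
      obtain ⟨Q, rfl⟩ := exists_under_eq (L := L) M P
      rw [hg, ← smul_under_restrictNormalHom] at hP
      obtain ⟨k, hk⟩ := exists_smul_eq_of_under_eq hP
      obtain ⟨x, rfl⟩ := hπ0s k
      have hx : (x * τ : Γ) • Q = Q := (mul_smul (x : Γ) τ Q).trans hk
      rw [← ord_algebraMap hd2, hbb]
      have hsm (y : Γ) (w : HeightOneSpectrum (𝓞 L)) (z : Lˣ) : (y • w).ord (y • z) = w.ord z :=
        ord_smul_smul (π y) w z
      have h2 : ((x : Γ) * τ) * (x * τ) ∈ Γ0 := Subgroup.mul_self_mem_of_index_two hΓ0i _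
      have hk2 : (((x : Γ) * τ) * (x * τ)) ^ Nat.card Gal(L/K) ∈ π.ker := by
        rw [MonoidHom.mem_ker, map_pow, pow_card_eq_one']
      have h0 := CrossedHom.valuation_eq_zero (fun w : HeightOneSpectrum (𝓞 L) ↦ w.ord (K := L))
        (fun w ↦ w.ord_mul) hsm hβ h2 (by rw [mul_smul, hx, hx]) Nat.card_pos.ne' (by
          have := Q.ord_mul (φ ⟨_, hk2⟩) (φ ⟨_, hk2⟩)
          rw [hφ, ord_one] at this
          change Q.ord (β _) = 0
          rw [hβφ ⟨_, hk2⟩]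
          omega)
      have := hsm (x * τ) Q (β x * (x : Γ) • c)
      rw [hx] at this
      rw [CrossedHom.apply_sq hΓ0i hβ hc hbfix (div_mul_cancel _ _).symm x.2, ord_mul, ord_mul,
        this] at h0
      exact ⟨-Q.ord (β x * (x : Γ) • c), by omega⟩)
    set d : Lˣ := Units.map (algebraMap M L : M →* L) f with hd
    have hdH {h : Γ} (hh : h ∈ Γ0) : h • d = d := by
      apply Units.ext
      change π h (algebraMap M L f) = algebraMap M L f
      have : π h ∈ M.fixingSubgroup := by rw [hfix]; exact hh
      exact this f
    have hdτ : b = d * τ • d := by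
      rw [← hbb, hf, map_mul]
      congr 1
      exact Units.ext (hga f)
    obtain ⟨β', hβ', hβ'β⟩ := CrossedHom.exists_extension (c := c * d) hΓ0i hτ hβ (fun h hh ↦ by
      rw [hc h hh, smul_mul', hdH hh, ← mul_assoc, mul_div_mul_right_eq_div]) (by
      rw [← div_mul_cancel (β (τ * τ)) (c * τ • c), ← hb, hdτ, smul_mul']
      ac_rfl)
    exact ⟨β', hβ', fun x ↦ (hβ'β x (hkerle x.2)).trans (hβφ x)⟩

end NumberField

namespace IsDedekindDomain.HeightOneSpectrum

variable {R : Type*} [CommRing R] [IsDedekindDomain R] {K : Type*} [Field K] [Algebra R K]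
  [IsFractionRing R K] (v : HeightOneSpectrum R)

theorem le_ord_iff_mem_pow {x : Kˣ} {a : R} (h : algebraMap R K a = x) (n : ℕ) :
    n ≤ v.ord x ↔ a ∈ v.asIdeal ^ n := by
  have h1 : v.valuation K (algebraMap R K a) = v.intValuation a := v.valuation_of_algebraMap a
  rw [h] at h1
  rw [← intValuation_le_pow_iff_mem, ← h1, valuation_eq_exp_neg_ord, WithZero.exp_le_exp,
    neg_le_neg_iff]

theorem exists_pow_notMem (n : ℕ) : ∃ a ∈ v.asIdeal ^ n, a ∉ v.asIdeal ^ (n + 1) :=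
  SetLike.exists_of_lt (Ideal.pow_right_strictAnti _ v.ne_bot v.isPrime.ne_top n.lt_succ_self)

theorem exists_nonneg_ord_eq (T : Finset (HeightOneSpectrum R)) (m : HeightOneSpectrum R → ℕ) :
    ∃ x : Kˣ, (∀ v : HeightOneSpectrum R, 0 ≤ v.ord x) ∧ ∀ v ∈ T, v.ord x = m v := by
  obtain rfl | ⟨w, hw⟩ := T.eq_empty_or_nonempty
  · exact ⟨1, by simp [ord_one], by simp⟩
  choose c hc hc' using fun v : HeightOneSpectrum R ↦ v.exists_pow_notMem (m v)
  obtain ⟨y, hy⟩ := exists_forall_sub_mem_ideal (s := T) (fun v ↦ v.asIdeal) (fun v ↦ m v + 1)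
    (fun v _ ↦ v.prime) (fun v _ w _ hvw h ↦ hvw (HeightOneSpectrum.ext h)) (fun v ↦ c v)
  have h1 (v) (hv : v ∈ T) : y ∈ v.asIdeal ^ m v := by
    have := add_mem (Ideal.pow_le_pow_right (Nat.le_succ _) (hy v hv)) (hc v)
    simpa using this
  have h2 (v) (hv : v ∈ T) : y ∉ v.asIdeal ^ (m v + 1) := fun h ↦
    hc' v (by simpa using sub_mem h (hy v hv))
  have h0 : algebraMap R K y ≠ 0 := by
    rw [Ne, FaithfulSMul.algebraMap_eq_zero_iff]
    rintro rfl
    exact h2 w hw (zero_mem _)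
  refine ⟨Units.mk0 _ h0, fun v ↦ v.ord_nonneg_of_mem rfl, fun v hv ↦ le_antisymm ?_ ?_⟩
  · have := (v.le_ord_iff_mem_pow (x := Units.mk0 _ h0) rfl (m v + 1)).not.2 (h2 v hv)
    push_cast at this
    omega
  · exact (v.le_ord_iff_mem_pow (x := Units.mk0 _ h0) rfl (m v)).2 (h1 v hv)

theorem exists_le_ord_eq (T : Finset (HeightOneSpectrum R)) (n : HeightOneSpectrum R →₀ ℤ) :
    ∃ x : Kˣ, (∀ v : HeightOneSpectrum R, n v ≤ v.ord x) ∧ ∀ v ∈ T, v.ord x = n v := by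
  classical
  obtain ⟨b, hb0, hb⟩ := exists_nonneg_ord_eq (K := K) (T ∪ n.support) fun v ↦ (-n v).toNat
  obtain ⟨a, ha0, ha⟩ := exists_nonneg_ord_eq (K := K) (T ∪ n.support ∪ (divisor b).support)
    fun v ↦ (n v + v.ord b).toNat
  have key (v) (hv : v ∈ T ∪ n.support ∪ (divisor b : HeightOneSpectrum R →₀ ℤ).support) :
      v.ord (a / b) = n v := by
    rw [ord_div, ha v hv]
    have h1 := hb0 v
    rcases Finset.mem_union.1 hv with h | h
    · have := hb v h
      omega
    · by_cases h' : v ∈ T ∪ n.support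
      · have := hb v h'
        omega
      · have : n v = 0 := by
          simp only [Finset.mem_union, Finsupp.mem_support_iff] at h'
          tauto
        omega
  refine ⟨a / b, fun v ↦ ?_, fun v hv ↦ key v (by simp [hv])⟩
  by_cases hv : v ∈ T ∪ n.support ∪ (divisor b : HeightOneSpectrum R →₀ ℤ).support
  · exact (key v hv).ge
  · simp only [Finset.mem_union, Finsupp.mem_support_iff, divisor_apply, not_or, not_not] at hv
    rw [ord_div, hv.1.2, hv.2, sub_zero]
    exact ha0 v

/-- An element of even order everywhere is, up to squares, integral and prime to a given finite set
of primes. -/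
theorem exists_ord_mul_sq_eq_zero (T : Finset (HeightOneSpectrum R)) (x : Kˣ)
    (hx : ∀ v : HeightOneSpectrum R, Even (v.ord x)) :
    ∃ (y : Kˣ) (a : R), algebraMap R K a = (x * y ^ 2 : Kˣ) ∧
      ∀ v ∈ T, v.ord (x * y ^ 2) = 0 := by
  obtain ⟨y, hy, hT⟩ := exists_le_ord_eq (K := K) T
    ((divisor x).mapRange (fun n ↦ -(n / 2)) (by simp))
  simp only [Finsupp.mapRange_apply, divisor_apply] at hy hT
  have h (v : HeightOneSpectrum R) : v.ord (x * y ^ 2) = v.ord x + 2 * v.ord y := by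
    rw [ord_mul, ord_pow]; simp
  obtain ⟨a, ha⟩ := exists_algebraMap_eq_of_ord_nonneg (R := R) (x := x * y ^ 2) fun v ↦ by
    have := hy v
    obtain ⟨m, hm⟩ := hx v
    rw [h]; omega
  refine ⟨y, a, ha, fun v hv ↦ ?_⟩
  have := hT v hv
  obtain ⟨m, hm⟩ := hx v
  rw [h]; omega

end IsDedekindDomain.HeightOneSpectrum

namespace NumberField

open IsDedekindDomain HeightOneSpectrum
open scoped Pointwise nonZeroDivisors

section Trace

variable (K : Type*) {L : Type*} [Field K] [NumberField K] [Field L] [NumberField L] [Algebra K L]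

/-- The trace of an extension with trivial different is surjective on integers. -/
theorem exists_trace_eq_one (h : differentIdeal (𝓞 K) (𝓞 L) = ⊤) :
    ∃ t : 𝓞 L, Algebra.trace K L t = 1 := by
  have hdual (x : L) (hx : ∀ y : 𝓞 L, IsIntegral ℤ (Algebra.trace K L (x * y))) :
      IsIntegral ℤ x := by
    have h1 := coeIdeal_differentIdeal (𝓞 K) K L (𝓞 L)
    rw [h, FractionalIdeal.coeIdeal_top, eq_comm, inv_eq_one] at h1
    have h2 : x ∈ FractionalIdeal.dual (𝓞 K) K (1 : FractionalIdeal (𝓞 L)⁰ L) := by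
      rw [FractionalIdeal.mem_dual (one_ne_zero (α := FractionalIdeal (𝓞 L)⁰ L))]
      intro a ha
      obtain ⟨y, rfl⟩ := (FractionalIdeal.mem_one_iff _).1 ha
      exact ⟨⟨_, hx y⟩, rfl⟩
    rw [h1] at h2
    obtain ⟨y, rfl⟩ := (FractionalIdeal.mem_one_iff _).1 h2
    exact y.isIntegral_coe
  suffices LinearMap.range (Algebra.intTrace (𝓞 K) (𝓞 L)) = ⊤ by
    obtain ⟨t, ht⟩ := (this ▸ Submodule.mem_top : (1 : 𝓞 K) ∈ LinearMap.range _)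
    exact ⟨t, by
      have := Algebra.algebraMap_intTrace (A := 𝓞 K) (B := 𝓞 L) (K := K) (L := L) t
      rw [ht, map_one] at this
      exact this.symm⟩
  by_contra hne
  obtain ⟨P, hP, hle⟩ := Ideal.exists_le_maximal _ hne
  let v : HeightOneSpectrum (𝓞 K) := ⟨P, hP.isPrime, by
    rintro rfl
    exact RingOfIntegers.not_isField K (Ring.isField_iff_maximal_bot.2 hP)⟩
  classical
  obtain ⟨x, hx, hxv⟩ := exists_le_ord_eq (K := K) {v} (Finsupp.single v (-1))
  have hxv := hxv v (by simp)
  rw [Finsupp.single_eq_same] at hxv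
  have hint (p : 𝓞 K) (hp : p ∈ P) : IsIntegral ℤ (x * p : K) := by
    rcases eq_or_ne p 0 with rfl | hp0
    · simpa using isIntegral_zero
    have hp0' : algebraMap (𝓞 K) K p ≠ 0 := by simpa using hp0
    obtain ⟨y, hy⟩ := exists_algebraMap_eq_of_ord_nonneg (R := 𝓞 K)
      (x := x * Units.mk0 _ hp0') fun w ↦ by
        rw [ord_mul]
        have := hx w
        rcases eq_or_ne w v with rfl | hw
        · have h2 := (ord_pos_iff_mem v (x := Units.mk0 _ hp0') (a := p) rfl).2 hp
          omega
        · have h2 := ord_nonneg_of_mem w (x := Units.mk0 _ hp0') (a := p) rfl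
          rw [Finsupp.single_eq_of_ne hw] at this
          omega
    exact (show algebraMap (𝓞 K) K y = x * p from hy) ▸ y.isIntegral_coe
  have h3 : IsIntegral ℤ (algebraMap K L x) := hdual _ fun y ↦ by
    rw [← Algebra.smul_def, map_smul, smul_eq_mul]
    have := hint _ (hle ⟨y, rfl⟩)
    rwa [show ((Algebra.intTrace (𝓞 K) (𝓞 L) y : 𝓞 K) : K) = Algebra.trace K L y from
      Algebra.algebraMap_intTrace (A := 𝓞 K) (B := 𝓞 L) (K := K) (L := L) y] at this
  have h4 := ord_nonneg_of_mem v (x := x) (a := (⟨x, (isIntegral_algebraMap_iff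
    (algebraMap K L).injective).1 h3⟩ : 𝓞 K)) rfl
  omega

end Trace

section Two

variable {L : Type*} [Field L] [NumberField L]

variable (L) in
theorem RingOfIntegers.not_isUnit_two : ¬ IsUnit (2 : 𝓞 L) := by
  intro h
  have := Ideal.map_eq_top_iff (algebraMap ℤ (𝓞 L)) (I := Ideal.span {2})
    (FaithfulSMul.algebraMap_injective ℤ (𝓞 L)) Algebra.IsIntegral.isIntegral
  rw [Ideal.map_span, Set.image_singleton, Ideal.span_singleton_eq_top,
    Ideal.span_singleton_eq_top, map_ofNat] at this
  exact absurd (Int.isUnit_iff.1 (this.1 h)) (by norm_num)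

/-- An integer of a field in which `2` is unramified is, up to squares, `1` modulo `2`. -/
theorem exists_mul_sq_eq (h2 : ∀ a : 𝓞 L, 2 ∣ a ^ 2 → 2 ∣ a) (a : 𝓞 L)
    (ha : ∀ v : HeightOneSpectrum (𝓞 L), 2 ∈ v.asIdeal → a ∉ v.asIdeal) :
    ∃ c κ : 𝓞 L, c ≠ 0 ∧ a * c ^ 2 = 1 + 2 * κ := by
  let I : Ideal (𝓞 L) := Ideal.span {2}
  have hI : I ≠ ⊥ := by simp [I]
  have := Ideal.finiteQuotientOfFreeOfNeBot I hI
  have h20 : (2 : 𝓞 L ⧸ I) = 0 :=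
    Ideal.Quotient.eq_zero_iff_mem.2 (Ideal.mem_span_singleton_self 2)
  have hinj : Function.Injective fun x : 𝓞 L ⧸ I ↦ x ^ 2 := by
    intro x y h
    obtain ⟨x, rfl⟩ := Ideal.Quotient.mk_surjective x
    obtain ⟨y, rfl⟩ := Ideal.Quotient.mk_surjective y
    have h' : (Ideal.Quotient.mk I) ((x - y) ^ 2) = 0 := by
      simp only [map_pow, map_sub] at h ⊢
      linear_combination h + (Ideal.Quotient.mk I y ^ 2 - Ideal.Quotient.mk I x * Ideal.Quotient.mk I y) * h20
    rw [Ideal.Quotient.eq_zero_iff_mem, Ideal.mem_span_singleton] at h'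
    rw [Ideal.Quotient.eq, Ideal.mem_span_singleton]
    exact h2 _ h'
  have hunit : IsUnit (Ideal.Quotient.mk I a) := by
    by_contra hu
    obtain ⟨M, hM, haM⟩ := exists_max_ideal_of_mem_nonunits hu
    have h2M : 2 ∈ M.comap (Ideal.Quotient.mk I) := by
      rw [Ideal.mem_comap, map_ofNat, h20]; exact zero_mem _
    refine ha ⟨M.comap (Ideal.Quotient.mk I), inferInstance, ?_⟩ h2M haM
    intro h0
    rw [h0] at h2M
    simp at h2M
  obtain ⟨b, hb⟩ := hunit.exists_right_inv
  obtain ⟨c, hc⟩ := (Finite.injective_iff_surjective.1 hinj) b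
  obtain ⟨c, rfl⟩ := Ideal.Quotient.mk_surjective c
  have h3 : (Ideal.Quotient.mk I) (a * c ^ 2) = (Ideal.Quotient.mk I) 1 := by
    rw [map_mul, map_pow, map_one, ← hb]; exact congrArg _ hc
  rw [Ideal.Quotient.eq, Ideal.mem_span_singleton] at h3
  obtain ⟨κ, hκ⟩ := h3
  refine ⟨c, κ, ?_, by linear_combination hκ⟩
  rintro rfl
  exact RingOfIntegers.not_isUnit_two L (IsUnit.of_mul_eq_one (-κ) (by linear_combination hκ))

theorem exists_mul_sq_eq_of_even (h2 : ∀ a : 𝓞 L, 2 ∣ a ^ 2 → 2 ∣ a) (x : Lˣ)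
    (hx : ∀ v : HeightOneSpectrum (𝓞 L), Even (v.ord x)) :
    ∃ (y : Lˣ) (κ : 𝓞 L), (x * y ^ 2 : L) = 1 + 2 * κ := by
  have h20 : algebraMap (𝓞 L) L 2 ≠ 0 := by simp
  obtain ⟨y, a, hya, hT⟩ := exists_ord_mul_sq_eq_zero (R := 𝓞 L)
    (finite_ord_ne_zero (R := 𝓞 L) (Units.mk0 _ h20)).toFinset x hx
  obtain ⟨c, κ, hc, h⟩ := exists_mul_sq_eq h2 a fun v hv hav ↦ by
    have h3 := (ord_pos_iff_mem v (x := Units.mk0 _ h20) (a := 2) rfl).2 hv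
    have h4 := (ord_pos_iff_mem v hya).2 hav
    rw [hT v (by simpa using h3.ne')] at h4
    exact lt_irrefl _ h4
  have hc' : algebraMap (𝓞 L) L c ≠ 0 := by simpa using hc
  refine ⟨y * Units.mk0 _ hc', κ, ?_⟩
  have h5 := congrArg (algebraMap (𝓞 L) L) h
  simp only [map_mul, map_pow, map_add, map_one, map_ofNat] at h5
  rw [hya] at h5
  rw [← h5]
  push_cast
  simp only [Units.val_mk0]
  ring

/-- The class modulo `2` of `κ` in `x y² = 1 + 2 κ` only depends on `x`. -/
theorem two_dvd_sub_of_mul_sq_eq (h2 : ∀ a : 𝓞 L, 2 ∣ a ^ 2 → 2 ∣ a) {a b : 𝓞 L} {d : L}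
    (h : (1 + 2 * a : L) * d ^ 2 = 1 + 2 * b) : 2 ∣ a - b := by
  have hint : IsIntegral (𝓞 L) (d * (1 + 2 * a) : L) := by
    refine IsIntegral.of_pow (n := 2) (by norm_num) ?_
    have : (d * (1 + 2 * a) : L) ^ 2 = algebraMap (𝓞 L) L ((1 + 2 * a) * (1 + 2 * b)) := by
      simp only [map_mul, map_add, map_one, map_ofNat]
      linear_combination (1 + 2 * a : L) * h
    rw [this]
    exact isIntegral_algebraMap
  obtain ⟨e, he⟩ := IsIntegrallyClosed.isIntegral_iff.1 hint
  have h3 : e ^ 2 = (1 + 2 * a) * (1 + 2 * b) := by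
    apply FaithfulSMul.algebraMap_injective (𝓞 L) L
    simp only [map_mul, map_add, map_one, map_ofNat, map_pow, he]
    linear_combination (1 + 2 * a : L) * h
  obtain ⟨m, hm⟩ := h2 (e - 1) ⟨a + b + 2 * a * b + 1 - e, by linear_combination h3⟩
  obtain rfl : e = 1 + 2 * m := by linear_combination hm
  have h4 : (2 : 𝓞 L) * (a - b) = 2 * (2 * (m + m ^ 2 - a * b - b)) := by
    linear_combination - h3
  exact ⟨_, mul_left_cancel₀ two_ne_zero h4⟩

end Two

end NumberField

namespace Subgroup

variable {E : Type*} [CommGroup E]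

theorem relIndex_le_card {H K : Subgroup E} {X : Type*} [Finite X] (f : K → X)
    (hf : ∀ x y : K, f x = f y → (x / y : E) ∈ H) :
    H.relIndex K ≠ 0 ∧ H.relIndex K ≤ Nat.card X := by
  have hinj : Function.Injective fun q : K ⧸ H.subgroupOf K ↦ f q.out := by
    intro p q h
    rw [← p.out_eq', ← q.out_eq', eq_comm, QuotientGroup.eq, mem_subgroupOf]
    have := hf _ _ h
    rwa [div_eq_inv_mul] at this
  have := Finite.of_injective _ hinj
  exact ⟨(Nat.card_pos (α := K ⧸ H.subgroupOf K)).ne', Nat.card_le_card_of_injective _ hinj⟩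

theorem card_le_relIndex {H K : Subgroup E} {X : Type*} (f : X → K)
    (hf : ∀ x y : X, (f x / f y : E) ∈ H → x = y) (h0 : H.relIndex K ≠ 0) :
    Nat.card X ≤ H.relIndex K := by
  have : Finite (K ⧸ H.subgroupOf K) := Nat.finite_of_card_ne_zero h0
  refine Nat.card_le_card_of_injective (fun x ↦ (f x : K ⧸ H.subgroupOf K)) fun x y h ↦ ?_
  refine (hf y x ?_).symm
  rw [QuotientGroup.eq, mem_subgroupOf] at h
  rwa [div_eq_inv_mul]

theorem relIndex_sup_le {R S V W T : Subgroup E} (hSW : S ≤ W) (hWV : W ≤ V) (hRV : R ≤ V)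
    (hTR : T ≤ R) (hTS : T ≤ S) {c m n : ℕ} (h0 : (W ⊔ R).relIndex V ≠ 0)
    (hc : (W ⊔ R).relIndex V ≤ c) (hn0 : S.relIndex W ≠ 0) (hn : S.relIndex W ≤ n)
    (hm0 : T.relIndex (R ⊓ S) ≠ 0) (hm : T.relIndex (R ⊓ S) ≤ m)
    (hT : T.relIndex (R ⊓ W) ≠ 0 → c ≤ T.relIndex (R ⊓ W)) :
    (R ⊔ S).relIndex V ≠ 0 ∧ (R ⊔ S).relIndex V ≤ n * m := by
  have e1 : (R ⊔ S).relIndex V = (R ⊔ S).relIndex (W ⊔ R) * (W ⊔ R).relIndex V :=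
    (relIndex_mul_relIndex _ _ _ (sup_le le_sup_right (hSW.trans le_sup_left))
      (sup_le hWV hRV)).symm
  have e2 : (R ⊔ S).relIndex (W ⊔ R) = (S ⊔ R ⊓ W).relIndex W := by
    have : W ⊔ R = W ⊔ (R ⊔ S) := le_antisymm (sup_le_sup_left le_sup_left _)
      (sup_le le_sup_left (sup_le le_sup_right (hSW.trans le_sup_left)))
    rw [this, relIndex_sup_right, ← inf_relIndex_right, sup_comm R S,
      sup_inf_assoc_of_le R hSW]
  have e3 : S.relIndex W = (R ⊓ S).relIndex (R ⊓ W) * (S ⊔ R ⊓ W).relIndex W := by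
    rw [← relIndex_mul_relIndex S (S ⊔ R ⊓ W) W le_sup_left (sup_le hSW inf_le_right),
      sup_comm, relIndex_sup_right]
    congr 1
    rw [← inf_relIndex_right]
    congr 1
    exact le_antisymm (le_inf (inf_le_right.trans inf_le_left) inf_le_left)
      (le_inf inf_le_right (inf_le_inf_left _ hSW))
  have e4 : T.relIndex (R ⊓ W) = T.relIndex (R ⊓ S) * (R ⊓ S).relIndex (R ⊓ W) :=
    (relIndex_mul_relIndex _ _ _ (le_inf hTR hTS) (inf_le_inf_left _ hSW)).symm
  have h3 := hn0
  rw [e3, mul_ne_zero_iff] at h3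
  have h4 := hT (by rw [e4]; exact mul_ne_zero hm0 h3.1)
  rw [e1, e2]
  refine ⟨mul_ne_zero h3.2 h0, ?_⟩
  calc (S ⊔ R ⊓ W).relIndex W * (W ⊔ R).relIndex V
      ≤ (S ⊔ R ⊓ W).relIndex W * (m * (R ⊓ S).relIndex (R ⊓ W)) := by
        gcongr
        exact hc.trans (h4.trans (e4.le.trans (by gcongr)))
    _ = S.relIndex W * m := by rw [e3]; ring
    _ ≤ n * m := by gcongr

end Subgroup

namespace NumberField

open IsDedekindDomain HeightOneSpectrum
open scoped Pointwise

section Sign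

/-- The embedding of the group of order two into the units of a ring. -/
noncomputable def signHom (R : Type*) [Ring R] : Multiplicative (ZMod 2) →* Rˣ where
  toFun a := if a = 1 then 1 else -1
  map_one' := by simp
  map_mul' a b := by
    have h (a : Multiplicative (ZMod 2)) : a = 1 ∨ a = .ofAdd 1 := by
      revert a; decide
    have h1 : (.ofAdd 1 : Multiplicative (ZMod 2)) ≠ 1 := by decide
    have h2 : (.ofAdd 1 * .ofAdd 1 : Multiplicative (ZMod 2)) = 1 := by decide
    obtain rfl | rfl := h a <;> obtain rfl | rfl := h b <;> simp [h1, h2]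

theorem signHom_mul_self {R : Type*} [Ring R] (a : Multiplicative (ZMod 2)) :
    signHom R a * signHom R a = 1 := by
  rw [← map_mul, show a * a = 1 by revert a; decide, map_one]

theorem signHom_injective (R : Type*) [Ring R] [CharZero R] :
    Function.Injective (signHom R) := by
  rw [injective_iff_map_eq_one]
  intro a h
  by_contra h1
  have := congrArg Units.val h
  simp [signHom, h1, neg_eq_iff_add_eq_zero, one_add_one_eq_two] at this

/-- A homomorphism to `{1, -1}` comes from a homomorphism to the group of order two. -/
theorem exists_signHom_comp_eq {R G : Type*} [CommRing R] [IsDomain R] [CharZero R] [Group G]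
    (χ : G →* Rˣ) (h : ∀ g, χ g * χ g = 1) :
    ∃ φ : G →* Multiplicative (ZMod 2), ∀ g, signHom R (φ g) = χ g := by
  classical
  have key (g : G) : ∃ a, signHom R a = χ g := by
    have h1 := congrArg Units.val (h g)
    rw [Units.val_mul, Units.val_one, mul_self_eq_one_iff] at h1
    rcases h1 with h1 | h1
    · exact ⟨1, by rw [map_one]; exact Units.ext h1.symm⟩
    · exact ⟨.ofAdd 1, Units.ext (by simp [signHom, h1])⟩
  choose f hf using key
  exact ⟨MonoidHom.mk' f fun x y ↦ signHom_injective R (by simp [hf]), hf⟩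

instance {G : Type*} [Group G] [Finite G] : Finite (G →* Multiplicative (ZMod 2)) :=
  Finite.of_injective _ DFunLike.coe_injective

end Sign

variable (K L : Type*) [Field K] [NumberField K] [Field L] [NumberField L] [Algebra K L]

section

variable {L}

/-- The elements generating extensions unramified at all places. -/
def IsSelmer (x : Lˣ) : Prop :=
  (∀ σ : L →+* ℝ, 0 < σ x) ∧ (∀ v : HeightOneSpectrum (𝓞 L), Even (v.ord x)) ∧
    ∃ (y : Lˣ) (w : 𝓞 L), (x * y ^ 2 : L) = 1 + 4 * w

variable (L) in
/-- The subgroup of squares. -/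
def squares : Subgroup Lˣ := (powMonoidHom 2).range

omit [NumberField L] in
theorem mem_squares {x : Lˣ} : x ∈ squares L ↔ ∃ y, y ^ 2 = x := Iff.rfl

end

/-- The elements invariant up to squares. -/
def invariants : Subgroup Lˣ where
  carrier := {x | ∀ g : Gal(L/K), g • x / x ∈ squares L}
  one_mem' := by simp [one_mem]
  mul_mem' {x y} hx hy g := by
    rw [smul_mul', mul_div_mul_comm]
    exact mul_mem (hx g) (hy g)
  inv_mem' {x} hx g := by
    rw [smul_inv', ← inv_div_inv, inv_inv, inv_inv, ← inv_div]
    exact inv_mem (hx g)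

/-- The elements invariant up to squares which have even order at all primes. -/
def evenInvariants : Subgroup Lˣ where
  carrier := {x | x ∈ invariants K L ∧ ∀ v : HeightOneSpectrum (𝓞 L), Even (v.ord x)}
  one_mem' := ⟨one_mem _, by simp [ord_one]⟩
  mul_mem' {x y} hx hy := ⟨mul_mem hx.1 hy.1, fun v ↦ by
    rw [ord_mul]; exact (hx.2 v).add (hy.2 v)⟩
  inv_mem' {x} hx := ⟨inv_mem hx.1, fun v ↦ by rw [ord_inv]; exact (hx.2 v).neg⟩

/-- The elements of the base field. -/
def baseUnits : Subgroup Lˣ := (Units.map (algebraMap K L : K →* L)).range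

/-- The squares of elements of the base field. -/
def baseSquares : Subgroup Lˣ :=
  ((Units.map (algebraMap K L : K →* L)).comp (powMonoidHom 2)).range

variable {K L}

omit [NumberField K] [NumberField L] in
theorem mem_invariants {x : Lˣ} :
    x ∈ invariants K L ↔ ∀ g : Gal(L/K), ∃ s : Lˣ, g • x = x * s ^ 2 := by
  refine forall_congr' fun g ↦ ?_
  rw [mem_squares]
  refine exists_congr fun s ↦ ?_
  rw [eq_div_iff_mul_eq', eq_comm, mul_comm]

omit [NumberField K] [NumberField L] in
theorem smul_map (g : Gal(L/K)) (x : Kˣ) :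
    g • Units.map (algebraMap K L : K →* L) x = Units.map (algebraMap K L : K →* L) x :=
  Units.ext (g.commutes x)

omit [NumberField K] [NumberField L] in
theorem squares_le_invariants : squares L ≤ invariants K L := by
  rintro _ ⟨y, rfl⟩ g
  exact ⟨g • y / y, by simp [div_pow]⟩

omit [NumberField K] in
theorem squares_le_evenInvariants : squares L ≤ evenInvariants K L := by
  rintro _ ⟨y, rfl⟩
  exact ⟨squares_le_invariants ⟨y, rfl⟩, fun v ↦ by simp [ord_pow]⟩

omit [NumberField K] in
theorem evenInvariants_le : evenInvariants K L ≤ invariants K L := fun _ h ↦ h.1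

omit [NumberField K] [NumberField L] in
theorem baseUnits_le_invariants : baseUnits K L ≤ invariants K L := by
  rintro _ ⟨y, rfl⟩ g
  rw [smul_map, div_self']
  exact one_mem _

omit [NumberField K] [NumberField L] in
theorem baseSquares_le_baseUnits : baseSquares K L ≤ baseUnits K L := by
  rintro _ ⟨y, rfl⟩
  exact ⟨y ^ 2, rfl⟩

omit [NumberField K] [NumberField L] in
theorem baseSquares_le_squares : baseSquares K L ≤ squares L := by
  rintro _ ⟨y, rfl⟩
  exact ⟨Units.map (algebraMap K L : K →* L) y, by simp⟩

variable [IsGalois K L]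

omit [NumberField K] [IsGalois K L] in
/-- The Kummer character attached to an element of `K` which becomes a square in `L`. -/
theorem exists_kummerCharacter {x : Kˣ} {y : Lˣ}
    (hy : y ^ 2 = Units.map (algebraMap K L : K →* L) x) :
    ∃ φ : Gal(L/K) →* Multiplicative (ZMod 2), ∀ g, signHom L (φ g) = g • y / y := by
  have h1 (g : Gal(L/K)) : (g • y / y) * (g • y / y) = 1 := by
    rw [← sq, div_pow, ← smul_pow', hy, smul_map, div_self']
  have h2 (g h : Gal(L/K)) : g • (h • y / y) = h • y / y := by
    have := congrArg Units.val (h1 h)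
    rw [Units.val_mul, Units.val_one, mul_self_eq_one_iff] at this
    rcases this with h' | h'
    · rw [show h • y / y = 1 from Units.ext h', smul_one]
    · rw [show h • y / y = -1 from Units.ext h']
      ext
      simp
  exact exists_signHom_comp_eq (R := L) (MonoidHom.mk' (fun g : Gal(L/K) ↦ g • y / y)
    fun g h ↦ by
      have := h2 g h
      rw [smul_div', ← mul_smul] at this
      rw [← this, mul_comm, div_mul_div_cancel]) h1

theorem exists_map_eq_div_of_kummerCharacter_eq {y y' : Lˣ}
    {φ : Gal(L/K) →* Multiplicative (ZMod 2)} (h : ∀ g, signHom L (φ g) = g • y / y)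
    (h' : ∀ g, signHom L (φ g) = g • y' / y') :
    ∃ z : Kˣ, Units.map (algebraMap K L : K →* L) z = y / y' :=
  exists_map_eq_of_smul_eq fun g ↦ by
    rw [smul_div', div_eq_div_iff_div_eq_div, ← h, h']

theorem relIndex_baseSquares_le :
    (baseSquares K L).relIndex (baseUnits K L ⊓ squares L) ≠ 0 ∧
      (baseSquares K L).relIndex (baseUnits K L ⊓ squares L) ≤
        Nat.card (Gal(L/K) →* Multiplicative (ZMod 2)) := by
  have key (x : ↥(baseUnits K L ⊓ squares L)) :
      ∃ (y : Lˣ) (φ : Gal(L/K) →* Multiplicative (ZMod 2)), y ^ 2 = x ∧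
        ∀ g, signHom L (φ g) = g • y / y := by
    obtain ⟨_, ⟨k, rfl⟩, ⟨y, hy⟩⟩ := x
    obtain ⟨φ, hφ⟩ := exists_kummerCharacter (K := K) (y := y) hy
    exact ⟨y, φ, hy, hφ⟩
  choose y φ hy hφ using key
  refine Subgroup.relIndex_le_card φ fun a b h ↦ ?_
  obtain ⟨z, hz⟩ := exists_map_eq_div_of_kummerCharacter_eq (hφ a) (h ▸ hφ b)
  refine ⟨z, ?_⟩
  rw [← hy, ← hy, ← div_pow, ← hz]
  simp

omit [IsGalois K L] in
theorem card_quotient_le_relIndex (hd : differentIdeal (𝓞 K) (𝓞 L) = ⊤)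
    (h0 : (baseSquares K L).relIndex (baseUnits K L ⊓ evenInvariants K L) ≠ 0) :
    Nat.card (ClassGroup (𝓞 K) ⧸ (powMonoidHom 2 : ClassGroup (𝓞 K) →* _).range) ≤
      (baseSquares K L).relIndex (baseUnits K L ⊓ evenInvariants K L) := by
  have hc : Nat.card (ClassGroup (𝓞 K) ⧸ (powMonoidHom 2 : ClassGroup (𝓞 K) →* _).range) =
      Nat.card (powMonoidHom 2 : ClassGroup (𝓞 K) →* _).ker := by
    have h1 := (powMonoidHom 2 : ClassGroup (𝓞 K) →* ClassGroup (𝓞 K)).range.card_mul_index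
    have h2 := (powMonoidHom 2 : ClassGroup (𝓞 K) →* ClassGroup (𝓞 K)).ker.card_mul_index
    rw [Subgroup.index_ker, mul_comm, ← h1] at h2
    exact (Nat.eq_of_mul_eq_mul_left Nat.card_pos h2).symm
  rw [hc]
  have key (c : (powMonoidHom 2 : ClassGroup (𝓞 K) →* ClassGroup (𝓞 K)).ker) :
      ∃ (D : HeightOneSpectrum (𝓞 K) →₀ ℤ) (x : Kˣ), divisorClass D = Additive.ofMul c.1 ∧
        ∀ v : HeightOneSpectrum (𝓞 K), v.ord x = 2 * D v := by
    obtain ⟨c, hc⟩ := c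
    obtain ⟨D, hD⟩ := divisorClass_surjective (𝓞 K) (Additive.ofMul c)
    have hc' : c ^ 2 = 1 := hc
    obtain ⟨x, hx⟩ := (divisorClass_eq_zero_iff K (n := 2 • D)).1 (by
      rw [map_nsmul, hD, ← ofMul_pow, hc', ofMul_one])
    exact ⟨D, x, hD, fun v ↦ by rw [hx]; simp⟩
  choose D x hD hx using key
  refine Subgroup.card_le_relIndex (fun c ↦ ⟨Units.map (algebraMap K L : K →* L) (x c),
    ⟨_, rfl⟩, baseUnits_le_invariants ⟨_, rfl⟩, fun v ↦ ?_⟩) (fun c c' h ↦ ?_) h0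
  · rw [ord_algebraMap hd, hx]
    exact even_two_mul _
  · obtain ⟨z, hz⟩ := h
    rw [← map_div] at hz
    have hz' := Units.map_injective (algebraMap K L).injective hz
    apply Subtype.ext
    apply Additive.ofMul.injective
    rw [← hD, ← hD, ← sub_eq_zero, ← map_sub, divisorClass_eq_zero_iff K]
    refine ⟨z, fun v ↦ ?_⟩
    have := congrArg v.ord hz'
    rw [powMonoidHom_apply, ord_pow, ord_div, hx, hx] at this
    rw [Finsupp.sub_apply]
    push_cast at this
    omega

theorem relIndex_evenInvariants_sup_le (hd : differentIdeal (𝓞 K) (𝓞 L) = ⊤) :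
    (evenInvariants K L ⊔ baseUnits K L).relIndex (invariants K L) ≠ 0 ∧
    (evenInvariants K L ⊔ baseUnits K L).relIndex (invariants K L) ≤
      Nat.card (ClassGroup (𝓞 K) ⧸ (powMonoidHom 2 : ClassGroup (𝓞 K) →* _).range) := by
  refine Subgroup.relIndex_le_card (fun x ↦
    (((divisorClass (push (divisor (R := 𝓞 L) x.1) : HeightOneSpectrum (𝓞 K) →₀ ℤ)).toMul :
      ClassGroup (𝓞 K)) : ClassGroup (𝓞 K) ⧸ (powMonoidHom 2 : ClassGroup (𝓞 K) →* _).range))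
    fun x y h ↦ ?_
  rw [eq_comm, QuotientGroup.eq] at h
  obtain ⟨c, hc⟩ := h
  obtain ⟨D, hD⟩ := divisorClass_surjective (𝓞 K) (Additive.ofMul c)
  obtain ⟨k, hk⟩ := (divisorClass_eq_zero_iff K
    (n := push (divisor (R := 𝓞 L) x.1) - push (divisor (R := 𝓞 L) y.1) - 2 • D)).1 (by
      rw [map_sub, map_sub, map_nsmul, hD, ← ofMul_pow, sub_eq_zero, sub_eq_neg_add]
      exact congrArg Additive.ofMul hc.symm)
  rw [← div_mul_cancel (x / y : Lˣ) (Units.map (algebraMap K L : K →* L) k)]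
  have hm : (x / y : Lˣ) ∈ invariants K L := div_mem x.2 y.2
  have hm' : (x / y / Units.map (algebraMap K L : K →* L) k : Lˣ) ∈ invariants K L :=
    div_mem hm (baseUnits_le_invariants ⟨k, rfl⟩)
  refine mul_mem (Subgroup.mem_sup_left ⟨hm', fun w ↦ ?_⟩)
    (Subgroup.mem_sup_right ⟨k, rfl⟩)
  obtain ⟨g, hg⟩ := exists_smul_eq_of_under_eq (K := K) (w := lift (w.under (𝓞 K))) (w' := w)
    (lift_under _)
  obtain ⟨s, hs⟩ := mem_invariants.1 hm g⁻¹
  have h1 := hk (w.under (𝓞 K))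
  have h2 : w.ord (x / y : Lˣ) = (lift (w.under (𝓞 K)) : HeightOneSpectrum (𝓞 L)).ord (g⁻¹ • (x / y : Lˣ)) := by
    rw [ord_smul, inv_inv, hg]
  rw [hs, ord_mul, ord_pow] at h2
  simp only [Finsupp.sub_apply, push_apply, divisor_apply, Finsupp.smul_apply] at h1
  rw [ord_div, h2, ord_div, ord_algebraMap hd, h1]
  refine ⟨D (w.under (𝓞 K)) + (lift (w.under (𝓞 K)) : HeightOneSpectrum (𝓞 L)).ord s, ?_⟩
  push_cast
  simp only [nsmul_eq_mul]
  push_cast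
  ring

end NumberField

namespace NumberField

open IsDedekindDomain HeightOneSpectrum
open scoped Pointwise

variable {K L : Type*} [Field K] [NumberField K] [Field L] [NumberField L] [Algebra K L]
  [IsGalois K L]

omit [NumberField K] [NumberField L] in
/-- Two real embeddings with the same restriction are conjugate. -/
theorem exists_comp_eq {σ τ : L →+* ℝ} (h : σ.comp (algebraMap K L) = τ.comp (algebraMap K L)) :
    ∃ g : Gal(L/K), ∀ x, τ x = σ (g x) := by
  obtain ⟨g, hg⟩ := ComplexEmbedding.exists_comp_symm_eq_of_comp_eq (k := K)
    (Complex.ofRealHom.comp σ) (Complex.ofRealHom.comp τ) (by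
      rw [RingHom.comp_assoc, RingHom.comp_assoc, h])
  exact ⟨g.symm, fun x ↦ Complex.ofReal_injective (RingHom.congr_fun hg x).symm⟩

omit [NumberField K] [NumberField L] in
theorem pos_iff_of_comp_eq {σ τ : L →+* ℝ}
    (h : σ.comp (algebraMap K L) = τ.comp (algebraMap K L)) {x : Lˣ} (hx : x ∈ invariants K L) :
    0 < τ x ↔ 0 < σ x := by
  obtain ⟨g, hg⟩ := exists_comp_eq h
  obtain ⟨s, hs⟩ := mem_invariants.1 hx g
  have h1 : g (x : L) = x * s ^ 2 := congrArg Units.val hs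
  have h2 : 0 < σ s ^ 2 := sq_pos_of_ne_zero ((map_ne_zero σ).2 s.ne_zero)
  rw [hg, h1, map_mul, map_pow, mul_pos_iff_of_pos_right h2]

theorem two_dvd_sub_trace (h2 : ∀ a : 𝓞 L, 2 ∣ a ^ 2 → 2 ∣ a) {t : 𝓞 L}
    (ht : Algebra.trace K L t = 1) {x y : Lˣ} {κ : 𝓞 L} (hx : x ∈ invariants K L)
    (h : (x * y ^ 2 : L) = 1 + 2 * κ) :
    2 ∣ κ - algebraMap (𝓞 K) (𝓞 L) (Algebra.intTrace (𝓞 K) (𝓞 L) (κ * t)) := by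
  classical
  have h1 (g : Gal(L/K)) : 2 ∣ κ - g • κ := by
    obtain ⟨s, hs⟩ := mem_invariants.1 hx g
    have hs' : g (x : L) = x * s ^ 2 := congrArg Units.val hs
    refine two_dvd_sub_of_mul_sq_eq h2 (d := s * g y / y) ?_
    have h3 := congrArg g h
    simp only [map_mul, map_pow, map_add, map_one, map_ofNat, hs'] at h3
    change _ = 1 + 2 * g (κ : L)
    rw [← h3, ← h]
    field_simp
  choose m hm using h1
  have h4 : ∑ g : Gal(L/K), g • t = 1 := by
    apply FaithfulSMul.algebraMap_injective (𝓞 L) L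
    have := trace_eq_sum_automorphisms (K := K) (t : L)
    rw [ht, map_one] at this
    rw [map_sum, map_one, this]
    rfl
  have h5 : algebraMap (𝓞 K) (𝓞 L) (Algebra.intTrace (𝓞 K) (𝓞 L) (κ * t)) =
      ∑ g : Gal(L/K), (g • κ) * (g • t) := by
    apply FaithfulSMul.algebraMap_injective (𝓞 L) L
    have := trace_eq_sum_automorphisms (K := K) ((κ * t : 𝓞 L) : L)
    rw [← Algebra.algebraMap_intTrace (A := 𝓞 K) (B := 𝓞 L)] at this
    rw [map_sum, ← IsScalarTower.algebraMap_apply, IsScalarTower.algebraMap_apply (𝓞 K) K L, this]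
    refine Finset.sum_congr rfl fun g _ ↦ ?_
    rw [← smul_mul']
    rfl
  refine ⟨∑ g : Gal(L/K), m g * (g • t), ?_⟩
  rw [h5, Finset.mul_sum, sub_eq_iff_eq_add, ← Finset.sum_add_distrib]
  conv_lhs => rw [← mul_one κ, ← h4, Finset.mul_sum]
  refine Finset.sum_congr rfl fun g _ ↦ ?_
  linear_combination (g • t) * hm g

theorem relIndex_squares_le (hK : Module.finrank ℚ K = 2)
    (hd : differentIdeal (𝓞 K) (𝓞 L) = ⊤) (h2 : ∀ a : 𝓞 L, 2 ∣ a ^ 2 → 2 ∣ a)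
    (hsel : ∀ x : Lˣ, IsSelmer x → x ∈ squares L) :
    (squares L).relIndex (evenInvariants K L) ≠ 0 ∧
      (squares L).relIndex (evenInvariants K L) ≤ 16 := by
  classical
  obtain ⟨t, ht⟩ := exists_trace_eq_one K hd
  choose y κ hκ using fun x : evenInvariants K L ↦ exists_mul_sq_eq_of_even h2 x.1 x.2.2
  let I : Ideal (𝓞 K) := Ideal.span {2}
  have hI : I ≠ ⊥ := by simp [I]
  have := Ideal.finiteQuotientOfFreeOfNeBot I hI
  have hinj : Function.Injective fun ρ : K →+* ℝ ↦ Complex.ofRealHom.comp ρ := fun ρ ρ' h ↦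
    RingHom.ext fun x ↦ Complex.ofReal_injective (RingHom.congr_fun h x)
  have : Finite (K →+* ℝ) := Finite.of_injective _ hinj
  have hcard1 : Nat.card (K →+* ℝ) ≤ 2 := by
    refine (Nat.card_le_card_of_injective _ hinj).trans ?_
    rw [Nat.card_eq_fintype_card, Embeddings.card, hK]
  have hcard2 : Nat.card (𝓞 K ⧸ I) = 4 := by
    have : Ideal.absNorm I = 4 := by
      rw [Ideal.absNorm_span_singleton, show (2 : 𝓞 K) = algebraMap ℤ (𝓞 K) 2 by simp,
        Algebra.norm_algebraMap, RingOfIntegers.rank, hK]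
      norm_num
    exact this
  have hcard : Nat.card (((K →+* ℝ) → Bool) × (𝓞 K ⧸ I)) ≤ 16 := by
    rw [Nat.card_prod, hcard2, Nat.card_fun, Nat.card_eq_fintype_card (α := Bool),
      Fintype.card_bool]
    calc 2 ^ Nat.card (K →+* ℝ) * 4 ≤ 2 ^ 2 * 4 := by gcongr; norm_num
      _ = 16 := by norm_num
  refine And.imp_right (fun h ↦ h.trans hcard) (Subgroup.relIndex_le_card (fun x ↦ (fun ρ ↦ decide (∃ σ : L →+* ℝ,
    σ.comp (algebraMap K L) = ρ ∧ 0 < σ x.1), Ideal.Quotient.mk I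
      (Algebra.intTrace (𝓞 K) (𝓞 L) (κ x * t)))) fun x x' h ↦ hsel _ ⟨fun σ ↦ ?_, fun v ↦ ?_, ?_⟩)
  · have h1 (x : evenInvariants K L) : (∃ τ : L →+* ℝ,
        τ.comp (algebraMap K L) = σ.comp (algebraMap K L) ∧ 0 < τ x.1) ↔ 0 < σ x.1 :=
      ⟨fun ⟨τ, h, hτ⟩ ↦ (pos_iff_of_comp_eq h x.2.1).2 hτ, fun h ↦ ⟨σ, rfl, h⟩⟩
    have h3 := congrFun (congrArg Prod.fst h) (σ.comp (algebraMap K L))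
    simp only [h1, decide_eq_decide] at h3
    have hx : σ x.1 ≠ 0 := (map_ne_zero σ).2 x.1.ne_zero
    have hx' : σ x'.1 ≠ 0 := (map_ne_zero σ).2 x'.1.ne_zero
    rw [Units.val_div_eq_div_val, map_div₀]
    rcases hx.lt_or_gt with h4 | h4
    · exact div_pos_of_neg_of_neg h4 (hx'.lt_of_le (not_lt.1 fun h ↦ (h3.2 h).not_gt h4))
    · exact div_pos h4 (h3.1 h4)
  · rw [ord_div]
    exact (x.2.2 v).sub (x'.2.2 v)
  · have h3 := congrArg Prod.snd h
    simp only [Ideal.Quotient.eq, I, Ideal.mem_span_singleton] at h3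
    have h4 := map_dvd (algebraMap (𝓞 K) (𝓞 L)) h3
    rw [map_ofNat, map_sub] at h4
    have h5 := ((two_dvd_sub_trace h2 ht x.2.1 (hκ x)).add h4).sub
      (two_dvd_sub_trace h2 ht x'.2.1 (hκ x'))
    obtain ⟨m, hm⟩ := h5
    have h0 : (1 + 2 * κ x' : L) ≠ 0 := by
      rw [← hκ]
      exact mul_ne_zero x'.1.ne_zero (pow_ne_zero 2 (y x').ne_zero)
    refine ⟨y x / y x' * Units.mk0 _ h0, κ x' + m + κ x * κ x', ?_⟩
    have h6 : (κ x - κ x' : L) = 2 * m := by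
      have := congrArg (algebraMap (𝓞 L) L) (show κ x - κ x' = 2 * m by rw [← hm]; ring)
      simpa only [map_sub, map_mul, map_ofNat] using this
    have h7 : ((x.1 / x'.1 : Lˣ) * (y x / y x' * Units.mk0 _ h0 : Lˣ) ^ 2 : L) =
        (1 + 2 * κ x) * (1 + 2 * κ x') := by
      push_cast
      simp only [Units.val_mk0]
      rw [← hκ, ← hκ]
      field_simp
    rw [h7]
    push_cast
    linear_combination 2 * h6

theorem relIndex_sup_squares_le (hK : Module.finrank ℚ K = 2)
    (hd : differentIdeal (𝓞 K) (𝓞 L) = ⊤) (h2 : ∀ a : 𝓞 L, 2 ∣ a ^ 2 → 2 ∣ a)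
    (hsel : ∀ x : Lˣ, IsSelmer x → x ∈ squares L) :
    (baseUnits K L ⊔ squares L).relIndex (invariants K L) ≠ 0 ∧
      (baseUnits K L ⊔ squares L).relIndex (invariants K L) ≤
        16 * Nat.card (Gal(L/K) →* Multiplicative (ZMod 2)) := by
  obtain ⟨h1, h1'⟩ := relIndex_evenInvariants_sup_le (K := K) (L := L) hd
  obtain ⟨h3, h3'⟩ := relIndex_squares_le hK hd h2 hsel
  obtain ⟨h4, h4'⟩ := relIndex_baseSquares_le (K := K) (L := L)
  exact Subgroup.relIndex_sup_le squares_le_evenInvariants evenInvariants_le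
    baseUnits_le_invariants baseSquares_le_baseUnits baseSquares_le_squares h1 h1' h3 h3' h4 h4'
    (card_quotient_le_relIndex hd)

end NumberField

namespace NumberField

open IsDedekindDomain HeightOneSpectrum
open scoped Pointwise

/-- If every element generating an everywhere unramified extension is a square, then the Galois
group has few generators. -/
theorem card_hom_le {K L : Type} [Field K] [NumberField K] [Field L] [NumberField L] [Algebra K L]
    [IsGalois K L] [IsTotallyReal L] {n : ℕ} (hn : Module.finrank K L = 2 ^ n)
    (hK : Module.finrank ℚ K = 2) (hd : differentIdeal (𝓞 K) (𝓞 L) = ⊤)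
    (h2 : ∀ a : 𝓞 L, 2 ∣ a ^ 2 → 2 ∣ a) (hsel : ∀ x : Lˣ, IsSelmer x → x ∈ squares L) :
    Nat.card (Gal(L/K) →* Multiplicative (ZMod 2)) ≤ 2 ^ 7 := by
  have hG : IsPGroup 2 Gal(L/K) := IsPGroup.of_card (n := n) (by
    rw [IsGalois.card_aut_eq_finrank, hn])
  obtain ⟨Γ, _, _, π, d, r, hπ, hd', hdr, hr, htriv⟩ := GroupAlgebra.exists_cover Gal(L/K) hG
  obtain ⟨h0, hle⟩ := relIndex_sup_squares_le hK hd h2 hsel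
  rw [hd'] at hle ⊢
  have key (φ : {φ : π.ker →* Multiplicative (ZMod 2) //
      ∀ (x : Γ) (n m : π.ker), (m : Γ) = x * n * x⁻¹ → φ m = φ n}) :
      ∃ (β : Γ → Lˣ) (e : Lˣ), (∀ x y, β (x * y) = β x * π x • β y) ∧
        (∀ x : π.ker, β x = signHom L (φ.1 x)) ∧ ∀ x, β x ^ 2 = π x • e / e := by
    obtain ⟨β, hβ, hβ'⟩ := exists_crossedHom n K hn hd Γ π hπ ((signHom L).comp φ.1)
      (fun x ↦ signHom_mul_self _) fun x n m h ↦ congrArg (signHom L) (φ.2 x n m h)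
    obtain ⟨e, he⟩ := exists_eq_smul_div (r := fun x ↦ β x ^ 2) hπ
      (fun x y ↦ by simp only [hβ, mul_pow, smul_pow']) fun x hx ↦ by
        have := hβ' ⟨x, hx⟩
        simp only at this
        rw [this, sq]
        exact signHom_mul_self _
    exact ⟨β, e, hβ, hβ', he⟩
  choose β e hβ hβ' he using key
  have hcount : 2 ^ r ≤ (baseUnits K L ⊔ squares L).relIndex (invariants K L) := by
    rw [← hr]
    refine Subgroup.card_le_relIndex (fun φ ↦ ⟨e φ, fun g ↦ ?_⟩) (fun φ ψ h ↦ ?_) h0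
    · obtain ⟨x, rfl⟩ := hπ g
      exact ⟨β φ x, he φ x⟩
    · obtain ⟨_, ⟨k, rfl⟩, _, ⟨s, rfl⟩, hs⟩ := Subgroup.mem_sup.1 h
      simp only [powMonoidHom_apply] at hs
      have hs' : e φ = Units.map (algebraMap K L : K →* L) k * s ^ 2 * e ψ := by
        rw [hs, div_mul_cancel]
      let χ (x : Γ) : Lˣ := β φ x / β ψ x * (s / π x • s)
      have hχ (x : Γ) : χ x * χ x = 1 := by
        rw [← sq, mul_pow, div_pow, he, he, hs', smul_mul', smul_mul', smul_map, smul_pow', div_pow]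
        have (a b c d f : Lˣ) : a * b * c / (a * d * f) / (c / f) * (d / b) = 1 := by
          ext
          push_cast [Units.val_div_eq_div_val]
          field_simp
        exact this ..
      have hfix (g : Gal(L/K)) (x : Γ) : g • χ x = χ x := by
        have := congrArg Units.val (hχ x)
        rw [Units.val_mul, Units.val_one, mul_self_eq_one_iff] at this
        rcases this with h' | h'
        · rw [show χ x = 1 from Units.ext h', smul_one]
        · rw [show χ x = -1 from Units.ext h']
          ext
          simp
      have hmul (x y : Γ) : χ (x * y) = χ x * χ y := by
        rw [← hfix (π x) y]
        simp only [χ, hβ, map_mul, mul_smul, smul_mul', smul_div']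
        have (a b c d f g i : Lˣ) : a * b / (c * d) * (f / g) = a / c * (f / i) * (b / d * (i / g)) := by
          ext
          push_cast [Units.val_div_eq_div_val]
          field_simp
        exact this ..
      obtain ⟨φ₀, hφ₀⟩ := exists_signHom_comp_eq (R := L) (MonoidHom.mk' χ hmul) hχ
      apply Subtype.ext
      ext1 x
      apply signHom_injective L
      have h3 := hφ₀ x
      rw [show φ₀ x = 1 from DFunLike.congr_fun (htriv φ₀) x, map_one] at h3
      change 1 = β φ x / β ψ x * (s / π x • s) at h3
      rw [show π x = 1 from x.2, one_smul, div_self', mul_one, hβ', hβ', eq_comm,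
        div_eq_one] at h3
      exact h3
  have : 2 ^ r ≤ 2 ^ (4 + d) := by
    rw [pow_add]
    exact hcount.trans hle
  have := (Nat.pow_le_pow_iff_right (by norm_num)).1 this
  exact Nat.pow_le_pow_right (by norm_num) (by omega)

end NumberField

/-! ### Adjoining square roots to number fields -/

open Polynomial in
theorem exists_isQuadraticExtension_sq_eq {L : Type} [Field L] {α : L} (hα : ¬ IsSquare α) :
    ∃ (L' : Type) (_ : Field L') (_ : Algebra L L') (θ : L'), Algebra.IsQuadraticExtension L L' ∧
      θ ^ 2 = algebraMap L L' α ∧ ∀ (f : L →+* L') (t : L'), t ^ 2 = f α →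
        ∃ F : L' →+* L', F.comp (algebraMap L L') = f ∧ F θ = t := by
  have hirr : Irreducible (X ^ 2 - C α) := X_pow_sub_C_irreducible_of_prime Nat.prime_two
    fun b hb ↦ hα ⟨b, by rw [← hb, sq]⟩
  have : Fact (Irreducible (X ^ 2 - C α)) := ⟨hirr⟩
  refine ⟨AdjoinRoot (X ^ 2 - C α), inferInstance, inferInstance, AdjoinRoot.root _, ⟨?_⟩, ?_, ?_⟩
  · rw [(AdjoinRoot.powerBasis hirr.ne_zero).finrank, AdjoinRoot.powerBasis_dim,
      natDegree_X_pow_sub_C]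
  · have := AdjoinRoot.eval₂_root (X ^ 2 - C α)
    rw [eval₂_sub, eval₂_pow, eval₂_X, eval₂_C, sub_eq_zero] at this
    exact this
  · intro f t ht
    have h : eval₂ f t (X ^ 2 - C α) = 0 := by simp [ht]
    exact ⟨AdjoinRoot.lift f t h, RingHom.ext fun x ↦ AdjoinRoot.lift_of h, AdjoinRoot.lift_root h⟩

section Galois

variable {K L L' : Type*} [Field K] [Field L] [Field L'] [Algebra K L] [Algebra L L'] [Algebra K L']
  [IsScalarTower K L L']

theorem Algebra.IsQuadraticExtension.adjoin_eq_top [Algebra.IsQuadraticExtension L L']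
    {x : L'} (hx : x ∉ (algebraMap L L').range) : Algebra.adjoin L {x} = ⊤ := by
  have : FiniteDimensional L L' := inferInstance
  have h2 := IntermediateField.isSimpleOrder_of_finrank_prime L L'
    (Algebra.IsQuadraticExtension.finrank_eq_two L L' ▸ Nat.prime_two)
  rw [← IntermediateField.adjoin_simple_toSubalgebra_of_isAlgebraic
    (Algebra.IsAlgebraic.isAlgebraic x)]
  rcases h2.eq_bot_or_eq_top (IntermediateField.adjoin L {x}) with h | h
  · rw [IntermediateField.adjoin_simple_eq_bot_iff, IntermediateField.mem_bot] at h
    exact absurd h hx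
  · rw [h, IntermediateField.top_toSubalgebra]

theorem isGalois_of_lift [CharZero K] [IsGalois K L] [FiniteDimensional K L]
    [Algebra.IsQuadraticExtension L L']
    (h : ∀ g : Gal(L/K), ∃ F : L' →+* L', F.comp (algebraMap L L') =
      (algebraMap L L').comp (g : L →+* L)) : IsGalois K L' := by
  have : CharZero L := charZero_of_injective_algebraMap (algebraMap K L).injective
  have : FiniteDimensional K L' := FiniteDimensional.trans K L L'
  refine IsGalois.of_fixedField_eq_bot K L' (le_bot_iff.1 fun x hx ↦ ?_)
  rw [IntermediateField.mem_fixedField_iff] at hx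
  obtain ⟨y, rfl⟩ := (IsGalois.mem_range_algebraMap_iff_fixed (F := L) x).2 fun f ↦
    hx (f.restrictScalars K) trivial
  obtain ⟨z, rfl⟩ := (IsGalois.mem_range_algebraMap_iff_fixed (F := K) y).2 fun g ↦ by
    obtain ⟨F, hF⟩ := h g
    have hF' (a : L) : F (algebraMap L L' a) = algebraMap L L' (g a) := RingHom.congr_fun hF a
    let F' : L' →ₐ[K] L' := ⟨F, fun r ↦ by
      change F (algebraMap K L' r) = _
      rw [IsScalarTower.algebraMap_apply K L L', hF', g.commutes]⟩
    have := hx (AlgEquiv.ofBijective F' (Algebra.IsAlgebraic.algHom_bijective F')) trivial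
    exact (algebraMap L L').injective ((hF' y).symm.trans this)
  exact IntermediateField.mem_bot.2 ⟨z, IsScalarTower.algebraMap_apply K L L' z⟩

end Galois

namespace NumberField

theorem isTotallyReal_of_forall_pos {L L' : Type*} [Field L] [NumberField L] [Field L']
    [NumberField L'] [Algebra L L'] [Algebra.IsQuadraticExtension L L'] [IsTotallyReal L]
    {α : L} {θ : L'} (hα : ¬ IsSquare α) (hθ : θ ^ 2 = algebraMap L L' α)
    (hpos : ∀ σ : L →+* ℝ, 0 < σ α) : IsTotallyReal L' := by
  refine ⟨fun v ↦ ?_⟩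
  rw [InfinitePlace.isReal_iff, ComplexEmbedding.isReal_iff]
  set φ := v.embedding
  have hθ' : θ ∉ (algebraMap L L').range := by
    rintro ⟨a, rfl⟩
    rw [← map_pow] at hθ
    exact hα ⟨a, by rw [← sq]; exact ((algebraMap L L').injective hθ).symm⟩
  have hreal : ComplexEmbedding.IsReal (φ.comp (algebraMap L L')) := by
    have := IsTotallyReal.isReal (InfinitePlace.mk (φ.comp (algebraMap L L')))
    rwa [InfinitePlace.isReal_mk_iff] at this
  have h1 (x : L) : φ (algebraMap L L' x) = (hreal.embedding x : ℂ) :=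
    (ComplexEmbedding.IsReal.coe_embedding_apply hreal x).symm
  have h2 : φ θ ^ 2 = (hreal.embedding α : ℂ) := by rw [← map_pow, hθ, h1]
  have h3 := hpos hreal.embedding
  obtain ⟨t, ht⟩ : ∃ t : ℝ, φ θ = t := by
    have : (Real.sqrt (hreal.embedding α) : ℂ) ^ 2 = φ θ ^ 2 := by
      rw [h2, ← Complex.ofReal_pow, Real.sq_sqrt h3.le]
    rcases sq_eq_sq_iff_eq_or_eq_neg.1 this with h | h
    · exact ⟨_, h.symm⟩
    · exact ⟨-Real.sqrt (hreal.embedding α), by rw [Complex.ofReal_neg, h, neg_neg]⟩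
  let _ : Algebra L ℂ := (φ.comp (algebraMap L L')).toAlgebra
  let φ₁ : L' →ₐ[L] ℂ := ⟨φ, fun _ ↦ rfl⟩
  let φ₂ : L' →ₐ[L] ℂ := ⟨ComplexEmbedding.conjugate φ, fun x ↦ by
    change (starRingEnd ℂ) (φ (algebraMap L L' x)) = φ (algebraMap L L' x)
    rw [h1, Complex.conj_ofReal]⟩
  have : φ₂ = φ₁ := AlgHom.ext_of_adjoin_eq_top
    (Algebra.IsQuadraticExtension.adjoin_eq_top hθ') fun x hx ↦ by
      rw [Set.mem_singleton_iff.1 hx]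
      change (starRingEnd ℂ) (φ θ) = φ θ
      rw [ht, Complex.conj_ofReal]
  exact congrArg (fun f : L' →ₐ[L] ℂ ↦ (f : L' →+* ℂ)) this

end NumberField

open Polynomial in
theorem minpoly.eq_X_sq_sub {A B : Type*} [CommRing A] [IsDomain A] [IsIntegrallyClosed A]
    [CommRing B] [IsDomain B] [Algebra A B] [Module.IsTorsionFree A B] {z : B} {b c : A}
    (hz : z ^ 2 = algebraMap A B b * z + algebraMap A B c) (hzA : z ∉ (algebraMap A B).range) :
    minpoly A z = X ^ 2 - (C b * X + C c) := by
  have hmonic : (X ^ 2 - (C b * X + C c)).Monic := monic_X_pow_sub (n := 2) degree_linear_lt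
  have h0 : Polynomial.aeval z (X ^ 2 - (C b * X + C c)) = 0 := by simp [hz]
  have h2 := (minpoly.two_le_natDegree_iff ⟨_, hmonic, h0⟩).2 hzA
  refine (minpoly.IsIntegrallyClosed.unique_of_degree_le_degree_minpoly hmonic h0 ?_).symm
  rw [degree_eq_natDegree (minpoly.ne_zero ⟨_, hmonic, h0⟩)]
  refine (degree_le_of_natDegree_le (n := 2) ?_).trans (by exact_mod_cast h2)
  compute_degree

namespace NumberField

set_option linter.unusedSectionVars false

open IsDedekindDomain HeightOneSpectrum

section Different

variable {L L' : Type*} [Field L] [NumberField L] [Field L'] [NumberField L'] [Algebra L L']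
  [Algebra.IsQuadraticExtension L L']

open Polynomial in
theorem exists_two_mul_sub_mem_differentIdeal {z : L'} {b c : 𝓞 L}
    (hz : z ^ 2 = algebraMap L L' b * z + algebraMap L L' c)
    (hzL : z ∉ (algebraMap L L').range) :
    ∃ z' : 𝓞 L', z' = z ∧
      z' ^ 2 = algebraMap (𝓞 L) (𝓞 L') b * z' + algebraMap (𝓞 L) (𝓞 L') c ∧
      2 * z' - algebraMap (𝓞 L) (𝓞 L') b ∈ differentIdeal (𝓞 L) (𝓞 L') := by
  have hint : IsIntegral ℤ z := by
    refine isIntegral_trans (A := 𝓞 L) z ⟨X ^ 2 - (C b * X + C c),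
      monic_X_pow_sub (n := 2) degree_linear_lt, ?_⟩
    simp only [eval₂_sub, eval₂_pow, eval₂_X, eval₂_add, eval₂_mul, eval₂_C, hz]
    exact sub_self _
  let z₀ : 𝓞 L' := ⟨z, hint⟩
  have hz' : z₀ ^ 2 = algebraMap (𝓞 L) (𝓞 L') b * z₀ + algebraMap (𝓞 L) (𝓞 L') c :=
    RingOfIntegers.coe_injective hz
  refine ⟨z₀, rfl, hz', ?_⟩
  have hmem := aeval_derivative_mem_differentIdeal (𝓞 L) L L' z₀
    (Algebra.IsQuadraticExtension.adjoin_eq_top hzL)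
  rw [minpoly.eq_X_sq_sub hz' fun ⟨x, hx⟩ ↦ hzL ⟨x, congrArg Subtype.val hx⟩] at hmem
  simpa [one_add_one_eq_two, sub_eq_add_neg, map_ofNat (algebraMap (𝓞 L) (𝓞 L')) 2] using hmem

variable {α : L} {θ : L'}

theorem mul_notMem_range (hα : ¬ IsSquare α) (hθ : θ ^ 2 = algebraMap L L' α) (y : Lˣ) :
    algebraMap L L' y * θ ∉ (algebraMap L L').range := by
  rintro ⟨x, hx⟩
  refine hα ⟨x / y, (algebraMap L L').injective ?_⟩
  have hy : algebraMap L L' y ≠ 0 := by simp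
  rw [← hθ, ← sq, map_pow, map_div₀, hx]
  field_simp

theorem not_dvd_differentIdeal_of_two_mem (hα : ¬ IsSquare α) (hθ : θ ^ 2 = algebraMap L L' α)
    {y : Lˣ} {w : 𝓞 L} (h : α * y ^ 2 = 1 + 4 * w) (P : HeightOneSpectrum (𝓞 L'))
    (hP : 2 ∈ P.asIdeal) : ¬ P.asIdeal ∣ differentIdeal (𝓞 L) (𝓞 L') := by
  rw [Ideal.dvd_iff_le]
  intro hle
  obtain ⟨z, hz, -, hmem⟩ := exists_two_mul_sub_mem_differentIdeal (L := L)
    (z := (1 + algebraMap L L' y * θ) / 2) (b := 1) (c := w) (by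
      have := congrArg (algebraMap L L') h
      simp only [map_mul, map_pow, ← hθ, map_add, map_one, map_ofNat] at this ⊢
      linear_combination this / 4) fun ⟨x, hx⟩ ↦ mul_notMem_range hα hθ y ⟨2 * x - 1, by
        rw [map_sub, map_mul, hx]
        simp only [map_ofNat, map_one]
        ring⟩
  rw [map_one] at hmem
  refine P.isPrime.ne_top ((Ideal.eq_top_iff_one _).2 ?_)
  have := P.asIdeal.sub_mem (P.asIdeal.mul_mem_right z hP) (hle hmem)
  rwa [sub_sub_cancel] at this

theorem differentIdeal_eq_top_of_sq_eq {α : Lˣ} (hα : ¬ IsSquare (α : L))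
    (hθ : θ ^ 2 = algebraMap L L' α) (hev : ∀ v : HeightOneSpectrum (𝓞 L), Even (v.ord α))
    {y : Lˣ} {w : 𝓞 L} (h : (α * y ^ 2 : L) = 1 + 4 * w) :
    differentIdeal (𝓞 L) (𝓞 L') = ⊤ := by
  by_contra hne
  obtain ⟨P, hP, hle⟩ := Ideal.exists_le_maximal _ hne
  let v : HeightOneSpectrum (𝓞 L') := ⟨P, hP.isPrime, by
    rintro rfl
    exact differentIdeal_ne_bot (le_bot_iff.1 hle)⟩
  by_cases h2 : (2 : 𝓞 L') ∈ P
  · exact not_dvd_differentIdeal_of_two_mem hα hθ h v h2 (Ideal.dvd_iff_le.2 hle)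
  obtain ⟨y, a, ha, hv⟩ := exists_ord_mul_sq_eq_zero {v.under (𝓞 L)} α hev
  obtain ⟨z, -, hz, hmem⟩ := exists_two_mul_sub_mem_differentIdeal (L := L)
    (z := algebraMap L L' y * θ) (b := 0) (c := a) (by
      have ha' : (a : L) = α * y ^ 2 := ha
      rw [ha', mul_pow, hθ]
      simp only [map_zero, map_mul, map_pow]
      ring) (mul_notMem_range hα hθ y)
  simp only [map_zero, sub_zero, zero_mul, zero_add] at hz hmem
  have hzP := (hP.isPrime.mem_or_mem (hle hmem)).resolve_left h2
  have haP : algebraMap (𝓞 L) (𝓞 L') a ∈ P := hz ▸ P.pow_mem_of_mem hzP 2 two_pos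
  exact ((ord_pos_iff_mem (v.under (𝓞 L)) ha).2 haP).ne' (hv _ (by simp))

end Different

section TwoAdic

variable {L : Type*} [Field L] [NumberField L]

theorem two_dvd_of_two_dvd_sq (h : ∀ (v : HeightOneSpectrum (𝓞 L)) (x : Lˣ), x = (2 : L) →
    v.ord x ≤ 1) (a : 𝓞 L) (ha : 2 ∣ a ^ 2) : 2 ∣ a := by
  rcases eq_or_ne a 0 with rfl | ha0
  · exact dvd_zero _
  obtain ⟨b, hb⟩ := ha
  have hb0 : b ≠ 0 := by rintro rfl; simp_all
  let t : Lˣ := Units.mk0 2 two_ne_zero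
  let a' : Lˣ := Units.mk0 a (by simpa using ha0)
  let b' : Lˣ := Units.mk0 b (by simpa using hb0)
  have hab : a' ^ 2 = t * b' := Units.ext (by
    have := congrArg (algebraMap (𝓞 L) L) hb
    rwa [map_pow, map_mul, map_ofNat] at this)
  obtain ⟨c, hc⟩ := exists_algebraMap_eq_of_ord_nonneg (R := 𝓞 L) (x := a' / t) fun v ↦ by
    have h1 := congrArg v.ord hab
    rw [ord_pow, ord_mul] at h1
    have h2 := h v t rfl
    have h3 := ord_nonneg_of_mem v (x := b') (a := b) rfl
    have h4 := ord_nonneg_of_mem v (x := t) (a := 2) (map_ofNat _ 2)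
    rw [ord_div]
    push_cast at h1
    omega
  refine ⟨c, RingOfIntegers.coe_injective ?_⟩
  have hc' : (c : L) = a / 2 := by
    have : (c : L) = ((a' / t : Lˣ) : L) := hc
    rw [this, Units.val_div_eq_div_val]
    rfl
  change (a : L) = algebraMap (𝓞 L) L (2 * c)
  rw [map_mul, map_ofNat]
  exact (hc' ▸ mul_div_cancel₀ _ two_ne_zero).symm

theorem ord_two_le_one (hL : Module.finrank ℚ L = 1) (v : HeightOneSpectrum (𝓞 L)) (x : Lˣ)
    (hx : x = (2 : L)) : v.ord x ≤ 1 := by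
  have hnorm : Algebra.norm ℤ (2 : 𝓞 L) = 2 := by
    have := Algebra.norm_algebraMap (R := ℤ) (S := 𝓞 L) 2
    rw [RingOfIntegers.rank, hL, pow_one, map_ofNat] at this
    exact this
  by_contra! h
  have h0 : algebraMap (𝓞 L) L 2 = x := by rw [hx, map_ofNat]
  have h2 := (v.le_ord_iff_mem_pow h0 2).1 h
  have h3 := Ideal.absNorm_dvd_absNorm_of_le ((Ideal.span_singleton_le_iff_mem _).2 h2)
  rw [map_pow, Ideal.absNorm_span_singleton, hnorm] at h3
  have h5 : Ideal.absNorm v.asIdeal ≠ 1 := fun h ↦ v.isPrime.ne_top (Ideal.absNorm_eq_one_iff.1 h)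
  generalize Ideal.absNorm v.asIdeal = m at h3 h5
  replace h3 : m ^ 2 ∣ 2 := h3
  have h6 : m ^ 2 ≤ 2 := Nat.le_of_dvd two_pos h3
  have h7 : m ≤ 1 := by nlinarith
  interval_cases m
  · simp at h3
  · exact h5 rfl

end TwoAdic

end NumberField

/-! ### An infinite everywhere unramified tower of totally real fields -/

/-- If a finite `2`-group acts on an abelian group, a predicate closed under `x ↦ g • x / x` which
is not contained in the subgroup `S` contains an element outside of `S` which is fixed modulo `S`. -/
theorem exists_smul_div_mem_of_card {G E : Type*} [Group G] [Finite G] [CommGroup E]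
    [MulDistribMulAction G E] {n : ℕ} (hG : Nat.card G = 2 ^ n) (S : Subgroup E)
    (hS : ∀ (g : G), ∀ x ∈ S, g • x ∈ S) (hsq : ∀ x : E, x ^ 2 ∈ S) (P : E → Prop)
    (hP : ∀ (g : G) (x : E), P x → P (g • x / x)) (h : ∃ x, P x ∧ x ∉ S) :
    ∃ x, P x ∧ x ∉ S ∧ ∀ g : G, g • x / x ∈ S := by
  induction n generalizing G with
  | zero =>
    obtain ⟨x, hx, hxS⟩ := h
    have := (Nat.card_eq_one_iff_unique.1 hG).1
    exact ⟨x, hx, hxS, fun g ↦ by simp [Subsingleton.elim g 1, one_mem]⟩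
  | succ n ih =>
    obtain ⟨H, hH⟩ := Sylow.exists_subgroup_card_pow_prime (G := G) 2 (n := n)
      (hG ▸ pow_dvd_pow 2 n.le_succ)
    have hidx : H.index = 2 := by
      have := H.card_mul_index
      rw [hH, hG, pow_succ] at this
      exact Nat.eq_of_mul_eq_mul_left (by positivity) this
    have hnorm : H.Normal := Subgroup.normal_of_index_eq_two hidx
    obtain ⟨x, hx, hxS, hfix⟩ := ih hH (fun g ↦ hS g) (fun g ↦ hP g)
    replace hfix (g : G) (hg : g ∈ H) : g • x / x ∈ S := hfix ⟨g, hg⟩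
    have key (g : G) (hg : g ∉ H) (y : E) (hy : ∀ h ∈ H, h • y / y ∈ S) (hgy : g • y / y ∈ S)
        (k : G) : k • y / y ∈ S := by
      by_cases hk : k ∈ H
      · exact hy k hk
      · have h1 := hS g _ (hy (g⁻¹ * k) ((Subgroup.mul_mem_iff_of_index_two hidx).2
          (by rw [inv_mem_iff]; exact iff_of_false hg hk)))
        rw [smul_div', mul_smul, smul_inv_smul] at h1
        simpa using mul_mem h1 hgy
    obtain ⟨g, hg⟩ : ∃ g, g ∉ H := by
      by_contra! h'
      rw [(Subgroup.eq_top_iff' H).2 h', Subgroup.index_top] at hidx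
      omega
    by_cases hgx : g • x / x ∈ S
    · exact ⟨x, hx, hxS, key g hg x hfix hgx⟩
    · refine ⟨g • x / x, hP g x hx, hgx, key g hg _ (fun k hk ↦ ?_) ?_⟩
      · have h1 := hS g _ (hfix (g⁻¹ * k * g) (by simpa using hnorm.conj_mem k hk g⁻¹))
        rw [smul_div', ← mul_smul, mul_assoc, mul_inv_cancel_left, mul_smul] at h1
        have := div_mem h1 (hfix k hk)
        rwa [smul_div', div_div_div_comm]
      · have h1 := hfix _ (Subgroup.mul_self_mem_of_index_two hidx g)
        have h2 := mul_mem h1 (hsq (x / g • x))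
        rw [mul_smul] at h2
        rw [smul_div']
        convert h2 using 1
        rw [sq, ← mul_assoc, div_mul_div_cancel, div_div_eq_mul_div, mul_div_assoc]

namespace NumberField

open IsDedekindDomain HeightOneSpectrum

section

variable {K L : Type*} [Field K] [NumberField K] [Field L] [NumberField L] [Algebra K L]

omit [NumberField K] in
theorem IsSelmer.smul_div (g : Gal(L/K)) {x : Lˣ} (hx : IsSelmer x) : IsSelmer (g • x / x) := by
  obtain ⟨hpos, hev, y, w, hy⟩ := hx
  refine ⟨fun σ ↦ ?_, fun v ↦ ?_, g • y * (x * y), w + g • w + 4 * w * g • w, ?_⟩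
  · rw [Units.val_div_eq_div_val, map_div₀]
    exact div_pos (hpos (σ.comp (g : L →+* L))) (hpos σ)
  · rw [ord_div, ord_smul]
    exact (hev _).sub (hev _)
  · have h1 := congrArg g hy
    have h3 : ((g • x : Lˣ) : L) = g x := rfl
    have h4 : ((g • y : Lˣ) : L) = g y := rfl
    simp only [map_mul, map_pow, map_add, map_one, map_ofNat] at h1
    push_cast [Units.val_div_eq_div_val]
    simp only [map_ofNat, h3, h4, AlgEquiv.smul_def]
    have : (x : L) ≠ 0 := x.ne_zero
    field_simp
    linear_combination (x * y ^ 2 : L) * h1 + (1 + 4 * g w) * hy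

end

section Step

variable {K L : Type} [Field K] [NumberField K] [Field L] [NumberField L] [Algebra K L]
  [IsGalois K L] [IsTotallyReal L]

theorem exists_extension {n : ℕ} (hn : Module.finrank K L = 2 ^ n)
    (hd : differentIdeal (𝓞 K) (𝓞 L) = ⊤) (h : ∃ x : Lˣ, IsSelmer x ∧ x ∉ squares L) :
    ∃ (L' : Type) (_ : Field L') (_ : NumberField L') (_ : Algebra K L'),
      IsGalois K L' ∧ IsTotallyReal L' ∧ Module.finrank K L' = 2 ^ (n + 1) ∧
      differentIdeal (𝓞 K) (𝓞 L') = ⊤ := by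
  obtain ⟨α, hα, hαS, hfix⟩ := exists_smul_div_mem_of_card (G := Gal(L/K)) (n := n)
    (by rw [IsGalois.card_aut_eq_finrank, hn]) (squares L)
    (by rintro g _ ⟨y, rfl⟩; exact ⟨g • y, by simp⟩) (fun x ↦ ⟨x, rfl⟩) IsSelmer
    (fun g x hx ↦ hx.smul_div g) h
  obtain ⟨hpos, hev, y, w, hy⟩ := hα
  have hα : ¬ IsSquare (α : L) := by
    rintro ⟨y, hy⟩
    have hy0 : y ≠ 0 := by rintro rfl; simp at hy
    exact hαS ⟨Units.mk0 y hy0, Units.ext (by simp [hy, sq])⟩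
  obtain ⟨L', _, _, θ, _, hθ, hlift⟩ := exists_isQuadraticExtension_sq_eq hα
  have : NumberField L' := NumberField.of_module_finite L L'
  let _ : Algebra K L' := ((algebraMap L L').comp (algebraMap K L)).toAlgebra
  have : IsScalarTower K L L' := IsScalarTower.of_algebraMap_eq fun _ ↦ rfl
  refine ⟨L', inferInstance, inferInstance, inferInstance, ?_,
    isTotallyReal_of_forall_pos hα hθ hpos, ?_, ?_⟩
  · refine isGalois_of_lift (L := L) fun g ↦ ?_
    obtain ⟨s, hs⟩ := hfix g
    have hs' : g α = α * s ^ 2 := by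
      have := congrArg Units.val (eq_div_iff_mul_eq'.1 hs)
      simpa [mul_comm] using this.symm
    obtain ⟨F, hF, -⟩ := hlift ((algebraMap L L').comp (g : L →+* L)) (algebraMap L L' s * θ) (by
      rw [mul_pow, hθ, ← map_pow, ← map_mul, mul_comm, ← hs']
      rfl)
    exact ⟨F, hF⟩
  · rw [← Module.finrank_mul_finrank K L L', hn, Algebra.IsQuadraticExtension.finrank_eq_two,
      pow_succ]
  · exact (differentIdeal_eq_top_iff K L L').2 ⟨hd, differentIdeal_eq_top_of_sq_eq hα hθ hev hy⟩

end Step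

end NumberField

section PadicVal

theorem padicValNat_prod_primes {S : Finset ℕ} (hS : ∀ p ∈ S, p.Prime) (q : ℕ)
    [hq : Fact q.Prime] : padicValNat q (∏ p ∈ S, p) = if q ∈ S then 1 else 0 := by
  induction S using Finset.induction_on with
  | empty => simp
  | insert p S hp ih =>
    have h1 := hS p (Finset.mem_insert_self _ _)
    have hS' : ∀ r ∈ S, r.Prime := fun r hr ↦ hS r (Finset.mem_insert_of_mem hr)
    have : Fact p.Prime := ⟨h1⟩
    rw [Finset.prod_insert hp, padicValNat.mul h1.ne_zero
      (Finset.prod_ne_zero_iff.2 fun r hr ↦ (hS' r hr).ne_zero), ih hS']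
    rcases eq_or_ne q p with rfl | hqp
    · simp [hp]
    · simp [hqp, padicValNat_primes hqp]

theorem not_isSquare_prod_primes {S : Finset ℕ} (hS : ∀ p ∈ S, p.Prime) (hne : S.Nonempty) :
    ¬ IsSquare ((∏ p ∈ S, p : ℕ) : ℚ) := by
  obtain ⟨q, hq⟩ := hne
  have : Fact q.Prime := ⟨hS q hq⟩
  rintro ⟨r, hr⟩
  have hr0 : r ≠ 0 := by
    rintro rfl
    rw [mul_zero, Nat.cast_eq_zero, Finset.prod_eq_zero_iff] at hr
    obtain ⟨p, hp, rfl⟩ := hr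
    exact Nat.not_prime_zero (hS 0 hp)
  have := congrArg (padicValRat q) hr
  rw [padicValRat.of_nat, padicValNat_prod_primes hS, if_pos hq, padicValRat.mul hr0 hr0] at this
  push_cast at this
  omega

theorem eq_of_prod_primes_eq {S T U : Finset ℕ} (hU : ∀ p ∈ U, p.Prime) (hS : S ⊆ U) (hT : T ⊆ U)
    {q : ℕ} (hqU : q ∈ U) (hqS : q ∉ S) (hqT : q ∉ T)
    (h : IsSquare ((∏ p ∈ S, p : ℕ) / (∏ p ∈ T, p : ℕ) : ℚ) ∨
      ∃ r : ℚ, ((∏ p ∈ S, p : ℕ) / (∏ p ∈ T, p : ℕ) : ℚ) = (∏ p ∈ U, p : ℕ) * r ^ 2) : S = T := by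
  have hSp : ∀ p ∈ S, p.Prime := fun p hp ↦ hU p (hS hp)
  have hTp : ∀ p ∈ T, p.Prime := fun p hp ↦ hU p (hT hp)
  have h0 {S : Finset ℕ} (hS : ∀ p ∈ S, p.Prime) : ((∏ p ∈ S, p : ℕ) : ℚ) ≠ 0 := by
    rw [Nat.cast_ne_zero]
    exact Finset.prod_ne_zero_iff.2 fun r hr ↦ (hS r hr).ne_zero
  have hval (p : ℕ) [Fact p.Prime] : padicValRat p ((∏ p ∈ S, p : ℕ) / (∏ p ∈ T, p : ℕ) : ℚ) =
      (if p ∈ S then 1 else 0 : ℕ) - (if p ∈ T then 1 else 0 : ℕ) := by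
    rw [padicValRat.div (h0 hSp) (h0 hTp), padicValRat.of_nat, padicValRat.of_nat,
      padicValNat_prod_primes hSp, padicValNat_prod_primes hTp]
  have hne := div_ne_zero (h0 hSp) (h0 hTp)
  rcases h with ⟨r, hr⟩ | ⟨r, hr⟩
  · have hr0 : r ≠ 0 := by
      rintro rfl
      exact hne (by rw [hr, mul_zero])
    ext p
    by_cases hp : p ∈ U
    · have : Fact p.Prime := ⟨hU p hp⟩
      have h1 := hval p
      rw [hr, padicValRat.mul hr0 hr0] at h1
      by_cases h2 : p ∈ S <;> by_cases h3 : p ∈ T <;> simp [h2, h3] at h1 ⊢ <;> omega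
    · exact iff_of_false (fun h ↦ hp (hS h)) fun h ↦ hp (hT h)
  · have hr0 : r ≠ 0 := by
      rintro rfl
      exact hne (by rw [hr]; simp)
    have : Fact q.Prime := ⟨hU q hqU⟩
    have h1 := hval q
    rw [hr, padicValRat.mul (h0 hU) (pow_ne_zero 2 hr0), padicValRat.pow, padicValRat.of_nat,
      padicValNat_prod_primes hU, if_pos hqU, if_neg hqS, if_neg hqT] at h1
    push_cast at h1
    omega

end PadicVal

namespace NumberField

open IsDedekindDomain HeightOneSpectrum

section Quadratic

variable {F K : Type*} [Field F] [NumberField F] [Field K] [NumberField K] [Algebra F K]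
  [Algebra.IsQuadraticExtension F K] {α : F} {θ : K}

theorem ord_two_le_one_of_sq_eq (hF : Module.finrank ℚ F = 1) (hα : ¬ IsSquare α)
    (hθ : θ ^ 2 = algebraMap F K α) {w : 𝓞 F} (h : α = 1 + 4 * w)
    (v : HeightOneSpectrum (𝓞 K)) (x : Kˣ) (hx : x = (2 : K)) : v.ord x ≤ 1 := by
  have h0 : algebraMap (𝓞 K) K 2 = x := by rw [hx, map_ofNat]
  by_cases h2 : (2 : 𝓞 K) ∈ v.asIdeal
  · have hd := not_dvd_differentIdeal_of_two_mem hα hθ (y := 1) (w := w) (by simpa using h) v h2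
    have h1 := ord_algebraMap_of_not_dvd hd (Units.mk0 2 two_ne_zero)
    have h3 : Units.map (algebraMap F K : F →* K) (Units.mk0 2 two_ne_zero) = x :=
      Units.ext (by rw [hx]; exact map_ofNat (algebraMap F K) 2)
    rw [← h3, h1]
    exact ord_two_le_one hF _ _ rfl
  · have := (ord_pos_iff_mem v h0).not.2 h2
    omega

theorem isSquare_or_of_sq_eq (hα : ¬ IsSquare α) (hθ : θ ^ 2 = algebraMap F K α) {k : K} {q : F}
    (hk : k ^ 2 = algebraMap F K q) : IsSquare q ∨ ∃ r, q = α * r ^ 2 := by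
  have hinj := (algebraMap F K).injective
  have hθF (y : F) : algebraMap F K y ≠ θ := fun h ↦ hα ⟨y, hinj (by
    rw [← hθ, ← h, map_mul, sq])⟩
  have hsgn {x : K} {q : F} (h : x ^ 2 = algebraMap F K q) (g : Gal(K/F)) :
      g x = x ∨ g x = -x := by
    rw [← sq_eq_sq_iff_eq_or_eq_neg, ← map_pow, h, g.commutes]
  by_cases hfix : ∀ g : Gal(K/F), g k = k
  · obtain ⟨r, rfl⟩ := (IsGalois.mem_range_algebraMap_iff_fixed k).2 hfix
    exact Or.inl ⟨r, hinj (by rw [← hk, map_mul, sq])⟩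
  · push Not at hfix
    obtain ⟨g, hg⟩ := hfix
    have hg1 : g ≠ 1 := by rintro rfl; exact hg rfl
    have hgk := (hsgn hk g).resolve_left hg
    have hall (h : Gal(K/F)) : h = 1 ∨ h = g := eq_one_or_eq_of_finrank_eq_two
      (Algebra.IsQuadraticExtension.finrank_eq_two F K) hg1 h
    have hgθ : g θ = -θ := (hsgn hθ g).resolve_left fun hgθ ↦ by
      obtain ⟨y, hy⟩ := (IsGalois.mem_range_algebraMap_iff_fixed θ).2 fun h ↦ by
        rcases hall h with rfl | rfl
        · rfl
        · exact hgθ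
      exact hθF y hy
    obtain ⟨r, hr⟩ := (IsGalois.mem_range_algebraMap_iff_fixed (F := F) (k / θ)).2 fun h ↦ by
      rcases hall h with rfl | rfl
      · rfl
      · rw [map_div₀, hgk, hgθ, neg_div_neg_eq]
    refine Or.inr ⟨r, hinj ?_⟩
    have hθ0 : θ ≠ 0 := fun h ↦ hθF 0 (by rw [h, map_zero])
    rw [← hk, map_mul, map_pow, hr, ← hθ]
    field_simp

end Quadratic

end NumberField

namespace NumberField

open IsDedekindDomain HeightOneSpectrum

section

variable {K L : Type*} [Field K] [NumberField K] [Field L] [NumberField L] [Algebra K L]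

omit [NumberField K] in
theorem even_ord_of_isCoprime {a b : 𝓞 L} (hab : IsCoprime a b) {x y z : Lˣ}
    (hx : algebraMap (𝓞 L) L a = x) (hy : algebraMap (𝓞 L) L b = y) (h : x * y = z ^ 2)
    (v : HeightOneSpectrum (𝓞 L)) : Even (v.ord x) := by
  have h0 := congrArg v.ord h
  rw [ord_mul, ord_pow] at h0
  have hx0 := ord_nonneg_of_mem v hx
  have hy0 := ord_nonneg_of_mem v hy
  have : v.ord x = 0 ∨ v.ord y = 0 := by
    by_contra! hne
    have h1 := (ord_pos_iff_mem v hx).1 (by omega)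
    have h2 := (ord_pos_iff_mem v hy).1 (by omega)
    obtain ⟨c, d, hcd⟩ := hab
    exact v.isPrime.ne_top ((Ideal.eq_top_iff_one _).2 (hcd ▸ v.asIdeal.add_mem
      (v.asIdeal.mul_mem_left c h1) (v.asIdeal.mul_mem_left d h2)))
  rcases this with h1 | h1
  · simp [h1]
  · exact ⟨v.ord z, by push_cast at h0; omega⟩

theorem isSelmer_of_mul_eq_sq {m n : ℕ} (hmn : m.Coprime n) (hm : m ≡ 1 [MOD 4]) {x : Lˣ}
    (hx : (x : L) = m) {θ : L} (hθ : θ ^ 2 = (m * n : ℕ)) (hn : n ≠ 0) : IsSelmer x := by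
  have hm0 : m ≠ 0 := by rintro rfl; simp at hx
  have hθ0 : θ ≠ 0 := by
    rintro rfl
    have : (m * n : ℕ) = 0 := by exact_mod_cast (hθ.symm.trans (by simp) : ((m * n : ℕ) : L) = 0)
    exact mul_ne_zero hm0 hn this
  refine ⟨fun σ ↦ ?_, fun v ↦ ?_, 1, ((m / 4 : ℕ) : 𝓞 L), ?_⟩
  · rw [hx, map_natCast]
    exact_mod_cast Nat.pos_of_ne_zero hm0
  · refine even_ord_of_isCoprime (a := (m : 𝓞 L)) (b := (n : 𝓞 L))
      (y := Units.mk0 (n : L) (by exact_mod_cast hn)) (z := Units.mk0 θ hθ0) ?_ ?_ ?_ ?_ v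
    · have := (Nat.isCoprime_iff_coprime.2 hmn).map (Int.castRingHom (𝓞 L))
      simpa using this
    · rw [hx, map_natCast]
    · simp
    · ext
      push_cast
      simp [hx, hθ]
  · have h1 : m = 1 + 4 * (m / 4) := by
      have : m % 4 = 1 := hm
      omega
    rw [hx]
    conv_lhs => rw [h1]
    push_cast
    simp

end

section

variable {K L : Type*} [Field K] [NumberField K] [Field L] [NumberField L] [Algebra K L]
  [Algebra.IsQuadraticExtension ℚ K] [IsGalois K L]

theorem two_pow_le_card_hom {U : Finset ℕ} (hU : ∀ p ∈ U, p.Prime) (h4 : ∀ p ∈ U, p ≡ 1 [MOD 4])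
    {q : ℕ} (hq : q ∈ U) {θ : K} (hθ : θ ^ 2 = algebraMap ℚ K (∏ p ∈ U, p : ℕ))
    (hsel : ∀ x : Lˣ, IsSelmer x → x ∈ squares L) :
    2 ^ (U.card - 1) ≤ Nat.card (Gal(L/K) →* Multiplicative (ZMod 2)) := by
  have h0 {S : Finset ℕ} (hS : S ⊆ U) : ∏ p ∈ S, p ≠ 0 :=
    Finset.prod_ne_zero_iff.2 fun p hp ↦ (hU p (hS hp)).ne_zero
  have key (S : (U.erase q).powerset) : ∃ (y : Lˣ) (φ : Gal(L/K) →* Multiplicative (ZMod 2)),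
      ((y : L) ^ 2 = (∏ p ∈ S.1, p : ℕ)) ∧ ∀ g, signHom L (φ g) = g • y / y := by
    obtain ⟨S, hS⟩ := S
    replace hS : S ⊆ U := (Finset.mem_powerset.1 hS).trans (Finset.erase_subset _ _)
    have h1 : ((∏ p ∈ S, p : ℕ) : K) ≠ 0 := by exact_mod_cast h0 hS
    obtain ⟨y, hy⟩ := hsel (Units.map (algebraMap K L : K →* L) (Units.mk0 _ h1)) <|
      isSelmer_of_mul_eq_sq (m := ∏ p ∈ S, p) (n := ∏ p ∈ U \ S, p) (θ := algebraMap K L θ)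
        (Nat.Coprime.prod_left fun a ha ↦ Nat.Coprime.prod_right fun b hb ↦
          (Nat.coprime_primes (hU a (hS ha)) (hU b (Finset.mem_sdiff.1 hb).1)).2 fun hab ↦
            (Finset.mem_sdiff.1 hb).2 (hab ▸ ha))
        (Finset.prod_induction _ (· ≡ 1 [MOD 4]) (fun _ _ h h' ↦ h.mul h') rfl
          fun p hp ↦ h4 p (hS hp)) (by simp) (by
          rw [← map_pow, hθ, mul_comm, Finset.prod_sdiff hS, map_natCast, map_natCast])
        (h0 Finset.sdiff_subset)
    obtain ⟨φ, hφ⟩ := exists_kummerCharacter (K := K) (y := y) hy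
    refine ⟨y, φ, ?_, hφ⟩
    simpa using congrArg Units.val hy
  choose y φ hy hφ using key
  rw [← Finset.card_erase_of_mem hq, ← Finset.card_powerset, ← Nat.card_eq_finsetCard]
  refine Nat.card_le_card_of_injective φ fun S T h ↦ Subtype.ext ?_
  obtain ⟨z, hz⟩ := exists_map_eq_div_of_kummerCharacter_eq (hφ S) (h ▸ hφ T)
  have hS := Finset.mem_powerset.1 S.2
  have hT := Finset.mem_powerset.1 T.2
  refine eq_of_prod_primes_eq hU (hS.trans (Finset.erase_subset _ _))
    (hT.trans (Finset.erase_subset _ _)) hq (fun h ↦ Finset.notMem_erase _ _ (hS h))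
    (fun h ↦ Finset.notMem_erase _ _ (hT h))
    (isSquare_or_of_sq_eq (not_isSquare_prod_primes hU ⟨q, hq⟩) hθ (k := z) ?_)
  apply (algebraMap K L).injective
  have h1 : algebraMap K L z = y S / y T := by
    simpa [Units.val_div_eq_div_val] using congrArg Units.val hz
  rw [map_pow, h1, div_pow, hy, hy]
  simp

end

end NumberField

namespace NumberField

open IsDedekindDomain HeightOneSpectrum

theorem exists_quadraticField {D : ℕ} (hD : ¬ IsSquare (D : ℚ)) (h4 : D ≡ 1 [MOD 4]) :
    ∃ (K : Type) (_ : Field K) (_ : NumberField K) (θ : K), Algebra.IsQuadraticExtension ℚ K ∧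
      θ ^ 2 = algebraMap ℚ K D ∧ IsTotallyReal K ∧
      ∀ (v : HeightOneSpectrum (𝓞 K)) (x : Kˣ), x = (2 : K) → v.ord x ≤ 1 := by
  obtain ⟨K, _, alg, θ, hq, hθ, -⟩ := exists_isQuadraticExtension_sq_eq hD
  have : CharZero K := charZero_of_injective_algebraMap (algebraMap ℚ K).injective
  have heq : alg = DivisionRing.toRatAlgebra := Subsingleton.elim _ _
  subst heq
  have : NumberField K := NumberField.of_module_finite ℚ K
  have hD' : D = 1 + 4 * (D / 4) := by
    have : D % 4 = 1 := h4
    omega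
  refine ⟨K, inferInstance, inferInstance, θ, hq, hθ,
    isTotallyReal_of_forall_pos hD hθ fun σ ↦ ?_,
    ord_two_le_one_of_sq_eq (Module.finrank_self ℚ) hD hθ (w := ((D / 4 : ℕ) : 𝓞 ℚ)) ?_⟩
  · rw [map_natCast]
    have : D ≠ 0 := by rintro rfl; simp at hD
    positivity
  · refine Eq.trans ?_ (congrArg (1 + 4 * ·) (map_natCast (algebraMap (𝓞 ℚ) ℚ) (D / 4)).symm)
    exact_mod_cast hD'

theorem differentIdeal_self_eq_top (K : Type*) [Field K] [NumberField K] :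
    differentIdeal (𝓞 K) (𝓞 K) = ⊤ := by
  have h := natAbs_discr_eq_absNorm_differentIdeal_mul_natAbs_discr_pow K (𝓞 K) K (𝓞 K)
  rw [Module.finrank_self, pow_one] at h
  rw [← Ideal.absNorm_eq_one_iff]
  refine Nat.eq_of_mul_eq_mul_right (Int.natAbs_pos.2 (discr_ne_zero K)) ?_
  rw [← h, one_mul]

/-- There is a real quadratic field with an infinite everywhere unramified tower of totally real
extensions. -/
theorem exists_unramifiedTower : ∃ (K : Type) (_ : Field K) (_ : NumberField K),
    Module.finrank ℚ K = 2 ∧ ∀ n : ℕ, ∃ (L : Type) (_ : Field L) (_ : NumberField L)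
      (_ : Algebra K L), IsGalois K L ∧ IsTotallyReal L ∧ Module.finrank K L = 2 ^ n ∧
      differentIdeal (𝓞 K) (𝓞 L) = ⊤ := by
  let U : Finset ℕ := {5, 13, 17, 29, 37, 41, 53, 61, 73}
  have hU : ∀ p ∈ U, p.Prime := by
    intro p hp
    simp only [U, Finset.mem_insert, Finset.mem_singleton] at hp
    rcases hp with rfl | rfl | rfl | rfl | rfl | rfl | rfl | rfl | rfl <;> norm_num
  have h4 : ∀ p ∈ U, p ≡ 1 [MOD 4] := by decide
  have h5 : 5 ∈ U := by decide
  obtain ⟨K, _, _, θ, _, hθ, hK, h2⟩ := exists_quadraticField (D := ∏ p ∈ U, p)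
    (not_isSquare_prod_primes hU ⟨5, h5⟩) (by decide)
  have hK2 := Algebra.IsQuadraticExtension.finrank_eq_two ℚ K
  refine ⟨K, inferInstance, inferInstance, hK2, fun n ↦ ?_⟩
  induction n with
  | zero => exact ⟨K, inferInstance, inferInstance, Algebra.id K, inferInstance, hK,
      Module.finrank_self K, differentIdeal_self_eq_top K⟩
  | succ n ih =>
    obtain ⟨L, _, _, _, _, _, hn, hd⟩ := ih
    refine exists_extension hn hd ?_
    by_contra! hsel
    have h1 := card_hom_le hn hK2 hd (two_dvd_of_two_dvd_sq fun v x hx ↦ ?_) hsel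
    · have h3 := two_pow_le_card_hom hU h4 h5 hθ hsel
      have h6 : U.card = 9 := by decide
      rw [h6] at h3
      omega
    · have h3 : Units.map (algebraMap K L : K →* L) (Units.mk0 2 two_ne_zero) = x :=
        Units.ext (by rw [hx]; exact map_ofNat (algebraMap K L) 2)
      rw [← h3, ord_algebraMap hd]
      exact h2 _ _ rfl

/-- There are totally real fields of arbitrarily large degree and bounded root discriminant. -/
theorem exists_isTotallyReal_discr_le : ∃ ρ : ℕ, ∀ N : ℕ, ∃ (L : Type) (_ : Field L)
    (_ : NumberField L), IsTotallyReal L ∧ N ≤ Module.finrank ℚ L ∧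
      (discr L).natAbs ≤ ρ ^ Module.finrank ℚ L := by
  obtain ⟨K, _, _, hK, h⟩ := exists_unramifiedTower
  refine ⟨(discr K).natAbs, fun N ↦ ?_⟩
  obtain ⟨L, _, _, _, -, hL, hn, hd⟩ := h N
  refine ⟨L, inferInstance, inferInstance, hL, ?_, ?_⟩
  · rw [← Module.finrank_mul_finrank ℚ K L, hK, hn]
    exact (Nat.lt_two_pow_self (n := N)).le.trans (Nat.le_mul_of_pos_left _ two_pos)
  · rw [natAbs_discr_eq_absNorm_differentIdeal_mul_natAbs_discr_pow K (𝓞 K) L (𝓞 L), hd,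
      Ideal.absNorm_top, one_mul]
    refine Nat.pow_le_pow_right (Int.natAbs_pos.2 (discr_ne_zero K)) ?_
    rw [← Module.finrank_mul_finrank ℚ K L, hK]
    omega

end NumberField

/-- The number of vectors of natural numbers with bounded average. -/
theorem Finset.card_le_of_sum_le {ι : Type*} [Fintype ι] {m : ℕ} (hm : 1 ≤ m) (S : Finset (ι → ℕ))
    (hS : ∀ n ∈ S, ∑ i, n i ≤ Fintype.card ι * m) :
    (S.card : ℝ) ≤ (Real.exp 1 * (m + 1)) ^ Fintype.card ι := by
  classical
  set d := Fintype.card ι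
  have hm0 : (0 : ℝ) < m := by exact_mod_cast hm
  set x : ℝ := m / (m + 1) with hx
  have hx0 : 0 < x := by positivity
  have hx1 : x < 1 := by rw [hx, div_lt_one (by positivity)]; linarith
  have h1 : (S.card : ℝ) * x ^ (d * m) ≤ (m + 1 : ℝ) ^ d := calc
    (S.card : ℝ) * x ^ (d * m) = ∑ _n ∈ S, x ^ (d * m) := by rw [sum_const, nsmul_eq_mul]
    _ ≤ ∑ n ∈ S, ∏ i, x ^ n i := by
      refine sum_le_sum fun n hn ↦ ?_
      rw [prod_pow_eq_pow_sum]
      exact pow_le_pow_of_le_one hx0.le hx1.le (hS n hn)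
    _ ≤ ∑ n ∈ Fintype.piFinset fun _ : ι ↦ range (d * m + 1), ∏ i, x ^ n i := by
      refine sum_le_sum_of_subset_of_nonneg (fun n hn ↦ ?_) fun _ _ _ ↦ by positivity
      refine Fintype.mem_piFinset.2 fun i ↦ mem_range_succ_iff.2 ?_
      exact (single_le_sum (fun _ _ ↦ Nat.zero_le _) (mem_univ i)).trans (hS n hn)
    _ = (∑ j ∈ range (d * m + 1), x ^ j) ^ d := by
      rw [sum_prod_piFinset, prod_const, card_univ]
    _ ≤ (m + 1 : ℝ) ^ d := by
      gcongr
      have h2 : (1 - x)⁻¹ = m + 1 := by rw [hx]; field_simp; ring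
      rw [← h2, ← tsum_geometric_of_lt_one hx0.le hx1]
      exact (summable_geometric_of_lt_one hx0.le hx1).sum_le_tsum _ fun _ _ ↦ by positivity
  have h2 : 1 ≤ Real.exp 1 * x ^ m := by
    have h3 : (x⁻¹) ^ m ≤ Real.exp 1 := by
      have h4 : x⁻¹ ≤ Real.exp (1 / m) := by
        have := Real.add_one_le_exp (1 / m : ℝ)
        have h5 : x⁻¹ = 1 / m + 1 := by rw [hx]; field_simp; ring
        rwa [h5]
      refine (pow_le_pow_left₀ (by positivity) h4 m).trans_eq ?_
      rw [← Real.exp_nat_mul, mul_one_div_cancel hm0.ne']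
    rw [inv_pow, inv_le_iff_one_le_mul₀ (by positivity)] at h3
    exact h3
  calc (S.card : ℝ) ≤ S.card * (Real.exp 1 * x ^ m) ^ d :=
        le_mul_of_one_le_right (by positivity) (one_le_pow₀ h2)
    _ = Real.exp 1 ^ d * (S.card * x ^ (d * m)) := by rw [mul_pow, ← pow_mul, mul_comm m d]; ring
    _ ≤ Real.exp 1 ^ d * (m + 1 : ℝ) ^ d := by gcongr
    _ = _ := (mul_pow _ _ _).symm

theorem Finset.prod_zpow_eq_zpow_sum {ι G₀ : Type*} [CommGroupWithZero G₀] {a : G₀} (ha : a ≠ 0)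
    (S : Finset ι) (s : ι → ℤ) : ∏ i ∈ S, a ^ s i = a ^ ∑ i ∈ S, s i := by
  classical
  induction S using Finset.induction_on with
  | empty => simp
  | insert i S hi ih => rw [Finset.prod_insert hi, Finset.sum_insert hi, ih, zpow_add₀ ha]

namespace NumberField

open InfinitePlace Module

variable {L : Type*} [Field L] [NumberField L] [IsTotallyReal L]

theorem card_infinitePlace_eq : Fintype.card (InfinitePlace L) = finrank ℚ L := by
  rw [card_eq_nrRealPlaces_add_nrComplexPlaces, nrComplexPlaces_eq_zero_iff.2 inferInstance,
    add_zero, IsTotallyReal.finrank L]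

theorem prod_infinitePlace_eq (x : L) : ∏ w : InfinitePlace L, w x = |Algebra.norm ℚ x| := by
  rw [← prod_eq_abs_norm]
  exact Finset.prod_congr rfl fun w _ ↦ by rw [mult_isReal ⟨w, IsTotallyReal.isReal w⟩, pow_one]

theorem prod_infinitePlace_eq_absNorm (x : 𝓞 L) :
    ∏ w : InfinitePlace L, w x = Ideal.absNorm (Ideal.span {x}) := by
  rw [prod_infinitePlace_eq, Ideal.absNorm_span_singleton, ← Algebra.coe_norm_int]
  simp

theorem one_le_prod_infinitePlace {x : 𝓞 L} (hx : x ≠ 0) : 1 ≤ ∏ w : InfinitePlace L, w x := by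
  rw [prod_infinitePlace_eq_absNorm, Nat.one_le_cast, Nat.one_le_iff_ne_zero, ne_eq,
    Ideal.absNorm_eq_zero_iff, Ideal.span_singleton_eq_bot]
  exact hx

theorem exists_infinitePlace_lt_zpow {X : ℝ} (hX : 0 < X)
    (hdisc : ((discr L).natAbs : ℝ) < (X ^ finrank ℚ L) ^ 2) {s : InfinitePlace L → ℤ}
    (hs : ∑ w, s w = 0) : ∃ x : 𝓞 L, x ≠ 0 ∧ ∀ w : InfinitePlace L, w x < X ^ (s w + 1) := by
  classical
  lift X to NNReal using hX.le
  rw [NNReal.coe_pos] at hX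
  refine mixedEmbedding.exists_ne_zero_mem_ringOfIntegers_lt (f := fun w ↦ X ^ (s w + 1)) L ?_
  have hc : nrComplexPlaces L = 0 := nrComplexPlaces_eq_zero_iff.2 inferInstance
  have hf : ∏ w : InfinitePlace L, (X ^ (s w + 1)) ^ mult w = X ^ finrank ℚ L := by
    rw [Finset.prod_congr rfl fun w _ ↦ show (X ^ (s w + 1)) ^ mult w = X ^ s w * X by
        rw [mult_isReal ⟨w, IsTotallyReal.isReal w⟩, pow_one, zpow_add_one₀ hX.ne'],
      Finset.prod_mul_distrib, Finset.prod_zpow_eq_zpow_sum hX.ne', hs, zpow_zero, one_mul,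
          Finset.prod_const, Finset.card_univ,
      card_infinitePlace_eq]
  rw [mixedEmbedding.convexBodyLT_volume, mixedEmbedding.minkowskiBound,
    mixedEmbedding.volume_fundamentalDomain_fractionalIdealLatticeBasis,
    mixedEmbedding.volume_fundamentalDomain_latticeBasis, mixedEmbedding.finrank,
    mixedEmbedding.convexBodyLTFactor, hc, IsTotallyReal.finrank L, hf]
  simp only [Units.val_one, map_one, Rat.cast_one, ENNReal.ofReal_one, pow_zero, one_mul, mul_one]
  rw [mul_comm, ENNReal.coe_pow, ENNReal.coe_ofNat]
  refine ENNReal.mul_lt_mul_right (by positivity) (by finiteness) ?_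
  rw [ENNReal.coe_lt_coe, ← NNReal.coe_lt_coe, Real.coe_sqrt, coe_nnnorm, Int.norm_eq_abs,
    NNReal.coe_pow, Real.sqrt_lt' (by positivity)]
  simpa using hdisc

/-- The number of algebraic integers of bounded house. -/
theorem card_le_of_infinitePlace_le {R : ℝ} (hR : 1 ≤ R) (S : Finset (𝓞 L))
    (hS : ∀ x ∈ S, ∀ w : InfinitePlace L, w x ≤ R) : (S.card : ℝ) ≤ (4 * R) ^ finrank ℚ L := by
  classical
  let σ (w : InfinitePlace L) : L →+* ℝ := embedding_of_isReal (IsTotallyReal.isReal w)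
  have hσ (w : InfinitePlace L) (x : L) : |σ w x| = w x := by
    have := norm_embedding_of_isReal (IsTotallyReal.isReal w) x
    rwa [Real.norm_eq_abs] at this
  let φ (x : 𝓞 L) (w : InfinitePlace L) : ℤ := ⌊σ w x⌋
  have hφ : Function.Injective φ := fun x y h ↦ by
    by_contra hxy
    have h1 := one_le_prod_infinitePlace (sub_ne_zero.2 hxy)
    refine h1.not_gt ?_
    have hlt (w : InfinitePlace L) : w ((x - y : 𝓞 L) : L) < 1 := by
      rw [← hσ, show ((x - y : 𝓞 L) : L) = x - y from map_sub (algebraMap (𝓞 L) L) x y, map_sub]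
      exact Int.abs_sub_lt_one_of_floor_eq_floor (congrFun h w)
    obtain ⟨w₀⟩ : Nonempty (InfinitePlace L) := inferInstance
    rw [← Finset.prod_const_one (s := Finset.univ (α := InfinitePlace L))]
    refine Finset.prod_lt_prod (fun w _ ↦ ?_) (fun w _ ↦ (hlt w).le)
      ⟨w₀, Finset.mem_univ _, hlt w₀⟩
    rw [pos_iff, RingOfIntegers.coe_ne_zero_iff]
    exact sub_ne_zero.2 hxy
  have h2 : S.card ≤ (Fintype.piFinset fun _ : InfinitePlace L ↦ Finset.Icc ⌊-R⌋ ⌊R⌋).card := by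
    refine Finset.card_le_card_of_injOn φ (fun x hx ↦ ?_) hφ.injOn
    refine Fintype.mem_piFinset.2 fun w ↦ Finset.mem_Icc.2 ?_
    have := hS x hx w
    rw [← hσ, abs_le] at this
    exact ⟨Int.floor_mono this.1, Int.floor_mono this.2⟩
  rw [Fintype.card_piFinset, Finset.prod_const, Finset.card_univ, card_infinitePlace_eq,
    Int.card_Icc] at h2
  have h3 : ((⌊R⌋ + 1 - ⌊-R⌋).toNat : ℝ) ≤ 4 * R := by
    have h4 : (0 : ℤ) ≤ ⌊R⌋ + 1 - ⌊-R⌋ := by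
      have : ⌊-R⌋ ≤ ⌊R⌋ := Int.floor_mono (by linarith)
      omega
    rw [show ((⌊R⌋ + 1 - ⌊-R⌋).toNat : ℝ) = (((⌊R⌋ + 1 - ⌊-R⌋).toNat : ℤ) : ℝ) by push_cast; rfl,
      Int.toNat_of_nonneg h4]
    push_cast
    linarith [Int.floor_le R, Int.lt_floor_add_one (-R)]
  calc (S.card : ℝ) ≤ ((⌊R⌋ + 1 - ⌊-R⌋).toNat : ℝ) ^ finrank ℚ L := by exact_mod_cast h2
    _ ≤ _ := by gcongr

end NumberField

/-! ### The number of ideals of bounded norm -/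

namespace NumberField

open IsDedekindDomain HeightOneSpectrum Module Filter Topology

theorem prod_one_sub_rpow_le_two (T : Finset ℕ) (hT : ∀ n ∈ T, 2 ≤ n) :
    ∏ n ∈ T, (1 - (n : ℝ) ^ (-2 : ℝ))⁻¹ ≤ 2 := by
  have h1 (n : ℕ) (hn : 2 ≤ n) : (1 - (n : ℝ) ^ (-2 : ℝ))⁻¹ = n ^ 2 / ((n - 1) * (n + 1)) := by
    have : (2 : ℝ) ≤ n := by exact_mod_cast hn
    have h2 : (n : ℝ) - 1 ≠ 0 := by linarith
    rw [Real.rpow_neg (by positivity), Real.rpow_ofNat, ← inv_inv ((n : ℝ) ^ 2 / _), inv_div]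
    congr 1
    field_simp
    ring
  have h2 (B : ℕ) : ∏ n ∈ Finset.Ico 2 (B + 2), (1 - (n : ℝ) ^ (-2 : ℝ))⁻¹ =
      2 * (B + 1) / (B + 2) := by
    induction B with
    | zero => norm_num
    | succ B ih =>
      rw [show B + 1 + 2 = (B + 2) + 1 by ring, Finset.prod_Ico_succ_top (by omega), ih,
        h1 _ (by omega)]
      push_cast
      rw [show (B : ℝ) + 2 - 1 = B + 1 by ring, show (B : ℝ) + 2 + 1 = B + 3 by ring]
      field_simp
      ring
  have h3 (n : ℕ) (hn : 2 ≤ n) : 1 ≤ (1 - (n : ℝ) ^ (-2 : ℝ))⁻¹ := by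
    rw [h1 n hn, one_le_div₀]
    · nlinarith
    · have : (2 : ℝ) ≤ n := by exact_mod_cast hn
      exact mul_pos (by linarith) (by linarith)
  have hsub : T ⊆ Finset.Ico 2 (T.sup id + 2) := fun n hn ↦ Finset.mem_Ico.2 ⟨hT n hn, by
    have := Finset.le_sup (f := id) hn
    simp only [id] at this
    omega⟩
  refine le_trans ?_ ((h2 _).trans_le ?_ : ∏ n ∈ Finset.Ico 2 (T.sup id + 2),
    (1 - (n : ℝ) ^ (-2 : ℝ))⁻¹ ≤ 2)
  · rw [← Finset.prod_sdiff hsub]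
    refine le_mul_of_one_le_left (Finset.prod_nonneg fun n hn ↦ zero_le_one.trans (h3 n (hT n hn)))
      (Finset.prod_induction _ (1 ≤ ·) (fun _ _ ↦ one_le_mul_of_one_le_of_one_le) le_rfl
        fun n hn ↦ h3 n (Finset.mem_Ico.1 (Finset.mem_sdiff.1 hn).1).1)
  · rw [div_le_iff₀ (by positivity)]
    linarith

variable {L : Type*} [Field L] [NumberField L]

theorem card_le_finrank_of_mem {p : ℕ} (hp : 2 ≤ p) (S : Finset (HeightOneSpectrum (𝓞 L)))
    (hS : ∀ v ∈ S, (p : 𝓞 L) ∈ v.asIdeal) (hS' : ∀ v ∈ S, p ≤ Ideal.absNorm v.asIdeal) :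
    S.card ≤ finrank ℚ L := by
  have hdvd : ∏ v ∈ S, v.asIdeal ∣ Ideal.span {(p : 𝓞 L)} := by
    refine Finset.prod_dvd_of_coprime (fun v _ w _ hvw ↦ ?_) fun v hv ↦ ?_
    · exact Ideal.isCoprime_iff_sup_eq.2 (v.isMaximal.coprime_of_ne w.isMaximal fun h ↦
        hvw (HeightOneSpectrum.ext h))
    · exact Ideal.dvd_span_singleton.2 (hS v hv)
  have hnorm : Ideal.absNorm (Ideal.span {(p : 𝓞 L)}) = p ^ finrank ℚ L := by
    rw [Ideal.absNorm_span_singleton, show (p : 𝓞 L) = algebraMap ℤ (𝓞 L) p by simp,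
      Algebra.norm_algebraMap, RingOfIntegers.rank]
    simp
  have h1 := Nat.le_of_dvd (by rw [hnorm]; positivity) (map_dvd Ideal.absNorm hdvd)
  rw [map_prod, hnorm] at h1
  refine (Nat.pow_le_pow_iff_right (by omega : 1 < p)).1 (le_trans ?_ h1)
  exact Finset.pow_card_le_prod _ _ _ hS'

theorem tsum_absNorm_le : ∑' I : Ideal (𝓞 L), (Ideal.absNorm I : ℝ) ^ (-2 : ℝ) ≤ 2 ^ finrank ℚ L := by
  classical
  refine le_of_tendsto' (tendsto_prod_absNorm one_lt_two) fun S ↦ ?_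
  let p (v : HeightOneSpectrum (𝓞 L)) : ℕ := Ideal.absNorm (v.asIdeal.under ℤ)
  have hp (v : HeightOneSpectrum (𝓞 L)) : 2 ≤ p v := by
    have : NeZero v.asIdeal := ⟨v.ne_bot⟩
    exact (Nat.absNorm_under_prime v.asIdeal).two_le
  have hle (v : HeightOneSpectrum (𝓞 L)) : p v ≤ Ideal.absNorm v.asIdeal :=
    Nat.le_of_dvd (Nat.pos_of_ne_zero (Ideal.absNorm_eq_zero_iff.not.2 v.ne_bot))
      (Int.absNorm_under_dvd_absNorm v.asIdeal)
  have hlt {n : ℕ} (hn : 2 ≤ n) : (n : ℝ) ^ (-2 : ℝ) < 1 :=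
    Real.rpow_lt_one_of_one_lt_of_neg (by exact_mod_cast hn) (by norm_num)
  calc ∏ v ∈ S, (1 - (Ideal.absNorm v.asIdeal : ℝ) ^ (-2 : ℝ))⁻¹
      ≤ ∏ v ∈ S, (1 - (p v : ℝ) ^ (-2 : ℝ))⁻¹ := by
        refine Finset.prod_le_prod (fun v _ ↦ ?_) fun v _ ↦ ?_
        · exact inv_nonneg.2 (sub_nonneg.2 (hlt ((hp v).trans (hle v))).le)
        · refine inv_anti₀ (sub_pos.2 (hlt (hp v))) (sub_le_sub_left ?_ _)
          refine Real.rpow_le_rpow_of_nonpos ?_ (by exact_mod_cast hle v) (by norm_num)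
          exact_mod_cast two_pos.trans_le (hp v)
    _ = ∏ n ∈ S.image p, ((1 - (n : ℝ) ^ (-2 : ℝ))⁻¹) ^ (S.filter (p · = n)).card := by
        rw [Finset.prod_comp (fun n : ℕ ↦ (1 - (n : ℝ) ^ (-2 : ℝ))⁻¹) p]
    _ ≤ ∏ n ∈ S.image p, ((1 - (n : ℝ) ^ (-2 : ℝ))⁻¹) ^ finrank ℚ L := by
        refine Finset.prod_le_prod (fun n hn ↦ ?_) fun n hn ↦ ?_
        all_goals obtain ⟨v, -, rfl⟩ := Finset.mem_image.1 hn
        · exact pow_nonneg (inv_nonneg.2 (sub_nonneg.2 (hlt (hp v)).le)) _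
        · refine pow_le_pow_right₀ ((one_le_inv₀ (sub_pos.2 (hlt (hp v)))).2
            (sub_le_self _ (by positivity))) (card_le_finrank_of_mem (hp v) _ ?_ ?_)
          · intro w hw
            rw [← (Finset.mem_filter.1 hw).2]
            simpa using Int.absNorm_under_mem w.asIdeal
          · intro w hw
            rw [← (Finset.mem_filter.1 hw).2]
            exact hle w
    _ ≤ 2 ^ finrank ℚ L := by
        rw [Finset.prod_pow]
        refine pow_le_pow_left₀ (Finset.prod_nonneg fun n hn ↦ ?_) (prod_one_sub_rpow_le_two _ ?_) _
        · obtain ⟨v, -, rfl⟩ := Finset.mem_image.1 hn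
          exact inv_nonneg.2 (sub_nonneg.2 (hlt (hp v)).le)
        · intro n hn
          obtain ⟨v, -, rfl⟩ := Finset.mem_image.1 hn
          exact hp v

/-- The number of ideals of bounded norm. -/
theorem card_ideal_le (S : Finset (Ideal (𝓞 L))) {B : ℝ} (h0 : ∀ I ∈ S, I ≠ ⊥)
    (hS : ∀ I ∈ S, (Ideal.absNorm I : ℝ) ≤ B) : (S.card : ℝ) ≤ 2 ^ finrank ℚ L * B ^ 2 := by
  rcases S.eq_empty_or_nonempty with rfl | ⟨I₀, hI₀⟩
  · simpa using by positivity
  have hpos {I : Ideal (𝓞 L)} (hI : I ∈ S) : (0 : ℝ) < Ideal.absNorm I := by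
    exact_mod_cast Nat.pos_of_ne_zero (Ideal.absNorm_eq_zero_iff.not.2 (h0 I hI))
  have hB : 0 < B := (hpos hI₀).trans_le (hS _ hI₀)
  have h1 : S.card * B ^ (-2 : ℝ) ≤ 2 ^ finrank ℚ L := calc
    S.card * B ^ (-2 : ℝ) = ∑ _I ∈ S, B ^ (-2 : ℝ) := by rw [Finset.sum_const, nsmul_eq_mul]
    _ ≤ ∑ I ∈ S, (Ideal.absNorm I : ℝ) ^ (-2 : ℝ) := Finset.sum_le_sum fun I hI ↦
      Real.rpow_le_rpow_of_nonpos (hpos hI) (hS I hI) (by norm_num)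
    _ ≤ _ := ((summable_absNorm_rpow L one_lt_two).sum_le_tsum _ fun _ _ ↦ by positivity).trans
      tsum_absNorm_le
  rwa [Real.rpow_neg hB.le, Real.rpow_ofNat, ← div_eq_mul_inv, div_le_iff₀ (by positivity)] at h1

end NumberField

/-! ### Many algebraic integers of small house generating the same ideal -/

theorem Finset.card_le_mul_of_card_fiber_le {α β : Type*} [DecidableEq β] (S : Finset α) (f : α → β)
    {a b : ℝ} (hb : 0 ≤ b) (ha : ((S.image f).card : ℝ) ≤ a)
    (h : ∀ y ∈ S.image f, ((S.filter (f · = y)).card : ℝ) ≤ b) : (S.card : ℝ) ≤ a * b := by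
  rw [Finset.card_eq_sum_card_image f S, Nat.cast_sum]
  refine (Finset.sum_le_card_nsmul _ _ _ h).trans ?_
  rw [nsmul_eq_mul]
  gcongr

namespace NumberField

open InfinitePlace Module

variable {L : Type*} [Field L] [NumberField L] [IsTotallyReal L]

omit [NumberField L] [IsTotallyReal L] in
theorem coe_infinitePlace_pos {x : 𝓞 L} (hx : x ≠ 0) (w : InfinitePlace L) : 0 < w x := by
  rwa [pos_iff, RingOfIntegers.coe_ne_zero_iff]

theorem sum_floor_sub_logb_le {X : ℝ} (hX : 1 < X) {x : 𝓞 L} (hx : x ≠ 0)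
    {t : InfinitePlace L → ℝ} (ht : ∀ w : InfinitePlace L, Real.logb X (w x) ≤ t w) :
    (∑ w : InfinitePlace L, ⌊t w - Real.logb X (w x)⌋₊ : ℝ) ≤ ∑ w, t w := by
  have h1 : 0 ≤ ∑ w : InfinitePlace L, Real.logb X (w x) := by
    rw [← Real.logb_prod _ _ fun w _ ↦ (coe_infinitePlace_pos hx w).ne']
    exact Real.logb_nonneg hX (one_le_prod_infinitePlace hx)
  calc (∑ w : InfinitePlace L, ⌊t w - Real.logb X (w x)⌋₊ : ℝ)
      ≤ ∑ w : InfinitePlace L, (t w - Real.logb X (w x)) :=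
        Finset.sum_le_sum fun w _ ↦ Nat.floor_le (sub_nonneg.2 (ht w))
    _ ≤ _ := by
      rw [Finset.sum_sub_distrib]
      linarith

/-- The number of generators of bounded house of an ideal. -/
theorem card_le_of_span_eq {X : ℝ} (hX : 1 < X) {m : ℕ} (hm : 1 ≤ m) (𝔟 : Ideal (𝓞 L))
    (S : Finset (𝓞 L)) (h0 : ∀ z ∈ S, z ≠ 0) (hS : ∀ z ∈ S, Ideal.span {z} = 𝔟)
    (hle : ∀ z ∈ S, ∀ w : InfinitePlace L, w z ≤ X ^ m) :
    (S.card : ℝ) ≤ (4 * Real.exp 1 * X * (m + 1)) ^ finrank ℚ L := by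
  classical
  have hlog {z : 𝓞 L} (hz : z ∈ S) (w : InfinitePlace L) : Real.logb X (w z) ≤ m := by
    rw [Real.logb_le_iff_le_rpow hX (coe_infinitePlace_pos (h0 z hz) w), Real.rpow_natCast]
    exact hle z hz w
  let n (z : 𝓞 L) (w : InfinitePlace L) : ℕ := ⌊m - Real.logb X (w z)⌋₊
  have himage : ((S.image n).card : ℝ) ≤ (Real.exp 1 * (m + 1)) ^ finrank ℚ L := by
    rw [← card_infinitePlace_eq]
    refine Finset.card_le_of_sum_le hm _ fun y hy ↦ ?_
    obtain ⟨z, hz, rfl⟩ := Finset.mem_image.1 hy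
    have := sum_floor_sub_logb_le hX (h0 z hz) (hlog hz)
    rw [Finset.sum_const, Finset.card_univ, nsmul_eq_mul] at this
    exact_mod_cast this
  rw [show 4 * Real.exp 1 * X * (m + 1) = Real.exp 1 * (m + 1) * (4 * X) by ring, mul_pow]
  refine S.card_le_mul_of_card_fiber_le n (by positivity) himage fun y hy ↦ ?_
  obtain ⟨z', hz', rfl⟩ := Finset.mem_image.1 hy
  have hdvd (z : 𝓞 L) : ∃ u : 𝓞 L, z ∈ S → z = z' * u := by
    by_cases hz : z ∈ S
    · obtain ⟨u, hu⟩ := Ideal.span_singleton_le_span_singleton.1 ((hS z hz).trans (hS z' hz').symm).le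
      exact ⟨u, fun _ ↦ hu⟩
    · exact ⟨0, fun h ↦ absurd h hz⟩
  choose u hu using hdvd
  have hinj : Set.InjOn u (S.filter (n · = n z')) := fun a ha b hb hab ↦ by
    rw [hu a (Finset.mem_filter.1 ha).1, hu b (Finset.mem_filter.1 hb).1, hab]
  rw [← Finset.card_image_of_injOn hinj]
  refine card_le_of_infinitePlace_le hX.le _ fun v hv w ↦ ?_
  obtain ⟨z, hz, rfl⟩ := Finset.mem_image.1 hv
  obtain ⟨hz, hnz⟩ := Finset.mem_filter.1 hz
  have hpos := coe_infinitePlace_pos (h0 z' hz') w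
  have hwz : w z = w z' * w (u z) := by
    rw [← map_mul, ← map_mul, ← hu z hz]
  have hu0 : 0 < w (u z) := pos_of_mul_pos_right (hwz ▸ coe_infinitePlace_pos (h0 z hz) w) hpos.le
  have h1 : Real.logb X (w z) = Real.logb X (w z') + Real.logb X (w (u z)) := by
    rw [hwz, Real.logb_mul hpos.ne' hu0.ne']
  have h2 := Nat.floor_le (sub_nonneg.2 (hlog hz w))
  have h3 := Nat.lt_floor_add_one ((m : ℝ) - Real.logb X (w z'))
  have h4 : ⌊m - Real.logb X (w z)⌋₊ = ⌊m - Real.logb X (w z')⌋₊ := congrFun hnz w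
  rw [h4] at h2
  have h5 : Real.logb X (w (u z)) ≤ 1 := by linarith
  rwa [Real.logb_le_iff_le_rpow hX hu0, Real.rpow_one] at h5

/-- Many algebraic integers of bounded house and bounded norm. -/
theorem exists_finset_infinitePlace_le {X : ℝ} (hX : 1 < X)
    (hdisc : ((discr L).natAbs : ℝ) < (X ^ finrank ℚ L) ^ 2) {J : ℕ} (hJ : 1 ≤ J) :
    ∃ A : Finset (𝓞 L), (∀ x ∈ A, x ≠ 0 ∧ (Ideal.absNorm (Ideal.span {x}) : ℝ) ≤ X ^ finrank ℚ L ∧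
      ∀ w : InfinitePlace L, w x ≤ X ^ J) ∧
      (J : ℝ) ^ finrank ℚ L ≤ A.card * ((2 * Real.exp 1) ^ finrank ℚ L * J) := by
  classical
  have hX0 : 0 < X := zero_lt_one.trans hX
  obtain ⟨w₀⟩ : Nonempty (InfinitePlace L) := inferInstance
  let s (i : InfinitePlace L → Fin J) (w : InfinitePlace L) : ℤ :=
    if w = w₀ then -∑ v ∈ Finset.univ.erase w₀, ((i v : ℕ) : ℤ) else (i w : ℕ)
  have hs (i : InfinitePlace L → Fin J) : ∑ w, s i w = 0 := by
    rw [← Finset.add_sum_erase _ _ (Finset.mem_univ w₀)]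
    simp only [s, if_true]
    rw [neg_add_eq_zero]
    exact Finset.sum_congr rfl fun w hw ↦ (if_neg (Finset.ne_of_mem_erase hw)).symm
  have hsJ (i : InfinitePlace L → Fin J) (w : InfinitePlace L) : s i w + 1 ≤ J := by
    simp only [s]
    split_ifs
    · have : 0 ≤ ∑ v ∈ Finset.univ.erase w₀, ((i v : ℕ) : ℤ) :=
        Finset.sum_nonneg fun _ _ ↦ by positivity
      omega
    · have := (i w).2
      omega
  choose x hx0 hx using fun i ↦ exists_infinitePlace_lt_zpow hX0 hdisc (hs i)
  refine ⟨Finset.univ.image x, fun y hy ↦ ?_, ?_⟩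
  · obtain ⟨i, -, rfl⟩ := Finset.mem_image.1 hy
    refine ⟨hx0 i, ?_, fun w ↦ (hx i w).le.trans ?_⟩
    · rw [← prod_infinitePlace_eq_absNorm]
      refine (Finset.prod_le_prod (fun w _ ↦ (coe_infinitePlace_pos (hx0 i) w).le)
        fun w _ ↦ (hx i w).le).trans_eq ?_
      rw [Finset.prod_zpow_eq_zpow_sum hX0.ne', Finset.sum_add_distrib, hs, zero_add,
        Finset.sum_const, Finset.card_univ,
        card_infinitePlace_eq, nsmul_one]
      simp
    · rw [← zpow_natCast]
      exact zpow_le_zpow_right₀ hX.le (hsJ i w)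
  have hcard : ((Finset.univ : Finset (InfinitePlace L → Fin J)).card : ℝ) = J ^ finrank ℚ L := by
    rw [Finset.card_univ, Fintype.card_fun, Fintype.card_fin, card_infinitePlace_eq, Nat.cast_pow]
  rw [← hcard]
  refine Finset.card_le_mul_of_card_fiber_le _ x (by positivity) le_rfl fun y hy ↦ ?_
  obtain ⟨i₀, -, rfl⟩ := Finset.mem_image.1 hy
  set F := Finset.univ.filter (x · = x i₀)
  have hlog {i : InfinitePlace L → Fin J} (hi : i ∈ F) (w : InfinitePlace L) :
      Real.logb X (w (x i₀)) ≤ (s i w + 1 : ℤ) := by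
    rw [Real.logb_le_iff_le_rpow hX (coe_infinitePlace_pos (hx0 i₀) w), Real.rpow_intCast,
      ← (Finset.mem_filter.1 hi).2]
    exact (hx i w).le
  let n (i : InfinitePlace L → Fin J) (w : InfinitePlace L) : ℕ :=
    ⌊((s i w + 1 : ℤ) : ℝ) - Real.logb X (w (x i₀))⌋₊
  have himage : ((F.image n).card : ℝ) ≤ (2 * Real.exp 1) ^ finrank ℚ L := by
    have := Finset.card_le_of_sum_le le_rfl (F.image n) fun y hy ↦ by
      obtain ⟨i, hi, rfl⟩ := Finset.mem_image.1 hy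
      have := sum_floor_sub_logb_le hX (hx0 i₀) (hlog hi)
      rw [← Int.cast_sum, Finset.sum_add_distrib, hs, zero_add, Finset.sum_const, nsmul_one] at this
      rw [mul_one]
      exact_mod_cast this
    rwa [card_infinitePlace_eq, Nat.cast_one, one_add_one_eq_two, mul_comm] at this
  have hinj : Set.InjOn (fun i ↦ (n i, i w₀)) F := fun i hi j hj hij ↦ by
    obtain ⟨hij, hij₀⟩ := Prod.mk.inj hij
    have hs_eq (w : InfinitePlace L) : s i w = s j w := by
      have h1 : ⌊((s i w + 1 : ℤ) : ℝ) - Real.logb X (w (x i₀))⌋₊ =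
        ⌊((s j w + 1 : ℤ) : ℝ) - Real.logb X (w (x i₀))⌋₊ := congrFun hij w
      have h2 := Nat.floor_le (sub_nonneg.2 (hlog hi w))
      have h3 := Nat.floor_le (sub_nonneg.2 (hlog hj w))
      have h4 := Nat.lt_floor_add_one (((s i w + 1 : ℤ) : ℝ) - Real.logb X (w (x i₀)))
      have h5 := Nat.lt_floor_add_one (((s j w + 1 : ℤ) : ℝ) - Real.logb X (w (x i₀)))
      rw [h1] at h2 h4
      have h6 : ((s i w : ℤ) : ℝ) < s j w + 1 := by push_cast at *; linarith
      have h7 : ((s j w : ℤ) : ℝ) < s i w + 1 := by push_cast at *; linarith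
      norm_cast at h6 h7
      omega
    funext w
    by_cases hw : w = w₀
    · rw [hw, hij₀]
    · have := hs_eq w
      simp only [s, if_neg hw] at this
      exact Fin.ext (by exact_mod_cast this)
  calc (F.card : ℝ) ≤ ((F.image n ×ˢ (Finset.univ : Finset (Fin J))).card : ℝ) := by
        exact_mod_cast Finset.card_le_card_of_injOn _ (fun i hi ↦ Finset.mem_coe.2 <|
          Finset.mem_product.2 ⟨Finset.mem_image_of_mem n hi, Finset.mem_univ _⟩) hinj
    _ ≤ _ := by
      rw [Finset.card_product, Finset.card_univ, Fintype.card_fin, Nat.cast_mul]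
      gcongr

/-- Many algebraic integers of bounded house generating the same ideal. -/
theorem exists_finset_span_eq {X : ℝ} (hX : 1 < X)
    (hdisc : ((discr L).natAbs : ℝ) < (X ^ finrank ℚ L) ^ 2) {J : ℕ} (hJ : 1 ≤ J) :
    ∃ (A : Finset (𝓞 L)) (𝔞 : Ideal (𝓞 L)), (∀ x ∈ A, x ≠ 0 ∧ Ideal.span {x} = 𝔞 ∧
      ∀ w : InfinitePlace L, w x ≤ X ^ J) ∧
      (J : ℝ) ^ finrank ℚ L ≤ (4 * Real.exp 1 * X ^ 2) ^ finrank ℚ L * J * A.card := by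
  classical
  obtain ⟨A, hA, hcard⟩ := exists_finset_infinitePlace_le hX hdisc hJ
  let g (x : 𝓞 L) : Ideal (𝓞 L) := Ideal.span {x}
  have hne : (A.image g).Nonempty := by
    rw [Finset.image_nonempty, Finset.nonempty_iff_ne_empty]
    rintro rfl
    have : (0 : ℝ) < J := by exact_mod_cast hJ
    have : 0 < (J : ℝ) ^ finrank ℚ L := by positivity
    simp only [Finset.card_empty, Nat.cast_zero, zero_mul] at hcard
    linarith
  obtain ⟨𝔞, -, h𝔞⟩ := (A.image g).exists_max_image (fun I ↦ (A.filter (g · = I)).card) hne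
  refine ⟨A.filter (g · = 𝔞), 𝔞, fun x hx ↦ ?_, ?_⟩
  · obtain ⟨hx, hg⟩ := Finset.mem_filter.1 hx
    exact ⟨(hA x hx).1, hg, (hA x hx).2.2⟩
  have himage : ((A.image g).card : ℝ) ≤ 2 ^ finrank ℚ L * (X ^ finrank ℚ L) ^ 2 := by
    refine card_ideal_le _ (fun I hI ↦ ?_) fun I hI ↦ ?_
    all_goals obtain ⟨x, hx, rfl⟩ := Finset.mem_image.1 hI
    · exact Ideal.span_singleton_eq_bot.not.2 (hA x hx).1
    · exact (hA x hx).2.1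
  have h := A.card_le_mul_of_card_fiber_le g (Nat.cast_nonneg _) himage fun I hI ↦
    Nat.cast_le.2 (h𝔞 I hI)
  calc (J : ℝ) ^ finrank ℚ L ≤ A.card * ((2 * Real.exp 1) ^ finrank ℚ L * J) := hcard
    _ ≤ 2 ^ finrank ℚ L * (X ^ finrank ℚ L) ^ 2 * (A.filter (g · = 𝔞)).card *
      ((2 * Real.exp 1) ^ finrank ℚ L * J) := by gcongr
    _ = _ := by
      rw [show 4 * Real.exp 1 * X ^ 2 = 2 * X ^ 2 * (2 * Real.exp 1) by ring, mul_pow (2 * X ^ 2),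
        mul_pow 2 (X ^ 2), ← pow_mul, ← pow_mul, mul_comm 2]
      ring

end NumberField

/-! ### Sum sets and product sets of algebraic integers -/

theorem ncard_kfoldSumSet_image_le {R S : Type*} [Semiring R] [Semiring S] (σ : R →+* S)
    (A : Finset R) (k : ℕ) {B : ℝ} (h : ∀ T : Finset R, (∀ x ∈ T, x ∈ kfoldSumSet k (A : Set R)) →
      (T.card : ℝ) ≤ B) : ((kfoldSumSet k (σ '' A)).ncard : ℝ) ≤ B := by
  classical
  let T : Finset R := Finset.univ.image fun f : Fin k → A ↦ ∑ i, (f i : R)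
  refine le_trans ?_ (h T fun x hx ↦ ?_)
  · rw [Nat.cast_le, ← Set.ncard_coe_finset]
    refine (Set.ncard_le_ncard ?_ (T.finite_toSet.image σ)).trans (Set.ncard_image_le T.finite_toSet)
    rintro _ ⟨f, hf, rfl⟩
    choose g hg hgf using hf
    refine ⟨∑ i, g i, ?_, by simp [hgf]⟩
    exact Finset.mem_coe.2 (Finset.mem_image.2 ⟨fun i ↦ ⟨g i, hg i⟩, Finset.mem_univ _, rfl⟩)
  · obtain ⟨f, -, rfl⟩ := Finset.mem_image.1 hx
    exact ⟨fun i ↦ f i, fun i ↦ (f i).2, rfl⟩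

theorem ncard_kfoldProdSet_image_le {R S : Type*} [CommSemiring R] [CommSemiring S] (σ : R →+* S)
    (A : Finset R) (k : ℕ) {B : ℝ} (h : ∀ T : Finset R, (∀ x ∈ T, x ∈ kfoldProdSet k (A : Set R)) →
      (T.card : ℝ) ≤ B) : ((kfoldProdSet k (σ '' A)).ncard : ℝ) ≤ B := by
  classical
  let T : Finset R := Finset.univ.image fun f : Fin k → A ↦ ∏ i, (f i : R)
  refine le_trans ?_ (h T fun x hx ↦ ?_)
  · rw [Nat.cast_le, ← Set.ncard_coe_finset]
    refine (Set.ncard_le_ncard ?_ (T.finite_toSet.image σ)).trans (Set.ncard_image_le T.finite_toSet)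
    rintro _ ⟨f, hf, rfl⟩
    choose g hg hgf using hf
    refine ⟨∏ i, g i, ?_, by simp [hgf]⟩
    exact Finset.mem_coe.2 (Finset.mem_image.2 ⟨fun i ↦ ⟨g i, hg i⟩, Finset.mem_univ _, rfl⟩)
  · obtain ⟨f, -, rfl⟩ := Finset.mem_image.1 hx
    exact ⟨fun i ↦ f i, fun i ↦ (f i).2, rfl⟩

namespace NumberField

open InfinitePlace Module

variable {L : Type*} [Field L] [NumberField L] [IsTotallyReal L]

/-- A set of reals with few sums and few products, from a totally real field of small
discriminant. -/
theorem exists_finite_ncard_kfold_le {X : ℝ} (hX : 1 < X)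
    (hdisc : ((discr L).natAbs : ℝ) < (X ^ finrank ℚ L) ^ 2) {J : ℕ} (hJ : 1 ≤ J) :
    ∃ A : Set ℝ, A.Finite ∧
      (J : ℝ) ^ finrank ℚ L ≤ (4 * Real.exp 1 * X ^ 2) ^ finrank ℚ L * J * A.ncard ∧
      ∀ k : ℕ, 1 ≤ k → ((kfoldSumSet k A).ncard : ℝ) ≤ (4 * X ^ J * k) ^ finrank ℚ L ∧
        ((kfoldProdSet k A).ncard : ℝ) ≤ (4 * Real.exp 1 * X * (J + 1) * k) ^ finrank ℚ L := by
  classical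
  have hX0 : 0 < X := zero_lt_one.trans hX
  obtain ⟨A, 𝔞, hA, hcard⟩ := exists_finset_span_eq hX hdisc hJ
  obtain ⟨w₀⟩ : Nonempty (InfinitePlace L) := inferInstance
  let σ : 𝓞 L →+* ℝ :=
    (embedding_of_isReal (IsTotallyReal.isReal w₀)).comp (algebraMap (𝓞 L) L)
  have hσ : Function.Injective σ :=
    (embedding_of_isReal (IsTotallyReal.isReal w₀)).injective.comp RingOfIntegers.coe_injective
  refine ⟨σ '' A, A.finite_toSet.image σ, ?_, fun k hk ↦ ⟨?_, ?_⟩⟩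
  · rwa [Set.ncard_image_of_injective _ hσ, Set.ncard_coe_finset]
  · refine ncard_kfoldSumSet_image_le σ A k fun T hT ↦ ?_
    have hk' : (1 : ℝ) ≤ k := by exact_mod_cast hk
    rw [show 4 * X ^ J * k = 4 * (k * X ^ J) by ring]
    refine card_le_of_infinitePlace_le (one_le_mul_of_one_le_of_one_le hk' (one_le_pow₀ hX.le)) T
      fun x hx w ↦ ?_
    obtain ⟨f, hf, rfl⟩ := hT x hx
    change w (algebraMap (𝓞 L) L (∑ i, f i)) ≤ _
    rw [map_sum]
    calc w (∑ i, (f i : L)) ≤ ∑ i, w (f i : L) := w.1.sum_le _ _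
      _ ≤ ∑ _i : Fin k, X ^ J := Finset.sum_le_sum fun i _ ↦ (hA _ (hf i)).2.2 w
      _ = k * X ^ J := by simp
  · refine ncard_kfoldProdSet_image_le σ A k fun T hT ↦ ?_
    refine (card_le_of_span_eq hX (m := k * J) (Nat.mul_pos hk hJ) (𝔞 ^ k) T (fun x hx ↦ ?_)
      (fun x hx ↦ ?_) fun x hx w ↦ ?_).trans ?_
    · obtain ⟨f, hf, rfl⟩ := hT x hx
      exact Finset.prod_ne_zero_iff.2 fun i _ ↦ (hA _ (hf i)).1
    · obtain ⟨f, hf, rfl⟩ := hT x hx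
      rw [← Ideal.prod_span_singleton, Finset.prod_congr rfl fun i _ ↦ (hA _ (hf i)).2.1]
      simp
    · obtain ⟨f, hf, rfl⟩ := hT x hx
      change w (algebraMap (𝓞 L) L (∏ i, f i)) ≤ _
      rw [map_prod, map_prod, mul_comm, pow_mul]
      exact (Finset.prod_le_prod (fun i _ ↦ apply_nonneg w _)
        fun i _ ↦ (hA _ (hf i)).2.2 w).trans_eq (by simp)
    · have hk' : (1 : ℝ) ≤ k := by exact_mod_cast hk
      rw [mul_assoc _ ((J : ℝ) + 1), Nat.cast_mul]
      gcongr
      linarith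

end NumberField

/-- There exists an absolute constant `C > 0` such that for every fixed `ε ∈ (0,1)` there
are arbitrarily large finite `A ⊆ ℝ` with
`max(|kA|, |A^{(k)}|) ≤ |A| ^ (C^(1/ε) + ε log k)` simultaneously for all `k ≥ 3`. -/
theorem statement4 :
    ∃ C : ℝ, 0 < C ∧
      ∀ ε : ℝ, 0 < ε → ε < 1 →
        ∀ N : ℕ, ∃ A : Set ℝ, A.Finite ∧ N ≤ A.ncard ∧
          ∀ k : ℕ, 3 ≤ k →
            max ((kfoldSumSet k A).ncard : ℝ) ((kfoldProdSet k A).ncard : ℝ) ≤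
              (A.ncard : ℝ) ^ (C ^ ((1 : ℝ) / ε) + ε * Real.log k) := by
  obtain ⟨ρ, hρ⟩ := NumberField.exists_isTotallyReal_discr_le
  set X : ℝ := ρ + 2 with hXdef
  have hX : 1 < X := by have : (0 : ℝ) ≤ ρ := ρ.cast_nonneg; linarith
  have hX0 : 0 < X := zero_lt_one.trans hX
  set c : ℝ := 4 * Real.exp 1 * X ^ 2 with hc
  have hc0 : 0 < c := by positivity
  set b : ℝ := 3 + 2 * X + 2 * X * c with hb
  have hb1 : 1 ≤ b := by
    have : 0 < X * c := by positivity
    linarith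
  refine ⟨b * Real.exp 1, by positivity, fun ε hε hε1 N ↦ ?_⟩
  set q : ℝ := 1 / ε with hq
  have hq1 : 1 ≤ q := one_le_one_div hε hε1.le
  set J : ℕ := ⌈2 * c * Real.exp q⌉₊ with hJ
  have hJ0 : 2 * c * Real.exp q ≤ J := Nat.le_ceil _
  have hJ1 : 1 ≤ J := Nat.ceil_pos.2 (by positivity)
  have hJ2 : (J : ℝ) ≤ 2 * c * Real.exp q + 1 := (Nat.ceil_lt_add_one (by positivity)).le
  set M : ℝ := (b * Real.exp 1) ^ q with hM
  have hM1 : 3 + X + X * J ≤ M := by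
    have h1 : b ≤ b ^ q := Real.self_le_rpow_of_one_le hb1 hq1
    have h2 : 1 ≤ Real.exp q := Real.one_le_exp (by linarith)
    calc 3 + X + X * J ≤ 3 + X + X * (2 * c * Real.exp q + 1) := by gcongr
      _ = (3 + 2 * X) * 1 + 2 * X * c * Real.exp q := by ring
      _ ≤ (3 + 2 * X) * Real.exp q + 2 * X * c * Real.exp q := by gcongr
      _ = b * Real.exp q := by ring
      _ ≤ b ^ q * Real.exp q := by gcongr
      _ = M := by
        rw [hM, Real.mul_rpow (by positivity) (by positivity), ← Real.exp_mul, one_mul]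
  obtain ⟨L, _, _, _, hd, hdisc⟩ := hρ (max N J)
  set d : ℕ := Module.finrank ℚ L with hddef
  have hd0 : d ≠ 0 := Module.finrank_pos.ne'
  have hdisc' : ((NumberField.discr L).natAbs : ℝ) < (X ^ d) ^ 2 := by
    calc ((NumberField.discr L).natAbs : ℝ) ≤ (ρ : ℝ) ^ d := by exact_mod_cast hdisc
      _ ≤ X ^ d := by
        gcongr
        linarith
      _ < (X ^ d) ^ 2 := lt_self_pow₀ (one_lt_pow₀ hX hd0) one_lt_two
  obtain ⟨A, hA, hcard, hk⟩ := NumberField.exists_finite_ncard_kfold_le hX hdisc' hJ1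
  have hA1 : Real.exp (q * d) ≤ A.ncard := by
    have h1 : (J : ℝ) ≤ 2 ^ d := by
      exact_mod_cast (Nat.lt_two_pow_self.le.trans
        (Nat.pow_le_pow_right two_pos ((le_max_right N J).trans hd)) : J ≤ 2 ^ d)
    have h2 : (2 * c) ^ d * Real.exp (q * d) ≤ (2 * c) ^ d * A.ncard := calc
      (2 * c) ^ d * Real.exp (q * d) = (2 * c * Real.exp q) ^ d := by
        rw [mul_comm q, Real.exp_nat_mul, mul_pow (2 * c)]
      _ ≤ (J : ℝ) ^ d := by gcongr
      _ ≤ c ^ d * J * A.ncard := hcard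
      _ ≤ c ^ d * 2 ^ d * A.ncard := by gcongr
      _ = (2 * c) ^ d * A.ncard := by rw [mul_comm 2 c, mul_pow c 2]
    exact le_of_mul_le_mul_left h2 (by positivity)
  refine ⟨A, hA, ?_, fun k hk3 ↦ ?_⟩
  · have h1 : (d : ℝ) ≤ A.ncard := calc
      (d : ℝ) ≤ q * d := le_mul_of_one_le_left d.cast_nonneg hq1
      _ ≤ q * d + 1 := by linarith
      _ ≤ _ := (Real.add_one_le_exp _).trans hA1
    exact ((le_max_left N J).trans hd).trans (by exact_mod_cast h1)
  have hk0 : (1 : ℝ) ≤ k := by exact_mod_cast (by omega : 1 ≤ k)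
  have hM0 : 0 < M := by positivity
  have hlog : 0 ≤ Real.log k := Real.log_nonneg hk0
  have hkey {r : ℝ} (hr0 : 0 ≤ r) (hr : r ≤ Real.exp M) :
      (r * k) ^ d ≤ (A.ncard : ℝ) ^ (M + ε * Real.log k) := calc
    (r * k) ^ d ≤ (Real.exp M * Real.exp (Real.log k)) ^ d := by
      rw [Real.exp_log (by linarith)]
      gcongr
    _ = Real.exp (d * (M + q * ε * Real.log k)) := by
      rw [← Real.exp_add, ← Real.exp_nat_mul, hq, one_div_mul_cancel hε.ne', one_mul]
    _ ≤ Real.exp (d * (q * M + q * ε * Real.log k)) := by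
      gcongr
      exact le_mul_of_one_le_left hM0.le hq1
    _ = Real.exp (q * d) ^ (M + ε * Real.log k) := by
      rw [← Real.exp_mul]
      ring_nf
    _ ≤ _ := Real.rpow_le_rpow (Real.exp_pos _).le hA1 (by positivity)
  have hXexp : X ≤ Real.exp X := (le_add_of_nonneg_right zero_le_one).trans (Real.add_one_le_exp X)
  have h4 : 4 ≤ Real.exp 2 := by
    have := Real.add_one_le_exp 1
    rw [show (2 : ℝ) = 1 + 1 by norm_num, Real.exp_add]
    nlinarith
  obtain ⟨hsum, hprod⟩ := hk k (by omega)
  refine max_le (hsum.trans (hkey (by positivity) ?_)) (hprod.trans (hkey (by positivity) ?_))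
  · calc 4 * X ^ J ≤ Real.exp 2 * Real.exp X ^ J := by gcongr
      _ = Real.exp (2 + X * J) := by rw [← Real.exp_nat_mul, ← Real.exp_add, mul_comm X]
      _ ≤ Real.exp M := by
        gcongr
        linarith
  · calc 4 * Real.exp 1 * X * (J + 1) ≤ Real.exp 2 * Real.exp 1 * Real.exp X * Real.exp J := by
          gcongr
          exact Real.add_one_le_exp _
      _ = Real.exp (3 + X + J) := by
        rw [← Real.exp_add, ← Real.exp_add, ← Real.exp_add]
        norm_num
      _ ≤ Real.exp M := by
        gcongr
        nlinarith
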